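/- (Theorem 3, oracle inequality) Let p∈(1,+∞], suppose Assumptions (N1)-(N2) hold, and let f̃ be the estimator given by the Goldenshluger–Lepski selection rule over the family {f̃_{(h,P)} : (h,P)∈H_p[𝔓]}. Then there exist constants C_{p,1}(f_p) and C_{p,2}(f_p), depending only on d, 𝔓, K, q and f_p := 1∨sup_{P,P'∈𝔓} sup_{I∈P⋄P'}‖f_I‖_p, and bounded on any bounded interval in f_p, such that for every integer n ≥ 3 and every f∈F_p[𝔓]: R_p[f̃,f] ≤ C_{p,1}(f_p) · inf_{(h,P)∈H_p[𝔓] : P∈𝔓(f)} { R_p[(h,P),f] + γ_p·U_p(h,P) } + C_{p,2}(f_p)·n^{-1/2}, where R_p[(h,P),f] := (E_f sup_{P'∈𝔓} sup_{I∈P⋄P'} ‖f̃_{h_I} − f_I‖_p^p)^{1/p} for p<∞ (with expectation of the supremum of sup-norms for p=∞) and U_p(h,P) := sup_{I∈P} U_p(h_I). -/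

import Mathlib

open MeasureTheory ENNReal Filter Finset
open scoped ENNReal Topology

noncomputable section

namespace Deconv

/-- Euclidean inner product on a finite coordinate space. -/
def dotp {ι : Type} [Fintype ι] (t x : ι → ℝ) : ℝ := ∑ j, t j * x j

/-- Fourier transform `ĝ(t) = ∫ e^{i⟨t,x⟩} g(x) dx` of a real function. -/
def ftI {ι : Type} [Fintype ι] (g : (ι → ℝ) → ℝ) (t : ι → ℝ) : ℂ :=
  ∫ x : ι → ℝ, Complex.exp (Complex.I * (dotp t x : ℝ)) * (g x : ℂ)

/-- Glue coordinates indexed by `I` with coordinates indexed by `Iᶜ`. -/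
def glue {d : ℕ} (I : Finset (Fin d)) (xI : I → ℝ) (y : ↥(Iᶜ) → ℝ) : Fin d → ℝ :=
  fun i => if h : i ∈ I then xI ⟨i, h⟩ else y ⟨i, Finset.mem_compl.mpr h⟩

/-- Marginal density on the coordinates indexed by `I`. -/
def marginal {d : ℕ} (I : Finset (Fin d)) (g : (Fin d → ℝ) → ℝ) (xI : I → ℝ) : ℝ :=
  ∫ y : ↥(Iᶜ) → ℝ, g (glue I xI y)

/-- A probability density. -/
def IsDensity {ι : Type} [Fintype ι] (g : (ι → ℝ) → ℝ) : Prop :=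
  (∀ x, 0 ≤ g x) ∧ (∫ x, g x) = 1

/-- Product kernel `K_I`. -/
def KI {d : ℕ} (I : Finset (Fin d)) (K : ℝ → ℝ) (xI : I → ℝ) : ℝ := ∏ j : I, K (xI j)

/-- Rescaled product kernel `K_{h_I}`. -/
def Kh {d : ℕ} (I : Finset (Fin d)) (K : ℝ → ℝ) (h : Fin d → ℝ) (xI : I → ℝ) : ℝ :=
  (∏ j ∈ I, h j)⁻¹ * ∏ j : I, K (xI j / h ↑j)

/-- The deconvolution kernel `L_{(h_I)}`. -/
def Lh {d : ℕ} (I : Finset (Fin d)) (K : ℝ → ℝ) (q : (Fin d → ℝ) → ℝ) (h : Fin d → ℝ)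
    (xI : I → ℝ) : ℂ :=
  (((2 * Real.pi) ^ (-(I.card : ℝ)) : ℝ) : ℂ) *
    ∫ t : I → ℝ, Complex.exp (-(Complex.I * (dotp t xI : ℝ))) *
      (ftI (Kh I K h) t / ftI (marginal I q) t)

/-- Convolution of two densities on `ℝ^d`. -/
def conv {d : ℕ} (f g : (Fin d → ℝ) → ℝ) (x : Fin d → ℝ) : ℝ := ∫ y, f (x - y) * g y

/-- Law of the observation vector `Y^{(n)} = (Y_1,…,Y_n)`, `Y_k = X_k + ε_k`:
the `n`-fold product of the measure with density `f ⋆ q`. -/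
def obsMeasure (d n : ℕ) (f q : (Fin d → ℝ) → ℝ) : Measure (Fin n → Fin d → ℝ) :=
  Measure.pi fun _ => volume.withDensity fun x => ENNReal.ofReal (conv f q x)

/-- Kernel deconvolution estimator `f̃_{h_I}` built from the sample `y`. -/
def fHat {d : ℕ} (I : Finset (Fin d)) (K : ℝ → ℝ) (q : (Fin d → ℝ) → ℝ) (h : Fin d → ℝ)
    {n : ℕ} (y : Fin n → Fin d → ℝ) (xI : I → ℝ) : ℂ :=
  (n : ℂ)⁻¹ * ∑ k, Lh I K q h (fun j => xI j - y k ↑j)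

/-- Expectation `E_f f̃_{h_I}(x_I)`. -/
def fHatMean {d : ℕ} (I : Finset (Fin d)) (K : ℝ → ℝ) (f q : (Fin d → ℝ) → ℝ)
    (h : Fin d → ℝ) (xI : I → ℝ) : ℂ :=
  ∫ y : Fin d → ℝ, Lh I K q h (fun j => xI j - y ↑j)
    ∂(volume.withDensity fun x => ENNReal.ofReal (conv f q x))

/-- Stochastic error `ξ_{h_I} = f̃_{h_I} - E_f f̃_{h_I}`. -/
def xiProc {d : ℕ} (I : Finset (Fin d)) (K : ℝ → ℝ) (f q : (Fin d → ℝ) → ℝ) (h : Fin d → ℝ)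
    {n : ℕ} (y : Fin n → Fin d → ℝ) (xI : I → ℝ) : ℂ :=
  fHat I K q h y xI - fHatMean I K f q h xI

/-- `λ_max = max_j λ_j`. -/
def lamMax {d : ℕ} (lam : Fin d → ℝ) : ℝ := sSup (Set.range lam)

/-- `b_p = (1/2) ∧ (1 - 1/p)`  (with the convention `p.toReal = 0` for `p = ∞`). -/
def bp (p : ℝ≥0∞) : ℝ := min (1 / 2) (1 - 1 / p.toReal)

/-- The constant `c_p` of the bandwidth grid. -/
def cpGrid {d : ℕ} (lam : Fin d → ℝ) (p : ℝ≥0∞) : ℝ :=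
  min 1 ((p.toReal / Real.exp 1 * (1 + lamMax lam * max 2 (p.toReal / (p.toReal - 1))))
    ^ (-(p.toReal * (bp p + lamMax lam))))

/-- Minimal bandwidth `h_min^{(p)}`. -/
def hminG (p : ℝ≥0∞) (n : ℕ) (m : ℕ) : ℝ :=
  if p = ⊤ then (n : ℝ)⁻¹ else (n : ℝ) ^ (-(max 1 (p.toReal / m)))

/-- Maximal bandwidth `h_max^{(p)}`. -/
def hmaxG (p : ℝ≥0∞) (n : ℕ) (m : ℕ) : ℝ :=
  if p = ⊤ then 1 else (Real.log n) ^ (-(p.toReal / m))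

/-- Membership in the dyadic bandwidth set `H_{p,I}` (only the coordinates in `I` matter). -/
def memGrid {d : ℕ} (lam : Fin d → ℝ) (p : ℝ≥0∞) (n : ℕ) (I : Finset (Fin d))
    (h : Fin d → ℝ) : Prop :=
  (∀ j ∈ I, ∃ k : ℕ, 1 ≤ k ∧ h j = 2 ^ (-(k : ℝ))) ∧
  (∀ j ∈ I, hminG p n I.card ≤ h j ∧ h j ≤ hmaxG p n I.card) ∧
  ((if p = ⊤ then Real.sqrt (Real.log n) else cpGrid lam p) ≤
    ((n : ℝ) * ∏ j ∈ I, h j) ^ bp p * ∏ j ∈ I, h j ^ lam j)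

/-- The majorant `U_p(h_I)`. -/
def Up {d : ℕ} (K : ℝ → ℝ) (q : (Fin d → ℝ) → ℝ) (lam : Fin d → ℝ) (p : ℝ≥0∞) (n : ℕ)
    (I : Finset (Fin d)) (h : Fin d → ℝ) : ℝ≥0∞ :=
  if p = ⊤ then
    ENNReal.ofReal ((n : ℝ) ^ (-(1 : ℝ) / 2) * Real.sqrt (Real.log n) *
      ∏ j ∈ I, h j ^ (-lam j - 1 / 2))
  else if p = 2 then
    ENNReal.ofReal ((n : ℝ) ^ (-(1 : ℝ) / 2) * ∏ j ∈ I, h j ^ (-lam j - 1 / 2))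
  else if p.toReal < 2 then
    ENNReal.ofReal ((n : ℝ) ^ (1 / p.toReal - 1)) * eLpNorm (Lh I K q h) p volume
  else
    ENNReal.ofReal ((n : ℝ) ^ (-(1 : ℝ) / 2)) *
      (ENNReal.ofReal (∏ j ∈ I, h j ^ (-lam j - 1 / 2)) +
        ENNReal.ofReal (Real.sqrt (Real.log n)) *
          eLpNorm (Lh I K q h) (ENNReal.ofReal (2 * p.toReal / (p.toReal + 2))) volume)

/-- First-order partial derivative in direction `j` of a complex-valued function. -/
def cpd {ι : Type} [Fintype ι] [DecidableEq ι] (j : ι) (φ : (ι → ℝ) → ℂ) (t : ι → ℝ) : ℂ :=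
  fderiv ℝ φ t (Pi.single j 1)

/-- Iterated mixed partial derivative `D^α φ`. -/
def multiPD {ι : Type} [Fintype ι] [DecidableEq ι] (α : ι → ℕ) (φ : (ι → ℝ) → ℂ) :
    (ι → ℝ) → ℂ :=
  (Finset.univ (α := ι)).toList.foldr (fun j ψ => (cpd j)^[α j] ψ) φ

/-- Assumption (N2), case `p = 2`: lower bound on `|q̂_I|`. -/
def N2two {d : ℕ} (I : Finset (Fin d)) (q : (Fin d → ℝ) → ℝ) (A : ℝ) (lam : Fin d → ℝ) :
    Prop :=
  ∀ t : I → ℝ, A⁻¹ * ∏ j : I, (1 + t j ^ 2) ^ (-lam ↑j / 2) ≤ ‖ftI (marginal I q) t‖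

/-- Assumption (N2), case `p ∈ (1,∞) \ {2}`. -/
def N2mid {d : ℕ} (I : Finset (Fin d)) (q : (Fin d → ℝ) → ℝ) (A : ℝ) (lam : Fin d → ℝ) :
    Prop :=
  (∀ t : I → ℝ, ftI (marginal I q) t ≠ 0) ∧
  ContDiff ℝ I.card (fun t : I → ℝ => (ftI (marginal I q) t)⁻¹) ∧
  ∀ α : I → ℕ, (∑ j, α j) ≤ I.card → ∀ t : I → ℝ,
    ‖multiPD α (fun u => (ftI (marginal I q) u)⁻¹) t * ∏ j, (t j : ℂ) ^ α j‖ ≤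
      A * ∏ j : I, (1 + t j ^ 2) ^ (lam ↑j / 2)

/-- Assumption (N2), case `p = ∞`. -/
def N2inf {d : ℕ} (I : Finset (Fin d)) (q : (Fin d → ℝ) → ℝ) (A : ℝ) (lam : Fin d → ℝ) :
    Prop :=
  (∀ t : I → ℝ, ftI (marginal I q) t ≠ 0) ∧
  ContDiff ℝ 1 (fun t : I → ℝ => (ftI (marginal I q) t)⁻¹) ∧
  ∀ k : I, ∀ a : ℕ, a ≤ 1 → ∀ t : I → ℝ,
    ‖(cpd k)^[a] (fun u => (ftI (marginal I q) u)⁻¹) t‖ ≤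
      A * ∏ j : I, (1 + t j ^ 2) ^ (lam ↑j / 2)

/-- Assumptions (N1)-(N2) of the paper, for a given `p` and a given block `I`. -/
def N1N2 {d : ℕ} (p : ℝ≥0∞) (I : Finset (Fin d)) (q : (Fin d → ℝ) → ℝ) (A : ℝ)
    (lam : Fin d → ℝ) : Prop :=
  0 < A ∧ (∀ j, 0 < lam j) ∧
  (p = 2 → Integrable (ftI (marginal I q)) ∧ N2two I q A lam) ∧
  (2 < p → eLpNorm (marginal I q) ⊤ volume < ⊤) ∧
  (p ≠ 2 → p ≠ ⊤ → N2mid I q A lam) ∧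
  (p = ⊤ → N2inf I q A lam)

/-- `K` is a symmetric Schwartz kernel integrating to one. -/
def IsKernel (K : ℝ → ℝ) : Prop :=
  (∃ KS : SchwartzMap ℝ ℝ, ⇑KS = K) ∧ (∀ z, K (-z) = K z) ∧ (∫ z, K z) = 1

/-- `⌊a⌋`, the largest integer strictly smaller than `a` (for `a > 0`). -/
def flr (a : ℝ) : ℕ := ⌈a⌉₊ - 1

/-- Partial derivative in direction `j` of a real function on `ℝ^ι`. -/
def rpd {ι : Type} [Fintype ι] [DecidableEq ι] (j : ι) (g : (ι → ℝ) → ℝ) (x : ι → ℝ) : ℝ :=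
  fderiv ℝ g x (Pi.single j 1)

/-- The anisotropic Nikolskii class `N_{r,s}(β,L)` of probability densities. -/
def Nikolskii {ι : Type} [Fintype ι] [DecidableEq ι] (r : ι → ℝ≥0∞) (β L : ι → ℝ) :
    Set ((ι → ℝ) → ℝ) :=
  {g | IsDensity g ∧
    (∀ j, ∀ k ≤ flr (β j), eLpNorm ((rpd j)^[k] g) (r j) volume ≤ ENNReal.ofReal (L j)) ∧
    (∀ j, ∀ z : ℝ,
      eLpNorm (fun x => (rpd j)^[flr (β j)] g (x + z • (Pi.single j 1 : ι → ℝ)) -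
        (rpd j)^[flr (β j)] g x) (r j) volume ≤
          ENNReal.ofReal (L j * |z| ^ (β j - flr (β j))))}

/-- Partitions of `{1,…,d}`. -/
abbrev Part (d : ℕ) := Finpartition (Finset.univ : Finset (Fin d))

/-- The operation `P ⋄ P'` on partitions. -/
def diamond {d : ℕ} (P P' : Part d) : Finset (Finset (Fin d)) :=
  ((P.parts ×ˢ P'.parts).image fun z => z.1 ∩ z.2).filter fun I => I.Nonempty

/-- The class `N_{r,d}(β,L,P)` taking smoothness and independence structure into account. -/
def NikolskiiP {d : ℕ} (𝔓 : Set (Part d)) (r : Fin d → ℝ≥0∞) (β L : Fin d → ℝ) (P : Part d) :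
    Set ((Fin d → ℝ) → ℝ) :=
  {g | IsDensity g ∧ (∀ x, g x = ∏ I ∈ P.parts, marginal I g fun j => x ↑j) ∧
    ∀ P' ∈ 𝔓, ∀ P'' ∈ 𝔓, ∀ I ∈ diamond P' P'',
      marginal I g ∈
        Nikolskii (fun j : I => r ↑j) (fun j : I => β ↑j) (fun j : I => L ↑j)}

/-- The set of partitions encoding an independence structure of `f`. -/
def structSet {d : ℕ} (𝔓 : Set (Part d)) (f : (Fin d → ℝ) → ℝ) : Set (Part d) :=
  {P ∈ 𝔓 | ∀ x, f x = ∏ I ∈ P.parts, marginal I f fun j => x ↑j}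

/-- The set `H_p[𝔓]` of admissible pairs `(h,P)`. -/
def HpSet {d : ℕ} (lam : Fin d → ℝ) (p : ℝ≥0∞) (n : ℕ) (𝔓 : Set (Part d)) :
    Set ((Fin d → ℝ) × Part d) :=
  {hP | hP.2 ∈ 𝔓 ∧ ∀ I ∈ hP.2.parts, memGrid lam p n I hP.1}

/-- The product estimator `f̃_{(h,P)}`. -/
def fHatProd {d : ℕ} (K : ℝ → ℝ) (q : (Fin d → ℝ) → ℝ) {n : ℕ}
    (hP : (Fin d → ℝ) × Part d) (y : Fin n → Fin d → ℝ) (x : Fin d → ℝ) : ℂ :=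
  ∏ I ∈ hP.2.parts, fHat I K q hP.1 y fun j => x ↑j

/-- Smoothed estimator `f̃_{h_I,η_I} = K_{η_I} ⋆ f̃_{h_I}`. -/
def fHatConv {d : ℕ} (K : ℝ → ℝ) (q : (Fin d → ℝ) → ℝ) (I : Finset (Fin d))
    (h η : Fin d → ℝ) {n : ℕ} (y : Fin n → Fin d → ℝ) (xI : I → ℝ) : ℂ :=
  ∫ u : I → ℝ, ((Kh I K η u : ℝ) : ℂ) * fHat I K q h y fun j => xI j - u j

/-- Auxiliary estimator `f̃_{(h,P),(η,P')}`. -/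
def fHatProdAux {d : ℕ} (K : ℝ → ℝ) (q : (Fin d → ℝ) → ℝ) {n : ℕ}
    (hP ηP' : (Fin d → ℝ) × Part d) (y : Fin n → Fin d → ℝ) (x : Fin d → ℝ) : ℂ :=
  ∏ I ∈ diamond hP.2 ηP'.2, fHatConv K q I hP.1 ηP'.1 y fun j => x ↑j

/-- `𝔡 = sup_{P ∈ 𝔓} |P|`. -/
def Dd {d : ℕ} (𝔓 : Set (Part d)) : ℕ := sSup ((fun P : Part d => P.parts.card) '' 𝔓)

/-- The random quantity `Ḡ_p`. -/
def Gbar {d : ℕ} (K : ℝ → ℝ) (q : (Fin d → ℝ) → ℝ) (lam : Fin d → ℝ) (p : ℝ≥0∞)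
    (𝔓 : Set (Part d)) {n : ℕ} (y : Fin n → Fin d → ℝ) : ℝ≥0∞ :=
  max 1 (ENNReal.ofReal ((∫ z, |K z|) ^ d) *
    ⨆ hP ∈ HpSet lam p n 𝔓, ⨆ P' ∈ 𝔓, ⨆ I ∈ diamond hP.2 P',
      eLpNorm (fHat I K q hP.1 y) p volume)

/-- The random threshold `Λ_p = 𝔡 γ_p Ḡ_p^{𝔡(𝔡-1)}`. -/
def LamThr {d : ℕ} (K : ℝ → ℝ) (q : (Fin d → ℝ) → ℝ) (lam : Fin d → ℝ) (p : ℝ≥0∞)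
    (𝔓 : Set (Part d)) (γp : ℝ≥0∞) {n : ℕ} (y : Fin n → Fin d → ℝ) : ℝ≥0∞ :=
  (Dd 𝔓 : ℝ≥0∞) * γp * Gbar K q lam p 𝔓 y ^ (Dd 𝔓 * (Dd 𝔓 - 1))

/-- `U_p(h,P) = sup_{I ∈ P} U_p(h_I)`. -/
def UpPart {d : ℕ} (K : ℝ → ℝ) (q : (Fin d → ℝ) → ℝ) (lam : Fin d → ℝ) (p : ℝ≥0∞) (n : ℕ)
    (hP : (Fin d → ℝ) × Part d) : ℝ≥0∞ :=
  ⨆ I ∈ hP.2.parts, Up K q lam p n I hP.1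

/-- The quantity `Δ̃_p(h,P)` of the selection rule. -/
def DeltaT {d : ℕ} (K : ℝ → ℝ) (q : (Fin d → ℝ) → ℝ) (lam : Fin d → ℝ) (p : ℝ≥0∞)
    (𝔓 : Set (Part d)) (γp : ℝ≥0∞) {n : ℕ} (y : Fin n → Fin d → ℝ)
    (hP : (Fin d → ℝ) × Part d) : ℝ≥0∞ :=
  ⨆ ηP' ∈ HpSet lam p n 𝔓,
    (eLpNorm (fun x => fHatProdAux K q hP ηP' y x - fHatProd K q ηP' y x) p volume -
      LamThr K q lam p 𝔓 γp y * UpPart K q lam p n ηP')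

/-- The selection criterion. -/
def crit {d : ℕ} (K : ℝ → ℝ) (q : (Fin d → ℝ) → ℝ) (lam : Fin d → ℝ) (p : ℝ≥0∞)
    (𝔓 : Set (Part d)) (γp : ℝ≥0∞) {n : ℕ} (y : Fin n → Fin d → ℝ)
    (hP : (Fin d → ℝ) × Part d) : ℝ≥0∞ :=
  DeltaT K q lam p 𝔓 γp y hP + LamThr K q lam p 𝔓 γp y * UpPart K q lam p n hP

/-- `(h̃,P̃)` obeys the data-driven selection rule. -/
def IsSelection {d : ℕ} (K : ℝ → ℝ) (q : (Fin d → ℝ) → ℝ) (lam : Fin d → ℝ) (p : ℝ≥0∞)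
    (𝔓 : Set (Part d)) (γp : ℝ≥0∞) {n : ℕ}
    (sel : (Fin n → Fin d → ℝ) → (Fin d → ℝ) × Part d) : Prop :=
  ∀ y, sel y ∈ HpSet lam p n 𝔓 ∧
    crit K q lam p 𝔓 γp y (sel y) = ⨅ hP ∈ HpSet lam p n 𝔓, crit K q lam p 𝔓 γp y hP

/-- `L_p`-risk of the selected estimator `f̃ = f̃_{(h̃,P̃)}` (`E_f ‖f̃ - f‖_∞` for `p = ∞`). -/
def riskSel {d : ℕ} (K : ℝ → ℝ) (q : (Fin d → ℝ) → ℝ) (p : ℝ≥0∞) {n : ℕ}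
    (sel : (Fin n → Fin d → ℝ) → (Fin d → ℝ) × Part d) (f : (Fin d → ℝ) → ℝ) : ℝ≥0∞ :=
  if p = ⊤ then
    ∫⁻ y, eLpNorm (fun x => fHatProd K q (sel y) y x - (f x : ℂ)) ⊤ volume
      ∂obsMeasure d n f q
  else
    (∫⁻ y, eLpNorm (fun x => fHatProd K q (sel y) y x - (f x : ℂ)) p volume ^ p.toReal
      ∂obsMeasure d n f q) ^ (1 / p.toReal)

/-- The oracle risk `R_p[(h,P),f]`. -/
def riskOracle {d : ℕ} (K : ℝ → ℝ) (q : (Fin d → ℝ) → ℝ) (p : ℝ≥0∞) (𝔓 : Set (Part d))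
    (n : ℕ) (hP : (Fin d → ℝ) × Part d) (f : (Fin d → ℝ) → ℝ) : ℝ≥0∞ :=
  if p = ⊤ then
    ∫⁻ y, (⨆ P' ∈ 𝔓, ⨆ I ∈ diamond hP.2 P',
      eLpNorm (fun xI => fHat I K q hP.1 y xI - (marginal I f xI : ℂ)) ⊤ volume)
      ∂obsMeasure d n f q
  else
    (∫⁻ y, (⨆ P' ∈ 𝔓, ⨆ I ∈ diamond hP.2 P',
      eLpNorm (fun xI => fHat I K q hP.1 y xI - (marginal I f xI : ℂ)) p volume) ^ p.toReal
      ∂obsMeasure d n f q) ^ (1 / p.toReal)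

/-- `f_p = 1 ∨ sup_{P,P' ∈ 𝔓} sup_{I ∈ P⋄P'} ‖f_I‖_p` (as an extended real). -/
def fpE {d : ℕ} (p : ℝ≥0∞) (𝔓 : Set (Part d)) (f : (Fin d → ℝ) → ℝ) : ℝ≥0∞ :=
  max 1 (⨆ P ∈ 𝔓, ⨆ P' ∈ 𝔓, ⨆ I ∈ diamond P P', eLpNorm (marginal I f) p volume)

local notation "cE" => Complex.exp
local notation "cI" => Complex.I
local notation "rE" => Real.exp
local notation "rC" => Real.cosh
local notation "rL" => Real.log
local notation "rP" => Real.pi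
local notation "fU" => Function.update
local notation "fC" => Fintype.card
local notation "oR" => ENNReal.ofReal
local notation "pnn" => Finset.prod_nonneg
local notation "rno" => Real.norm_of_nonneg
local notation "err" => ENNReal.rpow_le_rpow
local notation "ero" => ENNReal.rpow_one
local notation "erm" => ENNReal.rpow_mul
local notation "fpp" => Finset.prod_pos
local notation "ico" => integrable_const
local notation "fpl" => Finset.prod_le_prod
local notation "Eo" => ℝ≥0∞
local notation "rrn" => Real.rpow_nonneg
local notation "rra" => Real.rpow_add
local notation "rrc" => Real.rpow_natCast
local notation "cnr" => Complex.norm_real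
local notation "rrm" => Real.rpow_mul
local notation "rmr" => Real.mul_rpow
local notation "emt" => ENNReal.mul_ne_top
local notation "mR" => mul_le_mul_right
local notation "mL" => mul_le_mul_left
local notation "mNL" => mul_le_mul_of_nonneg_left
local notation "mNR" => mul_le_mul_of_nonneg_right
local notation "lcm1" => lintegral_const_mul
local notation "lcm2" => lintegral_const_mul'
local notation "icm" => integral_const_mul
local notation "lmo" => lintegral_mono
local notation "pmd" => Finset.prod_mul_distrib
local notation "pco" => Finset.prod_congr
local notation "oie" => ofReal_integral_eq_lintegral_ofReal
local notation "aR" => add_le_add_right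
local notation "aL" => add_le_add_left
local notation "oRl" => ENNReal.ofReal_le_ofReal
local notation "oRm" => ENNReal.ofReal_mul
local notation "oRp" => ENNReal.ofReal_pow
local notation "pcs" => Finset.prod_coe_sort
local notation "oRt" => ENNReal.ofReal_ne_top
local notation "mrn" => ENNReal.mul_rpow_of_nonneg
local notation "ppl" => pow_le_pow_left'
local notation "orn" => ENNReal.ofReal_rpow_of_nonneg
local notation "lls" => lintegral_lintegral_swap
local notation "eil" => enorm_integral_le_lintegral_enorm
local notation "enl" => eLpNorm_eq_lintegral_rpow_enorm_toReal
local notation "lal" => lintegral_add_left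
local notation "lco" => lintegral_congr
local notation "ASM" => AEStronglyMeasurable
local notation "IPM" => IsProbabilityMeasure
local notation "mco" => measurable_const
local notation "nnn" => norm_nonneg
local notation "lsa" => le_self_add
local notation "aoa" => ae_of_all
local notation "lpr" => Measurable.lintegral_prod_right'
local notation "ppr" => pow_le_pow_right₀
local notation "ifp" => integral_fintype_prod_volume_eq_prod
local notation "rnt" => ENNReal.rpow_ne_top_of_nonneg
local notation:max "Fd" d:max => ((Fin d → ℝ) → ℝ)
local notation:max "Fc" ι:max => ((ι → ℝ) → ℂ)
local notation:max "Fr" ι:max => ((ι → ℝ) → ℝ)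
local notation:max "Sd" d:max => Finset (Fin d)
local notation:max "mP" n:max ν:max => Measure.pi (fun _ : Fin n => ν)
local notation "pv" => (by positivity)
local notation "fpr" => (by fun_prop)
local notation "bS" => (by simp)
local notation "bL" => (by linarith)
local notation "bN" => (by norm_num)
local notation "bO" => (by omega)
local notation:max "iP" h:max => (∏ j, (h j)⁻¹)
local notation:max "nI" n:max => ((n : ℝ≥0∞)⁻¹)
local notation:max "cD" t:max x:max => (Complex.I * (dotp t x : ℝ))
local notation:max "rn" n:max => (n : ℝ)
local notation:max "Vr" ι:max => (ι → ℝ)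
set_option linter.unusedSectionVars false
def LL {ι : Type} [Fintype ι] (Φ : Fc ι) (x : ι → ℝ) : ℂ :=
  (((2 * rP) ^ (-(fC ι : ℝ)) : ℝ) : ℂ) *
    ∫ t : ι → ℝ, cE (-cD t x) * Φ t
def Bk {ι : Type} [Fintype ι] (h x : ι → ℝ) : ℝ :=
  ∏ j, ((2 * h j)⁻¹ * rE (-(|x j| / h j)))
def Qw {ι : Type} [Fintype ι] (h t : ι → ℝ) : ℝ := ∏ j, (1 + (h j * t j) ^ 2)⁻¹
lemma lap_ft_aux {h : ℝ} (hh : 0 < h) (t : ℝ) :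
    Integrable (fun u : ℝ ↦ cE (cI * ((t * u : ℝ) : ℂ)) *
      (((2 * h)⁻¹ * rE (-(|u| / h)) : ℝ) : ℂ)) ∧
    ∫ u : ℝ, cE (cI * ((t * u : ℝ) : ℂ)) *
      (((2 * h)⁻¹ * rE (-(|u| / h)) : ℝ) : ℂ) = (((1 + (h * t) ^ 2)⁻¹ : ℝ) : ℂ) := by
  set a : ℂ := cI * t - (h⁻¹ : ℝ) with ha
  set b : ℂ := cI * t + (h⁻¹ : ℝ) with hb
  have hi : 0 < h⁻¹ := inv_pos.2 hh
  have har : a.re < 0 := by simp [ha]; simpa using hh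
  have hbr : 0 < b.re := by simp [hb]; simpa using hh
  set G : ℝ → ℂ := fun u : ℝ ↦ cE (cI * ((t * u : ℝ) : ℂ)) *
      (((2 * h)⁻¹ * rE (-(|u| / h)) : ℝ) : ℂ) with hG
  have e1 : Set.EqOn (fun u : ℝ ↦ ((2 * h)⁻¹ : ℂ) * cE (a * u)) G (Set.Ioi 0) := by
    intro u hu
    simp only [hG, abs_of_pos (Set.mem_Ioi.1 hu)]
    push_cast
    rw [mul_left_comm, ← Complex.exp_add, ha]
    congr 2; push_cast; ring
  have e2 : Set.EqOn (fun u : ℝ ↦ ((2 * h)⁻¹ : ℂ) * cE (b * u)) G (Set.Iic 0) := by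
    intro u hu
    simp only [hG, abs_of_nonpos (Set.mem_Iic.1 hu)]
    push_cast
    rw [mul_left_comm, ← Complex.exp_add, hb]
    congr 2; push_cast; ring
  have i1 : IntegrableOn G (Set.Ioi 0) :=
    IntegrableOn.congr_fun ((integrableOn_exp_mul_complex_Ioi har 0).const_mul _) e1 measurableSet_Ioi
  have i2 : IntegrableOn G (Set.Iic 0) :=
    IntegrableOn.congr_fun ((integrableOn_exp_mul_complex_Iic hbr 0).const_mul _) e2 measurableSet_Iic
  have i3 : Integrable G := by
    rw [← integrableOn_univ, ← Set.Iic_union_Ioi (a := (0:ℝ))]; exact i2.union i1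
  refine ⟨i3, ?_⟩
  rw [← setIntegral_univ (f := G), ← Set.Iic_union_Ioi (a := (0:ℝ)),
    setIntegral_union (Set.Iic_disjoint_Ioi le_rfl) measurableSet_Ioi i2 i1,
    ← setIntegral_congr_fun measurableSet_Ioi e1, ← setIntegral_congr_fun measurableSet_Iic e2,
    icm, icm, integral_exp_mul_complex_Ioi har,
    integral_exp_mul_complex_Iic hbr]
  have ha0 : a ≠ 0 := fun h0 ↦ by simp [h0] at har
  have hb0 : b ≠ 0 := fun h0 ↦ by simp [h0] at hbr
  have hh' : (h : ℂ) ≠ 0 := by exact_mod_cast hh.ne'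
  have hab : (1 + (h * t : ℂ) ^ 2) = - (h:ℂ)^2 * (a * b) := by
    rw [ha, hb]; push_cast; field_simp; ring_nf; rw [Complex.I_sq]; ring
  have hba : b - a = 2 / (h:ℂ) := by rw [ha, hb]; push_cast; field_simp; ring
  simp only [Complex.ofReal_zero, mul_zero, Complex.exp_zero]
  push_cast
  rw [hab]
  have : (1 / b + -1 / a : ℂ) = -(2 / (h:ℂ)) / (a * b) := by
    rw [← hba]; field_simp; ring
  rw [← mul_add, this]; field_simp
variable {ι : Type} [Fintype ι]
lemma exp_dotp (t x : ι → ℝ) : cE (cD t x) =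
    ∏ j, cE (cI * ((t j * x j : ℝ) : ℂ)) := by
  rw [← Complex.exp_sum, ← mul_sum, dotp]; push_cast; rfl
lemma norm_exp_I (r : ℝ) : ‖cE (cI * (r : ℂ))‖ = 1 := by
  rw [mul_comm]; exact Complex.norm_exp_ofReal_mul_I r
lemma norm_exp_nI (r : ℝ) : ‖cE (-(cI * (r : ℂ)))‖ = 1 := by
  have := norm_exp_I (-r); simpa using this
lemma Bk_ft {h : ι → ℝ} (hh : ∀ j, 0 < h j) (t : ι → ℝ) :
    ∫ u : ι → ℝ, cE (cI * (dotp t u : ℝ)) * ((Bk h u : ℝ) : ℂ) =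
      ((Qw h t : ℝ) : ℂ) := by
  have : ∀ u : ι → ℝ, cE (cI * (dotp t u : ℝ)) * ((Bk h u : ℝ) : ℂ) =
      ∏ j, (cE (cI * ((t j * u j : ℝ) : ℂ)) *
        (((2 * h j)⁻¹ * rE (-(|u j| / h j)) : ℝ) : ℂ)) := by
    intro u; rw [exp_dotp, Bk, Complex.ofReal_prod, pmd]
  simp_rw [this]
  rw [ifp (fun j (v : ℝ) ↦ cE (cI * ((t j * v : ℝ) : ℂ)) *
        (((2 * h j)⁻¹ * rE (-(|v| / h j)) : ℝ) : ℂ)), Qw, Complex.ofReal_prod]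
  exact pco rfl fun j _ ↦ (lap_ft_aux (hh j) (t j)).2
lemma Bk_int {h : ι → ℝ} (hh : ∀ j, 0 < h j) : Integrable (Bk h) := by
  refine Integrable.fintype_prod (f := fun j (v : ℝ) ↦ (2 * h j)⁻¹ * rE (-(|v| / h j))) fun j ↦ ?_
  refine (lap_ft_aux (hh j) 0).1.re.congr (aoa _ fun v ↦ ?_)
  simp only [zero_mul, Complex.ofReal_zero, mul_zero, Complex.exp_zero, one_mul]
  exact Complex.ofReal_re _
lemma Bk_one {h : ι → ℝ} (hh : ∀ j, 0 < h j) : ∫ u, Bk h u = 1 := by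
  have := Bk_ft hh 0
  simp [dotp, Qw] at this
  exact_mod_cast this
lemma Bk_nonneg {h : ι → ℝ} (hh : ∀ j, 0 < h j) (x) : 0 ≤ Bk h x :=
  pnn fun j _ ↦ by have := hh j; positivity
lemma Bk_le {h : ι → ℝ} (hh : ∀ j, 0 < h j) (x) : Bk h x ≤ ∏ j, (2 * h j)⁻¹ := by
  refine fpl (fun j _ ↦ by have := hh j; positivity) fun j _ ↦ ?_
  have := hh j
  exact mul_le_of_le_one_right pv (Real.exp_le_one_iff.2 (by simp; positivity))
lemma Bk_neg (h x : ι → ℝ) : Bk h (-x) = Bk h x := by simp [Bk]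
lemma Bk_cont (h : ι → ℝ) : Continuous (Bk h) := by unfold Bk; fun_prop
lemma Bk_lint {h : ι → ℝ} (hh : ∀ j, 0 < h j) : ∫⁻ u, oR (Bk h u) = 1 := by
  rw [← oie (Bk_int hh) (aoa _ (Bk_nonneg hh)), Bk_one hh,
    ofReal_one]
lemma Qw_pos (h t : ι → ℝ) : 0 < Qw h t := fpp fun j _ ↦ by positivity
lemma Qw_le (h t : ι → ℝ) : Qw h t ≤ 1 :=
  prod_le_one (fun j _ ↦ by positivity) fun j _ ↦ inv_le_one_of_one_le₀ (by nlinarith [sq_nonneg (h j * t j)])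
lemma Qw_cont (h : ι → ℝ) : Continuous (Qw h) := by
  unfold Qw
  refine continuous_finsetProd _ fun j _ ↦ Continuous.inv₀ fpr fun t ↦ by positivity
lemma Qw_int_aux {h : ℝ} (hh : 0 < h) : Integrable (fun t : ℝ ↦ (1 + (h * t) ^ 2)⁻¹) ∧
    ∫ t : ℝ, (1 + (h * t) ^ 2)⁻¹ = rP / h := by
  refine ⟨integrable_inv_one_add_sq.comp_mul_left' hh.ne', ?_⟩
  rw [Measure.integral_comp_mul_left (fun t : ℝ ↦ (1 + t ^ 2)⁻¹), integral_univ_inv_one_add_sq]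
  rw [abs_of_pos pv]; simp; field_simp
lemma Qw_int {h : ι → ℝ} (hh : ∀ j, 0 < h j) : Integrable (Qw h) :=
  Integrable.fintype_prod (f := fun j (v : ℝ) ↦ (1 + (h j * v) ^ 2)⁻¹) fun j ↦ (Qw_int_aux (hh j)).1
lemma Qw_integral {h : ι → ℝ} (hh : ∀ j, 0 < h j) : ∫ t, Qw h t = ∏ j, (rP / h j) := by
  unfold Qw
  rw [ifp (fun j (v : ℝ) ↦ (1 + (h j * v) ^ 2)⁻¹)]
  exact pco rfl fun j _ ↦ (Qw_int_aux (hh j)).2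
lemma Qw_lint {h : ι → ℝ} (hh : ∀ j, 0 < h j) :
    ∫⁻ t, oR (Qw h t) = oR (∏ j, (rP / h j)) := by
  rw [← oie (Qw_int hh) (aoa _ fun t ↦ (Qw_pos h t).le),
    Qw_integral hh]
lemma exp_swap {X T : Type*} [MeasurableSpace X] [MeasurableSpace T] {μ : Measure X} {τ : Measure T}
    [SFinite μ] [SFinite τ] {s : T → X → ℝ} (hs : Measurable (Function.uncurry s)) {g : X → ℂ} {G : T → ℂ}
    (hg : Integrable g μ) (hG : Integrable G τ) :
    ∫ t, G t * ∫ x, cE (cI * (s t x : ℝ)) * g x ∂μ ∂τ =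
    ∫ x, g x * ∫ t, cE (cI * (s t x : ℝ)) * G t ∂τ ∂μ := by
  simp_rw [← icm]
  rw [integral_integral_swap]
  · congr 1; ext x; congr 1; ext t; ring
  · have h1 := hG.mul_prod hg
    refine (h1.bdd_mul (f := fun z : T × X ↦ cE (cI * (s z.1 z.2 : ℝ))) (c := 1) ?_ ?_).congr ?_
    · have : Measurable fun z : T × X ↦ s z.1 z.2 := hs
      fun_prop
    · exact aoa _ fun z ↦ (norm_exp_I _).le
    · exact aoa _ fun z ↦ by simp only [Function.uncurry]; ring
lemma dotp_comm (t x : ι → ℝ) : dotp t x = dotp x t := by simp [dotp, mul_comm]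
lemma dotp_sub (t x y : ι → ℝ) : dotp t (x - y) = dotp t x - dotp t y := by
  simp [dotp, mul_sub]
lemma dotp_cont : Continuous (fun z : Vr ι × Vr ι ↦ dotp z.1 z.2) := by
  unfold dotp; fun_prop
lemma LL_conv {Ω : Type*} [MeasurableSpace Ω] {μ : Measure Ω} [SFinite μ] {π : Ω → ι → ℝ}
    (hπ : Measurable π) {g : Ω → ℂ} (hg : Integrable g μ) {Φ : Fc ι} (hΦ : Integrable Φ) (x : ι → ℝ) :
    ∫ y, g y * LL Φ (x - π y) ∂μ =
      LL (fun t ↦ (∫ y, cE (cI * (dotp t (π y) : ℝ)) * g y ∂μ) * Φ t) x := by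
  unfold LL
  simp_rw [mul_left_comm (g _)]
  rw [icm]
  congr 1
  have := exp_swap (s := fun t y ↦ dotp t (π y) - dotp t x) (τ := volume) ?_ hg hΦ
  · have e : ∀ y t, cE (-(cI * (dotp t (x - π y) : ℝ))) =
        cE (cI * ((dotp t (π y) - dotp t x : ℝ) : ℂ)) := by
      intro y t; rw [dotp_sub]; congr 1; push_cast; ring
    simp_rw [e]
    rw [← this]
    congr 1; ext t
    have e2 : ∫ y, cE (cI * ((dotp t (π y) - dotp t x : ℝ) : ℂ)) * g y ∂μ =
        cE (-cD t x) *
          ∫ y, cE (cI * (dotp t (π y) : ℝ)) * g y ∂μ := by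
      rw [← icm]
      refine integral_congr_ae (aoa _ fun y ↦ ?_)
      simp only
      rw [← mul_assoc, ← Complex.exp_add]; congr 2; push_cast; ring
    rw [e2]; ring
  · have h1 : Measurable fun z : Vr ι × Ω ↦ dotp z.1 (π z.2) :=
      dotp_cont.measurable.comp (measurable_fst.prodMk (hπ.comp measurable_snd))
    have h2 : Measurable fun z : Vr ι × Ω ↦ dotp z.1 x :=
      dotp_cont.measurable.comp (measurable_fst.prodMk mco)
    exact h1.sub h2
variable {ι : Type} [Fintype ι]
lemma conv_lint {a k : Vr ι → ℝ≥0∞} (ha : AEMeasurable a) (hk : Measurable k) :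
    ∫⁻ x, ∫⁻ y, a y * k (x - y) = (∫⁻ u, k u) * ∫⁻ x, a x := by
  rw [lls]
  · have : ∀ y, ∫⁻ x, a y * k (x - y) = a y * ∫⁻ u, k u := fun y ↦ by
      rw [lcm1 _ fpr, lintegral_sub_right_eq_self k y]
    simp_rw [this]
    rw [lintegral_mul_const'' _ ha, mul_comm]
  · exact (ha.comp_quasiMeasurePreserving Measure.quasiMeasurePreserving_snd).mul
      (hk.comp (measurable_fst.sub measurable_snd)).aemeasurable
lemma two_mul_le_sq (a b : Eo) : 2 * (a * b) ≤ a ^ 2 + b ^ 2 := by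
  rcases eq_or_ne a ⊤ with rfl | ha
  · simp
  rcases eq_or_ne b ⊤ with rfl | hb
  · simp
  lift a to NNReal using ha
  lift b to NNReal using hb
  norm_cast
  rw [← NNReal.coe_le_coe]; push_cast; nlinarith [sq_nonneg ((a:ℝ) - b)]
lemma schur {a k : Vr ι → ℝ≥0∞} (ha : AEMeasurable a) (hk : Measurable k) :
    ∫⁻ x, a x * ∫⁻ y, a y * k (x - y) ≤ (∫⁻ u, k u) * ∫⁻ x, a x ^ 2 := by
  have m1 : ∀ x, Measurable fun y ↦ k (x - y) := fun x ↦ hk.comp (measurable_const.sub measurable_id)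
  have h2 : 2 * ∫⁻ x, a x * ∫⁻ y, a y * k (x - y) ≤ 2 * ((∫⁻ u, k u) * ∫⁻ x, a x ^ 2) := by
    calc 2 * ∫⁻ x, a x * ∫⁻ y, a y * k (x - y)
        = ∫⁻ x, ∫⁻ y, 2 * (a x * a y) * k (x - y) := by
          rw [← lcm2 _ _ bS]
          congr 1; ext x
          rw [← lintegral_const_mul'' (a x) (f := fun y ↦ a y * k (x - y)) (ha.mul (m1 x).aemeasurable),
            ← lcm2 _ _ bS]
          simp only [mul_assoc]
      _ ≤ ∫⁻ x, ∫⁻ y, (a x ^ 2 * k (x - y) + a y ^ 2 * k (x - y)) := by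
          gcongr with x y
          rw [← add_mul]; gcongr; exact two_mul_le_sq _ _
      _ = ∫⁻ x, (a x ^ 2 * (∫⁻ u, k u) + ∫⁻ y, a y ^ 2 * k (x - y)) := by
          congr 1; ext x
          rw [lintegral_add_left' (by exact (measurable_const.mul (m1 x)).aemeasurable),
            lcm1 _ (m1 x), lintegral_sub_left_eq_self k x]
      _ = _ := by
          rw [lintegral_add_left' fpr, lintegral_mul_const'' _ (ha.pow_const 2),
            conv_lint (ha.pow_const 2) hk, two_mul, mul_comm]
  exact (ENNReal.mul_le_mul_iff_right bS bS).1 h2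
lemma enorm_cofReal {r : ℝ} (hr : 0 ≤ r) : ‖(r : ℂ)‖ₑ = oR r := by
  rw [← ofReal_norm, cnr, rno hr]
lemma wlim (t : ι → ℝ) : Tendsto (fun N : ℕ ↦ (∏ _j : ι, (2 * ((N:ℝ)+1))) * Bk (fun _ ↦ ((N:ℝ)+1)) t) atTop (𝓝 1) := by
  have : ∀ N : ℕ, (∏ _j : ι, (2 * ((N:ℝ)+1))) * Bk (fun _ ↦ ((N:ℝ)+1)) t = ∏ j, rE (-(|t j| * (1 / ((N:ℝ)+1)))) := by
    intro N
    rw [Bk, ← pmd]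
    refine pco rfl fun j _ ↦ ?_
    have : (0:ℝ) < N + 1 := by positivity
    rw [← mul_assoc, mul_inv_cancel₀ pv, one_mul, mul_one_div]
  simp_rw [this]
  have h2 := tendsto_finsetProd (f := fun (j : ι) (N : ℕ) ↦ rE (-(|t j| * (1 / ((N:ℝ)+1))))) (x := atTop)
    (a := fun j ↦ rE (-(|t j| * 0))) univ fun j _ ↦
      (Real.continuous_exp.tendsto _).comp ((tendsto_one_div_add_atTop_nhds_zero_nat.const_mul _).neg)
  simpa only [mul_zero, neg_zero, Real.exp_zero, prod_const_one] using h2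
lemma bessel {Ψ : Fc ι} (hΨ : Integrable Ψ) :
    ∫⁻ t : ι → ℝ, ‖∫ x, cE cD t x * Ψ x‖ₑ ^ 2 ≤
      oR ((2 * rP) ^ fC ι) * ∫⁻ x, ‖Ψ x‖ₑ ^ 2 := by
  set F : Fc ι := fun t ↦ ∫ x, cE cD t x * Ψ x with hF
  have hFm : AEStronglyMeasurable F volume := by
    refine AEStronglyMeasurable.integral_prod_right' (f := fun z : Vr ι × Vr ι ↦
      cE (cI * (dotp z.1 z.2 : ℝ)) * Ψ z.2) ?_
    have := dotp_cont (ι := ι)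
    exact (by fun_prop : Continuous fun z : Vr ι × Vr ι ↦
      cE (cI * (dotp z.1 z.2 : ℝ))).aestronglyMeasurable.mul hΨ.1.comp_snd
  have hFb : ∀ t, ‖F t‖ ≤ ∫ x, ‖Ψ x‖ := fun t ↦ by
    refine (norm_integral_le_integral_norm _).trans_eq ?_
    simp only [norm_mul, norm_exp_I, one_mul]
  have key : ∀ N : ℝ, 0 < N → ∫⁻ t, ‖F t‖ₑ ^ 2 * oR ((∏ _j : ι, (2 * N)) * Bk (fun _ ↦ N) t) ≤
      oR ((2 * rP) ^ fC ι) * ∫⁻ x, ‖Ψ x‖ₑ ^ 2 := by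
    intro N hN
    have hN' : ∀ _j : ι, 0 < (fun _ ↦ N : ι → ℝ) _j := fun _ ↦ hN
    set c : ℝ := ∏ _j : ι, (2 * N) with hc
    have hc0 : 0 < c := by simp only [hc]; positivity
    set w : Fr ι := fun t ↦ c * Bk (fun _ ↦ N) t with hw
    have hw0 : ∀ t, 0 ≤ w t := fun t ↦ mul_nonneg hc0.le (Bk_nonneg hN' t)
    have hwi : Integrable (fun t ↦ (w t : ℂ)) := ((Bk_int hN').const_mul c).ofReal
    set G : Fc ι := fun t ↦ (starRingEnd ℂ) (F t) * w t with hG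
    have hGi : Integrable G := hwi.bdd_mul (c := ∫ x, ‖Ψ x‖)
      (RCLike.continuous_conj.comp_aestronglyMeasurable hFm)
      (aoa _ fun t ↦ by simpa using hFb t)
    have hpt : ∀ t, ‖F t‖ₑ ^ 2 * oR (w t) = ‖G t * F t‖ₑ := fun t ↦ by
      rw [hG, enorm_mul, enorm_mul]
      have : ‖(starRingEnd ℂ) (F t)‖ₑ = ‖F t‖ₑ := RCLike.enorm_conj _
      rw [this, enorm_cofReal (hw0 t)]; ring
    have hGF : ∀ t, G t * F t = ((‖F t‖ ^ 2 * w t : ℝ) : ℂ) := fun t ↦ by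
      rw [hG]; push_cast
      rw [mul_right_comm, ← Complex.conj_mul']
    have hGFi : Integrable (fun t ↦ ‖F t‖ ^ 2 * w t) := by
      have : Integrable (fun t ↦ G t * F t) := hGi.mul_bdd (c := ∫ x, ‖Ψ x‖) hFm (aoa _ hFb)
      simp_rw [hGF] at this
      exact this.re
    have e1 : ∫⁻ t, ‖F t‖ₑ ^ 2 * oR (w t) = ‖∫ t, G t * F t‖ₑ := by
      have hn : ∀ t, 0 ≤ ‖F t‖ ^ 2 * w t := fun t ↦ mul_nonneg pv (hw0 t)
      simp_rw [hpt, hGF]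
      rw [integral_complex_ofReal, enorm_cofReal (integral_nonneg hn),
        oie hGFi (aoa _ hn)]
      exact lco fun t ↦ enorm_cofReal (hn t)
    have e2 : ∫ t, G t * F t = ∫ x, Ψ x * ∫ y, (starRingEnd ℂ) (Ψ y) * ((c * Qw (fun _ ↦ N) (x - y) : ℝ) : ℂ) := by
      rw [exp_swap (s := fun t x ↦ dotp t x) dotp_cont.measurable hΨ hGi]
      congr 1; ext x; congr 1
      have hΨc : Integrable (fun y ↦ (starRingEnd ℂ) (Ψ y)) := Complex.conjCLE.toContinuousLinearMap.integrable_comp hΨ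
      have := exp_swap (s := fun t y ↦ - dotp t y) (τ := volume) (dotp_cont.measurable.neg) hΨc
        (G := fun t ↦ cE cD t x * (w t : ℂ)) ?_
      · refine Eq.trans ?_ (this.trans ?_)
        · congr 1; ext t
          rw [hG]; simp only [hF]
          rw [← integral_conj, mul_assoc, mul_comm (w t : ℂ)]
          congr 2
          congr 1; ext y
          rw [map_mul, ← Complex.exp_conj]; simp
        · congr 1; ext y; congr 1
          have e3 : ∀ t, cE (cI * ((-dotp t y : ℝ) : ℂ)) * (cE cD t x * (w t : ℂ))
              = (c : ℂ) * (cE (cI * (dotp (x - y) t : ℝ)) * ((Bk (fun _ ↦ N) t : ℝ) : ℂ)) := by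
            intro t
            rw [← mul_assoc, ← Complex.exp_add, hw, dotp_comm (x - y), dotp_sub]; push_cast
            rw [← mul_add, neg_add_eq_sub]; ring
          simp_rw [e3]
          rw [icm, Bk_ft hN']; push_cast; rfl
      · refine hwi.bdd_mul (c := 1) ?_ (aoa _ fun t ↦ (norm_exp_I _).le)
        have := dotp_cont (ι := ι)
        have h2 : Continuous fun t : ι → ℝ ↦ dotp t x := this.comp (by fun_prop : Continuous fun t : ι → ℝ ↦ (t, x))
        fun_prop
    rw [e1, e2]
    calc _ ≤ ∫⁻ x, ‖Ψ x‖ₑ * ∫⁻ y, ‖Ψ y‖ₑ * oR (c * Qw (fun _ ↦ N) (x - y)) := by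
          refine (eil _).trans (lmo fun x ↦ ?_)
          rw [enorm_mul]; gcongr
          refine (eil _).trans (lmo fun y ↦ ?_)
          rw [enorm_mul]
          have : ‖(starRingEnd ℂ) (Ψ y)‖ₑ = ‖Ψ y‖ₑ := RCLike.enorm_conj _
          rw [this]; gcongr
          rw [enorm_cofReal (mul_nonneg hc0.le (Qw_pos _ _).le)]
      _ ≤ _ := by
          refine (schur (k := fun u ↦ oR (c * Qw (fun _ ↦ N) u)) hΨ.1.enorm
            ((Qw_cont _).measurable.const_mul c).ennreal_ofReal).trans_eq ?_
          congr 1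
          simp_rw [oRm hc0.le]
          rw [lcm1 _ (Qw_cont _).measurable.ennreal_ofReal, Qw_lint hN', ← oRm hc0.le]
          congr 1
          rw [hc, ← pmd, prod_const, card_univ]
          congr 1; field_simp
  have hlim : ∀ t, Tendsto (fun N : ℕ ↦ ‖F t‖ₑ ^ 2 * oR ((∏ _j : ι, (2 * ((N:ℝ)+1))) * Bk (fun _ ↦ ((N:ℝ)+1)) t))
      atTop (𝓝 (‖F t‖ₑ ^ 2)) := by
    intro t
    have h1 := wlim t
    have h2 := ENNReal.Tendsto.const_mul (a := ‖F t‖ₑ ^ 2) (tendsto_ofReal h1) (Or.inl bS)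
    simpa using h2
  calc ∫⁻ t, ‖F t‖ₑ ^ 2 = ∫⁻ t, liminf (fun N : ℕ ↦ ‖F t‖ₑ ^ 2 * oR ((∏ _j : ι, (2 * ((N:ℝ)+1))) * Bk (fun _ ↦ ((N:ℝ)+1)) t)) atTop := by
        refine lco fun t ↦ ((hlim t).liminf_eq).symm
    _ ≤ _ := lintegral_liminf_le' fun N ↦ (hFm.enorm.pow_const 2).mul
        ((Bk_cont _).measurable.const_mul _).ennreal_ofReal.aemeasurable
    _ ≤ _ := liminf_le_of_frequently_le' (Frequently.of_forall fun N ↦ key _ pv)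
variable {ι : Type} [Fintype ι]
lemma jensen {α : Type*} [MeasurableSpace α] {μ : Measure α} {k v : α → Eo}
    (hk : AEMeasurable k μ) (hv : AEMeasurable v μ) {p : ℝ} (hp : 1 ≤ p) :
    (∫⁻ x, k x * v x ∂μ) ^ p ≤ (∫⁻ x, k x ∂μ) ^ (p - 1) * ∫⁻ x, k x * v x ^ p ∂μ := by
  rcases hp.eq_or_lt with rfl | hp
  · simp
  have hpq : p.HolderConjugate (p / (p - 1)) := Real.HolderConjugate.conjExponent hp
  have hp0 : 0 < p := by linarith
  have h := lintegral_mul_le_Lp_mul_Lq μ hpq (f := fun x ↦ k x ^ (1 / p) * v x)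
    (g := fun x ↦ k x ^ (1 / (p / (p - 1)))) ((hk.pow_const _).mul hv) (hk.pow_const _)
  have e1 : ∀ x, ((fun x ↦ k x ^ (1 / p) * v x) * fun x ↦ k x ^ (1 / (p / (p - 1)))) x = k x * v x := by
    intro x
    simp only [Pi.mul_apply]
    rw [mul_right_comm, ← rpow_add_of_nonneg _ _ pv (by have := hpq.symm.pos; positivity)]
    have : 1 / p + 1 / (p / (p - 1)) = 1 := by have := hpq.inv_add_inv_eq_one; simpa using this
    rw [this, ero]
  have e2 : ∀ x, ((fun x ↦ k x ^ (1 / p) * v x) x) ^ p = k x * v x ^ p := by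
    intro x
    simp only
    rw [mrn _ _ hp0.le, ← erm, one_div_mul_cancel hp0.ne', ero]
  have e3 : ∀ x, (k x ^ (1 / (p / (p - 1)))) ^ (p / (p - 1)) = k x := by
    intro x
    rw [← erm, one_div_mul_cancel hpq.symm.ne_zero, ero]
  simp_rw [e1, e2, e3] at h
  calc _ ≤ _ := err h hp0.le
    _ = _ := by
      rw [mrn _ _ hp0.le, ← erm, ← erm,
        one_div_mul_cancel hp0.ne', ero, mul_comm]
      congr 2
      have : p - 1 ≠ 0 := by linarith
      field_simp
lemma jensen2 {α : Type*} [MeasurableSpace α] {μ : Measure α} {k v : α → Eo}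
    (hk : AEMeasurable k μ) (hv : AEMeasurable v μ) (h1 : ∫⁻ x, k x ∂μ ≤ 1) :
    (∫⁻ x, k x * v x ∂μ) ^ 2 ≤ ∫⁻ x, k x * v x ^ 2 ∂μ := by
  have := jensen hk hv (p := 2) bN
  norm_num at this
  exact this.trans (mul_le_of_le_one_left' h1)
lemma LL_sup {Φ : Fc ι} (x : ι → ℝ) :
    ‖LL Φ x‖ ≤ (2 * rP) ^ (-(fC ι : ℝ)) * ∫ t, ‖Φ t‖ := by
  rw [LL, norm_mul, cnr, rno pv]
  gcongr
  refine (norm_integral_le_integral_norm _).trans_eq ?_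
  simp only [norm_mul, norm_exp_nI, one_mul]
lemma LL_cont {Φ : Fc ι} (hΦ : Integrable Φ) : Continuous (LL Φ) := by
  unfold LL
  refine continuous_const.mul (continuous_of_dominated (bound := fun t ↦ ‖Φ t‖) ?_ ?_ hΦ.norm ?_)
  · intro x
    have h2 : Continuous fun t : ι → ℝ ↦ dotp t x := dotp_cont.comp (by fun_prop : Continuous fun t : ι → ℝ ↦ (t, x))
    exact (by fun_prop : Continuous fun t : ι → ℝ ↦ cE (-cD t x)).aestronglyMeasurable.mul hΦ.1
  · intro x
    exact aoa _ fun t ↦ by rw [norm_mul, norm_exp_nI, one_mul]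
  · refine aoa _ fun t ↦ ?_
    have h2 : Continuous fun x : ι → ℝ ↦ dotp t x := dotp_cont.comp (by fun_prop : Continuous fun x : ι → ℝ ↦ (t, x))
    fun_prop
lemma LL_l2 {Φ : Fc ι} (hΦ : Integrable Φ) :
    ∫⁻ x, ‖LL Φ x‖ₑ ^ 2 ≤ oR ((2 * rP) ^ (-(fC ι : ℝ))) * ∫⁻ t, ‖Φ t‖ₑ ^ 2 := by
  have h1 := bessel hΦ
  rw [← lintegral_neg_eq_self] at h1
  set c : ℝ := (2 * rP) ^ (-(fC ι : ℝ)) with hc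
  have hc0 : 0 < c := by positivity
  have e : ∀ x, ‖LL Φ x‖ₑ ^ 2 = oR (c ^ 2) *
      ‖∫ t, cE (cI * (dotp (-x) t : ℝ)) * Φ t‖ₑ ^ 2 := by
    intro x
    rw [LL, enorm_mul, mul_pow, enorm_cofReal hc0.le, oRp hc0.le]
    have e3 : ∀ t, dotp (-x) t = - dotp t x := fun t ↦ by simp [dotp, mul_comm]
    congr 3; congr 1; ext t; rw [e3]; simp
  simp_rw [e]
  rw [lcm2 _ _ bS]
  refine (mR h1 _).trans_eq ?_
  rw [← mul_assoc, ← oRm pv]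
  congr 2
  rw [sq, mul_assoc]
  have : c * (2 * rP) ^ fC ι = 1 := by
    rw [hc, ← rrc, ← rra pv]; simp
  rw [this, mul_one]
lemma const_Q {h : ι → ℝ} (hh : ∀ j, 0 < h j) :
    (2 * rP) ^ (-(fC ι : ℝ)) * ∏ j, (rP / h j) ≤ iP h := by
  have : (2 * rP) ^ (-(fC ι : ℝ)) = ∏ _j : ι, (2 * rP)⁻¹ := by
    rw [Real.rpow_neg pv, rrc, prod_const, inv_pow, card_univ]
  rw [this, ← pmd]
  refine fpl (fun j _ ↦ by have := hh j; positivity) fun j _ ↦ ?_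
  have := hh j
  rw [div_eq_mul_inv, ← mul_assoc]
  refine mul_le_of_le_one_left pv ?_
  rw [mul_inv]; field_simp; norm_num
lemma int_of_Q {h : ι → ℝ} (hh : ∀ j, 0 < h j) {Γ : ℝ} {Φ : Fc ι}
    (hm : AEStronglyMeasurable Φ volume) (hb : ∀ t, ‖Φ t‖ ≤ Γ * Qw h t) : Integrable Φ :=
  ((Qw_int hh).const_mul Γ).mono' hm (aoa _ hb)
lemma LL_supQ {h : ι → ℝ} (hh : ∀ j, 0 < h j) {Γ : ℝ} (hΓ : 0 ≤ Γ) {Φ : Fc ι}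
    (hm : AEStronglyMeasurable Φ volume) (hb : ∀ t, ‖Φ t‖ ≤ Γ * Qw h t) (x : ι → ℝ) :
    ‖LL Φ x‖ ≤ Γ * iP h := by
  refine (LL_sup x).trans ?_
  calc _ ≤ (2 * rP) ^ (-(fC ι : ℝ)) * (Γ * ∏ j, (rP / h j)) := by
        gcongr
        rw [← Qw_integral hh, ← icm]
        exact integral_mono (int_of_Q hh hm hb).norm ((Qw_int hh).const_mul Γ) hb
    _ = Γ * ((2 * rP) ^ (-(fC ι : ℝ)) * (∏ j, (rP / h j))) := by ring
    _ ≤ _ := by gcongr; exact const_Q hh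
lemma LL_l2Q {h : ι → ℝ} (hh : ∀ j, 0 < h j) {Γ : ℝ} {Φ : Fc ι}
    (hm : AEStronglyMeasurable Φ volume) (hb : ∀ t, ‖Φ t‖ ≤ Γ * Qw h t) :
    ∫⁻ x, ‖LL Φ x‖ₑ ^ 2 ≤ oR (Γ ^ 2 * iP h) := by
  refine (LL_l2 (int_of_Q hh hm hb)).trans ?_
  calc _ ≤ oR ((2 * rP) ^ (-(fC ι : ℝ))) * ∫⁻ t, oR (Γ ^ 2) * oR (Qw h t) := by
        gcongr with t
        rw [← ofReal_norm, ← oRp (nnn _), ← oRm pv]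
        refine oRl ?_
        calc ‖Φ t‖ ^ 2 ≤ (Γ * Qw h t) ^ 2 := by gcongr; exact hb t
          _ = Γ ^ 2 * Qw h t * Qw h t := by ring
          _ ≤ _ := mul_le_of_le_one_right (mul_nonneg (sq_nonneg _) (Qw_pos h t).le) (Qw_le h t)
    _ ≤ _ := by
        rw [lcm2 _ _ bS, Qw_lint hh, ← oRm pv, ← oRm pv]
        refine oRl ?_
        rw [mul_left_comm]; gcongr; exact const_Q hh
lemma LL_smooth {h : ι → ℝ} (hh : ∀ j, 0 < h j) {Φ : Fc ι}
    (hi : Integrable fun t ↦ Φ t / (Qw h t : ℂ)) (x : ι → ℝ) :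
    LL Φ x = ∫ u, ((Bk h u : ℝ) : ℂ) * LL (fun t ↦ Φ t / (Qw h t : ℂ)) (x - u) := by
  have hB : Integrable (fun u ↦ ((Bk h u : ℝ) : ℂ)) := (Bk_int hh).ofReal
  refine Eq.trans ?_ (LL_conv (π := id) measurable_id hB hi x).symm
  congr 1; ext t
  simp only [id]
  rw [Bk_ft hh, mul_div_cancel₀]
  exact_mod_cast (Qw_pos h t).ne'
lemma LL_smooth_sq {h : ι → ℝ} (hh : ∀ j, 0 < h j) {Φ : Fc ι}
    (hi : Integrable fun t ↦ Φ t / (Qw h t : ℂ)) (x : ι → ℝ) :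
    ‖LL Φ x‖ₑ ^ 2 ≤ ∫⁻ u, oR (Bk h (x - u)) * ‖LL (fun t ↦ Φ t / (Qw h t : ℂ)) u‖ₑ ^ 2 := by
  rw [LL_smooth hh hi]
  have hc := LL_cont hi
  have hcB := Bk_cont h
  refine (ENNReal.pow_le_pow_left (eil _)).trans ?_
  simp_rw [enorm_mul, enorm_cofReal (Bk_nonneg hh _)]
  refine (jensen2 fpr fpr (Bk_lint hh).le).trans_eq ?_
  rw [← lintegral_sub_left_eq_self _ x]
  simp
section prob
variable {Ω : Type*} [MeasurableSpace Ω] (ν : Measure Ω) [IPM ν]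
lemma lint_insert {n : ℕ} (k : Fin (n + 1)) {G : (Fin (n + 1) → Ω) → Eo} (hG : Measurable G) :
    ∫⁻ y, G y ∂(Measure.pi fun _ ↦ ν) =
      ∫⁻ r, ∫⁻ a, G (k.insertNth a r) ∂ν ∂(mP n ν) := by
  have h := (measurePreserving_piFinSuccAbove (fun _ : Fin (n + 1) ↦ ν) k).symm
  rw [← h.lintegral_comp hG]
  exact lintegral_prod_symm' _ (hG.comp h.measurable)
lemma meas_insert {n : ℕ} (k : Fin (n + 1)) :
    Measurable (fun z : Ω × (Fin n → Ω) ↦ (k.insertNth z.1 z.2 : Fin (n + 1) → Ω)) :=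
  (MeasurableEquiv.piFinSuccAbove (fun _ ↦ Ω) k).symm.measurable
lemma meas_update {n : ℕ} (k : Fin n) :
    Measurable (fun z : (Fin n → Ω) × Ω ↦ fU z.1 k z.2) := by
  refine measurable_pi_iff.2 fun j ↦ ?_
  by_cases hj : j = k
  · subst hj; simpa using measurable_snd
  · simp only [Function.update_of_ne hj]; fun_prop
lemma resample {n : ℕ} (k : Fin n) {G : (Fin n → Ω) → Eo} (hG : Measurable G) :
    ∫⁻ y, ∫⁻ z, G (fU y k z) ∂ν ∂(Measure.pi fun _ ↦ ν) =
      ∫⁻ y, G y ∂(Measure.pi fun _ ↦ ν) := by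
  cases n with
  | zero => exact k.elim0
  | succ n =>
    rw [lint_insert ν k hG, lint_insert ν k]
    · simp [Fin.update_insertNth]
    · exact (hG.comp (meas_update k)).lintegral_prod_right'
lemma sq_ident (x y : Eo) : x ^ 2 + y ^ 2 ≤ 2 * (x * y) + ((x - y) ^ 2 + (y - x) ^ 2) := by
  wlog hxy : x ≤ y generalizing x y with H
  · have := H y x (le_of_not_ge hxy)
    rwa [add_comm (x ^ 2), mul_comm x, add_comm ((x - y) ^ 2)]
  rcases eq_or_ne y ⊤ with rfl | hy
  · rcases eq_or_ne x ⊤ with rfl | hx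
    · simp
    · simp [top_sub hx]
  have hx : x ≠ ⊤ := ne_top_of_le_ne_top hy hxy
  obtain ⟨c, rfl⟩ := exists_add_of_le hxy
  rw [tsub_eq_zero_of_le hxy, ENNReal.add_sub_cancel_left hx]
  exact le_of_eq (by ring)
lemma var_one {F : Ω → Eo} (hF : Measurable F) :
    ∫⁻ a, F a ^ 2 ∂ν ≤ (∫⁻ a, F a ∂ν) ^ 2 + ∫⁻ a, ∫⁻ b, (F a - F b) ^ 2 ∂ν ∂ν := by
  have hm : Measurable fun z : Ω × Ω ↦ (F z.1 - F z.2) ^ 2 :=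
    ((hF.comp measurable_fst).sub (hF.comp measurable_snd)).pow_const 2
  have h2 : 2 * ∫⁻ a, F a ^ 2 ∂ν ≤ 2 * ((∫⁻ a, F a ∂ν) ^ 2 + ∫⁻ a, ∫⁻ b, (F a - F b) ^ 2 ∂ν ∂ν) := by
    calc 2 * ∫⁻ a, F a ^ 2 ∂ν = ∫⁻ a, ∫⁻ b, (F a ^ 2 + F b ^ 2) ∂ν ∂ν := by
          simp_rw [lal mco]
          rw [lal (by simpa using hF.pow_const 2)]
          simp [two_mul]
      _ ≤ ∫⁻ a, ∫⁻ b, (2 * (F a * F b) + ((F a - F b) ^ 2 + (F b - F a) ^ 2)) ∂ν ∂ν := by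
          exact lmo fun a ↦ lmo fun b ↦ sq_ident _ _
      _ = ∫⁻ a, (2 * (F a * ∫⁻ b, F b ∂ν) + (∫⁻ b, (F a - F b) ^ 2 ∂ν + ∫⁻ b, (F b - F a) ^ 2 ∂ν)) ∂ν := by
          refine lco fun a ↦ ?_
          rw [lal fpr, lcm1 _ fpr,
            lcm1 _ hF, lal fpr]
      _ = _ := by
          rw [lal fpr, lcm1 _ fpr, lintegral_mul_const _ hF,
            lal hm.lintegral_prod_right', mul_add, sq]
          congr 1
          rw [two_mul]
          congr 1
          rw [lls]
          exact (hm.comp measurable_swap).aemeasurable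
  exact (ENNReal.mul_le_mul_iff_right bS bS).1 h2
lemma efron_stein : ∀ (n : ℕ) {F : (Fin n → Ω) → Eo}, Measurable F →
    ∫⁻ y, F y ^ 2 ∂(Measure.pi fun _ ↦ ν) ≤ (∫⁻ y, F y ∂(Measure.pi fun _ ↦ ν)) ^ 2 +
      ∑ k, ∫⁻ y, ∫⁻ z, (F y - F (fU y k z)) ^ 2 ∂ν ∂(Measure.pi fun _ ↦ ν) := by
  intro n
  induction n with
  | zero =>
    intro F hF
    simp [lintegral_unique]
  | succ n ih =>
    intro F hF
    set P := Measure.pi fun _ : Fin n ↦ ν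
    have hFi : Measurable fun z : Ω × (Fin n → Ω) ↦ F ((0 : Fin (n + 1)).insertNth z.1 z.2) :=
      hF.comp (meas_insert 0)
    have hFa : ∀ r, Measurable fun a ↦ F ((0 : Fin (n + 1)).insertNth a r) := fun r ↦
      hFi.comp (measurable_id.prodMk mco)
    have hGm : Measurable fun r ↦ ∫⁻ a, F ((0 : Fin (n + 1)).insertNth a r) ∂ν := hFi.lintegral_prod_left'
    have hsm : ∀ k : Fin (n + 1), Measurable fun y ↦ ∫⁻ z, (F y - F (fU y k z)) ^ 2 ∂ν := fun k ↦
      (((hF.comp measurable_fst).sub (hF.comp (meas_update k))).pow_const 2).lintegral_prod_right'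
    rw [lint_insert ν 0 (hF.pow_const 2), lint_insert ν 0 hF, Fin.sum_univ_succ]
    simp_rw [fun k ↦ lint_insert ν 0 (hsm k)]
    have step : ∫⁻ r, ∫⁻ a, F ((0 : Fin (n + 1)).insertNth a r) ^ 2 ∂ν ∂P ≤
        ∫⁻ r, (∫⁻ a, F ((0 : Fin (n + 1)).insertNth a r) ∂ν) ^ 2 ∂P +
        ∫⁻ r, ∫⁻ a, ∫⁻ z, (F ((0 : Fin (n + 1)).insertNth a r) -
          F (fU ((0 : Fin (n + 1)).insertNth a r) 0 z)) ^ 2 ∂ν ∂ν ∂P := by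
      rw [← lal (hGm.pow_const 2)]
      refine lmo fun r ↦ ?_
      simp only [Fin.update_insertNth]
      exact var_one ν (hFa r)
    refine step.trans ?_
    rw [add_comm (∫⁻ r, ∫⁻ a, ∫⁻ z, _ ∂ν ∂ν ∂P), ← add_assoc]
    gcongr
    refine (ih hGm).trans ?_
    refine aR (sum_le_sum fun k _ ↦ lmo fun r ↦ ?_) _
    have hfu : Measurable fun w : Ω × Ω ↦ F ((0 : Fin (n + 1)).insertNth w.1 (fU r k w.2)) :=
      hFi.comp (measurable_fst.prodMk ((meas_update k).comp (measurable_const.prodMk measurable_snd)))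
    calc _ ≤ ∫⁻ z, ∫⁻ a, (F ((0 : Fin (n + 1)).insertNth a r) -
          F ((0 : Fin (n + 1)).insertNth a (fU r k z))) ^ 2 ∂ν ∂ν := by
          refine lmo fun z ↦ ?_
          refine (ENNReal.pow_le_pow_left (lintegral_sub_le _ _ (hFa _))).trans ?_
          have := jensen2 (μ := ν) (k := fun _ ↦ 1) (v := fun a ↦ F ((0 : Fin (n + 1)).insertNth a r) -
            F ((0 : Fin (n + 1)).insertNth a (fU r k z))) measurable_const.aemeasurable
            ((hFa r).sub (hFa _)).aemeasurable bS
          simpa using this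
      _ = ∫⁻ a, ∫⁻ z, _ ∂ν ∂ν := lls
          ((((hFa r).comp measurable_snd).sub (hfu.comp measurable_swap)).pow_const 2).aemeasurable
      _ = _ := by
          refine lco fun a ↦ lco fun z ↦ ?_
          rw [Fin.insertNth_update]; simp
end prob
section mom
lemma pow_sub_pow_le' {x y : Eo} (hx : x ≠ ⊤) (m : ℕ) : x ^ (m + 1) - y ^ (m + 1) ≤ (m + 1) * x ^ m * (x - y) := by
  rcases le_total x y with h | h
  · rw [tsub_eq_zero_of_le (ppl h _)]; exact zero_le
  obtain ⟨c, rfl⟩ := exists_add_of_le h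
  have hy : y ≠ ⊤ := ne_top_of_le_ne_top hx h
  rw [ENNReal.add_sub_cancel_left hy]
  refine tsub_le_iff_right.2 ?_
  clear h hx hy
  induction m with
  | zero => simp [add_comm]
  | succ m ih =>
    calc (y + c) ^ (m + 1 + 1) = (y + c) ^ (m + 1) * c + (y + c) ^ (m + 1) * y := by ring
      _ ≤ (y + c) ^ (m + 1) * c + ((m + 1) * (y + c) ^ m * c + y ^ (m + 1)) * y := by gcongr
      _ = (y + c) ^ (m + 1) * c + ((m + 1) * ((y + c) ^ m * y) * c) + y ^ (m + 1 + 1) := by ring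
      _ ≤ (y + c) ^ (m + 1) * c + ((m + 1) * ((y + c) ^ m * (y + c)) * c) + y ^ (m + 1 + 1) := by
          gcongr; exact lsa
      _ = _ := by push_cast; ring
lemma young' (Y V D : Eo) (m : ℕ) : D * Y ^ (2 * m) * V ≤ 2⁻¹ * Y ^ (2 * (m + 1)) + (2 * D) ^ (m + 1) * V ^ (m + 1) := by
  rcases le_total (2 * D * V) (Y ^ 2) with h | h
  · calc D * Y ^ (2 * m) * V = 2⁻¹ * 2 * D * Y ^ (2 * m) * V := by
          rw [ENNReal.inv_mul_cancel bS bS, one_mul]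
      _ = 2⁻¹ * (Y ^ (2 * m) * (2 * D * V)) := by ring
      _ ≤ 2⁻¹ * (Y ^ (2 * m) * Y ^ 2) := by gcongr
      _ = 2⁻¹ * Y ^ (2 * (m + 1)) := by ring
      _ ≤ _ := lsa
  · calc D * Y ^ (2 * m) * V ≤ 2 * D * Y ^ (2 * m) * V := by
          gcongr; exact le_mul_of_one_le_left' bS
      _ = (Y ^ 2) ^ m * (2 * D * V) := by rw [pow_mul]; ring
      _ ≤ (2 * D * V) ^ m * (2 * D * V) := by gcongr
      _ = (2 * D) ^ (m + 1) * V ^ (m + 1) := by ring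
      _ ≤ _ := le_add_self
def CR : ℕ → Eo
  | 0 => 1
  | j + 1 => 2 * (CR j ^ 2 + (2 * ((2 ^ (j + 1) : ℕ) : Eo) ^ 2) ^ (2 ^ (j + 1)))
lemma CR_top (j : ℕ) : CR j ≠ ⊤ := by
  induction j with
  | zero => simp [CR]
  | succ j ih =>
    unfold CR
    refine emt bS (add_ne_top.2 ⟨pow_ne_top ih,
      pow_ne_top (emt bS (pow_ne_top (natCast_ne_top _)))⟩)
lemma half_absorb {x A : Eo} (hx : x ≠ ⊤) (h : x ≤ A + 2⁻¹ * x) : x ≤ 2 * A := by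
  have h1 : 2⁻¹ * x + 2⁻¹ * x ≤ A + 2⁻¹ * x := by
    rwa [← add_mul, inv_two_add_inv_two, one_mul]
  have h2 := (ENNReal.add_le_add_iff_right (emt bS hx)).1 h1
  calc x = 2 * (2⁻¹ * x) := by rw [← mul_assoc, ENNReal.mul_inv_cancel bS bS, one_mul]
    _ ≤ 2 * A := by gcongr
variable {Ω : Type*} [MeasurableSpace Ω] (ν : Measure Ω) [IPM ν]
lemma mom_rec {n : ℕ} {Z V : (Fin n → Ω) → Eo} (hZ : Measurable Z) (hVm : Measurable V) {M : Eo} (hM : M ≠ ⊤)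
    (hZM : ∀ y, Z y ≤ M) (hV : ∀ y, ∑ k, ∫⁻ z, (Z y - Z (fU y k z)) ^ 2 ∂ν ≤ V y) (j : ℕ) :
    ∫⁻ y, (Z y - ∫⁻ y', Z y' ∂(Measure.pi fun _ ↦ ν)) ^ (2 ^ (j + 1)) ∂(Measure.pi fun _ ↦ ν) ≤
      CR j * ∫⁻ y, V y ^ (2 ^ j) ∂(Measure.pi fun _ ↦ ν) := by
  set P := Measure.pi fun _ : Fin n ↦ ν with hP
  set a := ∫⁻ y', Z y' ∂P with ha
  have haM : a ≤ M := (lmo hZM).trans bS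
  have haT : a ≠ ⊤ := ne_top_of_le_ne_top hM haM
  have hsm : ∀ {F : (Fin n → Ω) → Eo}, Measurable F → ∀ k : Fin n,
      Measurable fun y ↦ ∫⁻ z, (F y - F (fU y k z)) ^ 2 ∂ν := fun hF k ↦
      (((hF.comp measurable_fst).sub (hF.comp (meas_update k))).pow_const 2).lintegral_prod_right'
  induction j with
  | zero =>
    have es := efron_stein ν n hZ
    rw [← lintegral_finsetSum _ (fun k _ ↦ hsm hZ k)] at es
    have es2 : ∫⁻ y, Z y ^ 2 ∂P ≤ a ^ 2 + ∫⁻ y, V y ∂P := es.trans (aR (lmo hV) _)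
    have pt : ∀ y, (Z y - a) ^ 2 + 2 * a * Z y ≤ Z y ^ 2 + a ^ 2 := by
      intro y
      rcases le_total (Z y) a with h | h
      · rw [tsub_eq_zero_of_le h]
        have := two_mul_le_sq a (Z y)
        simpa [mul_assoc, add_comm] using this
      · obtain ⟨c, hc⟩ := exists_add_of_le h
        rw [hc, ENNReal.add_sub_cancel_left haT]; exact le_of_eq (by ring)
    have h1 := lintegral_mono (μ := P) pt
    rw [lintegral_add_right _ fpr, lcm1 _ hZ, lintegral_add_right _ mco,
      lintegral_const, ← ha] at h1
    simp only [measure_univ, mul_one] at h1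
    simp only [CR, pow_zero, one_mul, pow_one, zero_add]
    have h2 : ∫⁻ y, (Z y - a) ^ 2 ∂P + 2 * a * a ≤ ∫⁻ y, V y ∂P + 2 * a * a :=
      h1.trans ((aL es2 _).trans (le_of_eq (by ring)))
    exact (ENNReal.add_le_add_iff_right (emt (emt bS haT) haT)).1 h2
  | succ j ih =>
    set Y : (Fin n → Ω) → Eo := fun y ↦ Z y - a with hY
    have hYm : Measurable Y := hZ.sub mco
    have hYM : ∀ y, Y y ≤ M := fun y ↦ tsub_le_self.trans (hZM y)
    obtain ⟨m, hm⟩ : ∃ m, 2 ^ (j + 1) = m + 1 := ⟨2 ^ (j + 1) - 1, by have := Nat.one_le_two_pow (n := j+1); omega⟩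
    have e2 : 2 ^ (j + 1 + 1) = 2 * (m + 1) := by rw [pow_succ, hm]; ring
    have es := efron_stein ν n (hYm.pow_const (m + 1))
    rw [← lintegral_finsetSum _ (fun k _ ↦ hsm (hYm.pow_const (m + 1)) k)] at es
    have hsum : ∀ y, ∑ k, ∫⁻ z, (Y y ^ (m + 1) - Y (fU y k z) ^ (m + 1)) ^ 2 ∂ν ≤
        ((m + 1 : ℕ) : Eo) ^ 2 * Y y ^ (2 * m) * V y := by
      intro y
      refine le_trans ?_ (mR (hV y) _)
      rw [mul_sum]
      refine sum_le_sum fun k _ ↦ ?_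
      rw [← lcm2 _ _ (emt bS
        (pow_ne_top (ne_top_of_le_ne_top hM (hYM y))))]
      refine lmo fun z ↦ ?_
      calc _ ≤ ((m + 1) * Y y ^ m * (Y y - Y (fU y k z))) ^ 2 := by
            gcongr; exact pow_sub_pow_le' (ne_top_of_le_ne_top hM (hYM y)) m
        _ ≤ ((m + 1) * Y y ^ m * (Z y - Z (fU y k z))) ^ 2 := by
            refine ppl (mR ?_ _) 2
            exact tsub_le_iff_right.2 (tsub_le_iff_right.2 (by
              have h3 : Z (fU y k z) ≤ Y (fU y k z) + a := le_tsub_add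
              calc Z y ≤ Z y - Z (fU y k z) + Z (fU y k z) := le_tsub_add
                _ ≤ _ := by rw [add_assoc]; gcongr))
        _ = _ := by push_cast; ring
    have h4 : ∫⁻ y, Y y ^ (2 * (m + 1)) ∂P ≤ ((∫⁻ y, Y y ^ (m + 1) ∂P) ^ 2 +
        (2 * ((m + 1 : ℕ) : Eo) ^ 2) ^ (m + 1) * ∫⁻ y, V y ^ (m + 1) ∂P) + 2⁻¹ * ∫⁻ y, Y y ^ (2 * (m + 1)) ∂P := by
      calc ∫⁻ y, Y y ^ (2 * (m + 1)) ∂P = ∫⁻ y, (Y y ^ (m + 1)) ^ 2 ∂P := by simp_rw [← pow_mul, mul_comm]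
        _ ≤ _ := es
        _ ≤ (∫⁻ y, Y y ^ (m + 1) ∂P) ^ 2 + ∫⁻ y, (2⁻¹ * Y y ^ (2 * (m + 1)) +
            (2 * ((m + 1 : ℕ) : Eo) ^ 2) ^ (m + 1) * V y ^ (m + 1)) ∂P := by
            gcongr with y; exact (hsum y).trans (young' _ _ _ m)
        _ = _ := by
            rw [lal fpr, lcm1 _ fpr,
              lcm1 _ fpr]; ring
    have hfin : ∫⁻ y, Y y ^ (2 * (m + 1)) ∂P ≠ ⊤ :=
      ne_top_of_le_ne_top (pow_ne_top hM (n := 2 * (m + 1)))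
        ((lmo fun y ↦ ppl (hYM y) _).trans bS)
    have h5 := half_absorb hfin h4
    have h6 : (∫⁻ y, V y ^ (2 ^ j) ∂P) ^ 2 ≤ ∫⁻ y, V y ^ (m + 1) ∂P := by
      have := jensen2 (μ := P) (k := fun _ ↦ 1) (v := fun y ↦ V y ^ (2 ^ j)) measurable_const.aemeasurable
        (hVm.pow_const _).aemeasurable bS
      simp only [one_mul, ← pow_mul, ← pow_succ] at this
      rwa [hm] at this
    rw [e2, hm]
    refine h5.trans ?_
    rw [hm] at ih
    calc _ ≤ 2 * ((CR j * ∫⁻ y, V y ^ (2 ^ j) ∂P) ^ 2 +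
        (2 * ((m + 1 : ℕ) : Eo) ^ 2) ^ (m + 1) * ∫⁻ y, V y ^ (m + 1) ∂P) := by gcongr
      _ ≤ 2 * (CR j ^ 2 * ∫⁻ y, V y ^ (m + 1) ∂P +
        (2 * ((m + 1 : ℕ) : Eo) ^ 2) ^ (m + 1) * ∫⁻ y, V y ^ (m + 1) ∂P) := by
          rw [mul_pow]; gcongr
      _ = _ := by rw [CR, hm]; ring
end mom
section prob2
variable {Ω : Type*} [MeasurableSpace Ω] (ν : Measure Ω) [IPM ν]
def SC (D : Eo) : ℕ → Eo
  | 0 => 1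
  | r + 1 => 2 ^ (r + 1) * (D ^ (r + 1) + SC D r * D)
lemma SC_top {D : Eo} (hD : D ≠ ⊤) (r : ℕ) : SC D r ≠ ⊤ := by
  induction r with
  | zero => simp [SC]
  | succ r ih => exact emt bS (add_ne_top.2 ⟨pow_ne_top hD, emt ih hD⟩)
lemma add_pow_le2 (a b : Eo) (r : ℕ) : (a + b) ^ r ≤ 2 ^ r * (a ^ r + b ^ r) := by
  rcases le_total a b with h | h
  · calc (a + b) ^ r ≤ (b + b) ^ r := by gcongr
      _ = 2 ^ r * b ^ r := by rw [← two_mul, mul_pow]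
      _ ≤ _ := by gcongr; exact le_add_self
  · calc (a + b) ^ r ≤ (a + a) ^ r := by gcongr
      _ = 2 ^ r * a ^ r := by rw [← two_mul, mul_pow]
      _ ≤ _ := by gcongr; exact lsa
lemma S_mom {n : ℕ} (hn : n ≠ 0) {β : Ω → Eo} (hβ : Measurable β) {D : Eo} (hD : D ≠ ⊤)
    (hb : ∀ z, β z ≤ n * D) (hμ : ∫⁻ z, β z ∂ν ≤ D) (r : ℕ) :
    ∫⁻ y, (nI n * ∑ k, β (y k)) ^ (r + 1) ∂(mP n ν) ≤ SC D r * ∫⁻ z, β z ∂ν := by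
  have hn0 : (n : Eo) ≠ 0 := by exact_mod_cast hn
  have hnT : (n : Eo) ≠ ⊤ := natCast_ne_top n
  set P := Measure.pi fun _ : Fin n ↦ ν
  set S : (Fin n → Ω) → Eo := fun y ↦ nI n * ∑ k, β (y k) with hS
  have hSm : Measurable S := by fun_prop
  have key : ∀ r, ∫⁻ y, S y ^ (r + 1) ∂P ≤ (∫⁻ z, β z ∂ν) * ∫⁻ y, (D + S y) ^ r ∂P := by
    intro r
    have hk : ∀ k : Fin n, ∫⁻ y, β (y k) * S y ^ r ∂P ≤ (∫⁻ z, β z ∂ν) * ∫⁻ y, (D + S y) ^ r ∂P := by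
      intro k
      rw [← resample ν k (G := fun y ↦ β (y k) * S y ^ r) fpr, ← lcm1 _ fpr]
      refine lmo fun y ↦ ?_
      rw [← lintegral_mul_const _ hβ]
      refine lmo fun z ↦ ?_
      simp only [Function.update_self]
      refine mR (ppl ?_ r) _
      calc S (fU y k z) = nI n * (β z + ∑ l ∈ univ \ {k}, β (y l)) := by
            refine congrArg (fun t ↦ nI n * t) ?_
            rw [← sum_update_of_mem (mem_univ k) (fun l ↦ β (y l)) (β z)]
            refine sum_congr rfl fun l _ ↦ ?_
            by_cases hl : l = k
            · subst hl; simp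
            · simp [Function.update_of_ne hl]
        _ ≤ nI n * (n * D + ∑ l, β (y l)) := by
            gcongr
            · exact hb z
            · exact subset_univ _
        _ = D + S y := by rw [mul_add, ← mul_assoc, ENNReal.inv_mul_cancel hn0 hnT, one_mul]
    calc ∫⁻ y, S y ^ (r + 1) ∂P = ∫⁻ y, nI n * ∑ k, β (y k) * S y ^ r ∂P := by
          refine lco fun y ↦ ?_
          rw [← sum_mul, ← mul_assoc, pow_succ']
      _ = nI n * ∑ k, ∫⁻ y, β (y k) * S y ^ r ∂P := by
          rw [lcm1 _ fpr, lintegral_finsetSum _ fpr]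
      _ ≤ nI n * ∑ _k : Fin n, (∫⁻ z, β z ∂ν) * ∫⁻ y, (D + S y) ^ r ∂P := by gcongr; exact hk _
      _ = _ := by
          rw [sum_const, card_univ, Fintype.card_fin, nsmul_eq_mul, ← mul_assoc,
            ENNReal.inv_mul_cancel hn0 hnT, one_mul]
  induction r with
  | zero => refine (key 0).trans ?_; simp [SC, P]
  | succ r ih =>
    calc _ ≤ _ := key (r + 1)
      _ ≤ (∫⁻ z, β z ∂ν) * ∫⁻ y, 2 ^ (r + 1) * (D ^ (r + 1) + S y ^ (r + 1)) ∂P := by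
          gcongr; exact add_pow_le2 _ _ _
      _ = (∫⁻ z, β z ∂ν) * (2 ^ (r + 1) * (D ^ (r + 1) + ∫⁻ y, S y ^ (r + 1) ∂P)) := by
          rw [lcm1 _ fpr, lal mco]; simp [P]
      _ ≤ (∫⁻ z, β z ∂ν) * (2 ^ (r + 1) * (D ^ (r + 1) + SC D r * D)) := by
          gcongr; exact ih.trans (by gcongr)
      _ = _ := by rw [SC, mul_comm]
lemma exp_one {X : Ω → ℝ} (hX : Measurable X) (h1 : ∀ z, |X z| ≤ 1) (h0 : ∫ z, X z ∂ν = 0) {w : ℝ}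
    (hw : ∫ z, X z ^ 2 ∂ν ≤ w) : ∫ z, rE (X z) ∂ν ≤ rE w := by
  have hXi : Integrable X ν := Integrable.of_bound hX.aestronglyMeasurable 1 (by filter_upwards with z using by simpa using h1 z)
  have hX2 : Integrable (fun z ↦ X z ^ 2) ν := Integrable.of_bound (hX.pow_const 2).aestronglyMeasurable 1
    (by filter_upwards with z using by simpa using h1 z)
  have hXa : Integrable (fun z ↦ 1 + X z) ν := (ico _).add hXi
  calc ∫ z, rE (X z) ∂ν ≤ ∫ z, (1 + X z + X z ^ 2) ∂ν := by
        refine integral_mono_of_nonneg (by filter_upwards with z using (Real.exp_pos _).le)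
          (hXa.add hX2) ?_
        filter_upwards with z
        have := abs_le.1 (Real.abs_exp_sub_one_sub_id_le (h1 z))
        linarith [this.2]
    _ = 1 + ∫ z, X z ^ 2 ∂ν := by
        rw [integral_add hXa hX2, integral_add (ico _) hXi, h0]; simp
    _ ≤ w + 1 := by linarith
    _ ≤ _ := Real.add_one_le_exp w
lemma cosh_mom {n : ℕ} {φ : Ω → ℝ} (hφ : Measurable φ) {M v θ : ℝ} (hM : ∀ z, |φ z| ≤ M)
    (hv : ∫ z, φ z ^ 2 ∂ν ≤ v) (hθ : 0 ≤ θ) (h2 : 2 * θ * M ≤ 1) :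
    ∫⁻ y, oR (rC (θ * ∑ k, (φ (y k) - ∫ z, φ z ∂ν)) - 1) ∂(mP n ν) ≤
      oR (n * θ ^ 2 * v * rE (n * θ ^ 2 * v)) := by
  have hφi : Integrable φ ν := Integrable.of_bound hφ.aestronglyMeasurable M (by filter_upwards with z using by simpa using hM z)
  have hφ2 : Integrable (fun z ↦ φ z ^ 2) ν := Integrable.of_bound (hφ.pow_const 2).aestronglyMeasurable (M ^ 2)
    (by filter_upwards with z using by simpa using pow_le_pow_left₀ (abs_nonneg _) (hM z) 2)
  set m := ∫ z, φ z ∂ν with hm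
  have hmM : |m| ≤ M := by
    have := norm_integral_le_of_norm_le_const (μ := ν) (f := φ) (C := M) (by filter_upwards with z using by simpa using hM z)
    simpa using this
  set X : Ω → ℝ := fun z ↦ θ * (φ z - m) with hXd
  have hX1 : ∀ z, |X z| ≤ 1 := fun z ↦ by
    rw [hXd, abs_mul, abs_of_nonneg hθ]
    calc θ * |φ z - m| ≤ θ * (M + M) := by gcongr; exact (abs_sub _ _).trans (add_le_add (hM z) hmM)
      _ ≤ 1 := by linarith
  have hX0 : ∫ z, X z ∂ν = 0 := by
    rw [icm, integral_sub hφi (ico _)]; simp [hm]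
  have hX2 : ∫ z, X z ^ 2 ∂ν ≤ θ ^ 2 * v := by
    simp only [hXd, mul_pow]
    rw [icm]
    gcongr
    have : ∫ z, (φ z - m) ^ 2 ∂ν = ∫ z, φ z ^ 2 ∂ν - m ^ 2 := by
      have e : ∀ z, (φ z - m) ^ 2 = φ z ^ 2 - (2 * m * φ z - m ^ 2) := fun z ↦ by ring
      simp_rw [e]
      have hi : Integrable (fun z ↦ 2 * m * φ z - m ^ 2) ν := (hφi.const_mul _).sub (ico _)
      rw [integral_sub hφ2 hi,
        integral_sub (hφi.const_mul _) (ico _), icm]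
      simp only [← hm, integral_const, probReal_univ, smul_eq_mul]; ring
    rw [this]; nlinarith [sq_nonneg m]
  have hXm : Measurable X := by fun_prop
  have hpow : ∀ {Y : Ω → ℝ}, Measurable Y → (∀ z, |Y z| ≤ 1) → ∫ z, Y z ∂ν = 0 → ∫ z, Y z ^ 2 ∂ν ≤ θ ^ 2 * v →
      Integrable (fun y : Fin n → Ω ↦ rE (∑ k, Y (y k))) (Measure.pi fun _ ↦ ν) ∧
      ∫ y : Fin n → Ω, rE (∑ k, Y (y k)) ∂(Measure.pi fun _ ↦ ν) ≤ rE (n * θ ^ 2 * v) := by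
    intro Y hY h1 h0 hw
    constructor
    · refine Integrable.of_bound (Measurable.aestronglyMeasurable fpr) (rE n) ?_
      filter_upwards with y
      rw [Real.norm_eq_abs, Real.abs_exp, Real.exp_le_exp]
      calc ∑ k, Y (y k) ≤ ∑ _k : Fin n, (1 : ℝ) := sum_le_sum fun k _ ↦ (abs_le.1 (h1 _)).2
        _ = n := by simp
    · simp_rw [Real.exp_sum]
      rw [integral_fintype_prod_eq_pow (fun z ↦ rE (Y z)), Fintype.card_fin, mul_assoc, Real.exp_nat_mul]
      exact pow_le_pow_left₀ (integral_nonneg fun z ↦ (Real.exp_pos _).le) (exp_one ν hY h1 h0 hw) n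
  obtain ⟨i1, b1⟩ := hpow hXm hX1 hX0 hX2
  obtain ⟨i2, b2⟩ := hpow (Y := fun z ↦ -X z) hXm.neg (fun z ↦ by simpa using hX1 z)
    (by rw [integral_neg, hX0, neg_zero]) (by simpa using hX2)
  have e : ∀ y : Fin n → Ω, rC (θ * ∑ k, (φ (y k) - m)) - 1 =
      (rE (∑ k, X (y k)) + rE (∑ k, -X (y k))) / 2 - 1 := fun y ↦ by
    rw [Real.cosh_eq, sum_neg_distrib, mul_sum]
  simp_rw [e]
  have i3 : Integrable (fun y : Fin n → Ω ↦ (rE (∑ k, X (y k)) + rE (∑ k, -X (y k))) / 2) (Measure.pi fun _ ↦ ν) :=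
    (i1.add i2).div_const 2
  have i4 : Integrable (fun y : Fin n → Ω ↦ (rE (∑ k, X (y k)) + rE (∑ k, -X (y k))) / 2 - 1) (Measure.pi fun _ ↦ ν) :=
    i3.sub (ico _)
  rw [← oie i4]
  · refine oRl ?_
    have hs : ∫ y : Fin n → Ω, ((rE (∑ k, X (y k)) + rE (∑ k, -X (y k))) / 2 - 1) ∂(Measure.pi fun _ ↦ ν) =
      (∫ y : Fin n → Ω, rE (∑ k, X (y k)) ∂(Measure.pi fun _ ↦ ν) +
        ∫ y : Fin n → Ω, rE (∑ k, -X (y k)) ∂(Measure.pi fun _ ↦ ν)) / 2 - 1 := by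
      rw [integral_sub i3 (ico _), integral_div, integral_add i1 i2]; simp
    rw [hs]
    set x := n * θ ^ 2 * v
    have h7 := Real.add_one_le_exp (-x)
    have h8 : rE (-x) * rE x = 1 := by rw [← Real.exp_add]; simp
    nlinarith [Real.exp_pos x]
  · filter_upwards with y
    rw [← e]; simpa using Real.one_le_cosh _
lemma vbe_pt {p : ℝ} (hp : 1 < p) (hp2 : p ≤ 2) (a : ℂ) : ∃ w : ℂ, ∀ b : ℂ,
    ‖a + b‖ ^ p ≤ ‖a‖ ^ p + inner ℝ w b + 6 * ‖b‖ ^ p := by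
  rcases eq_or_ne a 0 with rfl | ha
  · refine ⟨0, fun b ↦ ?_⟩
    have := rrn (nnn b) p
    rw [zero_add, inner_zero_left, norm_zero, Real.zero_rpow bL]; linarith
  have hx : 0 < ‖a‖ := norm_pos_iff.2 ha
  set x := ‖a‖ with hxd
  refine ⟨(p * x ^ (p - 2)) • a, fun b ↦ ?_⟩
  rw [real_inner_smul_left]
  set y := ‖b‖ with hyd
  have hy : 0 ≤ y := nnn b
  have hyp := rrn hy p
  have hin := abs_le.1 (abs_real_inner_le_norm a b)
  rw [← hxd, ← hyd] at hin
  have hxp := rrn hx.le (p - 2)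
  have hxp' := rrn hx.le p
  rcases le_or_gt y x with hyx | hyx
  · have hsq := norm_add_sq_real a b
    set s := inner ℝ a b
    set u := (2 * s + y ^ 2) / x ^ 2 with hu
    have hux : x ^ 2 * (1 + u) = ‖a + b‖ ^ 2 := by rw [hsq, hu]; field_simp; ring
    have hu1 : -1 ≤ u := by
      by_contra hc
      have : x ^ 2 * (1 + u) < 0 := mul_neg_of_pos_of_neg pv bL
      rw [hux] at this; nlinarith [sq_nonneg ‖a + b‖]
    have hB := rpow_one_add_le_one_add_mul_self hu1 (p := p / 2) bL bL
    have e1 : ‖a + b‖ ^ p = x ^ p * (1 + u) ^ (p / 2) := by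
      calc ‖a + b‖ ^ p = (‖a + b‖ ^ 2) ^ (p / 2) := by
            rw [← rrc, ← rrm (nnn _)]; congr 1; push_cast; ring
        _ = _ := by
            rw [← hux, rmr pv bL, ← rrc x 2, ← rrm hx.le]
            congr 2; push_cast; ring
    have e2 : x ^ p = x ^ (p - 2) * x ^ 2 := by
      rw [← rrc x 2, ← rra hx]; congr 1; push_cast; ring
    have e3 : x ^ p * (p / 2 * u) = p * x ^ (p - 2) * s + p / 2 * (x ^ (p - 2) * y ^ 2) := by
      rw [e2, hu]; field_simp
    have e4 : x ^ (p - 2) * y ^ 2 ≤ y ^ p := by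
      rcases eq_or_lt_of_le hy with h0 | h0
      · rw [← h0, Real.zero_rpow bL]; simp
      · have : y ^ 2 = y ^ p * y ^ (2 - p) := by
          rw [← rrc y 2, ← rra h0]; congr 1; push_cast; ring
        calc x ^ (p - 2) * y ^ 2 ≤ x ^ (p - 2) * (y ^ p * x ^ (2 - p)) := by
              rw [this]
              refine mNL (mNL
                (Real.rpow_le_rpow hy hyx bL) hyp) hxp
          _ = y ^ p * (x ^ (p - 2) * x ^ (2 - p)) := by ring
          _ = y ^ p := by rw [← rra hx]; simp
    have e5 := mNL hB hxp'
    rw [e1]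
    nlinarith
  · have e1 : ‖a + b‖ ^ p ≤ 4 * y ^ p := by
      calc ‖a + b‖ ^ p ≤ (2 * y) ^ p := by
            refine Real.rpow_le_rpow (nnn _) ((norm_add_le _ _).trans bL) bL
        _ = 2 ^ p * y ^ p := rmr bN hy
        _ ≤ 2 ^ (2 : ℝ) * y ^ p := by gcongr; norm_num
        _ = 4 * y ^ p := by norm_num
    have e2 : x ^ (p - 2) * (x * y) ≤ y ^ p := by
      calc x ^ (p - 2) * (x * y) = x ^ (p - 1) * y := by
            rw [← mul_assoc, ← Real.rpow_add_one hx.ne']; congr 2; ring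
        _ ≤ y ^ (p - 1) * y := by gcongr
        _ = y ^ p := by rw [← Real.rpow_add_one bL]; congr 1; ring
    have e3 : x ^ (p - 2) * (-(x * y)) ≤ x ^ (p - 2) * inner ℝ a b := mNL hin.1 hxp
    nlinarith
lemma vbe {p : ℝ} (hp : 1 < p) (hp2 : p ≤ 2) {X : Ω → ℂ} (hX : Measurable X) {M : ℝ} (hM : ∀ z, ‖X z‖ ≤ M)
    (h0 : ∫ z, X z ∂ν = 0) : ∀ (n : ℕ) (a : ℂ),
    ∫⁻ y, ‖a + ∑ k, X (y k)‖ₑ ^ p ∂(mP n ν) ≤ ‖a‖ₑ ^ p + n * (6 * ∫⁻ z, ‖X z‖ₑ ^ p ∂ν) := by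
  have hp0 : 0 ≤ p := by linarith
  have one : ∀ a : ℂ, ∫⁻ z, ‖a + X z‖ₑ ^ p ∂ν ≤ ‖a‖ₑ ^ p + 6 * ∫⁻ z, ‖X z‖ₑ ^ p ∂ν := by
    intro a
    obtain ⟨w, hw⟩ := vbe_pt hp hp2 a
    have hen : ∀ c : ℂ, ‖c‖ₑ ^ p = oR (‖c‖ ^ p) := fun c ↦ by
      rw [← ofReal_norm, orn (nnn _) hp0]
    simp_rw [hen]
    have hib : ∀ c : ℂ, Integrable (fun z ↦ ‖c + X z‖ ^ p) ν := fun c ↦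
      Integrable.of_bound fpr ((‖c‖ + M) ^ p) (by
        filter_upwards with z
        rw [rno pv]
        exact Real.rpow_le_rpow (nnn _) ((norm_add_le _ _).trans (by linarith [hM z])) hp0)
    have hib0 : Integrable (fun z ↦ ‖X z‖ ^ p) ν := by simpa using hib 0
    have hXi : Integrable X ν := Integrable.of_bound hX.aestronglyMeasurable M (by filter_upwards with z using hM z)
    rw [← oie (hib a) (by filter_upwards with z using by positivity),
      ← oie hib0 (by filter_upwards with z using by positivity),
      show (6 : Eo) = oR 6 by simp, ← oRm bN,
      ← ofReal_add pv (mul_nonneg bN (integral_nonneg fun z ↦ by positivity))]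
    refine oRl ?_
    have ii : Integrable (fun z ↦ inner ℝ w (X z)) ν := hXi.const_inner w
    have ij : Integrable (fun z ↦ ‖a‖ ^ p + inner ℝ w (X z)) ν := (ico _).add ii
    calc ∫ z, ‖a + X z‖ ^ p ∂ν ≤ ∫ z, (‖a‖ ^ p + inner ℝ w (X z) + 6 * ‖X z‖ ^ p) ∂ν :=
          integral_mono (hib a) (ij.add (hib0.const_mul 6)) fun z ↦ hw _
      _ = _ := by
          rw [integral_add ij (hib0.const_mul 6),
            integral_add (ico _) ii, integral_inner hXi, h0, icm]
          simp
  intro n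
  induction n with
  | zero => intro a; simp
  | succ n ih =>
    intro a
    rw [lint_insert ν 0 fpr]
    calc _ ≤ ∫⁻ r : Fin n → Ω, (‖a + ∑ k, X (r k)‖ₑ ^ p + 6 * ∫⁻ z, ‖X z‖ₑ ^ p ∂ν) ∂(Measure.pi fun _ ↦ ν) := by
          refine lmo fun r ↦ ?_
          refine le_trans (le_of_eq ?_) (one (a + ∑ k, X (r k)))
          refine lco fun z ↦ ?_
          rw [Fin.sum_univ_succ]
          simp only [Fin.insertNth_zero', Fin.cons_zero, Fin.cons_succ]
          rw [add_right_comm, add_assoc]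
      _ = (∫⁻ r : Fin n → Ω, ‖a + ∑ k, X (r k)‖ₑ ^ p ∂(Measure.pi fun _ ↦ ν)) + 6 * ∫⁻ z, ‖X z‖ₑ ^ p ∂ν := by
          rw [lintegral_add_right _ mco]; simp
      _ ≤ _ := by
          refine (aL (ih a) _).trans (le_of_eq ?_)
          push_cast; ring
end prob2
section xi
variable {ι : Type} [Fintype ι] {Ω : Type*} [MeasurableSpace Ω] (ν : Measure Ω) [IPM ν] (π : Ω → ι → ℝ)
def xiA (L : Fc ι) {n : ℕ} (y : Fin n → Ω) (x : ι → ℝ) : ℂ :=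
  (n : ℂ)⁻¹ * ∑ k, L (x - π (y k)) - ∫ ω, L (x - π ω) ∂ν
variable {π}
lemma mean_meas (hπ : Measurable π) {L : Fc ι} (hL : Measurable L) :
    Measurable fun x ↦ ∫ ω, L (x - π ω) ∂ν := by
  have h : StronglyMeasurable (Function.uncurry fun (x : ι → ℝ) ω ↦ L (x - π ω)) :=
    (hL.comp (measurable_fst.sub (hπ.comp measurable_snd))).stronglyMeasurable
  exact (h.integral_prod_right (ν := ν)).measurable
lemma xi_meas (hπ : Measurable π) {L : Fc ι} (hL : Measurable L) (n : ℕ) :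
    Measurable fun z : (Fin n → Ω) × Vr ι ↦ xiA ν π L z.1 z.2 := by
  have h : Measurable fun z : (Fin n → Ω) × Vr ι ↦ ∫ ω, L (z.2 - π ω) ∂ν := (mean_meas ν hπ hL).comp measurable_snd
  refine Measurable.sub (measurable_const.mul (measurable_sum _ fun k _ ↦ hL.comp ?_)) h
  exact measurable_snd.sub (hπ.comp ((measurable_pi_apply k).comp measurable_fst))
lemma xi_meas1 (hπ : Measurable π) {L : Fc ι} (hL : Measurable L) {n : ℕ} (y : Fin n → Ω) :
    Measurable (xiA ν π L y) :=
  Measurable.sub (measurable_const.mul (measurable_sum _ fun _ _ ↦ hL.comp (measurable_id.sub mco))) (mean_meas ν hπ hL)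
lemma L_int (hπ : Measurable π) {L : Fc ι} (hL : Measurable L) {M : ℝ} (hM : ∀ x, ‖L x‖ ≤ M) (x : ι → ℝ) :
    Integrable (fun ω ↦ L (x - π ω)) ν :=
  Integrable.of_bound (Measurable.aestronglyMeasurable fpr) M (by filter_upwards with z using hM _)
lemma mean_le {L : Fc ι} {M : ℝ} (hM : ∀ x, ‖L x‖ ≤ M) (x : ι → ℝ) :
    ‖∫ ω, L (x - π ω) ∂ν‖ ≤ M := by
  have := norm_integral_le_of_norm_le_const (μ := ν) (f := fun ω ↦ L (x - π ω)) (C := M) (by filter_upwards with z using hM _)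
  simpa using this
lemma xi_bd {L : Fc ι} {M : ℝ} (hM : ∀ x, ‖L x‖ ≤ M) {n : ℕ} (hn : n ≠ 0) (y : Fin n → Ω) (x : ι → ℝ) :
    ‖xiA ν π L y x‖ ≤ 2 * M := by
  have h1 : ‖(n : ℂ)⁻¹ * ∑ k, L (x - π (y k))‖ ≤ M := by
    rw [norm_mul, norm_inv, Complex.norm_natCast]
    have : ‖∑ k, L (x - π (y k))‖ ≤ n * M := (norm_sum_le _ _).trans ((sum_le_sum fun k _ ↦ hM _).trans bS)
    have hn' : (0:ℝ) < n := by positivity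
    calc rn n⁻¹ * _ ≤ rn n⁻¹ * (n * M) := by gcongr
      _ = M := by field_simp
  unfold xiA
  linarith [norm_sub_le ((n : ℂ)⁻¹ * ∑ k, L (x - π (y k))) (∫ ω, L (x - π ω) ∂ν), mean_le ν (π := π) hM x]
lemma lint_shift {g : Vr ι → ℝ≥0∞} (hπ : Measurable π) (hg : Measurable g) :
    ∫⁻ x, ∫⁻ ω, g (x - π ω) ∂ν = ∫⁻ x, g x := by
  rw [lls (Measurable.aemeasurable fpr)]
  simp_rw [lintegral_sub_right_eq_self (fun x ↦ g x)]
  simp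
lemma cosh_int (hπ : Measurable π) {L : Fc ι} (hL : Measurable L) {M : ℝ} (hM : ∀ x, ‖L x‖ ≤ M) {vb : ℝ} (hvb0 : 0 ≤ vb)
    (hvb : ∀ x, ∫⁻ ω, ‖L (x - π ω)‖ₑ ^ 2 ∂ν ≤ oR vb) {θ : ℝ} (hθ : 0 ≤ θ) (h2 : 2 * θ * M ≤ 1)
    (re : ℂ →L[ℝ] ℝ) (hre : ∀ z, |re z| ≤ ‖z‖) {n : ℕ} (hn : n ≠ 0) :
    ∫⁻ y, (∫⁻ x, oR (rC (θ * n * re (xiA ν π L y x)) - 1)) ∂(mP n ν) ≤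
      ENNReal.ofReal (n * θ ^ 2 * Real.exp (n * θ ^ 2 * vb)) * ∫⁻ x, ‖L x‖ₑ ^ 2 := by
  have hxm := xi_meas ν hπ hL n
  rw [lls (Measurable.aemeasurable fpr), ← lint_shift ν hπ (g := fun x ↦ ‖L x‖ₑ ^ 2) fpr,
    ← lintegral_const_mul _ (Measurable.lintegral_prod_right' (f := fun z : Vr ι × Ω ↦ ‖L (z.1 - π z.2)‖ₑ ^ 2) fpr)]
  refine lmo fun x ↦ ?_
  set φ : Ω → ℝ := fun ω ↦ re (L (x - π ω)) with hφ
  have hφm : Measurable φ := by fun_prop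
  have hT : ∫⁻ ω, ‖L (x - π ω)‖ₑ ^ 2 ∂ν ≠ ⊤ := ne_top_of_le_ne_top oRt (hvb x)
  set v := (∫⁻ ω, ‖L (x - π ω)‖ₑ ^ 2 ∂ν).toReal with hv
  have hvv : v ≤ vb := toReal_le_of_le_ofReal hvb0 (hvb x)
  have hmean : ∫ ω, φ ω ∂ν = re (∫ ω, L (x - π ω) ∂ν) := re.integral_comp_comm (L_int ν hπ hL hM x)
  have hsq : ∫ ω, φ ω ^ 2 ∂ν ≤ v := by
    rw [integral_eq_lintegral_of_nonneg_ae (by filter_upwards with z using sq_nonneg _) (hφm.pow_const 2).aestronglyMeasurable]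
    refine toReal_mono hT (lmo fun ω ↦ ?_)
    rw [← ofReal_norm, ← oRp (nnn _)]
    exact oRl (by rw [← sq_abs]; exact pow_le_pow_left₀ (abs_nonneg _) (hre _) 2)
  have key := cosh_mom ν (n := n) hφm (fun ω ↦ (hre _).trans (hM _)) hsq hθ h2
  have e : ∀ y : Fin n → Ω, θ * n * re (xiA ν π L y x) = θ * ∑ k, (φ (y k) - ∫ z, φ z ∂ν) := by
    intro y
    have hn' : rn n ≠ 0 := by exact_mod_cast hn
    rw [hmean, sum_sub_distrib, mul_assoc]
    congr 1
    have : re (xiA ν π L y x) = rn n⁻¹ * ∑ k, φ (y k) - re (∫ ω, L (x - π ω) ∂ν) := by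
      unfold xiA
      rw [map_sub, ← map_sum, show (n : ℂ)⁻¹ * ∑ k, L (x - π (y k)) = rn n⁻¹ • ∑ k, L (x - π (y k)) by
        rw [Complex.real_smul]; push_cast; rfl, map_smul, smul_eq_mul]
    rw [this]; simp; field_simp
  simp_rw [e]
  refine key.trans ?_
  rw [← ofReal_toReal hT, ← hv, ← oRm pv]
  refine oRl ?_
  have : 0 ≤ v := toReal_nonneg
  calc n * θ ^ 2 * v * rE (n * θ ^ 2 * v) ≤ n * θ ^ 2 * v * rE (n * θ ^ 2 * vb) := by gcongr
    _ = _ := by ring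
lemma var_bd {h : ι → ℝ} (hh : ∀ j, 0 < h j) (hπ : Measurable π) {Γ : ℝ} {Φ : Fc ι} (hΦ : ASM Φ)
    (hΓ : ∀ t, ‖Φ t‖ ≤ Γ * Qw h t ^ 2) {Cq : Eo} (hCq : ∀ z, ∫⁻ ω, oR (Bk h (z - π ω)) ∂ν ≤ Cq) (x : ι → ℝ) :
    ∫⁻ ω, ‖LL Φ (x - π ω)‖ₑ ^ 2 ∂ν ≤ Cq * oR (Γ ^ 2 * iP h) := by
  set Φ1 := fun t ↦ Φ t / (Qw h t : ℂ) with hΦ1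
  have hm1 : ASM Φ1 := by
    have : Continuous fun t ↦ ((Qw h t : ℝ) : ℂ) := Complex.continuous_ofReal.comp (Qw_cont h)
    exact (hΦ.aemeasurable.div this.measurable.aemeasurable).aestronglyMeasurable
  have hb1 : ∀ t, ‖Φ1 t‖ ≤ Γ * Qw h t := fun t ↦ by
    have := Qw_pos h t
    rw [norm_div, cnr, rno this.le, div_le_iff₀ this]
    exact (hΓ t).trans (le_of_eq (by ring))
  have hi := int_of_Q hh hm1 hb1
  have hLc := LL_cont hi
  have hBc := Bk_cont h
  calc _ ≤ ∫⁻ ω, (∫⁻ u, oR (Bk h (x - π ω - u)) * ‖LL Φ1 u‖ₑ ^ 2) ∂ν :=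
        lmo fun ω ↦ LL_smooth_sq hh hi _
    _ = ∫⁻ u, ∫⁻ ω, oR (Bk h (x - π ω - u)) * ‖LL Φ1 u‖ₑ ^ 2 ∂ν := by
        refine lls (Measurable.aemeasurable ?_)
        have := hBc.measurable; have := hLc.measurable; fun_prop
    _ ≤ ∫⁻ u, Cq * ‖LL Φ1 u‖ₑ ^ 2 := by
        refine lmo fun u ↦ ?_
        rw [lintegral_mul_const _ (by have := hBc.measurable; fun_prop)]
        gcongr
        simp_rw [fun ω ↦ show x - π ω - u = x - u - π ω by abel]
        exact hCq _
    _ ≤ _ := by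
        rw [lcm1 _ (by have := hLc.measurable; fun_prop)]
        gcongr
        exact LL_l2Q hh hm1 hb1
def Cc (p : ℝ) : ℝ := 6 * (⌈p⌉₊.factorial : ℝ) + 2
lemma Cc_pos (p : ℝ) : 0 < Cc p := by unfold Cc; positivity
lemma half_sq_le_cosh (u : ℝ) : u ^ 2 / 2 ≤ rC u - 1 := by
  have h1 : rC u - 1 = 2 * Real.sinh (u / 2) ^ 2 := by
    have := Real.cosh_two_mul (u / 2)
    rw [show 2 * (u / 2) = u by ring, Real.cosh_sq] at this; linarith
  have h2 : |u / 2| ≤ |Real.sinh (u / 2)| := by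
    rw [Real.abs_sinh]; exact Real.self_le_sinh_iff.2 (abs_nonneg _)
  have := sq_le_sq' (by linarith [abs_nonneg (u/2), abs_nonneg (Real.sinh (u/2))]) h2
  rw [sq_abs, sq_abs] at this
  rw [h1]; linarith
lemma pow_le_cosh {p : ℝ} (hp : 2 ≤ p) (u : ℝ) : |u| ^ p ≤ Cc p * (rC u - 1) := by
  have hc := half_sq_le_cosh u
  have hc0 : 0 ≤ rC u - 1 := by linarith [Real.one_le_cosh u]
  have hf : (0:ℝ) ≤ (⌈p⌉₊.factorial : ℝ) := by positivity
  rcases le_total |u| 1 with h | h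
  · calc |u| ^ p ≤ |u| ^ (2:ℝ) := Real.rpow_le_rpow_of_exponent_ge_of_imp (abs_nonneg _) h hp (fun _ ↦ by intro; linarith)
      _ = u ^ 2 := by rw [Real.rpow_two, sq_abs]
      _ ≤ 2 * (rC u - 1) := by linarith
      _ ≤ _ := by unfold Cc; nlinarith
  · have h1 : |u| ^ p ≤ ⌈p⌉₊.factorial * rE |u| := by
      calc |u| ^ p ≤ |u| ^ ((⌈p⌉₊ : ℕ) : ℝ) := Real.rpow_le_rpow_of_exponent_le h (Nat.le_ceil p)
        _ = |u| ^ ⌈p⌉₊ := rrc _ _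
        _ ≤ _ := by
          have := Real.pow_div_factorial_le_exp |u| (abs_nonneg _) ⌈p⌉₊
          rwa [div_le_iff₀ pv, mul_comm] at this
    have h2 : rE |u| ≤ 2 * rC u := by
      rw [← Real.cosh_abs, Real.cosh_eq]; linarith [Real.exp_pos (-|u|)]
    have h3 : 1 ≤ u ^ 2 := by rw [← sq_abs]; nlinarith
    have h4 : rE |u| ≤ 6 * (rC u - 1) := by linarith
    calc |u| ^ p ≤ _ := h1
      _ ≤ ⌈p⌉₊.factorial * (6 * (rC u - 1)) := by gcongr
      _ ≤ _ := by unfold Cc; nlinarith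
end xi
section c8
variable {ι : Type} [Fintype ι]
def lpB (p : ℝ) (B : Set Vr ι) (g : Fc ι) : Eo := (∫⁻ x in B, ‖g x‖ₑ ^ p) ^ (1 / p)
lemma lint_bd {p : ℝ} (hp : 0 ≤ p) {B : Set Vr ι} {g : Fc ι} {M : ℝ} (hM : ∀ x, ‖g x‖ ≤ M) :
    ∫⁻ x in B, ‖g x‖ₑ ^ p ≤ oR M ^ p * volume B := by
  refine (lmo (g := fun _ ↦ oR M ^ p) fun x ↦ ?_).trans bS
  rw [← ofReal_norm]
  exact err (oRl (hM x)) hp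
lemma norming {p : ℝ} (hp : 2 ≤ p) {B : Set Vr ι} (hB : MeasurableSet B) (hBf : volume B ≠ ⊤)
    {g : Fc ι} (hg : Measurable g) {M : ℝ} (hM : ∀ x, ‖g x‖ ≤ M) :
    ∃ φ : Fc ι, Measurable φ ∧ Integrable φ ∧ (∫⁻ x, ‖φ x‖ₑ ^ (p / (p - 1)) ≤ 1) ∧
      ∀ g2 : Fc ι, Measurable g2 → (∀ x, ‖g2 x‖ ≤ M) →
        lpB p B g ≤ lpB p B g2 + ‖∫ x, φ x * (g x - g2 x)‖ₑ := by
  have hp1 : 0 < p - 1 := by linarith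
  have hM0 : 0 ≤ M := (nnn _).trans (hM 0)
  set A := ∫⁻ x in B, ‖g x‖ₑ ^ p with hA
  have hAt : A ≠ ⊤ := ne_top_of_le_ne_top (by finiteness) (lint_bd bL hM)
  by_cases hA0 : A = 0
  · refine ⟨0, mco, integrable_zero _ _ _, by simp [div_pos (by linarith : 0 < p) hp1], fun g2 _ _ ↦ ?_⟩
    unfold lpB; rw [← hA, hA0, zero_rpow_of_pos pv]; exact zero_le
  set a := A.toReal with ha
  have ha0 : 0 < a := toReal_pos hA0 hAt
  have haA : oR a = A := ofReal_toReal hAt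
  set κ : ℝ := a ^ (-(p - 1) / p) with hκ
  have hκ0 : 0 < κ := Real.rpow_pos_of_pos ha0 _
  set ψ : Fc ι := fun x ↦ ((‖g x‖ ^ (p - 2) * κ : ℝ) : ℂ) * (starRingEnd ℂ) (g x) with hψ
  have hψm : Measurable ψ := by
    have : Measurable fun x ↦ (starRingEnd ℂ) (g x) := Complex.continuous_conj.measurable.comp hg
    fun_prop
  have hψn : ∀ x, ‖ψ x‖ = ‖g x‖ ^ (p - 1) * κ := fun x ↦ by
    simp only [hψ, norm_mul, cnr, RCLike.norm_conj, rno hκ0.le, rno (rrn (nnn _) _)]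
    by_cases h : ‖g x‖ = 0
    · rw [h, Real.zero_rpow hp1.ne']; ring
    · have := Real.rpow_add_one h (p - 2)
      rw [show p - 2 + 1 = p - 1 by ring] at this; rw [this]; ring
  have hψb : ∀ x, ‖ψ x‖ ≤ M ^ (p - 1) * κ := fun x ↦ by
    rw [hψn]; gcongr; exact hM x
  have hφi : Integrable (B.indicator ψ) := (integrable_indicator_iff hB).2
    (Measure.integrableOn_of_bounded hBf hψm.aestronglyMeasurable (by filter_upwards with x using hψb x))
  have hs : ∀ x, ‖ψ x‖ₑ ^ (p / (p - 1)) = ‖g x‖ₑ ^ p * A⁻¹ := fun x ↦ by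
    rw [← ofReal_norm, hψn, ← ofReal_norm, ← haA, orn pv pv,
      orn pv pv, ← ofReal_inv_of_pos ha0, ← oRm pv,
      rmr pv hκ0.le, ← rrm (nnn _), hκ, ← rrm ha0.le,
      show (p - 1) * (p / (p - 1)) = p by field_simp, show -(p - 1) / p * (p / (p - 1)) = -1 by field_simp, Real.rpow_neg_one]
  have hs1 : ∫⁻ x in B, ‖ψ x‖ₑ ^ (p / (p - 1)) ≤ 1 := by
    simp_rw [hs]
    rw [lintegral_mul_const _ fpr, ← hA, ENNReal.mul_inv_cancel hA0 hAt]
  refine ⟨B.indicator ψ, hψm.indicator hB, hφi, ?_, fun g2 hg2 hM2 ↦ ?_⟩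
  · refine le_trans (le_of_eq ?_) hs1
    rw [← lintegral_indicator hB]
    refine lco fun x ↦ ?_
    by_cases h : x ∈ B <;> simp [h, div_pos (by linarith : 0 < p) hp1]
  have hin : ∀ u : Fc ι, ∫ x, B.indicator ψ x * u x = ∫ x in B, ψ x * u x := fun u ↦ by
    rw [← integral_indicator hB]; congr 1; ext x; by_cases h : x ∈ B <;> simp [h]
  have hiu : ∀ u : Fc ι, Measurable u → (∀ x, ‖u x‖ ≤ M) → IntegrableOn (fun x ↦ ψ x * u x) B := fun u hu hub ↦
    Measure.integrableOn_of_bounded (M := M ^ (p - 1) * κ * M) hBf (hψm.mul hu).aestronglyMeasurable (by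
      filter_upwards with x
      rw [norm_mul]; exact mul_le_mul (hψb x) (hub x) (nnn _) pv)
  have e1 : ‖∫ x in B, ψ x * g x‖ₑ = lpB p B g := by
    have : ∀ x, ψ x * g x = ((‖g x‖ ^ p * κ : ℝ) : ℂ) := fun x ↦ by
      simp only [hψ]; rw [mul_assoc, mul_comm _ (g x), Complex.mul_conj, Complex.normSq_eq_norm_sq, ← Complex.ofReal_mul]
      congr 1
      by_cases h : ‖g x‖ = 0
      · rw [h, Real.zero_rpow (by linarith : p ≠ 0)]; ring
      · have := Real.rpow_add_natCast h (p - 2) 2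
        rw [show p - 2 + (2:ℕ) = p by push_cast; ring] at this; rw [this]; ring
    simp_rw [this]
    rw [integral_complex_ofReal, enorm_cofReal (integral_nonneg fun x ↦ by positivity),
      oie _ (by filter_upwards with x; positivity)]
    · simp_rw [fun x ↦ ENNReal.ofReal_mul (p := ‖g x‖ ^ p) (q := κ) pv,
        fun x ↦ (orn (nnn (g x)) (by linarith : 0 ≤ p)).symm, ofReal_norm]
      rw [lintegral_mul_const _ fpr, ← hA, ← haA, ← oRm ha0.le]
      unfold lpB
      rw [← hA, ← haA, orn ha0.le pv, hκ]
      congr 1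
      have := rra ha0 1 (-(p - 1) / p)
      rw [Real.rpow_one] at this; rw [← this]; congr 1; field_simp; ring
    · have := (hiu g hg hM).norm
      refine this.congr (by filter_upwards with x; rw [‹∀ x, ψ x * g x = _› x, cnr, rno pv])
  have e2 : ‖∫ x in B, ψ x * g2 x‖ₑ ≤ lpB p B g2 := by
    refine (eil _).trans ?_
    simp_rw [enorm_mul]
    have hc : (p / (p - 1)).HolderConjugate p := by
      refine (Real.holderConjugate_iff (p := p / (p - 1))).2 ⟨by rw [lt_div_iff₀ hp1]; linarith, by field_simp; ring⟩
    refine (lintegral_mul_le_Lp_mul_Lq _ hc fpr fpr).trans ?_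
    unfold lpB
    calc _ ≤ (1:Eo) ^ (1 / (p / (p - 1))) * _ := mL (err hs1 pv) _
      _ = _ := by rw [one_rpow, one_mul]
  rw [hin, ← e1]
  have e3 : ∫ x in B, ψ x * (g x - g2 x) = (∫ x in B, ψ x * g x) - ∫ x in B, ψ x * g2 x := by
    rw [← integral_sub (hiu g hg hM) (hiu g2 hg2 hM2)]; simp_rw [mul_sub]
  rw [e3]
  calc ‖∫ x in B, ψ x * g x‖ₑ = ‖(∫ x in B, ψ x * g2 x) + ((∫ x in B, ψ x * g x) - ∫ x in B, ψ x * g2 x)‖ₑ := by congr 1; ring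
    _ ≤ _ := enorm_add_le _ _
    _ ≤ _ := by gcongr
end c8
section c9
variable {ι : Type} [Fintype ι]
lemma Qw_neg (h t : ι → ℝ) : Qw h (-t) = Qw h t := by
  unfold Qw; simp
lemma LL_neg (Φ : Fc ι) (x : ι → ℝ) : LL Φ (-x) = LL (fun t ↦ Φ (-t)) x := by
  unfold LL
  congr 1
  rw [← integral_neg_eq_self]
  congr 1; ext t
  simp [dotp]
lemma Bk_le' {h : ι → ℝ} (hh : ∀ j, 0 < h j) (x) : Bk h x ≤ iP h := by
  refine (Bk_le hh x).trans (fpl (fun j _ ↦ by have := hh j; positivity) fun j _ ↦ ?_)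
  have := hh j
  rw [inv_le_inv₀ pv this]; linarith
lemma conv_Bk_ft {h : ι → ℝ} (hh : ∀ j, 0 < h j) {φ : Fc ι} (hφ : Integrable φ) :
    Integrable (fun x ↦ ∫ u, ((Bk h (x - u) : ℝ) : ℂ) * φ u) ∧ ∀ t,
    ∫ x, cE cD t x * ∫ u, ((Bk h (x - u) : ℝ) : ℂ) * φ u =
      (∫ x, cE cD t x * φ x) * ((Qw h t : ℝ) : ℂ) := by
  have hi : Integrable (fun z : Vr ι × Vr ι ↦ ((Bk h (z.1 - z.2) : ℝ) : ℂ) * φ z.2) (volume.prod volume) := by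
    have := Integrable.convolution_integrand (ContinuousLinearMap.mul ℂ ℂ) hφ (Bk_int hh).ofReal (μ := volume) (ν := volume)
    refine this.congr (by filter_upwards with z; simp [mul_comm])
  refine ⟨hi.integral_prod_left, fun t ↦ ?_⟩
  have hd : Continuous fun x : ι → ℝ ↦ dotp t x := dotp_cont.comp (by fun_prop : Continuous fun x : ι → ℝ ↦ (t, x))
  have hi2 : Integrable (Function.uncurry fun (x u : ι → ℝ) ↦ cE cD t x * (((Bk h (x - u) : ℝ) : ℂ) * φ u))
      (volume.prod volume) := by
    refine Integrable.bdd_mul (c := 1) hi (Measurable.aestronglyMeasurable ?_) (by filter_upwards with z; rw [norm_exp_I])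
    have := hd.measurable; fun_prop
  simp_rw [← icm]
  rw [integral_integral_swap hi2, ← integral_mul_const]
  congr 1; ext u
  rw [← integral_add_right_eq_self _ u]
  rw [← Bk_ft hh t, ← icm]
  congr 1; ext x
  have : dotp t (x + u) = dotp t u + dotp t x := by simp [dotp, mul_add, sum_add_distrib, add_comm]
  rw [this, add_sub_cancel_right]; push_cast; rw [mul_add, Complex.exp_add]; ring
lemma N_l2 {h : ι → ℝ} (hh : ∀ j, 0 < h j) {φ : Fc ι} (hφ : Integrable φ) {p : ℝ} (hp : 2 ≤ p)
    (h1 : ∫⁻ x, ‖φ x‖ₑ ^ (p / (p - 1)) ≤ 1) :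
    ∫⁻ x, ‖∫ u, ((Bk h (x - u) : ℝ) : ℂ) * φ u‖ₑ ^ 2 ≤ ENNReal.ofReal (iP h ^ (1 - 2 / p)) := by
  have hp1 : 0 < p - 1 := by linarith
  set s := p / (p - 1) with hs
  have hs1 : 1 ≤ s := by rw [hs, le_div_iff₀ hp1]; linarith
  have hs0 : 0 < s := by linarith
  have hs2 : 2 / s - 1 = 1 - 2 / p := by rw [hs]; field_simp; ring
  have hE : 0 ≤ 1 - 2 / p := by rw [sub_nonneg, div_le_one bL]; exact hp
  have hP : 0 ≤ iP h := pnn fun j _ ↦ (inv_pos.2 (hh j)).le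
  have hBm := (Bk_cont h).measurable
  have hφe : AEMeasurable (fun u ↦ ‖φ u‖ₑ) := hφ.1.enorm
  set J : Vr ι → ℝ≥0∞ := fun x ↦ ∫⁻ u, ‖φ u‖ₑ ^ s * ENNReal.ofReal (Bk h (x - u)) with hJ
  have hBl : ∀ x : ι → ℝ, ∫⁻ u, oR (Bk h (x - u)) = 1 := fun x ↦ by
    rw [lintegral_sub_left_eq_self (fun u ↦ oR (Bk h u)) x, Bk_lint hh]
  have hJi : ∫⁻ x, J x ≤ 1 := by
    rw [hJ, conv_lint (hφe.pow_const s) (k := fun u ↦ oR (Bk h u)) fpr, Bk_lint hh, one_mul]; exact h1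
  have hJb : ∀ x, J x ≤ oR iP h := fun x ↦ by
    calc J x ≤ ∫⁻ u, ‖φ u‖ₑ ^ s * oR iP h :=
          lmo fun u ↦ mR (oRl (Bk_le' hh _)) _
      _ = (∫⁻ u, ‖φ u‖ₑ ^ s) * oR iP h := lintegral_mul_const' _ _ oRt
      _ ≤ 1 * _ := by gcongr
      _ = _ := one_mul _
  have key : ∀ x, ‖∫ u, ((Bk h (x - u) : ℝ) : ℂ) * φ u‖ₑ ^ 2 ≤ J x * oR iP h ^ (1 - 2 / p) := fun x ↦ by
    have h2 : ‖∫ u, ((Bk h (x - u) : ℝ) : ℂ) * φ u‖ₑ ^ s ≤ J x := by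
      calc _ ≤ (∫⁻ u, oR (Bk h (x - u)) * ‖φ u‖ₑ) ^ s := by
            refine err ((eil _).trans (lmo fun u ↦ ?_)) hs0.le
            rw [enorm_mul, enorm_cofReal (Bk_nonneg hh _)]
        _ ≤ _ := jensen fpr hφe hs1
        _ = _ := by rw [hBl, one_rpow, one_mul, hJ]; simp_rw [mul_comm]
    calc _ = (‖∫ u, ((Bk h (x - u) : ℝ) : ℂ) * φ u‖ₑ ^ s) ^ (2 / s) := by
          rw [← erm, mul_div_cancel₀ _ hs0.ne', rpow_two]
      _ ≤ J x ^ (2 / s) := err h2 pv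
      _ = J x * J x ^ (1 - 2 / p) := by
          rw [show 2 / s = 1 + (1 - 2 / p) by rw [← hs2]; ring, rpow_add_of_nonneg _ _ zero_le_one hE, ero]
      _ ≤ _ := mR (err (hJb x) hE) _
  calc _ ≤ ∫⁻ x, J x * oR iP h ^ (1 - 2 / p) := lmo key
    _ = (∫⁻ x, J x) * oR iP h ^ (1 - 2 / p) := lintegral_mul_const' _ _ (rnt hE oRt)
    _ ≤ 1 * _ := by gcongr
    _ = _ := by rw [one_mul, orn hP hE]
lemma weak_var {h : ι → ℝ} (hh : ∀ j, 0 < h j) {Γ : ℝ} (hΓ0 : 0 ≤ Γ) {Φ : Fc ι} (hΦ : ASM Φ)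
    (hΓ : ∀ t, ‖Φ t‖ ≤ Γ * Qw h t ^ 3) {φ : Fc ι} (hφ : Integrable φ) {p : ℝ} (hp : 2 ≤ p)
    (h1 : ∫⁻ x, ‖φ x‖ₑ ^ (p / (p - 1)) ≤ 1) :
    ∃ τ : Vr ι → ℝ≥0∞, Measurable τ ∧
      (∀ w, ‖∫ x, φ x * LL Φ (x - w)‖ₑ ^ 2 ≤ ∫⁻ u, oR (Bk h (w - u)) * ∫⁻ v, oR (Bk h (u - v)) * τ v) ∧
      ∫⁻ v, τ v ≤ oR (Γ ^ 2 * iP h ^ (1 - 2 / p)) := by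
  set φ' : Fc ι := fun t ↦ ∫ y, cE (cI * (dotp t y : ℝ)) * φ y with hφ'
  have hφ'b : ∀ t, ‖φ' t‖ ≤ ∫ y, ‖φ y‖ := fun t ↦ by
    refine (norm_integral_le_integral_norm _).trans (le_of_eq ?_)
    simp_rw [norm_mul, norm_exp_I, one_mul]
  have hφ'm : ASM φ' := by
    have hs : AEStronglyMeasurable (fun z : Vr ι × Vr ι ↦ Complex.exp (Complex.I * (dotp z.1 z.2 : ℝ)) * φ z.2) (volume.prod volume) := by
      refine AEStronglyMeasurable.mul (Measurable.aestronglyMeasurable ?_) hφ.1.comp_snd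
      have := (dotp_cont (ι := ι)).measurable; fun_prop
    exact hs.integral_prod_right'
  have hQc : Continuous fun t ↦ ((Qw h t : ℝ) : ℂ) := Complex.continuous_ofReal.comp (Qw_cont h)
  set Ψ : Fc ι := fun t ↦ φ' t * Φ (-t) with hΨ
  have hΨm : ASM Ψ :=
    hφ'm.mul (hΦ.comp_quasiMeasurePreserving (Measure.measurePreserving_neg (volume : Measure Vr ι)).quasiMeasurePreserving)
  have hΨ1m : ASM (fun t ↦ Ψ t / (Qw h t : ℂ)) := (hΨm.aemeasurable.div hQc.measurable.aemeasurable).aestronglyMeasurable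
  have hΨ2m : ASM (fun t ↦ Ψ t / (Qw h t : ℂ) / (Qw h t : ℂ)) := (hΨ1m.aemeasurable.div hQc.measurable.aemeasurable).aestronglyMeasurable
  have hΨb : ∀ t, ‖Ψ t‖ ≤ (Γ * ‖φ' t‖ * Qw h t) * Qw h t * Qw h t := fun t ↦ by
    rw [hΨ, norm_mul]
    have := hΓ (-t); rw [Qw_neg] at this
    calc _ ≤ ‖φ' t‖ * (Γ * Qw h t ^ 3) := by gcongr
      _ = _ := by ring
  have hn : ∀ t, ‖(Qw h t : ℂ)‖ = Qw h t := fun t ↦ by rw [cnr, rno (Qw_pos h t).le]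
  have hΨ1b : ∀ t, ‖Ψ t / (Qw h t : ℂ)‖ ≤ (Γ * ‖φ' t‖ * Qw h t) * Qw h t := fun t ↦ by
    rw [norm_div, hn, div_le_iff₀ (Qw_pos h t)]; exact hΨb t
  have hΨ2b : ∀ t, ‖Ψ t / (Qw h t : ℂ) / (Qw h t : ℂ)‖ ≤ (Γ * ‖φ' t‖ * Qw h t) := fun t ↦ by
    rw [norm_div, hn, div_le_iff₀ (Qw_pos h t)]; exact hΨ1b t
  have hc : ∀ t, Γ * ‖φ' t‖ * Qw h t ≤ Γ * (∫ y, ‖φ y‖) * Qw h t := fun t ↦ by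
    have := Qw_pos h t; have := hφ'b t; gcongr
  have hi2 : Integrable (fun t ↦ Ψ t / (Qw h t : ℂ) / (Qw h t : ℂ)) := int_of_Q hh hΨ2m fun t ↦ (hΨ2b t).trans (hc t)
  have hi1 : Integrable (fun t ↦ Ψ t / (Qw h t : ℂ)) := int_of_Q hh hΨ1m fun t ↦ (hΨ1b t).trans (by
    refine (mul_le_of_le_one_right ?_ (Qw_le h t)).trans (hc t)
    have := Qw_pos h t; positivity)
  have hΦi : Integrable (fun t ↦ Φ (-t)) := by
    refine int_of_Q hh (hΦ.comp_quasiMeasurePreserving (Measure.measurePreserving_neg (volume : Measure Vr ι)).quasiMeasurePreserving) (Γ := Γ) fun t ↦ ?_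
    have := hΓ (-t); rw [Qw_neg] at this
    refine this.trans ?_
    have := Qw_pos h t
    gcongr
    exact pow_le_of_le_one this.le (Qw_le h t) bN
  refine ⟨fun v ↦ ‖LL (fun t ↦ Ψ t / (Qw h t : ℂ) / (Qw h t : ℂ)) v‖ₑ ^ 2, by have := (LL_cont hi2).measurable; fun_prop, fun w ↦ ?_, ?_⟩
  · have e : ∫ x, φ x * LL Φ (x - w) = LL Ψ w := by
      refine Eq.trans ?_ (LL_conv measurable_id hφ hΦi w)
      congr 1; ext x
      rw [← LL_neg]; simp
    rw [e]
    refine (LL_smooth_sq hh hi1 w).trans (lmo fun u ↦ mR (LL_smooth_sq hh hi2 u) _)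
  · obtain ⟨hGi, hG⟩ := conv_Bk_ft hh hφ
    have hb := bessel hGi
    simp_rw [hG] at hb
    refine (LL_l2 hi2).trans ?_
    set c : ℝ := (2 * rP) ^ (-(fC ι : ℝ)) with hcd
    have hc0 : 0 ≤ c := by positivity
    calc _ ≤ oR c * ∫⁻ t, oR (Γ ^ 2) * ‖φ' t * ((Qw h t : ℝ) : ℂ)‖ₑ ^ 2 := by
          refine mR (lmo fun t ↦ ?_) _
          rw [← ofReal_norm, ← ofReal_norm, ← oRp (nnn _), ← oRp (nnn _), ← oRm pv]
          refine oRl ?_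
          rw [norm_mul, hn, ← mul_pow, ← mul_assoc]
          exact pow_le_pow_left₀ (nnn _) (hΨ2b t) 2
      _ = oR c * (oR (Γ ^ 2) * ∫⁻ t, ‖φ' t * ((Qw h t : ℝ) : ℂ)‖ₑ ^ 2) := by rw [lcm2 _ _ oRt]
      _ ≤ oR c * (oR (Γ ^ 2) * (oR ((2 * rP) ^ fC ι) * oR (iP h ^ (1 - 2 / p)))) := by
          refine mR (mR (hb.trans (mR (N_l2 hh hφ hp h1) _)) _) _
      _ = _ := by
          rw [← oRm pv, ← oRm pv, ← oRm hc0]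
          congr 1
          rw [hcd, Real.rpow_neg pv, rrc]
          field_simp
end c9
section c10
variable {ι : Type} [Fintype ι] {Ω : Type*} [MeasurableSpace Ω] (ν : Measure Ω) [IPM ν] {π : Ω → ι → ℝ}
lemma xi_update {L : Fc ι} {n : ℕ} (y : Fin n → Ω) (k : Fin n) (z : Ω) (x : ι → ℝ) :
    xiA ν π L y x - xiA ν π L (fU y k z) x = (n : ℂ)⁻¹ * (L (x - π (y k)) - L (x - π z)) := by
  have h2 : ∑ i, L (x - π (fU y k z i)) - L (x - π z) = ∑ i, L (x - π (y i)) - L (x - π (y k)) := by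
    rw [← add_sum_erase _ _ (mem_univ k), ← add_sum_erase _ (fun i ↦ L (x - π (y i))) (mem_univ k)]
    simp only [Function.update_self, add_sub_cancel_left]
    refine sum_congr rfl fun i hi ↦ ?_
    rw [Function.update_of_ne (ne_of_mem_erase hi)]
  unfold xiA
  linear_combination -(n : ℂ)⁻¹ * h2
lemma enorm_natC_inv {n : ℕ} (h : n ≠ 0) : ‖(n : ℂ)⁻¹‖ₑ = nI n := by
  rw [enorm_inv (by exact_mod_cast h), ← ofReal_norm, Complex.norm_natCast, ofReal_natCast]
lemma sub_sq_le (a b : ℂ) : ‖a - b‖ₑ ^ 2 ≤ 2 * (‖a‖ₑ ^ 2 + ‖b‖ₑ ^ 2) := by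
  have h : ‖a - b‖ ^ 2 ≤ 2 * (‖a‖ ^ 2 + ‖b‖ ^ 2) := by
    nlinarith [norm_sub_le a b, nnn (a - b), sq_nonneg (‖a‖ - ‖b‖)]
  rw [← ofReal_norm, ← ofReal_norm, ← ofReal_norm]
  rw [← oRp (nnn _), ← oRp (nnn _), ← oRp (nnn _),
    ← ofReal_add pv pv, show (2:Eo) = oR 2 by simp, ← oRm pv]
  exact oRl h
def bE (h : ι → ℝ) (π : Ω → ι → ℝ) {n : ℕ} (y : Fin n → Ω) (u : ι → ℝ) : Eo :=
  nI n * ∑ k, oR (Bk h (π (y k) - u))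
lemma bE_meas {h : ι → ℝ} (hπ : Measurable π) (n : ℕ) :
    Measurable fun z : (Fin n → Ω) × Vr ι ↦ bE h π z.1 z.2 := by
  have := (Bk_cont h).measurable
  refine measurable_const.mul (measurable_sum _ fun k _ ↦ measurable_ofReal.comp (this.comp ?_))
  exact (hπ.comp ((measurable_pi_apply k).comp measurable_fst)).sub measurable_snd
lemma bE_meas1 {h : ι → ℝ} {n : ℕ} (y : Fin n → Ω) : Measurable fun u ↦ bE h π y u := by
  have := (Bk_cont h).measurable
  refine measurable_const.mul (measurable_sum _ fun k _ ↦ measurable_ofReal.comp (this.comp ?_))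
  exact measurable_const.sub measurable_id
lemma bE_sup {h : ι → ℝ} (hh : ∀ j, 0 < h j) (hπ : Measurable π) {n : ℕ} (y : Fin n → Ω) {R : ℕ} (hR : 1 ≤ R)
    {τ : Vr ι → ℝ≥0∞} (hτ : Measurable τ) :
    ∫⁻ u, bE h π y u * ∫⁻ v, oR (Bk h (u - v)) * τ v ≤
      (oR iP h * ∫⁻ u, bE h π y u ^ R) ^ (1 / (R : ℝ)) * ∫⁻ v, τ v := by
  have hBm := (Bk_cont h).measurable
  have hbm : Measurable (bE h π y) := bE_meas1 y
  have hR0 : (0:ℝ) < R := by exact_mod_cast hR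
  have e : ∀ u, bE h π y u * ∫⁻ v, oR (Bk h (u - v)) * τ v = ∫⁻ v, bE h π y u * (oR (Bk h (u - v)) * τ v) := fun u ↦
    (lcm1 _ fpr).symm
  simp_rw [e]
  rw [lls (Measurable.aemeasurable fpr), ← lcm1 _ hτ]
  refine lmo fun v ↦ ?_
  simp_rw [← mul_assoc]
  rw [lintegral_mul_const _ fpr]
  refine mL ?_ _
  rw [one_div, le_rpow_inv_iff hR0]
  have hj := jensen (μ := volume) (k := fun u ↦ oR (Bk h (u - v))) (v := bE h π y) fpr hbm.aemeasurable (p := R) (by exact_mod_cast hR)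
  simp_rw [mul_comm (bE h π y _)]
  refine hj.trans ?_
  rw [lintegral_sub_right_eq_self (fun u ↦ oR (Bk h u)) v, Bk_lint hh, one_rpow, one_mul, ← lcm1 _ fpr]
  refine lmo fun u ↦ ?_
  rw [rpow_natCast]
  exact mL (oRl (Bk_le' hh _)) _
lemma bE_mom {h : ι → ℝ} (hh : ∀ j, 0 < h j) (hπ : Measurable π) {n : ℕ} (hn : n ≠ 0) {D : Eo} (hD : D ≠ ⊤)
    (hnD : oR iP h ≤ n * D) (hCq : ∀ z, ∫⁻ ω, oR (Bk h (z - π ω)) ∂ν ≤ D) (r : ℕ) :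
    ∫⁻ y, (∫⁻ u, bE h π y u ^ (r + 1)) ∂(mP n ν) ≤ SC D r := by
  have hBm := (Bk_cont h).measurable
  have hm := bE_meas (h := h) hπ n
  rw [lls (Measurable.aemeasurable fpr)]
  have hs : ∀ u, ∫⁻ ω, oR (Bk h (π ω - u)) ∂ν = ∫⁻ ω, oR (Bk h (u - π ω)) ∂ν := fun u ↦ by
    congr 1; ext ω; rw [← Bk_neg, neg_sub]
  calc _ ≤ ∫⁻ u, SC D r * ∫⁻ ω, oR (Bk h (u - π ω)) ∂ν := by
        refine lmo fun u ↦ ?_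
        rw [← hs]
        simp only [bE]
        exact S_mom ν hn (β := fun ω ↦ oR (Bk h (π ω - u))) fpr hD (fun z ↦ (oRl (Bk_le' hh _)).trans hnD) (by rw [hs]; exact hCq u) r
    _ = SC D r * ∫⁻ u, ∫⁻ ω, oR (Bk h (u - π ω)) ∂ν := lcm2 _ _ (SC_top hD r)
    _ = SC D r := by rw [lint_shift ν hπ (g := fun u ↦ ENNReal.ofReal (Bk h u)) fpr, Bk_lint hh, mul_one]
end c10
section c11
variable {ι : Type} [Fintype ι] {Ω : Type*} [MeasurableSpace Ω] (ν : Measure Ω) [IPM ν] {π : Ω → ι → ℝ}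
lemma pow3_le {h : ι → ℝ} {Γ : ℝ} (hΓ0 : 0 ≤ Γ) {Φ : Fc ι} (hΓ : ∀ t, ‖Φ t‖ ≤ Γ * Qw h t ^ 3) {i : ℕ} (hi : i ≤ 3) (t) : ‖Φ t‖ ≤ Γ * Qw h t ^ i :=
  (hΓ t).trans (mNL (pow_le_pow_of_le_one (Qw_pos h t).le (Qw_le h t) hi) hΓ0)
lemma pow3_le1 {h : ι → ℝ} {Γ : ℝ} (hΓ0 : 0 ≤ Γ) {Φ : Fc ι} (hΓ : ∀ t, ‖Φ t‖ ≤ Γ * Qw h t ^ 3) (t) : ‖Φ t‖ ≤ Γ * Qw h t := by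
  have := pow3_le hΓ0 hΓ (i := 1) bN t; rwa [pow_one] at this
def Vp (h : ι → ℝ) (π : Ω → ι → ℝ) (Γ p : ℝ) (D : Eo) (R : ℕ) {n : ℕ} (y : Fin n → Ω) : Eo :=
  2 * oR (Γ ^ 2 * iP h ^ (1 - 2 / p)) * nI n *
    ((oR iP h * ∫⁻ u, bE h π y u ^ R) ^ (1 / (R : ℝ)) + D)
lemma es_bound {h : ι → ℝ} (hh : ∀ j, 0 < h j) (hπ : Measurable π) {Γ : ℝ} (hΓ0 : 0 ≤ Γ) {Φ : Fc ι} (hΦ : ASM Φ)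
    (hΓ : ∀ t, ‖Φ t‖ ≤ Γ * Qw h t ^ 3) {p : ℝ} (hp : 2 ≤ p) {B : Set Vr ι} (hB : MeasurableSet B) (hBf : volume B ≠ ⊤)
    {D : Eo} (hCq : ∀ z, ∫⁻ ω, oR (Bk h (z - π ω)) ∂ν ≤ D) {n : ℕ} (hn : n ≠ 0) {R : ℕ} (hR : 1 ≤ R) (y : Fin n → Ω) :
    ∑ k, ∫⁻ z, (lpB p B (xiA ν π (LL Φ) y) - lpB p B (xiA ν π (LL Φ) (Function.update y k z))) ^ 2 ∂ν ≤ Vp h π Γ p D R y := by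
  have hBm := (Bk_cont h).measurable
  have hΦ1 := pow3_le1 hΓ0 hΓ
  have hLi : Integrable Φ := int_of_Q hh hΦ hΦ1
  have hLm : Measurable (LL Φ) := (LL_cont hLi).measurable
  have hLb := LL_supQ hh hΓ0 hΦ hΦ1
  obtain ⟨φ, hφm, hφi, hφ1, hφ⟩ := norming hp hB hBf (xi_meas1 ν hπ hLm y) (xi_bd ν hLb hn y)
  obtain ⟨τ, hτm, hτ, hτi⟩ := weak_var hh hΓ0 hΦ hΓ hφi hp hφ1
  set S : Vr ι → ℝ≥0∞ := fun u ↦ ∫⁻ v, ENNReal.ofReal (Bk h (u - v)) * τ v with hS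
  have hSm : Measurable S := Measurable.lintegral_prod_right' (f := fun z : Vr ι × Vr ι ↦ ENNReal.ofReal (Bk h (z.1 - z.2)) * τ z.2) fpr
  set G : Vr ι → ℝ≥0∞ := fun w ↦ ∫⁻ u, ENNReal.ofReal (Bk h (w - u)) * S u with hG
  have hGm : Measurable G := Measurable.lintegral_prod_right' (f := fun z : Vr ι × Vr ι ↦ ENNReal.ofReal (Bk h (z.1 - z.2)) * S z.2) fpr
  have hint : ∀ w, Integrable fun x ↦ φ x * LL Φ (x - w) := fun w ↦ by
    have : Integrable fun x ↦ LL Φ (x - w) * φ x := hφi.bdd_mul (c := Γ * iP h) (Measurable.aestronglyMeasurable fpr) (by filter_upwards with x using hLb _)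
    simpa [mul_comm] using this
  have step : ∀ k z, (lpB p B (xiA ν π (LL Φ) y) - lpB p B (xiA ν π (LL Φ) (fU y k z))) ^ 2 ≤
      nI n ^ 2 * (2 * (G (π (y k)) + G (π z))) := fun k z ↦ by
    have h1 := hφ _ (xi_meas1 ν hπ hLm (fU y k z)) (xi_bd ν hLb hn _)
    have h2 : ∫ x, φ x * (xiA ν π (LL Φ) y x - xiA ν π (LL Φ) (fU y k z) x) =
        (n : ℂ)⁻¹ * ((∫ x, φ x * LL Φ (x - π (y k))) - ∫ x, φ x * LL Φ (x - π z)) := by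
      rw [← integral_sub (hint _) (hint _), ← icm]
      congr 1; ext x; rw [xi_update]; ring
    rw [h2] at h1
    calc _ ≤ ‖(n : ℂ)⁻¹ * ((∫ x, φ x * LL Φ (x - π (y k))) - ∫ x, φ x * LL Φ (x - π z))‖ₑ ^ 2 :=
          ppl (tsub_le_iff_left.2 h1) 2
      _ = nI n ^ 2 * ‖(∫ x, φ x * LL Φ (x - π (y k))) - ∫ x, φ x * LL Φ (x - π z)‖ₑ ^ 2 := by
          rw [enorm_mul, mul_pow, enorm_natC_inv hn]
      _ ≤ _ := mR ((sub_sq_le _ _).trans (mR (add_le_add (hτ _) (hτ _)) _)) _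
  have hGk : nI n * ∑ k, G (π (y k)) = ∫⁻ u, bE h π y u * S u := by
    simp only [bE, hG]
    rw [← lintegral_finsetSum _ (fun k _ ↦ by fun_prop), ← lcm1 _ fpr]
    congr 1; ext u; rw [mul_assoc, sum_mul]
  have hGz : ∫⁻ z, G (π z) ∂ν ≤ D * ∫⁻ v, τ v := by
    simp only [hG]
    rw [lls (Measurable.aemeasurable fpr)]
    have e : ∫⁻ u, S u = ∫⁻ v, τ v := by
      have := conv_lint hτm.aemeasurable (k := fun u ↦ oR (Bk h u)) fpr
      rw [Bk_lint hh, one_mul] at this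
      rw [← this, hS]; simp_rw [mul_comm]
    rw [← e, ← lcm1 _ hSm]
    refine lmo fun u ↦ ?_
    rw [lintegral_mul_const _ fpr]
    refine mL ?_ _
    refine le_trans (le_of_eq ?_) (hCq u)
    congr 1; ext ω; rw [← Bk_neg, neg_sub]
  have hnn : (n : Eo) ≠ 0 := by exact_mod_cast hn
  have hnt : (n : Eo) ≠ ⊤ := natCast_ne_top n
  calc _ ≤ ∑ k, ∫⁻ z, nI n ^ 2 * (2 * (G (π (y k)) + G (π z))) ∂ν := sum_le_sum fun k _ ↦ lmo fun z ↦ step k z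
    _ = ∑ k, nI n ^ 2 * (2 * (G (π (y k)) + ∫⁻ z, G (π z) ∂ν)) := by
        refine sum_congr rfl fun k _ ↦ ?_
        rw [lcm1 _ fpr, lcm1 _ fpr, lal mco]; simp
    _ = 2 * nI n * (nI n * ∑ k, G (π (y k)) + ∫⁻ z, G (π z) ∂ν) := by
        rw [← mul_sum, ← mul_sum, sum_add_distrib, sum_const, card_univ, Fintype.card_fin, nsmul_eq_mul]
        have : ∫⁻ z, G (π z) ∂ν = nI n * (n * ∫⁻ z, G (π z) ∂ν) := by rw [← mul_assoc, ENNReal.inv_mul_cancel hnn hnt, one_mul]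
        nth_rewrite 2 [this]
        ring
    _ ≤ 2 * nI n * ((oR iP h * ∫⁻ u, bE h π y u ^ R) ^ (1 / (R : ℝ)) * (∫⁻ v, τ v) + D * ∫⁻ v, τ v) := by
        rw [hGk]
        exact mR (add_le_add (bE_sup hh hπ y hR hτm) hGz) _
    _ = 2 * (∫⁻ v, τ v) * nI n * ((oR iP h * ∫⁻ u, bE h π y u ^ R) ^ (1 / (R : ℝ)) + D) := by ring
    _ ≤ _ := by
        unfold Vp
        exact mL (mL (mR hτi _) _) _
lemma lpB_meas {p : ℝ} {B : Set Vr ι} {n : ℕ} {L : Fc ι} (hπ : Measurable π) (hL : Measurable L) :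
    Measurable fun y : Fin n → Ω ↦ lpB p B (xiA ν π L y) := by
  have := xi_meas ν hπ hL n
  exact (Measurable.lintegral_prod_right' (ν := volume.restrict B) (f := fun z : (Fin n → Ω) × Vr ι ↦ ‖xiA ν π L z.1 z.2‖ₑ ^ p) (this.enorm.pow_const p)).pow_const _
def CV (D : Eo) (j : ℕ) : Eo := CR j * (4 ^ (2 ^ j) * (SC D (2 ^ j - 1) + D ^ (2 ^ j)))
lemma CV_top {D : Eo} (hD : D ≠ ⊤) (j : ℕ) : CV D j ≠ ⊤ := by
  have := CR_top j; have := SC_top hD (2 ^ j - 1)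
  unfold CV; finiteness
lemma dev_B {h : ι → ℝ} (hh : ∀ j, 0 < h j) (hh1 : ∀ j, h j ≤ 1) (hπ : Measurable π) {Γ : ℝ} (hΓ0 : 0 ≤ Γ) {Φ : Fc ι} (hΦ : ASM Φ)
    (hΓ : ∀ t, ‖Φ t‖ ≤ Γ * Qw h t ^ 3) {p : ℝ} (hp : 2 ≤ p) {B : Set Vr ι} (hB : MeasurableSet B) (hBf : volume B ≠ ⊤)
    {D : Eo} (hD : D ≠ ⊤) {n : ℕ} (hn : n ≠ 0) (hnD : oR iP h ≤ n * D)
    (hCq : ∀ z, ∫⁻ ω, oR (Bk h (z - π ω)) ∂ν ≤ D) (j : ℕ) :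
    ∫⁻ y, (lpB p B (xiA ν π (LL Φ) y) - ∫⁻ y', lpB p B (xiA ν π (LL Φ) y') ∂(mP n ν)) ^ (2 ^ (j + 1)) ∂(mP n ν) ≤
      CV D j * ((ENNReal.ofReal (Γ ^ 2 * (∏ j, (h j)⁻¹) ^ (1 - 2 / p)) * (n : ℝ≥0∞)⁻¹) ^ (2 ^ j) * ENNReal.ofReal (∏ j, (h j)⁻¹)) := by
  have hΦ1 := pow3_le1 hΓ0 hΓ
  have hLm : Measurable (LL Φ) := (LL_cont (int_of_Q hh hΦ hΦ1)).measurable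
  have hLb := LL_supQ hh hΓ0 hΦ hΦ1
  have hbm := bE_meas (h := h) hπ n
  set R := 2 ^ j with hRd
  have hR : 1 ≤ R := Nat.one_le_two_pow
  have hW : Measurable fun y : Fin n → Ω ↦ ∫⁻ u, bE h π y u ^ R :=
    Measurable.lintegral_prod_right' (f := fun z : (Fin n → Ω) × Vr ι ↦ bE h π z.1 z.2 ^ R) (hbm.pow_const R)
  have hVm : Measurable fun y : Fin n → Ω ↦ Vp h π Γ p D R y := by
    unfold Vp
    exact measurable_const.mul (((measurable_const.mul hW).pow_const _).add mco)
  have hM : (oR (2 * (Γ * iP h)) ^ p * volume B) ^ (1 / p) ≠ ⊤ := by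
    have : 0 ≤ p := by linarith
    have : 0 ≤ 1 / p := by positivity
    finiteness
  have key := mom_rec ν (lpB_meas ν (B := B) hπ hLm) hVm hM
    (fun y => ENNReal.rpow_le_rpow (lint_bd (by linarith) (xi_bd ν hLb hn y)) (by have : 0 ≤ p := by linarith
                                                                                  positivity))
    (fun y ↦ es_bound ν hh hπ hΓ0 hΦ hΓ hp hB hBf hCq hn hR y) j
  refine key.trans ?_
  unfold CV
  rw [mul_assoc]
  refine mR ?_ _
  set Hi := oR iP h with hHi
  have hHi1 : 1 ≤ Hi := by
    rw [hHi, ← ofReal_one]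
    refine oRl ?_
    rw [Finset.prod_inv_distrib]
    exact (one_le_inv₀ (fpp fun j _ ↦ hh j)).2 (prod_le_one (fun j _ ↦ (hh j).le) fun j _ ↦ hh1 j)
  set c := oR (Γ ^ 2 * iP h ^ (1 - 2 / p)) * nI n with hc
  have hR0 : rn R ≠ 0 := by positivity
  have hV : ∀ y : Fin n → Ω, Vp h π Γ p D R y ^ R ≤ (4 ^ R * c ^ R) * (Hi * (∫⁻ u, bE h π y u ^ R) + D ^ R) := fun y ↦ by
    have e : Vp h π Γ p D R y = 2 * c * ((Hi * ∫⁻ u, bE h π y u ^ R) ^ (1 / (R : ℝ)) + D) := by unfold Vp; rw [hc]; ring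
    rw [e, mul_pow]
    refine (mR (add_pow_le2 _ _ R) _).trans (le_of_eq ?_)
    rw [← rpow_mul_natCast, one_div, inv_mul_cancel₀ hR0, ero, mul_pow, show (4:Eo) ^ R = 2 ^ R * 2 ^ R by rw [← mul_pow]; norm_num]; ring
  calc _ ≤ ∫⁻ y, (4 ^ R * c ^ R) * (Hi * (∫⁻ u, bE h π y u ^ R) + D ^ R) ∂(mP n ν) := lmo hV
    _ = (4 ^ R * c ^ R) * (Hi * (∫⁻ y, (∫⁻ u, bE h π y u ^ R) ∂(mP n ν)) + D ^ R) := by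
        rw [lcm1 _ fpr, lintegral_add_right _ mco, lcm1 _ hW]; simp
    _ ≤ (4 ^ R * c ^ R) * (Hi * SC D (R - 1) + Hi * D ^ R) := by
        have := bE_mom ν hh hπ hn hD hnD hCq (R - 1)
        rw [Nat.sub_add_cancel hR] at this
        refine mR (add_le_add (mR this _) ?_) _
        calc D ^ R = 1 * D ^ R := (one_mul _).symm
          _ ≤ _ := mL hHi1 _
    _ = _ := by ring
end c11
section c12
variable {ι : Type} [Fintype ι] {Ω : Type*} [MeasurableSpace Ω] (ν : Measure Ω) [IPM ν] {π : Ω → ι → ℝ}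
lemma conv_pow {Z a : Eo} (ha : a ≠ 0) (hat : a ≠ ⊤) {m N : ℕ} (hm : m ≠ 0) (hmN : m ≤ N) :
    (Z - 2 * a) ^ m ≤ (Z - a) ^ N * (a⁻¹) ^ (N - m) := by
  have e : Z - 2 * a = (Z - a) - a := by rw [two_mul, tsub_add_eq_tsub_tsub]
  rw [e]
  set X := Z - a
  rcases le_total X a with h | h
  · rw [tsub_eq_zero_of_le h, zero_pow hm]; exact zero_le
  calc (X - a) ^ m ≤ X ^ m := ppl tsub_le_self m
    _ = X ^ m * (a ^ (N - m) * (a⁻¹) ^ (N - m)) := by rw [← mul_pow, ENNReal.mul_inv_cancel ha hat, one_pow, mul_one]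
    _ ≤ X ^ m * (X ^ (N - m) * (a⁻¹) ^ (N - m)) := mR (mL (ppl h _) _) _
    _ = _ := by rw [← mul_assoc, ← pow_add, Nat.add_sub_cancel' hmN]
lemma ll_add {α β : Type*} [MeasurableSpace α] [MeasurableSpace β] (μ1 : Measure α) (μ2 : Measure β) [SFinite μ2] {c : Eo} (hc : c ≠ ⊤)
    (F G : α → β → Eo) (hF : Measurable fun z : α × β ↦ F z.1 z.2) :
    ∫⁻ y, (∫⁻ x, c * (F y x + G y x) ∂μ2) ∂μ1 = c * (∫⁻ y, (∫⁻ x, F y x ∂μ2) ∂μ1 + ∫⁻ y, (∫⁻ x, G y x ∂μ2) ∂μ1) := by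
  rw [← lal (lpr hF), ← lcm2 _ _ hc]
  refine lco fun y ↦ ?_
  have hy : Measurable (F y) := hF.comp measurable_prodMk_left
  rw [lcm2 _ _ hc, lal hy]
def U0 (h : ι → ℝ) (n : ℕ) (Γ : ℝ) : ℝ := Γ / Real.sqrt (n * ∏ j, h j)
def CM (p c0 D : ℝ) : ℝ := 2 ^ p * (2 * (Cc p * ((Real.sqrt c0 / 2) ^ 2 * rE ((Real.sqrt c0 / 2) ^ 2 * D)) / (Real.sqrt c0 / 2) ^ p))
lemma CM_pos {p c0 D : ℝ} (hc : 0 < c0) : 0 < CM p c0 D := by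
  have := Cc_pos p; have := Real.sqrt_pos.2 hc
  unfold CM; positivity
lemma norm_rpow_cosh {p : ℝ} (hp : 2 ≤ p) {a : ℝ} (ha : 0 < a) (z : ℂ) :
    ‖z‖ₑ ^ p ≤ oR (2 ^ p * (Cc p / a ^ p)) * (oR (rC (a * z.re) - 1) + oR (rC (a * z.im) - 1)) := by
  have hp0 : 0 ≤ p := by linarith
  have hcc := Cc_pos p
  have h1 : ∀ r : ℝ, |r| ^ p ≤ Cc p / a ^ p * (rC (a * r) - 1) := fun r ↦ by
    have := pow_le_cosh hp (a * r)
    rw [abs_mul, rmr (abs_nonneg _) (abs_nonneg _), abs_of_pos ha] at this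
    rw [div_mul_eq_mul_div, le_div_iff₀ pv]; linarith
  have hm : ‖z‖ ^ p ≤ 2 ^ p * (|z.re| ^ p + |z.im| ^ p) := by
    have h2 : ‖z‖ ≤ 2 * max |z.re| |z.im| := (Complex.norm_le_abs_re_add_abs_im z).trans (by linarith [le_max_left |z.re| |z.im|, le_max_right |z.re| |z.im|])
    calc _ ≤ (2 * max |z.re| |z.im|) ^ p := by gcongr
      _ = 2 ^ p * (max |z.re| |z.im|) ^ p := rmr bN pv
      _ ≤ _ := by
        gcongr
        rcases max_choice |z.re| |z.im| with h | h <;> rw [h]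
        · have : 0 ≤ |z.im| ^ p := by positivity
          linarith
        · have : 0 ≤ |z.re| ^ p := by positivity
          linarith
  have h0 : ∀ u, 0 ≤ rC u - 1 := fun u ↦ by linarith [Real.one_le_cosh u]
  rw [← ofReal_norm, orn (nnn _) hp0, ← ofReal_add (h0 _) (h0 _), ← oRm pv]
  refine oRl (hm.trans ?_)
  rw [mul_assoc]
  gcongr
  linarith [h1 z.re, h1 z.im]
lemma cosh_re {h : ι → ℝ} (hh : ∀ j, 0 < h j) (hπ : Measurable π) {Γ : ℝ} (hΓ0 : 0 < Γ) {Φ : Fc ι} (hΦ : ASM Φ)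
    (hΓ : ∀ t, ‖Φ t‖ ≤ Γ * Qw h t ^ 2) {n : ℕ} (hn : n ≠ 0) {c D : ℝ} (hc0 : 0 < c) (hc : 2 * c ≤ Real.sqrt (n * ∏ j, h j)) (hD0 : 0 ≤ D)
    (hCq : ∀ z, ∫⁻ ω, oR (Bk h (z - π ω)) ∂ν ≤ oR D) (re : ℂ →L[ℝ] ℝ) (hre : ∀ z, |re z| ≤ ‖z‖) :
    ∫⁻ y, (∫⁻ x, oR (rC (c / U0 h n Γ * re (xiA ν π (LL Φ) y x)) - 1)) ∂(mP n ν) ≤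
      oR (c ^ 2 * rE (c ^ 2 * D)) := by
  have hΦ1 : ∀ t, ‖Φ t‖ ≤ Γ * Qw h t := fun t ↦ (hΓ t).trans (mNL (pow_le_of_le_one (Qw_pos h t).le (Qw_le h t) bN) hΓ0.le)
  have hLm : Measurable (LL Φ) := (LL_cont (int_of_Q hh hΦ hΦ1)).measurable
  have hLb := LL_supQ hh hΓ0.le hΦ hΦ1
  set H := ∏ j, h j with hH
  have hH0 : 0 < H := fpp fun j _ ↦ hh j
  have hHi : iP h = H⁻¹ := prod_inv_distrib ..
  have hn0 : (0:ℝ) < n := by positivity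
  set r := Real.sqrt (n * H) with hr
  have hr0 : 0 < r := Real.sqrt_pos.2 pv
  have hr2 : r ^ 2 = n * H := Real.sq_sqrt pv
  have hv := var_bd ν hh hπ hΦ hΓ hCq
  simp_rw [← oRm hD0] at hv
  set θ : ℝ := c * r / (n * Γ) with hθ
  have e1 : n * θ ^ 2 = c ^ 2 * (H / Γ ^ 2) := by rw [hθ, div_pow, mul_pow, hr2]; field_simp
  have key := cosh_int ν hπ hLm hLb (vb := D * (Γ ^ 2 * iP h)) (by rw [hHi]; positivity) hv (θ := θ) pv (by
    rw [hHi, hθ, show 2 * (c * r / (n * Γ)) * (Γ * H⁻¹) = 2 * c * r / (n * H) by field_simp, ← hr2, div_le_one pv]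
    nlinarith) re hre hn
  have e2 : θ * n = c / U0 h n Γ := by unfold U0; rw [← hH, ← hr, hθ]; field_simp
  rw [e2] at key
  refine key.trans ((mR (LL_l2Q hh hΦ hΦ1) _).trans (le_of_eq ?_))
  rw [← oRm pv, e1, hHi]
  congr 1
  rw [show c ^ 2 * (H / Γ ^ 2) * (D * (Γ ^ 2 * H⁻¹)) = c ^ 2 * D by field_simp]; field_simp
lemma mom_ge2 {h : ι → ℝ} (hh : ∀ j, 0 < h j) (hπ : Measurable π) {Γ : ℝ} (hΓ0 : 0 < Γ) {Φ : Fc ι} (hΦ : ASM Φ)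
    (hΓ : ∀ t, ‖Φ t‖ ≤ Γ * Qw h t ^ 3) {p : ℝ} (hp : 2 ≤ p) {n : ℕ} (hn : n ≠ 0) {c0 D : ℝ} (hc0 : 0 < c0) (hc : c0 ≤ n * ∏ j, h j) (hD0 : 0 ≤ D)
    (hCq : ∀ z, ∫⁻ ω, oR (Bk h (z - π ω)) ∂ν ≤ oR D) :
    ∫⁻ y, (∫⁻ x, ‖xiA ν π (LL Φ) y x‖ₑ ^ p) ∂(mP n ν) ≤ oR (CM p c0 D * U0 h n Γ ^ p) := by
  have hΓ2 := pow3_le hΓ0.le hΓ (i := 2) bN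
  have hΦ1 := pow3_le1 hΓ0.le hΓ
  have hLm : Measurable (LL Φ) := (LL_cont (int_of_Q hh hΦ hΦ1)).measurable
  have hxm := xi_meas ν hπ hLm n
  set c := Real.sqrt c0 / 2 with hcd
  have hcp : 0 < c := by have := Real.sqrt_pos.2 hc0; positivity
  have hU : 0 < U0 h n Γ := div_pos hΓ0 (Real.sqrt_pos.2 (hc0.trans_le hc))
  have h2 : 2 * c ≤ Real.sqrt (n * ∏ j, h j) := by rw [hcd]; have := Real.sqrt_le_sqrt hc; linarith
  have k1 := cosh_re ν hh hπ hΓ0 hΦ hΓ2 hn hcp h2 hD0 hCq Complex.reCLM Complex.abs_re_le_norm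
  have k2 := cosh_re ν hh hπ hΓ0 hΦ hΓ2 hn hcp h2 hD0 hCq Complex.imCLM Complex.abs_im_le_norm
  set a := c / U0 h n Γ with ha
  have ha0 : 0 < a := div_pos hcp hU
  have hmR : Measurable fun z : (Fin n → Ω) × Vr ι ↦ oR (rC (a * (xiA ν π (LL Φ) z.1 z.2).re) - 1) := by
    have := Complex.measurable_re.comp hxm
    exact measurable_ofReal.comp ((Real.measurable_cosh.comp (measurable_const.mul this)).sub mco)
  have hcc := Cc_pos p
  calc _ ≤ ∫⁻ y, (∫⁻ x, oR (2 ^ p * (Cc p / a ^ p)) * (oR (rC (a * (xiA ν π (LL Φ) y x).re) - 1) +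
          oR (rC (a * (xiA ν π (LL Φ) y x).im) - 1))) ∂(mP n ν) :=
        lmo fun y ↦ lmo fun x ↦ norm_rpow_cosh hp ha0 _
    _ = oR (2 ^ p * (Cc p / a ^ p)) * (∫⁻ y, (∫⁻ x, oR (rC (a * (xiA ν π (LL Φ) y x).re) - 1)) ∂(mP n ν) +
          ∫⁻ y, (∫⁻ x, oR (rC (a * (xiA ν π (LL Φ) y x).im) - 1)) ∂(mP n ν)) := by
        exact ll_add _ _ oRt (fun y x ↦ oR (rC (a * (xiA ν π (LL Φ) y x).re) - 1)) (fun y x ↦ oR (rC (a * (xiA ν π (LL Φ) y x).im) - 1)) hmR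
    _ ≤ oR (2 ^ p * (Cc p / a ^ p)) * (oR (c ^ 2 * rE (c ^ 2 * D)) + oR (c ^ 2 * rE (c ^ 2 * D))) :=
        mR (add_le_add k1 k2) _
    _ = _ := by
        rw [← ofReal_add pv pv, ← oRm pv]
        congr 1
        unfold CM
        rw [← hcd, ha, Real.div_rpow hcp.le hU.le]
        field_simp; ring
end c12
section c13
variable {ι : Type} [Fintype ι] {Ω : Type} [MeasurableSpace Ω] (ν : Measure Ω) [IPM ν] {π : Ω → ι → ℝ}
lemma U0_pow_le {h : ι → ℝ} (hh : ∀ j, 0 < h j) (hh1 : ∀ j, h j ≤ 1) {n : ℕ} (hn : n ≠ 0) {Γ G a : ℝ} (hΓ0 : 0 ≤ Γ) (hG : 0 < G) (hΓG : Γ ≤ G * (∏ j, h j) ^ (-a))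
    {m : ℕ} {s : ℝ} (hs : 2 + m * (a + 1 / 2) ≤ s) :
    U0 h n Γ ^ m * (∏ j, h j) ^ s * (∏ j, h j)⁻¹ ≤ G ^ m * rn n ^ (-rn m / 2) * ∏ j, h j := by
  have hn0 : (0:ℝ) < n := by positivity
  unfold U0
  set H := ∏ j, h j with hH
  have hH0 : 0 < H := fpp fun j _ ↦ hh j
  have hH1 : H ≤ 1 := prod_le_one (fun j _ ↦ (hh j).le) fun j _ ↦ hh1 j
  have e1 : Γ / √(n * H) ≤ G * rn n ^ (-(1:ℝ) / 2) * H ^ (-(a + 1 / 2)) := by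
    rw [Real.sqrt_eq_rpow, rmr hn0.le hH0.le, div_le_iff₀ pv]
    calc Γ ≤ G * H ^ (-a) := hΓG
      _ = G * (rn n ^ (-(1:ℝ) / 2) * rn n ^ (1 / 2 : ℝ)) * (H ^ (-(a + 1 / 2)) * H ^ (1 / 2 : ℝ)) := by
        rw [← rra hn0, ← rra hH0]; norm_num
      _ = _ := by ring
  calc _ ≤ (G * rn n ^ (-(1:ℝ) / 2) * H ^ (-(a + 1 / 2))) ^ m * H ^ s * H⁻¹ := by gcongr
    _ = G ^ m * rn n ^ (-(m:ℝ) / 2) * H ^ (-(a + 1 / 2) * m + s - 1) := by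
      rw [mul_pow, mul_pow, ← Real.rpow_mul_natCast hn0.le, ← Real.rpow_mul_natCast hH0.le, Real.rpow_sub_one hH0.ne', rra hH0]
      rw [show -(1:ℝ) / 2 * m = -(m:ℝ) / 2 by ring]; ring
    _ ≤ _ := by
      gcongr
      calc _ ≤ H ^ (1:ℝ) := Real.rpow_le_rpow_of_exponent_ge hH0 hH1 (by nlinarith)
        _ = H := Real.rpow_one H
lemma lpB_fatou {p : ℝ} (hπ : Measurable π) {L : Fc ι} (hL : Measurable L) (n N : ℕ) (e C : Eo)
    (hB : ∀ k : ℕ, ∫⁻ y, (lpB p (Metric.closedBall 0 k) (xiA ν π L y) - e) ^ N ∂(mP n ν) ≤ C) :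
    ∫⁻ y, (lpB p Set.univ (xiA ν π L y) - e) ^ N ∂(mP n ν) ≤ C := by
  have key : ∀ y : Fin n → Ω, Tendsto (fun k : ℕ ↦ (lpB p (Metric.closedBall 0 k) (xiA ν π L y) - e) ^ N) atTop (𝓝 ((lpB p Set.univ (xiA ν π L y) - e) ^ N)) := fun y ↦ by
    have h1 := (aecover_closedBall (μ := (volume : Measure Vr ι)) (x := 0) (tendsto_natCast_atTop_atTop (R := ℝ))).lintegral_tendsto_of_countably_generated
      (f := fun x ↦ ‖xiA ν π L y x‖ₑ ^ p) (((xi_meas1 ν hπ hL y).enorm.pow_const p).aemeasurable)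
    rw [← setLIntegral_univ (μ := volume)] at h1
    have hc : Continuous fun t : Eo ↦ (t ^ (1 / p) - e) ^ N :=
      (ENNReal.continuous_pow N).comp ((ENNReal.continuous_sub_right e).comp ENNReal.continuous_rpow_const)
    exact (hc.tendsto _).comp h1
  calc _ = ∫⁻ y, liminf (fun k : ℕ ↦ (lpB p (Metric.closedBall 0 k) (xiA ν π L y) - e) ^ N) atTop ∂(mP n ν) :=
        lco fun y ↦ (key y).liminf_eq.symm
    _ ≤ liminf (fun k : ℕ ↦ ∫⁻ y, (lpB p (Metric.closedBall 0 k) (xiA ν π L y) - e) ^ N ∂(mP n ν)) atTop :=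
        lintegral_liminf_le fun k ↦ ((lpB_meas ν hπ hL).sub mco).pow_const N
    _ ≤ liminf (fun _ : ℕ ↦ C) atTop := liminf_le_liminf (Eventually.of_forall hB)
    _ = C := by simp
lemma dev_ge2 {p : ℝ} (hp : 2 ≤ p) {c0 D G a : ℝ} (hc0 : 0 < c0) (hD : c0⁻¹ ≤ D) (hG : 0 < G) (ha : 0 ≤ a) {m : ℕ} (hm : m ≠ 0) :
    ∃ γ C : ℝ, 0 < γ ∧ 0 < C ∧ ∀ {Ω : Type} [MeasurableSpace Ω] (ν : Measure Ω) [IPM ν] {π : Ω → ι → ℝ} (_ : Measurable π)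
      {h : ι → ℝ} (_ : ∀ j, 0 < h j) (_ : ∀ j, h j ≤ 1) {Γ : ℝ} (_ : 0 < Γ) (_ : Γ ≤ G * (∏ j, h j) ^ (-a)) {Φ : Fc ι} (_ : ASM Φ)
      (_ : ∀ t, ‖Φ t‖ ≤ Γ * Qw h t ^ 3) {n : ℕ} (_ : n ≠ 0) (_ : c0 ≤ n * ∏ j, h j)
      (_ : ∀ z, ∫⁻ ω, oR (Bk h (z - π ω)) ∂ν ≤ oR D),
      ∫⁻ y, (lpB p Set.univ (xiA ν π (LL Φ) y) - oR (γ * U0 h n Γ)) ^ m ∂(mP n ν) ≤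
        oR (C * rn n ^ (-rn m / 2) * ∏ j, h j) := by
  have hp0 : 0 < p := by linarith
  have hD0 : 0 < D := (inv_pos.2 hc0).trans_le hD
  have hcm := CM_pos (p := p) (D := D) hc0
  set g := CM p c0 D ^ (1 / p) with hg
  have hg0 : 0 < g := by positivity
  obtain ⟨j, hj⟩ := pow_unbounded_of_one_lt (max (p * (2 + m * (a + 1 / 2))) m) (one_lt_two)
  have hj1 : 2 + m * (a + 1 / 2) ≤ 2 / p * (2 ^ j : ℕ) := by
    have := (le_max_left (p * (2 + m * (a + 1 / 2))) (m:ℝ)).trans hj.le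
    rw [div_mul_eq_mul_div, le_div_iff₀ hp0]; push_cast
    nlinarith [show (0:ℝ) ≤ 2 ^ j by positivity]
  have hmN : m ≤ 2 ^ (j + 1) := by
    have : (m:ℝ) ≤ 2 ^ j := (le_max_right _ _).trans hj.le
    have : m ≤ 2 ^ j := by exact_mod_cast this
    rw [pow_succ]; omega
  refine ⟨2 * g, (CV (oR D) j).toReal * (g⁻¹ ^ (2 ^ (j + 1) - m) * G ^ m) + 1, by positivity, by positivity, ?_⟩
  intro Ω _ ν _ π hπ h hh hh1 Γ hΓ0 hΓG Φ hΦ hΓ n hn hc hCq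
  have hLm : Measurable (LL Φ) := (LL_cont (int_of_Q hh hΦ (pow3_le1 hΓ0.le hΓ))).measurable
  have hn0 : (0:ℝ) < n := by positivity
  have hfin := U0_pow_le hh hh1 hn hΓ0.le hG hΓG hj1
  have hU : 0 < U0 h n Γ := div_pos hΓ0 (Real.sqrt_pos.2 (hc0.trans_le hc))
  have hHi : iP h = (∏ j, h j)⁻¹ := prod_inv_distrib ..
  have hU2 : Γ ^ 2 * iP h ^ (1 - 2 / p) * (n:ℝ)⁻¹ = U0 h n Γ ^ 2 * (∏ j, h j) ^ (2 / p) := by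
    have hH0 : 0 < ∏ j, h j := fpp fun j _ ↦ hh j
    unfold U0
    rw [hHi, div_pow, Real.sq_sqrt pv, Real.rpow_sub pv, Real.rpow_one, Real.inv_rpow hH0.le]; field_simp
  have hmom := mom_ge2 ν hh hπ hΓ0 hΦ hΓ hp hn hc0 hc hD0.le hCq
  have hCV := CV_top (D := oR D) oRt j
  have hnD : oR iP h ≤ n * oR D := by
    rw [← ofReal_natCast, ← oRm hn0.le, hHi]
    refine oRl ?_
    have hH0 : 0 < ∏ j, h j := fpp fun j _ ↦ hh j
    calc (∏ j, h j)⁻¹ = n * (n * ∏ j, h j)⁻¹ := by field_simp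
      _ ≤ n * D := mNL ((inv_anti₀ hc0 hc).trans hD) hn0.le
  have hEZ : ∀ B : Set Vr ι, ∫⁻ y, lpB p B (xiA ν π (LL Φ) y) ∂(mP n ν) ≤ oR (g * U0 h n Γ) := fun B ↦ by
    have j1 := jensen (μ := Measure.pi fun _ : Fin n ↦ ν) (k := fun _ ↦ 1) aemeasurable_const (lpB_meas (p := p) (B := B) (n := n) ν hπ hLm).aemeasurable (p := p) bL
    simp only [one_mul, lintegral_const, measure_univ, one_rpow] at j1
    have j2 : ∫⁻ y, lpB p B (xiA ν π (LL Φ) y) ^ p ∂(mP n ν) ≤ oR ((g * U0 h n Γ) ^ p) := by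
      rw [rmr hg0.le hU.le, hg, ← rrm hcm.le, one_div_mul_cancel hp0.ne', Real.rpow_one]
      refine (lmo fun y ↦ ?_).trans hmom
      rw [lpB, ← erm, one_div_mul_cancel hp0.ne', ero]
      exact setLIntegral_le_lintegral _ _
    rw [← ofReal_rpow_of_pos pv] at j2
    exact (rpow_le_rpow_iff hp0).1 (j1.trans j2)
  set e := oR (g * U0 h n Γ) with he
  have he0 : e ≠ 0 := by rw [he]; simp; positivity
  have hF := lpB_fatou ν hπ hLm n (2 ^ (j + 1)) e _ fun k ↦
    (lmo fun y ↦ ppl (tsub_le_tsub_left (hEZ _) _) _).trans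
      (dev_B ν hh hh1 hπ hΓ0.le hΦ hΓ hp Metric.isClosed_closedBall.measurableSet measure_closedBall_lt_top.ne oRt hn hnD hCq j)
  have e2 : oR (2 * g * U0 h n Γ) = 2 * e := by
    rw [mul_assoc, oRm bN, he]; norm_num
  rw [e2]
  calc _ ≤ ∫⁻ y, (lpB p Set.univ (xiA ν π (LL Φ) y) - e) ^ (2 ^ (j + 1)) * (e⁻¹) ^ (2 ^ (j + 1) - m) ∂(mP n ν) :=
        lmo fun y ↦ conv_pow he0 oRt hm hmN
    _ = (∫⁻ y, (lpB p Set.univ (xiA ν π (LL Φ) y) - e) ^ (2 ^ (j + 1)) ∂(mP n ν)) * (e⁻¹) ^ (2 ^ (j + 1) - m) :=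
        lintegral_mul_const' _ _ (pow_ne_top (inv_ne_top.2 he0))
    _ ≤ _ := by
        refine (mL hF _).trans ?_
        have hH0 : 0 < ∏ j, h j := fpp fun j _ ↦ hh j
        rw [← ofReal_natCast, ← ofReal_inv_of_pos hn0, ← oRm (by rw [hHi]; positivity), hU2, he,
          ← ofReal_inv_of_pos pv, ← oRp pv, ← oRp pv,
          ← oRm pv, ← ofReal_toReal hCV, ← oRm toReal_nonneg, ← oRm (by rw [hHi]; positivity)]
        refine oRl ?_
        have e3 : (U0 h n Γ ^ 2 * (∏ j, h j) ^ (2 / p)) ^ 2 ^ j * iP h = U0 h n Γ ^ (2 ^ (j + 1) - m) * (U0 h n Γ ^ m * (∏ j, h j) ^ (2 / p * (2 ^ j : ℕ)) * (∏ j, h j)⁻¹) := by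
          rw [hHi, mul_pow, ← pow_mul, Real.rpow_mul_natCast hH0.le, ← mul_assoc, ← mul_assoc, ← pow_add, Nat.sub_add_cancel hmN, pow_succ' 2 j]
        rw [e3, mul_inv, mul_pow]
        set c := (CV (oR D) j).toReal
        have hc0' : 0 ≤ c := toReal_nonneg
        calc c * (U0 h n Γ ^ (2 ^ (j + 1) - m) * (U0 h n Γ ^ m * (∏ j, h j) ^ (2 / p * (2 ^ j : ℕ)) * (∏ j, h j)⁻¹)) * (g⁻¹ ^ (2 ^ (j + 1) - m) * (U0 h n Γ)⁻¹ ^ (2 ^ (j + 1) - m))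
            = c * g⁻¹ ^ (2 ^ (j + 1) - m) * (U0 h n Γ * (U0 h n Γ)⁻¹) ^ (2 ^ (j + 1) - m) * (U0 h n Γ ^ m * (∏ j, h j) ^ (2 / p * (2 ^ j : ℕ)) * (∏ j, h j)⁻¹) := by rw [mul_pow]; ring
          _ = c * g⁻¹ ^ (2 ^ (j + 1) - m) * (U0 h n Γ ^ m * (∏ j, h j) ^ (2 / p * (2 ^ j : ℕ)) * (∏ j, h j)⁻¹) := by rw [mul_inv_cancel₀ hU.ne', one_pow, mul_one]
          _ ≤ c * g⁻¹ ^ (2 ^ (j + 1) - m) * (G ^ m * rn n ^ (-rn m / 2) * ∏ j, h j) := mNL hfin pv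
          _ ≤ _ := by
            have : 0 ≤ rn n ^ (-rn m / 2) * ∏ j, h j := by positivity
            rw [toReal_ofReal hc0']; linarith
end c13
section c14
variable {ι : Type} [Fintype ι] {Ω : Type} [MeasurableSpace Ω] (ν : Measure Ω) [IPM ν] {π : Ω → ι → ℝ}
lemma xi_conv (hπ : Measurable π) {k L L2 : Fc ι} (hk : Integrable k) (hL : Measurable L) {M : ℝ} (hM : ∀ x, ‖L x‖ ≤ M)
    (hL2 : ∀ x, L2 x = ∫ u, k u * L (x - u)) {n : ℕ} (y : Fin n → Ω) (x : ι → ℝ) :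
    xiA ν π L2 y x = ∫ u, k u * xiA ν π L y (x - u) := by
  have hi : ∀ w, Integrable fun u ↦ k u * L (x - u - w) := fun w ↦
    hk.mul_bdd (c := M) (Measurable.aestronglyMeasurable fpr) (aoa _ fun u ↦ hM _)
  have hi2 : Integrable fun u ↦ k u * ∫ ω, L (x - u - π ω) ∂ν :=
    hk.mul_bdd (c := M) (Measurable.aestronglyMeasurable ((mean_meas ν hπ hL).comp (measurable_const.sub measurable_id))) (aoa _ fun u ↦ mean_le ν hM _)
  have hi3 : Integrable fun u ↦ k u * ((n : ℂ)⁻¹ * ∑ i, L (x - u - π (y i))) := by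
    have : Integrable fun u ↦ (n : ℂ)⁻¹ * ∑ i, k u * L (x - u - π (y i)) := (integrable_finsetSum _ fun i _ ↦ hi _).const_mul _
    refine this.congr (aoa _ fun u ↦ ?_)
    simp only [← mul_sum]; ring
  have hsw : ∫ ω, L2 (x - π ω) ∂ν = ∫ u, k u * ∫ ω, L (x - u - π ω) ∂ν := by
    simp_rw [hL2, ← icm]
    have e : ∀ ω u, x - π ω - u = x - u - π ω := fun ω u ↦ by abel
    simp_rw [e]
    refine integral_integral_swap ?_
    exact (hk.comp_snd ν).mul_bdd (c := M) (Measurable.aestronglyMeasurable (hL.comp ((measurable_const.sub measurable_snd).sub (hπ.comp measurable_fst)))) (aoa _ fun u ↦ hM _)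
  simp only [xiA, mul_sub]
  rw [integral_sub hi3 hi2, hsw]
  congr 1
  simp only [hL2]
  have e : ∀ i u, x - π (y i) - u = x - u - π (y i) := fun i u ↦ by abel
  simp_rw [e]
  rw [← integral_finsetSum _ fun i _ ↦ hi _, ← icm]
  refine integral_congr_ae (aoa _ fun u ↦ ?_)
  simp only [← mul_sum]; ring
lemma cosh_tan (r v : ℝ) : rC r - 1 + Real.sinh r * (v - r) ≤ rC v - 1 := by
  have h1 := mNL (Real.add_one_le_exp (v - r)) (Real.exp_pos r).le
  have h2 := mNL (Real.add_one_le_exp (-(v - r))) (Real.exp_pos (-r)).le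
  rw [← Real.exp_add] at h1 h2
  rw [show r + (v - r) = v by ring] at h1
  rw [show -r + -(v - r) = -v by ring] at h2
  rw [Real.cosh_eq, Real.cosh_eq, Real.sinh_eq]
  nlinarith
lemma cosh_jensen {h : ι → ℝ} (hh : ∀ j, 0 < h j) {v : Fr ι} (hv : Measurable v) {M : ℝ} (hM : ∀ u, |v u| ≤ M) (x : ι → ℝ) :
    oR (rC (∫ u, Bk h u * v (x - u)) - 1) ≤ oR iP h * ∫⁻ u, oR (rC (v u) - 1) := by
  set r := ∫ u, Bk h u * v (x - u)
  have hB := Bk_int hh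
  have hm : Measurable fun u ↦ v (x - u) := by fun_prop
  have hi : Integrable fun u ↦ Bk h u * v (x - u) := hB.mul_bdd (c := M) hm.aestronglyMeasurable (aoa _ fun u ↦ hM _)
  have hi2 : Integrable fun u ↦ Bk h u * (rC (v (x - u)) - 1) := hB.mul_bdd (c := rC M + 1)
    (Measurable.aestronglyMeasurable ((Real.measurable_cosh.comp hm).sub mco)) (aoa _ fun u ↦ by
      have := Real.cosh_le_cosh.2 ((hM (x - u)).trans (le_abs_self M))
      have h1 := Real.one_le_cosh (v (x - u))
      rw [Real.norm_eq_abs, abs_of_nonneg bL]; linarith)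
  have h0 : ∀ u, 0 ≤ rC u - 1 := fun u ↦ by linarith [Real.one_le_cosh u]
  have key : rC r - 1 ≤ ∫ u, Bk h u * (rC (v (x - u)) - 1) := by
    have hi4 : Integrable fun u ↦ (rC r - 1 - Real.sinh r * r) * Bk h u := hB.const_mul _
    have hi5 : Integrable fun u ↦ Real.sinh r * (Bk h u * v (x - u)) := hi.const_mul _
    have e : ∫ u, ((rC r - 1 - Real.sinh r * r) * Bk h u + Real.sinh r * (Bk h u * v (x - u))) = rC r - 1 := by
      rw [integral_add hi4 hi5, icm, icm, Bk_one hh]; ring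
    rw [← e]
    refine integral_mono (hi4.add hi5) hi2 fun u ↦ ?_
    have := mNL (cosh_tan r (v (x - u))) (Bk_nonneg hh u)
    simp only; nlinarith
  calc _ ≤ oR (∫ u, Bk h u * (rC (v (x - u)) - 1)) := oRl key
    _ = ∫⁻ u, oR (Bk h u * (rC (v (x - u)) - 1)) :=
        oie hi2 (aoa _ fun u ↦ mul_nonneg (Bk_nonneg hh u) (h0 _))
    _ ≤ ∫⁻ u, oR iP h * oR (rC (v (x - u)) - 1) := lmo fun u ↦ by
        rw [← oRm (by have := hh; exact pnn fun j _ ↦ (inv_pos.2 (hh j)).le)]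
        exact oRl (mNR (Bk_le' hh u) (h0 _))
    _ = _ := by rw [lcm2 _ _ oRt, lintegral_sub_left_eq_self (fun u ↦ oR (rC (v u) - 1)) x]
lemma exp_norm_le (a : ℝ) (ha : 0 ≤ a) (z : ℂ) : rE (a * ‖z‖ / 2) ≤ 2 + ((rC (a * z.re) - 1) + (rC (a * z.im) - 1)) := by
  have h1 : ∀ r, rE (a * |r|) ≤ 2 * rC (a * r) := fun r ↦ by
    rw [← Real.cosh_abs, abs_mul, abs_of_nonneg ha, Real.cosh_eq]; linarith [Real.exp_pos (-(a * |r|))]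
  have h2 : rE (a * ‖z‖ / 2) ≤ rE (a * |z.re| / 2) * rE (a * |z.im| / 2) := by
    rw [← Real.exp_add]
    exact Real.exp_le_exp.2 (by nlinarith [Complex.norm_le_abs_re_add_abs_im z])
  have h3 : ∀ r, rE (a * |r| / 2) ^ 2 = rE (a * |r|) := fun r ↦ by rw [← Real.exp_nat_mul]; congr 1; push_cast; ring
  nlinarith [h1 z.re, h1 z.im, h3 z.re, h3 z.im, sq_nonneg (rE (a * |z.re| / 2) - rE (a * |z.im| / 2))]
lemma pow_le_exp {a : ℝ} (ha : 0 < a) {m : ℕ} (hm : m ≠ 0) {t τ : ℝ} (hτ : 0 ≤ τ) : (oR t - oR τ) ^ m ≤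
    oR (m.factorial * (2 / a) ^ m * rE (-(a * τ / 2)) * rE (a * t / 2)) := by
  rw [← ofReal_sub _ hτ]
  rcases le_total t τ with h | h
  · rw [ofReal_of_nonpos bL, zero_pow hm]; exact zero_le
  rw [← oRp bL]
  refine oRl ?_
  have := Real.pow_div_factorial_le_exp (x := a * (t - τ) / 2) (by have := mul_nonneg ha.le (sub_nonneg.2 h); linarith) m
  rw [div_le_iff₀ pv] at this
  rw [mul_assoc, ← Real.exp_add, show -(a * τ / 2) + a * t / 2 = a * (t - τ) / 2 by ring]
  calc (t - τ) ^ m = (2 / a) ^ m * (a * (t - τ) / 2) ^ m := by rw [← mul_pow]; congr 1; field_simp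
    _ ≤ (2 / a) ^ m * (rE (a * (t - τ) / 2) * m.factorial) := by gcongr
    _ = _ := by ring
lemma dev_top {D G a : ℝ} (hD : 0 ≤ D) (hG : 0 < G) (ha : 0 ≤ a) {m : ℕ} (hm : m ≠ 0) :
    ∃ γ C : ℝ, 0 < γ ∧ 0 < C ∧ ∀ {Ω : Type} [MeasurableSpace Ω] (ν : Measure Ω) [IPM ν] {π : Ω → ι → ℝ} (_ : Measurable π)
      {h : ι → ℝ} (_ : ∀ j, 0 < h j) (_ : ∀ j, h j ≤ 1) {Γ : ℝ} (_ : 0 < Γ) (_ : Γ ≤ G * (∏ j, h j) ^ (-a)) {Φ : Fc ι} (_ : ASM Φ)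
      (_ : ∀ t, ‖Φ t‖ ≤ Γ * Qw h t ^ 3) {n : ℕ} (_ : 3 ≤ n) (_ : rL n ≤ n * ∏ j, h j)
      (_ : ∀ z, ∫⁻ ω, oR (Bk h (z - π ω)) ∂ν ≤ oR D),
      ∫⁻ y, (eLpNorm (xiA ν π (LL Φ) y) ⊤ volume - oR (γ * (Real.sqrt (rL n) * U0 h n Γ))) ^ m ∂(mP n ν) ≤
        oR (C * rn n ^ (-rn m / 2) * ∏ j, h j) := by
  set γ := 4 * (a * m + 2 + D / 4 + m / 2) with hγ
  have hγ0 : 0 < γ := by positivity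
  refine ⟨γ, m.factorial * 4 ^ m * 3 * G ^ m, hγ0, by positivity, ?_⟩
  intro Ω _ ν _ π hπ h hh hh1 Γ hΓ0 hΓG Φ hΦ hΓ n hn3 hlog hCq
  have hn1 : (3:ℝ) ≤ n := by exact_mod_cast hn3
  have hn0 : (0:ℝ) < n := by linarith
  have hn : n ≠ 0 := by omega
  have hl1 : 1 ≤ rL n := by
    rw [Real.le_log_iff_exp_le hn0]; exact (Real.exp_one_lt_d9.le.trans bN).trans hn1
  have hH0 : 0 < ∏ j, h j := fpp fun j _ ↦ hh j
  have hHi : iP h = (∏ j, h j)⁻¹ := prod_inv_distrib ..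
  set H := ∏ j, h j with hH
  have hr0 : 0 < √(n * H) := Real.sqrt_pos.2 pv
  have hU : 0 < U0 h n Γ := div_pos hΓ0 hr0
  set Φ1 := fun t ↦ Φ t / (Qw h t : ℂ) with hΦ1
  have hQ : ∀ t, ‖Φ1 t‖ ≤ Γ * Qw h t ^ 2 := fun t ↦ by
    have hq := Qw_pos h t
    rw [hΦ1, norm_div, cnr, Real.norm_eq_abs, abs_of_pos hq, div_le_iff₀ hq]
    calc _ ≤ _ := hΓ t
      _ = _ := by ring
  have hQ1 : ∀ t, ‖Φ1 t‖ ≤ Γ * Qw h t := fun t ↦ (hQ t).trans (mNL (pow_le_of_le_one (Qw_pos h t).le (Qw_le h t) bN) hΓ0.le)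
  have hm1 : ASM Φ1 := by
    refine (hΦ.aemeasurable.div (Measurable.aemeasurable ?_)).aestronglyMeasurable
    exact Complex.measurable_ofReal.comp (Qw_cont h).measurable
  have hLi := int_of_Q hh hm1 hQ1
  have hLm : Measurable (LL Φ1) := (LL_cont hLi).measurable
  have hLb := LL_supQ hh hΓ0.le hm1 hQ1
  set c := √(rL n) / 2 with hc
  have hs1 : 1 ≤ √(rL n) := Real.one_le_sqrt.2 hl1
  have hc0 : 0 < c := by positivity
  have h2 : 2 * c ≤ √(n * H) := by rw [hc]; have := Real.sqrt_le_sqrt hlog; linarith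
  have k1 := cosh_re ν hh hπ hΓ0 hm1 hQ hn hc0 h2 hD hCq Complex.reCLM Complex.abs_re_le_norm
  have k2 := cosh_re ν hh hπ hΓ0 hm1 hQ hn hc0 h2 hD hCq Complex.imCLM Complex.abs_im_le_norm
  set b := c / U0 h n Γ with hb
  have hb0 : 0 < b := div_pos hc0 hU
  have hB : Integrable (fun u ↦ ((Bk h u : ℝ) : ℂ)) := (Bk_int hh).ofReal
  have hsm : ∀ (re : ℂ →L[ℝ] ℝ) (_ : ∀ z, |re z| ≤ ‖z‖) (y : Fin n → Ω) x, oR (rC (b * re (xiA ν π (LL Φ) y x)) - 1) ≤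
      oR iP h * ∫⁻ u, oR (rC (b * re (xiA ν π (LL Φ1) y u)) - 1) := fun re hre y x ↦ by
    have hxm := xi_meas1 ν hπ hLm y
    have hxb := xi_bd ν (π := π) hLb hn y
    have hvm : Measurable fun u ↦ b * re (xiA ν π (LL Φ1) y u) := measurable_const.mul (re.measurable.comp hxm)
    have := cosh_jensen hh hvm (M := b * (2 * (Γ * iP h))) (fun u ↦ by
      rw [abs_mul, abs_of_pos hb0]; exact mNL ((hre _).trans (hxb u)) hb0.le) x
    refine le_trans (le_of_eq ?_) this
    have hI : Integrable fun u ↦ ((Bk h u : ℝ) : ℂ) * xiA ν π (LL Φ1) y (x - u) :=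
      hB.mul_bdd (c := 2 * (Γ * iP h)) (Measurable.aestronglyMeasurable (hxm.comp (measurable_const.sub measurable_id))) (aoa _ fun u ↦ hxb _)
    rw [xi_conv ν hπ hB hLm hLb (LL_smooth hh hLi) y x, ← re.integral_comp_comm hI, ← icm]
    congr 3
    refine integral_congr_ae (aoa _ fun u ↦ ?_)
    simp only
    rw [← Complex.real_smul, map_smul, smul_eq_mul]; ring
  set W : (Fin n → Ω) → Eo := fun y ↦ 2 + oR iP h * ((∫⁻ u, oR (rC (b * Complex.reCLM (xiA ν π (LL Φ1) y u)) - 1)) +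
    ∫⁻ u, oR (rC (b * Complex.imCLM (xiA ν π (LL Φ1) y u)) - 1)) with hW
  have hexp : ∀ y x, oR (rE (b * ‖xiA ν π (LL Φ) y x‖ / 2)) ≤ W y := fun y x ↦ by
    have h0 : ∀ u, 0 ≤ rC u - 1 := fun u ↦ by linarith [Real.one_le_cosh u]
    refine (oRl (exp_norm_le b hb0.le _)).trans ?_
    rw [ofReal_add bN (add_nonneg (h0 _) (h0 _)), ofReal_add (h0 _) (h0 _)]
    simp only [hW, mul_add]
    exact add_le_add bN (add_le_add (hsm Complex.reCLM Complex.abs_re_le_norm y x) (hsm Complex.imCLM Complex.abs_im_le_norm y x))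
  set τ := γ * (√(rL n) * U0 h n Γ) with hτ
  set A := m.factorial * (2 / b) ^ m * rE (-(b * τ / 2)) with hA
  have hA0 : 0 ≤ A := by positivity
  have hpt : ∀ y, (eLpNorm (xiA ν π (LL Φ) y) ⊤ volume - oR τ) ^ m ≤ oR A * W y := fun y ↦ by
    have h1 : ∀ x, ‖xiA ν π (LL Φ) y x‖ₑ ≤ oR τ + (oR A * W y) ^ (1 / (m:ℝ)) := fun x ↦ by
      rw [← tsub_le_iff_left, one_div, le_rpow_inv_iff pv, rpow_natCast, ← ofReal_norm]
      refine (pow_le_exp hb0 hm pv).trans ?_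
      rw [oRm hA0]
      exact mR (hexp y x) _
    have h2 : eLpNorm (xiA ν π (LL Φ) y) ⊤ volume ≤ oR τ + (oR A * W y) ^ (1 / (m:ℝ)) := by
      rw [eLpNorm_exponent_top]; exact eLpNormEssSup_le_of_ae_enorm_bound (aoa _ h1)
    rwa [← tsub_le_iff_left, one_div, le_rpow_inv_iff pv, rpow_natCast] at h2
  have hWint : ∫⁻ y, W y ∂(mP n ν) ≤ oR (3 * (n:ℝ) ^ (1 + D / 4)) := by
    have hmR : Measurable fun z : (Fin n → Ω) × Vr ι ↦ oR (rC (b * Complex.reCLM (xiA ν π (LL Φ1) z.1 z.2)) - 1) := by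
      have := Complex.measurable_re.comp (xi_meas ν hπ hLm n)
      exact measurable_ofReal.comp ((Real.measurable_cosh.comp (measurable_const.mul this)).sub mco)
    rw [hW, lal mco, lintegral_const, measure_univ, mul_one, lcm2 _ _ oRt,
      lal (lpr hmR)]
    refine (aR (mR (add_le_add k1 k2) _) _).trans ?_
    rw [← ofReal_add pv pv, ← oRm (by rw [hHi]; positivity), show (2:Eo) = oR 2 by norm_num,
      ← ofReal_add bN (by rw [hHi]; positivity), hHi]
    refine oRl ?_
    have hc2 : c ^ 2 = rL n / 4 := by rw [hc, div_pow, Real.sq_sqrt bL]; norm_num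
    have e1 : rE (c ^ 2 * D) = (n:ℝ) ^ (D / 4) := by rw [Real.rpow_def_of_pos hn0, hc2]; congr 1; ring
    rw [e1, hc2, rra hn0, Real.rpow_one]
    have e2 : H⁻¹ * rL n ≤ n := by rw [inv_mul_le_iff₀ hH0]; linarith
    have e3 : 1 ≤ (n:ℝ) ^ (D / 4) := Real.one_le_rpow bL pv
    have e4 : (1:ℝ) ≤ n * (n:ℝ) ^ (D / 4) := by nlinarith
    nlinarith [mNR e2 (by linarith : 0 ≤ (n:ℝ) ^ (D / 4))]
  refine (lmo hpt).trans ?_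
  rw [lcm2 _ _ oRt]
  refine (mR hWint _).trans ?_
  rw [← oRm hA0]
  refine oRl ?_
  have hHn : H⁻¹ ≤ n := by rw [inv_le_iff_one_le_mul₀ hH0]; linarith
  have e5 : U0 h n Γ ≤ G * (n:ℝ) ^ a := by
    unfold U0; rw [← hH, div_le_iff₀ hr0]
    calc Γ ≤ G * H ^ (-a) := hΓG
      _ = G * (H⁻¹) ^ a := by rw [Real.rpow_neg hH0.le, Real.inv_rpow hH0.le]
      _ ≤ G * (n:ℝ) ^ a := by gcongr
      _ ≤ _ := le_mul_of_one_le_right pv (Real.one_le_sqrt.2 bL)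
  have e6 : 2 / b ≤ 4 * (G * (n:ℝ) ^ a) := by
    rw [hb, hc]
    calc 2 / (√(rL n) / 2 / U0 h n Γ) = 4 * U0 h n Γ / √(rL n) := by field_simp; norm_num
      _ ≤ 4 * U0 h n Γ := div_le_self pv hs1
      _ ≤ _ := by linarith
  have e7 : rE (-(b * τ / 2)) = (n:ℝ) ^ (-(γ / 4)) := by
    rw [Real.rpow_def_of_pos hn0]
    congr 1
    have : √(rL n) * √(rL n) = rL n := Real.mul_self_sqrt bL
    rw [hτ, hb, hc]; field_simp; rw [sq, this]; ring
  calc A * (3 * (n:ℝ) ^ (1 + D / 4)) ≤ m.factorial * (4 * (G * (n:ℝ) ^ a)) ^ m * (n:ℝ) ^ (-(γ / 4)) * (3 * (n:ℝ) ^ (1 + D / 4)) := by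
        rw [hA, e7]; gcongr
    _ = m.factorial * 4 ^ m * 3 * G ^ m * ((n:ℝ) ^ (-(m:ℝ) / 2) * (n:ℝ)⁻¹) := by
        rw [← Real.rpow_neg_one, ← rra hn0, show -(m:ℝ) / 2 + -1 = a * m + (-(γ / 4) + (1 + D / 4)) by rw [hγ]; ring, rra hn0 (a * m), rra hn0 (-(γ / 4)),
          Real.rpow_mul_natCast hn0.le]; ring
    _ ≤ m.factorial * 4 ^ m * 3 * G ^ m * ((n:ℝ) ^ (-(m:ℝ) / 2) * H) := by
        have : (n:ℝ)⁻¹ ≤ H := (inv_le_comm₀ hH0 hn0).1 hHn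
        gcongr
    _ = _ := by ring
end c14
section c15
variable {ι : Type} [Fintype ι] {Ω : Type} [MeasurableSpace Ω] (ν : Measure Ω) [IPM ν] {π : Ω → ι → ℝ}
lemma lpB_eq {p : ℝ} (hp : 0 < p) (g : Fc ι) : eLpNorm g (oR p) volume = lpB p Set.univ g := by
  rw [enl (by simpa using hp) oRt, toReal_ofReal hp.le, lpB, Measure.restrict_univ]
lemma eLp_pow {p : ℝ} (hp : 0 < p) (g : Fc ι) : eLpNorm g (oR p) volume ^ p = ∫⁻ x, ‖g x‖ₑ ^ p := by
  rw [enl (by simpa using hp) oRt, toReal_ofReal hp.le, ← erm, one_div,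
    inv_mul_cancel₀ hp.ne', ero]
lemma eLp_shift (p : Eo) {L : Fc ι} (hL : Measurable L) (z : ι → ℝ) : eLpNorm (fun x ↦ L (x - z)) p volume = eLpNorm L p volume :=
  eLpNorm_comp_measurePreserving hL.aestronglyMeasurable (measurePreserving_sub_right volume z)
lemma mean_pow {p : ℝ} (hp : 1 ≤ p) (hπ : Measurable π) {L : Fc ι} (hL : Measurable L) (x : ι → ℝ) :
    ‖∫ ω, L (x - π ω) ∂ν‖ₑ ^ p ≤ ∫⁻ ω, ‖L (x - π ω)‖ₑ ^ p ∂ν := by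
  have h := jensen (μ := ν) (k := fun _ ↦ 1) (v := fun ω ↦ ‖L (x - π ω)‖ₑ) aemeasurable_const
    (hL.comp (measurable_const.sub hπ)).enorm.aemeasurable hp
  simp only [one_mul, lintegral_const, measure_univ, one_rpow] at h
  exact (err (eil _) bL).trans h
lemma dev_lt2 {p : ℝ} (hp : 1 < p) (hp2 : p < 2) {m : ℕ} (hm : m ≠ 0) (r : ℝ) :
    ∃ C : Eo, C ≠ ⊤ ∧ ∀ {Ω : Type} [MeasurableSpace Ω] (ν : Measure Ω) [IPM ν] {π : Ω → ι → ℝ} (_ : Measurable π)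
      {L : Fc ι} (_ : Measurable L) {M : ℝ} (_ : ∀ x, ‖L x‖ ≤ M) (_ : eLpNorm L (oR p) volume ≠ ⊤) {n : ℕ} (_ : n ≠ 0),
      ∫⁻ y, (eLpNorm (xiA ν π L y) (oR p) volume - 24 * (oR (rn n ^ (1 / p - 1)) * eLpNorm L (oR p) volume)) ^ m
          ∂(mP n ν) ≤
        C * (oR (rn n ^ (1 / p - 1)) * eLpNorm L (oR p) volume) ^ m * oR (rn n ^ (-r)) := by
  have hp0 : 0 < p := by linarith
  have hδ : 0 < 1 / p - 1 / 2 := sub_pos.2 (one_div_lt_one_div_of_lt hp0 hp2)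
  obtain ⟨j, hj⟩ : ∃ j : ℕ, max rn m (r / (1 / p - 1 / 2)) ≤ (2 ^ (j + 1) : ℕ) := by
    obtain ⟨j, hj⟩ := pow_unbounded_of_one_lt (max rn m (r / (1 / p - 1 / 2))) one_lt_two
    exact ⟨j, hj.le.trans (by push_cast; rw [pow_succ]; linarith [pow_pos (two_pos : (0:ℝ) < 2) j])⟩
  set N := 2 ^ (j + 1) with hN
  have hmN : m ≤ N := by exact_mod_cast (le_max_left _ _).trans hj
  have hrN : r ≤ N * (1 / p - 1 / 2) := (div_le_iff₀ hδ).1 ((le_max_right _ _).trans hj)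
  refine ⟨CR j * 4 ^ 2 ^ j, emt (CR_top j) (by finiteness), fun {Ω} _ ν _ {π} hπ {L} hL {M} hM hLt {n} hn ↦ ?_⟩
  set P := oR p with hP
  have hP1 : 1 ≤ P := by rw [hP]; simpa using hp.le
  set ℓ := eLpNorm L P volume with hℓ
  have hn0 : (0:ℝ) < n := by positivity
  have hn1 : (1:ℝ) ≤ n := by exact_mod_cast Nat.one_le_iff_ne_zero.2 hn
  set U := oR (rn n ^ (1 / p - 1)) * ℓ with hU
  have hxm := fun y : Fin n → Ω ↦ (xi_meas1 ν hπ hL y).aestronglyMeasurable (μ := volume)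
  have hnC : ‖(n : ℂ)⁻¹‖ₑ = nI n := enorm_natC_inv hn
  have hni : (n:Eo) * (n:Eo)⁻¹ = 1 := ENNReal.mul_inv_cancel (by simpa using hn) bS
  have hsh : ∀ z : ι → ℝ, AEStronglyMeasurable (fun x ↦ L (x - z)) volume := fun z ↦ (hL.comp (measurable_id.sub measurable_const)).aestronglyMeasurable
  have hmeanP : eLpNorm (fun x ↦ ∫ ω, L (x - π ω) ∂ν) P volume ≤ ℓ := by
    rw [← rpow_le_rpow_iff hp0, eLp_pow hp0, hℓ, eLp_pow hp0]
    exact (lmo fun x ↦ mean_pow ν hp.le hπ hL x).trans (lint_shift ν hπ (hL.enorm.pow_const p)).le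
  have hZM : ∀ y : Fin n → Ω, eLpNorm (xiA ν π L y) P volume ≤ 2 * ℓ := fun y ↦ by
    unfold xiA
    have h1 : eLpNorm (fun x ↦ (n : ℂ)⁻¹ * ∑ k, L (x - π (y k))) P volume ≤ ℓ := by
      have h2 := eLpNorm_const_smul (n : ℂ)⁻¹ (∑ k, fun x ↦ L (x - π (y k))) P (volume : Measure Vr ι)
      have h3 : ((n : ℂ)⁻¹ • ∑ k, fun x ↦ L (x - π (y k))) = fun x ↦ (n : ℂ)⁻¹ * ∑ k, L (x - π (y k)) := by
        ext x; simp [Finset.sum_apply]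
      rw [h3] at h2
      rw [h2, hnC]
      refine (mR (eLpNorm_sum_le (fun k _ ↦ hsh _) hP1) _).trans ?_
      simp only [eLp_shift P hL, sum_const, card_univ, Fintype.card_fin, nsmul_eq_mul]
      rw [← mul_assoc, mul_comm (n:Eo)⁻¹, hni, one_mul]
    have hs : Measurable fun x ↦ (n : ℂ)⁻¹ * ∑ k, L (x - π (y k)) :=
      measurable_const.mul (measurable_sum _ fun k _ ↦ hL.comp (measurable_id.sub mco))
    refine (eLpNorm_sub_le hs.aestronglyMeasurable (mean_meas ν hπ hL).aestronglyMeasurable hP1).trans ?_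
    rw [two_mul]; exact add_le_add h1 hmeanP
  rcases eq_or_ne ℓ 0 with hl0 | hl0
  · have : ∀ y : Fin n → Ω, eLpNorm (xiA ν π L y) P volume = 0 := fun y ↦ by simpa [hl0] using hZM y
    simp only [this, zero_tsub, zero_pow hm, lintegral_zero]; exact zero_le
  set Z : (Fin n → Ω) → Eo := fun y ↦ eLpNorm (xiA ν π L y) P volume with hZ
  have hZm : Measurable Z := by
    have := lpB_meas (p := p) (B := Set.univ) (n := n) ν hπ hL
    simpa only [hZ, hP, lpB_eq hp0] using this
  have hES : ∀ y k z, Z y - Z (fU y k z) ≤ (n:Eo)⁻¹ * (2 * ℓ) := fun y k z ↦ by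
    rw [tsub_le_iff_left]
    have h1 : xiA ν π L y = xiA ν π L (fU y k z) + (n : ℂ)⁻¹ • ((fun x ↦ L (x - π (y k))) - fun x ↦ L (x - π z)) := by
      ext x; have := xi_update ν (π := π) (L := L) y k z x
      simp only [Pi.add_apply, Pi.smul_apply, Pi.sub_apply, smul_eq_mul, ← this]; ring
    simp only [hZ]
    conv_lhs => rw [h1]
    refine (eLpNorm_add_le (hxm _) (((hsh _).sub (hsh _)).const_smul _) hP1).trans (aR ?_ _)
    rw [eLpNorm_const_smul, hnC]
    refine mR ((eLpNorm_sub_le (hsh _) (hsh _) hP1).trans ?_) _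
    rw [eLp_shift P hL, eLp_shift P hL, two_mul]
  have hV : ∀ y, ∑ k, ∫⁻ z, (Z y - Z (fU y k z)) ^ 2 ∂ν ≤ (n:Eo)⁻¹ * (4 * ℓ ^ 2) := fun y ↦ by
    calc _ ≤ ∑ k : Fin n, ((n:Eo)⁻¹ * (2 * ℓ)) ^ 2 := sum_le_sum fun k _ ↦ by
            refine (lmo fun z ↦ ppl (hES y k z) 2).trans ?_
            rw [lintegral_const, measure_univ, mul_one]
      _ = n * (n:Eo)⁻¹ * ((n:Eo)⁻¹ * (4 * ℓ ^ 2)) := by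
            simp only [sum_const, card_univ, Fintype.card_fin, nsmul_eq_mul]; ring
      _ = _ := by rw [hni, one_mul]
  have hEZ : ∫⁻ y, Z y ∂(mP n ν) ≤ 12 * U := by
    have h1 := jensen (μ := Measure.pi fun _ : Fin n ↦ ν) (k := fun _ ↦ 1) (v := Z) aemeasurable_const hZm.aemeasurable hp.le
    simp only [one_mul, lintegral_const, measure_univ, one_rpow] at h1
    rw [← rpow_le_rpow_iff hp0]
    refine h1.trans ?_
    simp only [hZ, hP, eLp_pow hp0]
    have hmj : Measurable fun z : (Fin n → Ω) × Vr ι ↦ ‖xiA ν π L z.1 z.2‖ₑ ^ p := (xi_meas ν hπ hL n).enorm.pow_const p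
    rw [lls hmj.aemeasurable]
    have hpt : ∀ x, ∫⁻ y, ‖xiA ν π L y x‖ₑ ^ p ∂(mP n ν) ≤ oR ((n:ℝ) ^ (1 - p)) * 12 ^ p * ∫⁻ ω, ‖L (x - π ω)‖ₑ ^ p ∂ν := fun x ↦ by
      set X : Ω → ℂ := fun ω ↦ L (x - π ω) - ∫ ω, L (x - π ω) ∂ν with hX
      have hLi := L_int ν hπ hL hM x
      have hXm : Measurable X := (hL.comp (measurable_const.sub hπ)).sub mco
      have h0 : ∫ z, X z ∂ν = 0 := by rw [hX, integral_sub hLi (ico _)]; simp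
      have hb := vbe ν hp hp2.le hXm (M := M + M) (fun z ↦ (norm_sub_le _ _).trans (add_le_add (hM _) (mean_le ν hM x))) h0 n 0
      simp only [zero_add, enorm_zero, zero_rpow_of_pos hp0] at hb
      have e1 : ∀ y : Fin n → Ω, ‖xiA ν π L y x‖ₑ ^ p = (n:Eo)⁻¹ ^ p * ‖∑ k, X (y k)‖ₑ ^ p := fun y ↦ by
        rw [← mrn _ _ hp0.le, ← hnC, ← enorm_mul]
        congr 2
        simp only [xiA, hX, sum_sub_distrib, sum_const, card_univ, Fintype.card_fin, nsmul_eq_mul, mul_sub]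
        rw [← mul_assoc, inv_mul_cancel₀ (by exact_mod_cast hn), one_mul]
      simp only [e1]
      rw [lcm2 _ _ (rnt hp0.le (by simpa using hn))]
      refine (mR hb _).trans ?_
      have e2 : ∫⁻ z, ‖X z‖ₑ ^ p ∂ν ≤ 2 ^ p * ∫⁻ ω, ‖L (x - π ω)‖ₑ ^ p ∂ν := by
        have : ∀ z, ‖X z‖ₑ ^ p ≤ 2 ^ (p - 1) * (‖L (x - π z)‖ₑ ^ p + ∫⁻ ω, ‖L (x - π ω)‖ₑ ^ p ∂ν) := fun z ↦
          (err (enorm_sub_le) hp0.le).trans ((rpow_add_le_mul_rpow_add_rpow _ _ hp.le).trans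
            (mR (aR (mean_pow ν hp.le hπ hL x) _) _))
        refine (lmo this).trans ?_
        rw [lcm2 _ _ (by finiteness), lintegral_add_right _ mco, lintegral_const, measure_univ, mul_one, ← two_mul, ← mul_assoc]
        refine mL (le_of_eq ?_) _
        conv_lhs => rw [← ero 2, ← erm, one_mul, ← rpow_add _ _ bS bS]
        norm_num
      refine (mR (mR (mR e2 _) _) _).trans ?_
      have e3 : oR ((n:ℝ) ^ (1 - p)) = (n:Eo)⁻¹ ^ p * n := by
        rw [← ofReal_rpow_of_pos hn0, ofReal_natCast, sub_eq_neg_add, rpow_add _ _ (by simpa using hn) bS, ero,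
          rpow_neg, inv_rpow]
      have e4 : (6:Eo) * 2 ^ p ≤ 12 ^ p := by
        rw [show (12:Eo) = 6 * 2 by norm_num, mrn _ _ hp0.le]
        refine mL ?_ _
        conv_lhs => rw [← ero 6]
        exact rpow_le_rpow_of_exponent_le bN hp.le
      rw [e3]
      calc _ = (n:Eo)⁻¹ ^ p * n * (6 * 2 ^ p) * ∫⁻ ω, ‖L (x - π ω)‖ₑ ^ p ∂ν := by ring
        _ ≤ _ := mL (mR e4 _) _
    refine (lmo hpt).trans ?_
    rw [lcm2 _ _ (by finiteness), lint_shift ν hπ (hL.enorm.pow_const p), hU, ← eLp_pow hp0, mrn _ _ hp0.le,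
      mrn _ _ hp0.le, orn pv hp0.le, ← rrm hn0.le,
      show (1 / p - 1) * p = 1 - p by field_simp]
    exact le_of_eq (by ring)
  have hmr := mom_rec ν (V := fun _ ↦ (n:Eo)⁻¹ * (4 * ℓ ^ 2)) hZm mco (M := 2 * ℓ) (emt bS hLt) hZM hV j
  rw [lintegral_const, measure_univ, mul_one] at hmr
  have hc0 : oR (rn n ^ (1 / p - 1)) ≠ 0 := by simp; positivity
  have hU0 : U ≠ 0 := mul_ne_zero hc0 hl0
  have hUt : U ≠ ⊤ := emt oRt hLt
  calc ∫⁻ y, (Z y - 24 * U) ^ m ∂(mP n ν)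
      ≤ ∫⁻ y, (Z y - ∫⁻ y', Z y' ∂(mP n ν)) ^ N * (U⁻¹) ^ (N - m) ∂(mP n ν) := lmo fun y ↦ by
        have := conv_pow (Z := Z y) (a := 12 * U) (mul_ne_zero bN hU0) (emt bN hUt) hm hmN
        rw [← mul_assoc, show (2:Eo) * 12 = 24 by norm_num] at this
        refine this.trans (mul_le_mul' (ppl (tsub_le_tsub_left hEZ _) _) (ppl (ENNReal.inv_le_inv.2 ?_) _))
        exact le_mul_of_one_le_left zero_le bN
    _ ≤ CR j * ((n:Eo)⁻¹ * (4 * ℓ ^ 2)) ^ 2 ^ j * (U⁻¹) ^ (N - m) := by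
        rw [lintegral_mul_const' _ _ (by simp [hU0])]; exact mL hmr _
    _ = CR j * 4 ^ 2 ^ j * U ^ m * oR (rn n ^ (-(N * (1 / p - 1 / 2)))) := by
        have e1 : ℓ = oR (rn n ^ (1 - 1 / p)) * U := by
          rw [hU, ← mul_assoc, ← oRm pv, ← rra hn0]; simp
        have e2 : (n:Eo)⁻¹ = oR ((n:ℝ) ^ (-1:ℝ)) := by
          rw [Real.rpow_neg_one, ofReal_inv_of_pos hn0, ofReal_natCast]
        have e3 : U ^ N * (U⁻¹) ^ (N - m) = U ^ m := by
          conv_lhs => rw [← Nat.sub_add_cancel hmN, add_comm, pow_add]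
          rw [Nat.add_sub_cancel_left, mul_assoc, ← mul_pow, ENNReal.mul_inv_cancel hU0 hUt, one_pow, mul_one]
        have e4 : (oR ((n:ℝ) ^ (-1:ℝ)) * oR (rn n ^ (1 - 1 / p)) ^ 2) ^ 2 ^ j = oR (rn n ^ (-(N * (1 / p - 1 / 2)))) := by
          rw [← oRp pv, ← oRm pv, ← oRp pv]
          congr 1
          rw [← Real.rpow_mul_natCast hn0.le, ← rra hn0, ← Real.rpow_mul_natCast hn0.le]
          congr 1; rw [hN]; push_cast; rw [pow_succ]; ring
        rw [← e3, ← e4, e2]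
        conv_lhs => rw [e1]
        rw [hN, pow_succ 2 j, mul_comm (2 ^ j) 2, pow_mul U]; ring
    _ ≤ _ := mR (oRl (Real.rpow_le_rpow_of_exponent_le hn1 bL)) _
end c15
section c16
lemma diff1 {g g' : ℝ → ℂ} (hg : ∀ s, HasDerivAt g (g' s) s) {M : ℝ} (hM : ∀ s, ‖g s‖ ≤ M) (hM' : ∀ s, |s| * ‖g' s‖ ≤ M) {u : ℝ} (hu : 0 < u) (s : ℝ) :
    ‖g (s + u) - g s‖ ≤ 6 * M * (√(1 + (u⁻¹ * s) ^ 2))⁻¹ := by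
  have hM0 : 0 ≤ M := (nnn _).trans (hM 0)
  have hr : 0 < √(1 + (u⁻¹ * s) ^ 2) := by positivity
  rw [← div_eq_mul_inv, le_div_iff₀ hr]
  have hx : |u⁻¹ * s| * u = |s| := by rw [abs_mul, abs_of_pos (inv_pos.2 hu)]; field_simp
  have hs : √(1 + (u⁻¹ * s) ^ 2) ≤ 1 + |u⁻¹ * s| := by
    rw [Real.sqrt_le_left pv, ← sq_abs (u⁻¹ * s)]; nlinarith [abs_nonneg (u⁻¹ * s)]
  by_cases h : |s| ≤ 2 * u
  · have h1 : |u⁻¹ * s| ≤ 2 := by nlinarith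
    have h2 : ‖g (s + u) - g s‖ ≤ M + M := (norm_sub_le _ _).trans (add_le_add (hM _) (hM _))
    calc _ ≤ (M + M) * 3 := mul_le_mul h2 bL hr.le bL
      _ = _ := by ring
  · push Not at h
    have hsu : 0 < |s| - u := by linarith
    have h2 : ‖g (s + u) - g s‖ ≤ M / (|s| - u) * ‖s + u - s‖ := by
      refine Convex.norm_image_sub_le_of_norm_hasDerivWithin_le (s := Set.Icc s (s + u)) (fun x _ ↦ (hg x).hasDerivWithinAt) (fun x hx ↦ ?_) (convex_Icc _ _)
        (by simp [hu.le]) (by simp [hu.le])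
      have h3 : |s| - u ≤ |x| := by
        rcases abs_cases s with h4 | h4 <;> rcases abs_cases x with h5 | h5 <;> linarith [hx.1, hx.2]
      rw [le_div_iff₀ hsu, mul_comm]
      exact (mNR h3 (nnn _)).trans (hM' x)
    rw [show s + u - s = u by ring, rno hu.le] at h2
    have h6 : M / (|s| - u) * u ≤ 2 * M / |u⁻¹ * s| := by
      have : 0 < |u⁻¹ * s| := by by_contra h7; push Not at h7; nlinarith
      rw [div_mul_eq_mul_div, div_le_div_iff₀ hsu this]
      nlinarith
    have h8 : 2 ≤ |u⁻¹ * s| := by nlinarith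
    calc _ ≤ 2 * M / |u⁻¹ * s| * (3 * |u⁻¹ * s|) := mul_le_mul (h2.trans h6) bL hr.le pv
      _ = _ := by
        have h9 : |u⁻¹ * s| ≠ 0 := by linarith
        generalize |u⁻¹ * s| = x at h9
        field_simp; ring
variable {ι : Type} [Fintype ι] [DecidableEq ι]
def Dk (k : ι → ℕ) (v : ι → ℝ) (a : ι) (ψ : Fc ι) (t : ι → ℝ) : ℂ :=
  if k a = 0 then ψ t else ψ (t + Pi.single a (v a)) - ψ t
def Tk (κ : ι → ℝ → ℂ) (k : ι → ℕ) (v : ι → ℝ) (a : ι) (ψ : Fc ι) : Fc ι := Dk k v a fun t ↦ κ a (t a) * ψ t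
def TL (κ : ι → ℝ → ℂ) (k : ι → ℕ) (v : ι → ℝ) : List ι → (Fc ι) → Fc ι
  | [], ψ => ψ
  | a :: l, ψ => TL κ k v l (Tk κ k v a ψ)
def DL (S : Finset ι) (l : List ι) (ψ : Fc ι) : Fc ι := l.foldr (fun j ψ ↦ if j ∈ S then cpd j ψ else ψ) ψ
lemma DL_congr {S S' : Finset ι} {l : List ι} (h : ∀ j ∈ l, j ∈ S ↔ j ∈ S') (ψ : Fc ι) : DL S l ψ = DL S' l ψ := by
  induction l with
  | nil => rfl
  | cons a l ih =>
    simp only [DL, List.foldr_cons] at ih ⊢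
    rw [ih fun j hj ↦ h j (List.mem_cons_of_mem _ hj)]
    simp only [h a List.mem_cons_self]
lemma cpd_contDiff {m : ℕ} {ψ : Fc ι} (h : ContDiff ℝ ((m + 1 : ℕ) : WithTop ℕ∞) ψ) (a : ι) : ContDiff ℝ m (cpd a ψ) :=
  (h.fderiv_right (m := m) (by norm_cast)).clm_apply contDiff_const
lemma DL_contDiff (S : Finset ι) (l : List ι) {m : ℕ} {ψ : Fc ι} (h : ContDiff ℝ ((m + l.length : ℕ) : WithTop ℕ∞) ψ) : ContDiff ℝ m (DL S l ψ) := by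
  induction l generalizing m with
  | nil => simpa [DL] using h
  | cons a l ih =>
    have h1 : ContDiff ℝ ((m + 1 : ℕ) : WithTop ℕ∞) (DL S l ψ) := ih (by simpa [add_assoc, add_comm 1] using h)
    simp only [DL, List.foldr_cons] at h1 ⊢
    split_ifs
    · exact cpd_contDiff h1 a
    · exact h1.of_le (by norm_cast; omega)
lemma Tk_contDiff {κ : ι → ℝ → ℂ} (hκ : ∀ a (m : ℕ), ContDiff ℝ m (κ a)) (k v a) {m : ℕ} {ψ : Fc ι} (h : ContDiff ℝ m ψ) : ContDiff ℝ m (Tk κ k v a ψ) := by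
  have h1 : ContDiff ℝ m fun t : ι → ℝ ↦ κ a (t a) * ψ t := ((hκ a m).comp (contDiff_apply ℝ ℝ a)).mul h
  unfold Tk Dk
  split_ifs
  · exact h1
  · exact (h1.comp (contDiff_id.add contDiff_const)).sub h1
lemma cpd_Tk {κ : ι → ℝ → ℂ} (hκ : ∀ a (m : ℕ), ContDiff ℝ m (κ a)) (k v) {a b : ι} (hab : b ≠ a) {g : Fc ι} (h : ContDiff ℝ (1:ℕ) g) :
    cpd b (Tk κ k v a g) = Tk κ k v a (cpd b g) := by
  have hg := h.differentiable bN
  have hk : ∀ t : ι → ℝ, HasFDerivAt (fun t : ι → ℝ ↦ κ a (t a)) (((ContinuousLinearMap.toSpanSingleton ℝ (deriv (κ a) (t a)))).comp (ContinuousLinearMap.proj a)) t := fun t ↦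
    HasFDerivAt.comp t ((((hκ a 1).differentiable bN) (t a)).hasDerivAt.hasFDerivAt) (ContinuousLinearMap.proj (R := ℝ) (φ := fun _ : ι ↦ ℝ) a).hasFDerivAt
  have hm : ∀ t, fderiv ℝ (fun t ↦ κ a (t a) * g t) t (Pi.single b 1) = κ a (t a) * cpd b g t := fun t ↦ by
    have hM : HasFDerivAt (fun t ↦ κ a (t a) * g t) _ t := (hk t).mul (hg t).hasFDerivAt
    rw [hM.fderiv]
    simp [cpd, Pi.single_eq_of_ne hab.symm]
  have hd : Differentiable ℝ fun t : ι → ℝ ↦ κ a (t a) * g t := fun t ↦ ((hk t).mul (hg t).hasFDerivAt).differentiableAt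
  ext t
  unfold Tk Dk
  by_cases h0 : k a = 0
  · simp only [h0, if_true]; exact hm t
  · simp only [h0, if_false, cpd]
    have hd2 : Differentiable ℝ (fun t : ι → ℝ ↦ κ a ((t + Pi.single a (v a) : ι → ℝ) a) * g (t + Pi.single a (v a))) := hd.comp (differentiable_id.add_const _)
    rw [fderiv_fun_sub hd2.differentiableAt hd.differentiableAt]
    rw [sub_apply, hm, fderiv_comp_add_right (f := fun t : ι → ℝ ↦ κ a (t a) * g t), hm]; rfl
lemma DL_Tk {κ : ι → ℝ → ℂ} (hκ : ∀ a (m : ℕ), ContDiff ℝ m (κ a)) (k v) {a : ι} (S : Finset ι) {l : List ι} (ha : a ∉ l) {ψ : Fc ι}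
    (h : ContDiff ℝ (l.length : ℕ) ψ) : DL S l (Tk κ k v a ψ) = Tk κ k v a (DL S l ψ) := by
  induction l with
  | nil => rfl
  | cons b l ih =>
    simp only [List.mem_cons, not_or] at ha
    have ih := ih ha.2 (h.of_le (by norm_cast; simp))
    have hc : ContDiff ℝ (1:ℕ) (DL S l ψ) := DL_contDiff S l (by simpa [add_comm] using h)
    simp only [DL, List.foldr_cons] at ih hc ⊢
    rw [ih]
    split_ifs
    · exact cpd_Tk hκ k v (Ne.symm ha.1) hc
    · rfl
lemma Tk_bd {κ : ι → ℝ → ℂ} (hκ : ∀ a (m : ℕ), ContDiff ℝ m (κ a)) {k : ι → ℕ} {v : ι → ℝ} {a : ι} (hv : 0 < v a) {G : Fc ι} (hG : ContDiff ℝ (1:ℕ) G)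
    {w : ℝ → ℝ} {B : ℝ} (h1 : ∀ s, ‖κ a s‖ * w s ≤ B * (√(1 + ((v a)⁻¹ * 2 ^ (-(k a) : ℤ) * s) ^ 2))⁻¹) (h2 : ∀ s, |s| * ‖deriv (κ a) s‖ * w s ≤ B)
    {R : ℝ} (hR0 : 0 ≤ R) (t : ι → ℝ) (hG1 : ∀ s, ‖G (fU t a s)‖ ≤ R * w s) (hG2 : ∀ s, |s| * ‖cpd a G (fU t a s)‖ ≤ R * w s) : ‖Tk κ k v a G t‖ ≤ R * (12 * B * (√(1 + ((v a)⁻¹ * t a) ^ 2))⁻¹) := by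
  have hB : 0 ≤ B := by
    have := h1 0
    by_contra hB
    have h3 := h2 0
    simp only [abs_zero, zero_mul] at h3; exact hB h3
  have h1' : ∀ s, ‖κ a s‖ * w s ≤ B := fun s ↦ (h1 s).trans (mul_le_of_le_one_right hB (inv_le_one_of_one_le₀ (Real.one_le_sqrt.2 (by nlinarith [sq_nonneg ((v a)⁻¹ * 2 ^ (-(k a) : ℤ) * s)]))))
  unfold Tk Dk
  by_cases h0 : k a = 0
  · simp only [h0, if_true, norm_mul] at h1 ⊢
    have h3 := h1 (t a)
    simp only [Nat.cast_zero, neg_zero, zpow_zero, mul_one] at h3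
    calc _ ≤ ‖κ a (t a)‖ * (R * w (t a)) := mNL ((hG1 (t a)).trans' (by rw [Function.update_eq_self])) (nnn _)
      _ = R * (‖κ a (t a)‖ * w (t a)) := by ring
      _ ≤ R * (B * (√(1 + ((v a)⁻¹ * t a) ^ 2))⁻¹) := mNL h3 hR0
      _ ≤ _ := by
        refine mNL (mNR bL pv) hR0
  · simp only [h0, if_false]
    have hd : ∀ s, HasDerivAt (fun s ↦ κ a s * G (fU t a s)) (deriv (κ a) s * G (fU t a s) + κ a s * cpd a G (fU t a s)) s := fun s ↦
      (((hκ a 1).differentiable bN) s).hasDerivAt.mul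
        (HasFDerivAt.comp_hasDerivAt s ((hG.differentiable bN) (fU t a s)).hasFDerivAt (hasDerivAt_update t a s))
    have e : t + Pi.single a (v a) = fU t a (t a + v a) := by
      ext j; by_cases hj : j = a
      · subst hj; simp
      · simp [hj]
    have hb1 : ∀ s, ‖κ a s * G (fU t a s)‖ ≤ R * B := fun s ↦ by
      have h3 := hG1 s
      rw [norm_mul]
      calc _ ≤ ‖κ a s‖ * (R * w s) := mNL h3 (nnn _)
        _ = R * (‖κ a s‖ * w s) := by ring
        _ ≤ _ := mNL (h1' s) hR0
    have := diff1 hd (M := 2 * (R * B)) (fun s ↦ (hb1 s).trans (by nlinarith [mul_nonneg hR0 hB])) (fun s ↦ ?_) hv (t a)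
    · rw [e]
      simp only [Function.update_self]
      rw [Function.update_eq_self] at this
      exact this.trans (le_of_eq (by ring))
    · have h3 := hG1 s
      have h4 := hG2 s
      calc _ ≤ |s| * (‖deriv (κ a) s‖ * ‖G (fU t a s)‖ + ‖κ a s‖ * ‖cpd a G (fU t a s)‖) :=
            mNL ((norm_add_le _ _).trans (by rw [norm_mul, norm_mul])) (abs_nonneg _)
        _ = |s| * ‖deriv (κ a) s‖ * ‖G (fU t a s)‖ + ‖κ a s‖ * (|s| * ‖cpd a G (fU t a s)‖) := by ring
        _ ≤ |s| * ‖deriv (κ a) s‖ * (R * w s) + ‖κ a s‖ * (R * w s) :=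
            add_le_add (mNL h3 pv) (mNL h4 (nnn _))
        _ = R * (|s| * ‖deriv (κ a) s‖ * w s) + R * (‖κ a s‖ * w s) := by ring
        _ ≤ R * B + R * B := add_le_add (mNL (h2 s) hR0) (mNL (h1' s) hR0)
        _ = _ := by ring
lemma TL_bd {κ : ι → ℝ → ℂ} (hκ : ∀ a (m : ℕ), ContDiff ℝ m (κ a)) {k : ι → ℕ} {v : ι → ℝ} (hv : ∀ a, 0 < v a) 
    {w : ι → ℝ → ℝ} (hw : ∀ a s, 0 ≤ w a s) {B : ι → ℝ} (h1 : ∀ a s, ‖κ a s‖ * w a s ≤ B a * (√(1 + ((v a)⁻¹ * 2 ^ (-(k a) : ℤ) * s) ^ 2))⁻¹)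
    (h2 : ∀ a s, |s| * ‖deriv (κ a) s‖ * w a s ≤ B a) {l : List ι} (hl : l.Nodup) {ψ : Fc ι}
    (hψ : ContDiff ℝ (l.length : ℕ) ψ) {W : Fr ι} (hW0 : ∀ t, 0 ≤ W t) (hW : ∀ a ∈ l, ∀ t s, W (fU t a s) = W t)
    (hD : ∀ S t, ‖DL S l ψ t‖ * (l.map fun j ↦ if j ∈ S then |t j| else 1).prod ≤ W t * (l.map fun j ↦ w j (t j)).prod) (t : ι → ℝ) :
    ‖TL κ k v l ψ t‖ ≤ W t * (l.map fun j ↦ 12 * B j * (√(1 + ((v j)⁻¹ * t j) ^ 2))⁻¹).prod := by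
  have hB : ∀ a, 0 ≤ B a := fun a ↦ by simpa using h2 a 0
  induction l generalizing ψ W with
  | nil => simpa [TL, DL] using hD ∅ t
  | cons a l ih =>
    rw [List.nodup_cons] at hl
    have hupd : ∀ (f : ι → ℝ → ℝ) (t : ι → ℝ) s, (l.map fun j ↦ f j (fU t a s j)) = l.map fun j ↦ f j (t j) := fun f t s ↦
      List.map_congr_left fun j hj ↦ by rw [Function.update_of_ne]; rintro rfl; exact hl.1 hj
    have hlen : ContDiff ℝ (l.length : ℕ) ψ := hψ.of_le (by norm_cast; simp)
    have := ih hl.2 (Tk_contDiff hκ k v a hlen) (W := fun t ↦ W t * (12 * B a * (√(1 + ((v a)⁻¹ * t a) ^ 2))⁻¹))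
      (fun t ↦ mul_nonneg (hW0 t) (mul_nonneg (mul_nonneg bN (hB a)) pv)) (fun b hb t s ↦ ?_) (fun S t ↦ ?_)
    · refine this.trans (le_of_eq ?_)
      rw [List.map_cons, List.prod_cons]; ring
    · have hba : a ≠ b := by rintro rfl; exact hl.1 hb
      simp only [hW b (List.mem_cons_of_mem _ hb), Function.update_of_ne hba]
    · rw [DL_Tk hκ k v S hl.1 hlen]
      set E : Fr ι := fun t ↦ (l.map fun j ↦ if j ∈ S then |t j| else 1).prod with hE
      set X : Fr ι := fun t ↦ (l.map fun j ↦ w j (t j)).prod with hX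
      have hX0 : ∀ t, 0 ≤ X t := fun t ↦ List.prod_nonneg (by simp only [List.mem_map]; rintro _ ⟨j, _, rfl⟩; exact hw j _)
      have hE0 : 0 ≤ E t := List.prod_nonneg (by
        simp only [List.mem_map]; rintro _ ⟨j, _, rfl⟩; split_ifs <;> positivity)
      rcases hE0.eq_or_lt with he | he
      · rw [show (l.map fun j ↦ if j ∈ S then |t j| else 1).prod = E t from rfl, ← he, mul_zero]
        exact mul_nonneg (mul_nonneg (hW0 t) (mul_nonneg (mul_nonneg bN (hB a)) pv)) (hX0 t)
      have hEu : ∀ t s, E (fU t a s) = E t := fun t s ↦ by simp only [hE]; rw [hupd (fun j x ↦ if j ∈ S then |x| else 1)]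
      have hXu : ∀ t s, X (fU t a s) = X t := fun t s ↦ by simp only [hX]; rw [hupd w]
      have hSe : ∀ S' : Finset ι, (∀ j ∈ l, j ∈ S' ↔ j ∈ S) → (DL S' l ψ = DL S l ψ) ∧ ∀ t : ι → ℝ, (l.map fun j ↦ if j ∈ S' then |t j| else 1).prod = E t := fun S' h ↦
        ⟨DL_congr h ψ, fun t ↦ by simp only [hE]; congr 1; exact List.map_congr_left fun j hj ↦ by simp only [h j hj]⟩
      have hline : ∀ t', (∃ s, t' = fU t a s) → ‖DL S l ψ t'‖ ≤ W t' * X t' / E t * w a (t' a) ∧ |t' a| * ‖cpd a (DL S l ψ) t'‖ ≤ W t' * X t' / E t * w a (t' a) := by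
        rintro t' ⟨s, rfl⟩
        constructor
        · have h3 := hD (S.erase a) (fU t a s)
          obtain ⟨e1, e2⟩ := hSe (S.erase a) fun j hj ↦ by simp only [mem_erase, and_iff_right_iff_imp]; rintro _ rfl; exact hl.1 hj
          simp only [DL, List.foldr_cons, notMem_erase, if_false, List.map_cons, List.prod_cons, one_mul] at h3 e1 ⊢
          rw [e1, e2, hEu] at h3
          rw [div_mul_eq_mul_div, le_div_iff₀ he]
          exact h3.trans (le_of_eq (by simp only [hX]; ring))
        · have h3 := hD (insert a S) (fU t a s)
          obtain ⟨e1, e2⟩ := hSe (insert a S) fun j hj ↦ by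
            simp only [mem_insert, or_iff_right_iff_imp]; rintro rfl; exact absurd hj hl.1
          simp only [DL, List.foldr_cons, mem_insert_self, if_true, List.map_cons, List.prod_cons] at h3 e1 ⊢
          rw [e1, e2, hEu] at h3
          rw [div_mul_eq_mul_div, le_div_iff₀ he]
          refine le_trans (le_of_eq ?_) (h3.trans (le_of_eq (by simp only [hX]; ring)))
          ring
      have hR0 : 0 ≤ W t * X t / E t := div_nonneg (mul_nonneg (hW0 t) (hX0 t)) he.le
      have hWu : ∀ s, W (fU t a s) = W t := fun s ↦ hW a List.mem_cons_self t s
      have := Tk_bd hκ (k := k) (hv a) (DL_contDiff S l (m := 1) (by simpa [add_comm] using hψ)) (h1 a) (h2 a) hR0 t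
        (fun s ↦ by have := (hline _ ⟨s, rfl⟩).1; rwa [hWu, hXu, Function.update_self] at this)
        (fun s ↦ by have := (hline _ ⟨s, rfl⟩).2; rwa [hWu, hXu, Function.update_self] at this)
      refine (mNR this he.le).trans (le_of_eq ?_)
      show _ = W t * (12 * B a * (√(1 + ((v a)⁻¹ * t a) ^ 2))⁻¹) * X t
      field_simp
end c16
section c17
variable {ι : Type} [Fintype ι] [DecidableEq ι]
lemma tsum_prod_le (g : ι → ℕ → Eo) : ∑' k : ι → ℕ, ∏ j, g j (k j) ≤ ∏ j, ∑' i, g j i := by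
  rw [ENNReal.tsum_eq_iSup_sum]
  refine iSup_le fun s ↦ ?_
  calc ∑ k ∈ s, ∏ j, g j (k j) ≤ ∑ k ∈ Fintype.piFinset fun j ↦ s.image (fun k ↦ k j), ∏ j, g j (k j) :=
        sum_le_sum_of_subset fun k hk ↦ Fintype.mem_piFinset.2 fun j ↦ mem_image_of_mem _ hk
    _ = ∏ j, ∑ i ∈ s.image (fun k ↦ k j), g j i := (prod_univ_sum _ _).symm
    _ ≤ _ := Finset.prod_le_prod' fun j _ ↦ ENNReal.sum_le_tsum _
lemma multiPD_ind (S : Finset ι) (φ : Fc ι) : multiPD (fun j ↦ if j ∈ S then 1 else 0) φ = DL S univ.toList φ := by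
  unfold multiPD DL
  congr 1
  funext j ψ
  beta_reduce
  split_ifs <;> rfl
lemma LL_Dk {Φ : Fc ι} (hΦ : Integrable Φ) (k : ι → ℕ) (v : ι → ℝ) (a : ι) : Integrable (Dk k v a Φ) ∧
    ∀ x : ι → ℝ, LL (Dk k v a Φ) x = (if k a = 0 then 1 else cE (cI * ((v a * x a : ℝ) : ℂ)) - 1) * LL Φ x := by
  by_cases h0 : k a = 0
  · have : Dk k v a Φ = Φ := by ext t; simp [Dk, h0]
    rw [this]; exact ⟨hΦ, fun x ↦ by simp [h0]⟩
  have e : Dk k v a Φ = fun t ↦ Φ (t + Pi.single a (v a)) - Φ t := by ext t; simp [Dk, h0]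
  have hs : Integrable fun t : ι → ℝ ↦ Φ (t + Pi.single a (v a)) := hΦ.comp_add_right _
  rw [e]
  refine ⟨hs.sub hΦ, fun x ↦ ?_⟩
  have hE : ∀ {Ψ : Fc ι}, Integrable Ψ → Integrable fun t ↦ cE (-cD t x) * Ψ t := fun h ↦
    h.bdd_mul (c := 1) (Measurable.aestronglyMeasurable (by unfold dotp; fun_prop)) (aoa _ fun t ↦ (norm_exp_nI _).le)
  simp only [h0, if_false]
  unfold LL
  have h1 : ∫ t : ι → ℝ, cE (-cD t x) * (Φ (t + Pi.single a (v a)) - Φ t) =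
      (∫ t : ι → ℝ, cE (-cD t x) * Φ (t + Pi.single a (v a))) - ∫ t : ι → ℝ, cE (-cD t x) * Φ t := by
    rw [← integral_sub (hE hs) (hE hΦ)]; simp only [mul_sub]
  have h2 : ∫ t : ι → ℝ, cE (-cD t x) * Φ (t + Pi.single a (v a)) =
      cE (cI * ((v a * x a : ℝ) : ℂ)) * ∫ t : ι → ℝ, cE (-cD t x) * Φ t := by
    rw [← integral_add_right_eq_self (fun t : ι → ℝ ↦ cE (-cD t x) * Φ t) (Pi.single a (v a)), ← icm]
    congr 1; ext t
    rw [← mul_assoc, ← Complex.exp_add]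
    congr 2
    have : dotp (t + Pi.single a (v a)) x = dotp t x + v a * x a := by
      simp [dotp, add_mul, sum_add_distrib, Pi.single_apply]
    rw [this]; push_cast; ring
  rw [h1, h2]; ring
lemma LL_TL (κ : ι → ℝ → ℂ) (k : ι → ℕ) (v : ι → ℝ) {l : List ι} (hl : l.Nodup) {ψ : Fc ι}
    (hi : Integrable fun t ↦ (l.map fun j ↦ κ j (t j)).prod * ψ t) : Integrable (TL κ k v l ψ) ∧
    ∀ x, LL (TL κ k v l ψ) x = (l.map fun a ↦ if k a = 0 then 1 else cE (cI * ((v a * x a : ℝ) : ℂ)) - 1).prod * LL (fun t ↦ (l.map fun j ↦ κ j (t j)).prod * ψ t) x := by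
  induction l generalizing ψ with
  | nil => simp only [List.map_nil, List.prod_nil, one_mul] at hi ⊢; exact ⟨hi, fun _ ↦ rfl⟩
  | cons a l ih =>
    rw [List.nodup_cons] at hl
    have e : (fun t ↦ (l.map fun j ↦ κ j (t j)).prod * Tk κ k v a ψ t) = Dk k v a (fun t ↦ ((a :: l).map fun j ↦ κ j (t j)).prod * ψ t) := by
      ext t
      have : (l.map fun j ↦ κ j ((t + Pi.single a (v a) : ι → ℝ) j)) = l.map fun j ↦ κ j (t j) := List.map_congr_left fun j hj ↦ by
        have : j ≠ a := by rintro rfl; exact hl.1 hj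
        simp [this]
      simp only [Tk, Dk, List.map_cons, List.prod_cons, this]
      split_ifs <;> ring
    have h1 := LL_Dk hi k v a
    rw [← e] at h1
    have h2 := ih hl.2 h1.1
    refine ⟨h2.1, fun x ↦ ?_⟩
    show LL (TL κ k v l (Tk κ k v a ψ)) x = _
    rw [h2.2, h1.2]
    rw [List.map_cons (f := fun a ↦ if k a = 0 then 1 else cE (cI * ((v a * x a : ℝ) : ℂ)) - 1), List.prod_cons]; ring
lemma exp_sub_one_ge {θ : ℝ} (h1 : 1 / 2 ≤ |θ|) (h2 : |θ| ≤ 1) : 1 ≤ 10 * ‖cE (cI * (θ : ℂ)) - 1‖ ^ 2 := by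
  have h3 := Real.cos_le_one_sub_mul_cos_sq (x := θ) (h2.trans (by linarith [Real.pi_gt_three]))
  have h4 : ‖cE (cI * (θ : ℂ)) - 1‖ ^ 2 = 2 - 2 * Real.cos θ := by
    rw [← Complex.normSq_eq_norm_sq, Complex.normSq_apply, mul_comm cI, Complex.exp_mul_I]
    simp only [Complex.sub_re, Complex.sub_im, Complex.add_re, Complex.add_im, Complex.mul_re, Complex.mul_im, Complex.I_re, Complex.I_im, Complex.one_re, Complex.one_im, ← Complex.ofReal_cos, ← Complex.ofReal_sin, Complex.ofReal_re, Complex.ofReal_im]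
    nlinarith [Real.sin_sq_add_cos_sq θ]
  have h5 : 1 / 4 ≤ θ ^ 2 := by rw [← sq_abs]; nlinarith
  have h6 : 2 / 10 ≤ 2 / rP ^ 2 := by
    refine div_le_div_of_nonneg_left bN pv ?_
    nlinarith [Real.pi_lt_d2, Real.pi_gt_three]
  rw [h4]; nlinarith
lemma shell_l2 {κ : ι → ℝ → ℂ} (hκ : ∀ a (m : ℕ), ContDiff ℝ m (κ a)) {h : ι → ℝ} (hh : ∀ a, 0 < h a) {w : ι → ℝ → ℝ} (hw : ∀ a s, 0 ≤ w a s) {B : ι → ℝ}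
    (h1 : ∀ a s, ‖κ a s‖ * w a s ≤ B a * (√(1 + (h a * s) ^ 2))⁻¹) (h2 : ∀ a s, |s| * ‖deriv (κ a) s‖ * w a s ≤ B a) {ψ : Fc ι}
    (hψ : ContDiff ℝ (fC ι : ℕ) ψ) {A : ℝ} (hA : 0 ≤ A)
    (hD : ∀ S : Finset ι, ∀ t, ‖multiPD (fun j ↦ if j ∈ S then 1 else 0) ψ t‖ * ∏ j, (if j ∈ S then |t j| else 1) ≤ A * ∏ j, w j (t j))
    (hi : Integrable fun t ↦ (∏ j, κ j (t j)) * ψ t) (k : ι → ℕ) :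
    ∫⁻ x in {x | ∀ j, |x j| ≤ 2 ^ k j * h j ∧ (k j ≠ 0 → 2 ^ k j * h j / 2 ≤ |x j|)}, ‖LL (fun t ↦ (∏ j, κ j (t j)) * ψ t) x‖ₑ ^ 2 ≤
      oR (A ^ 2 * ∏ j, (1440 * B j ^ 2 / (2 ^ k j * h j))) := by
  set h' : ι → ℝ := fun j ↦ 2 ^ k j * h j with hh'
  have hh0 : ∀ j, 0 < h' j := fun j ↦ mul_pos pv (hh j)
  set v : ι → ℝ := fun j ↦ (h' j)⁻¹ with hv
  set l : List ι := (univ : Finset ι).toList with hl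
  have hln : l.Nodup := nodup_toList _
  have hpr : ∀ {M : Type} [CommMonoid M] (f : ι → M), (l.map f).prod = ∏ j, f j := fun f ↦ prod_map_toList _ f
  have hlen : l.length = fC ι := by simp [hl]
  have hi' : Integrable fun t ↦ (l.map fun j ↦ κ j (t j)).prod * ψ t := by simpa only [hpr] using hi
  have T1 := LL_TL κ k v hln hi'
  simp only [hpr] at T1
  have T2 : ∀ t, ‖TL κ k v l ψ t‖ ≤ A * ∏ j, (12 * B j * (√(1 + (h' j * t j) ^ 2))⁻¹) := fun t ↦ by
    have := TL_bd hκ (k := k) (v := v) (fun a ↦ inv_pos.2 (hh0 a)) hw (B := B) (fun a s ↦ ?_) h2 hln (by rw [hlen]; exact hψ) (W := fun _ ↦ A) (fun _ ↦ hA) (fun _ _ _ _ ↦ rfl) (fun S t ↦ ?_) t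
    · simpa only [hpr, hv, inv_inv] using this
    · have : (v a)⁻¹ * 2 ^ (-(k a) : ℤ) = h a := by
        simp only [hv, inv_inv, hh', zpow_neg, zpow_natCast]; field_simp
      rw [this]; exact h1 a s
    · rw [hpr, hpr, ← multiPD_ind]; exact hD S t
  set F := LL (fun t ↦ (∏ j, κ j (t j)) * ψ t) with hF
  have hc : ∀ x ∈ {x : ι → ℝ | ∀ j, |x j| ≤ 2 ^ k j * h j ∧ (k j ≠ 0 → 2 ^ k j * h j / 2 ≤ |x j|)}, ‖F x‖ₑ ^ 2 ≤ oR (10 ^ fC ι) * ‖LL (TL κ k v l ψ) x‖ₑ ^ 2 := fun x hx ↦ by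
    rw [T1.2 x, ← ofReal_norm, ← ofReal_norm, ← oRp (nnn _), ← oRp (nnn _), ← oRm pv]
    refine oRl ?_
    rw [norm_mul, norm_prod, mul_pow, ← prod_pow, ← mul_assoc, ← card_univ, ← prod_const, ← pmd]
    have this : ∀ j, 1 ≤ 10 * ‖if k j = 0 then (1:ℂ) else cE (cI * ((v j * x j : ℝ) : ℂ)) - 1‖ ^ 2 := fun j ↦ ?_
    · refine le_mul_of_one_le_left pv (by rw [← prod_const_one (s := univ (α := ι))]; exact fpl (fun _ _ ↦ zero_le_one) fun j _ ↦ this j)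
    split_ifs with h0
    · norm_num
    · have e : |v j * x j| = |x j| / h' j := by rw [abs_mul, abs_of_pos (inv_pos.2 (hh0 j))]; field_simp
      refine exp_sub_one_ge ?_ ?_
      · rw [e, le_div_iff₀ (hh0 j)]; have := (hx j).2 h0; simp only [hh']; linarith
      · rw [e, div_le_one (hh0 j)]; exact (hx j).1
  have hm : MeasurableSet {x : ι → ℝ | ∀ j, |x j| ≤ 2 ^ k j * h j ∧ (k j ≠ 0 → 2 ^ k j * h j / 2 ≤ |x j|)} := by measurability
  calc _ ≤ ∫⁻ x in {x | ∀ j, |x j| ≤ 2 ^ k j * h j ∧ (k j ≠ 0 → 2 ^ k j * h j / 2 ≤ |x j|)}, oR (10 ^ fC ι) * ‖LL (TL κ k v l ψ) x‖ₑ ^ 2 := setLIntegral_mono' hm hc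
    _ ≤ ∫⁻ x, oR (10 ^ fC ι) * ‖LL (TL κ k v l ψ) x‖ₑ ^ 2 := setLIntegral_le_lintegral _ _
    _ = oR (10 ^ fC ι) * ∫⁻ x, ‖LL (TL κ k v l ψ) x‖ₑ ^ 2 := lcm2 _ _ ofReal_ne_top
    _ ≤ oR (10 ^ fC ι) * (oR ((2 * rP) ^ (-(fC ι : ℝ))) * ∫⁻ t, oR ((A ^ 2 * ∏ j, (144 * B j ^ 2)) * Qw h' t)) := by
        refine mR ((LL_l2 T1.1).trans (mR (lmo fun t ↦ ?_) _)) _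
        rw [← ofReal_norm, ← oRp (nnn _)]
        refine oRl ((pow_le_pow_left₀ (nnn _) (T2 t) 2).trans (le_of_eq ?_))
        rw [mul_pow, ← prod_pow, mul_assoc, Qw, ← pmd]
        congr 1; refine pco rfl fun j _ ↦ ?_
        rw [mul_pow, mul_pow, inv_pow, Real.sq_sqrt pv]; ring
    _ = oR (10 ^ fC ι * ((2 * rP) ^ (-(fC ι : ℝ)) * ((A ^ 2 * ∏ j, (144 * B j ^ 2)) * ∏ j, (rP / h' j)))) := by
        have e0 : 0 ≤ A ^ 2 * ∏ j, (144 * B j ^ 2) := mul_nonneg (sq_nonneg _) (pnn fun j _ ↦ by positivity)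
        generalize A ^ 2 * ∏ j, (144 * B j ^ 2) = X at e0
        simp_rw [oRm e0]
        rw [lcm2 _ _ ofReal_ne_top, Qw_lint hh0, oRm pv, oRm pv, oRm e0]
    _ ≤ _ := by
        refine oRl ?_
        have := const_Q hh0
        have e0 : 0 ≤ A ^ 2 * ∏ j, (144 * B j ^ 2) := mul_nonneg (sq_nonneg _) (pnn fun j _ ↦ by positivity)
        calc _ = 10 ^ fC ι * ((A ^ 2 * ∏ j, (144 * B j ^ 2)) * ((2 * rP) ^ (-(fC ι : ℝ)) * ∏ j, (rP / h' j))) := by ring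
          _ ≤ 10 ^ fC ι * ((A ^ 2 * ∏ j, (144 * B j ^ 2)) * ∏ j, (h' j)⁻¹) := by gcongr
          _ = _ := by
            rw [← card_univ, ← prod_const, mul_assoc, ← pmd, mul_left_comm, ← pmd]
            congr 1; refine pco rfl fun j _ ↦ ?_
            simp only [hh']; ring
lemma partD {κ : ι → ℝ → ℂ} (hκ : ∀ a (m : ℕ), ContDiff ℝ m (κ a)) {h : ι → ℝ} (hh : ∀ a, 0 < h a) {w : ι → ℝ → ℝ} (hw : ∀ a s, 0 ≤ w a s) {B : ι → ℝ}
    (h1 : ∀ a s, ‖κ a s‖ * w a s ≤ B a * (√(1 + (h a * s) ^ 2))⁻¹) (h2 : ∀ a s, |s| * ‖deriv (κ a) s‖ * w a s ≤ B a) {ψ : Fc ι}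
    (hψ : ContDiff ℝ (fC ι : ℕ) ψ) {A : ℝ} (hA : 0 ≤ A)
    (hD : ∀ S : Finset ι, ∀ t, ‖multiPD (fun j ↦ if j ∈ S then 1 else 0) ψ t‖ * ∏ j, (if j ∈ S then |t j| else 1) ≤ A * ∏ j, w j (t j))
    (hi : Integrable fun t ↦ (∏ j, κ j (t j)) * ψ t) {p : ℝ} (hp : 1 < p) (hp2 : p < 2) :
    ∫⁻ x, ‖LL (fun t ↦ (∏ j, κ j (t j)) * ψ t) x‖ₑ ^ p ≤
      oR (A ^ p * ∏ j, (2880 * B j ^ p * h j ^ (1 - p))) * ((1 - oR (2 ^ (1 - p)))⁻¹) ^ fC ι := by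
  have hB : ∀ a, 0 ≤ B a := fun a ↦ by simpa using h2 a 0
  set F := LL (fun t ↦ (∏ j, κ j (t j)) * ψ t) with hF
  set E : (ι → ℕ) → Set Vr ι := fun k ↦ {x | ∀ j, |x j| ≤ 2 ^ k j * h j ∧ (k j ≠ 0 → 2 ^ k j * h j / 2 ≤ |x j|)} with hE
  have hFm : Measurable F := (LL_cont hi).measurable
  have hcov : (⋃ k, E k) = Set.univ := by
    refine Set.eq_univ_of_forall fun x ↦ Set.mem_iUnion.2 ?_
    have : ∀ j, ∃ k : ℕ, |x j| ≤ 2 ^ k * h j ∧ (k ≠ 0 → 2 ^ k * h j / 2 ≤ |x j|) := fun j ↦ by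
      classical
      have hex : ∃ k : ℕ, |x j| ≤ 2 ^ k * h j := by
        obtain ⟨k, hk⟩ := pow_unbounded_of_one_lt (|x j| / h j) (one_lt_two)
        exact ⟨k, by rw [← div_le_iff₀ (hh j)]; exact hk.le⟩
      refine ⟨Nat.find hex, Nat.find_spec hex, fun h0 ↦ ?_⟩
      have := Nat.find_min hex (Nat.sub_lt (Nat.pos_of_ne_zero h0) one_pos)
      push Not at this
      obtain ⟨r, hr⟩ := Nat.exists_eq_succ_of_ne_zero h0
      rw [hr] at this ⊢
      simp only [Nat.succ_eq_add_one, Nat.add_sub_cancel, pow_succ] at this ⊢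
      linarith
    choose k hk using this
    exact ⟨k, hk⟩
  have hvol : ∀ k, volume (E k) ≤ oR (∏ j, (2 * (2 ^ k j * h j))) := fun k => by
    refine (measure_mono (t := Set.Icc (fun j => -(2 ^ k j * h j)) fun j => 2 ^ k j * h j) fun x hx => ⟨fun j => (abs_le.1 (hx j).1).1, fun j => (abs_le.1 (hx j).1).2⟩).trans ?_
    rw [Real.volume_Icc_pi, ← ENNReal.ofReal_prod_of_nonneg fun j _ => by have := hh j; have : 0 < (2:ℝ) ^ k j * h j := by positivity
                                                                          linarith]
    exact le_of_eq (by congr 1; exact pco rfl fun j _ ↦ by ring)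
  have hpp : 0 < p := by linarith
  have hEk : ∀ k, ∫⁻ x in E k, ‖F x‖ₑ ^ p ≤ ENNReal.ofReal (A ^ p * ∏ j, (2880 * B j ^ p * h j ^ (1 - p))) * ∏ j, ENNReal.ofReal (2 ^ (1 - p)) ^ k j := fun k ↦ by
    have hJ := jensen (μ := volume.restrict (E k)) (k := fun _ ↦ 1) (v := fun x ↦ ‖F x‖ₑ ^ p) aemeasurable_const fpr (p := 2 / p) (by rw [le_div_iff₀ hpp]; linarith)
    simp only [one_mul, lintegral_const, Measure.restrict_apply_univ] at hJ
    have e2 : ∀ x, (‖F x‖ₑ ^ p) ^ (2 / p) = ‖F x‖ₑ ^ 2 := fun x ↦ by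
      rw [← erm, mul_div_cancel₀ _ hpp.ne', ← rpow_natCast]; norm_num
    simp only [e2] at hJ
    have hS := shell_l2 hκ hh hw h1 h2 hψ hA hD hi k
    have hq : 0 ≤ 2 / p - 1 := by rw [le_sub_iff_add_le, le_div_iff₀ hpp]; linarith
    have hJ2 := hJ.trans (mul_le_mul' (err (hvol k) hq) hS)
    have n1 : 0 ≤ ∏ j, (2 * (2 ^ k j * h j)) := pnn fun j _ ↦ by have := hh j; positivity
    have n2 : 0 ≤ A ^ 2 * ∏ j, (1440 * B j ^ 2 / (2 ^ k j * h j)) := mul_nonneg (sq_nonneg _) (pnn fun j _ ↦ by have := hh j; positivity)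
    rw [orn n1 hq, ← oRm (rrn n1 _)] at hJ2
    have hJ3 := ENNReal.rpow_le_rpow hJ2 (z := p / 2) pv
    rw [← erm, show 2 / p * (p / 2) = 1 by field_simp, ero, orn (mul_nonneg (rrn n1 _) n2) pv] at hJ3
    refine hJ3.trans ?_
    simp_rw [← oRp (rrn (zero_le_two) (1 - p))]
    rw [← ofReal_prod_of_nonneg fun j _ ↦ by positivity, ← oRm (mul_nonneg pv (pnn fun j _ ↦ by have := hh j; have := hB j; positivity))]
    refine oRl ?_
    rw [mul_assoc, ← pmd, rmr (rrn n1 _) n2, ← rrm n1, rmr (sq_nonneg _) (pnn fun j _ ↦ by have := hh j; positivity), ← Real.finsetProd_rpow _ _ (fun j _ ↦ by have := hh j; positivity),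
      ← Real.finsetProd_rpow _ _ (fun j _ ↦ by have := hh j; positivity), mul_left_comm, ← pmd]
    rw [show (A ^ 2) ^ (p / 2) = A ^ p by rw [← rrc, ← rrm hA]; congr 1; push_cast; ring]
    refine mNL (fpl (fun j _ ↦ by have := hh j; positivity) fun j _ ↦ ?_) pv
    have hj := hh j
    have hbj := hB j
    obtain ⟨x, hx⟩ : ∃ x : ℝ, x = 2 ^ k j * h j := ⟨_, rfl⟩
    rw [← hx]
    have hx0 : 0 < x := by rw [hx]; positivity
    have e3 : h j ^ (1 - p) * (2 ^ (1 - p)) ^ k j = x ^ (1 - p) := by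
      rw [hx, rmr pv hj.le, ← rrc, ← rrc, ← rrm bN, ← rrm bN, mul_comm (k j : ℝ)]; ring
    have e4 : (2 / p - 1) * (p / 2) = 1 - p / 2 := by field_simp
    rw [mul_assoc, e3, e4, rmr bN hx0.le, mul_div_assoc, rmr bN pv, Real.div_rpow pv hx0.le]
    have e5 : (B j ^ 2) ^ (p / 2) = B j ^ p := by rw [← rrc, ← rrm hbj]; congr 1; push_cast; ring
    have e6 : x ^ (1 - p) = x ^ (1 - p / 2) / x ^ (p / 2) := by rw [← Real.rpow_sub hx0]; congr 1; ring
    have e7 : (2:ℝ) ^ (1 - p / 2) ≤ 2 := (Real.rpow_le_rpow_of_exponent_le bN bL).trans (Real.rpow_one 2).le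
    have e8 : (1440:ℝ) ^ (p / 2) ≤ 1440 := (Real.rpow_le_rpow_of_exponent_le bN bL).trans (Real.rpow_one 1440).le
    rw [e5, e6]
    calc _ = ((2:ℝ) ^ (1 - p / 2) * 1440 ^ (p / 2)) * (B j ^ p * (x ^ (1 - p / 2) / x ^ (p / 2))) := by ring
      _ ≤ (2 * 1440) * (B j ^ p * (x ^ (1 - p / 2) / x ^ (p / 2))) := by gcongr
      _ = _ := by ring
  calc ∫⁻ x, ‖F x‖ₑ ^ p = ∫⁻ x in ⋃ k, E k, ‖F x‖ₑ ^ p := by rw [hcov, Measure.restrict_univ]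
    _ ≤ ∑' k, ∫⁻ x in E k, ‖F x‖ₑ ^ p := lintegral_iUnion_le _ _
    _ ≤ ∑' k : ι → ℕ, oR (A ^ p * ∏ j, (2880 * B j ^ p * h j ^ (1 - p))) * ∏ j, oR (2 ^ (1 - p)) ^ k j := ENNReal.tsum_le_tsum hEk
    _ ≤ _ := by
      rw [ENNReal.tsum_mul_left]
      refine mR ((tsum_prod_le _).trans (le_of_eq ?_)) _
      rw [pco rfl fun j _ ↦ tsum_geometric _, prod_const, card_univ]
end c17
section c18
open scoped FourierTransform SchwartzMap
def Khat (K : ℝ → ℝ) (s : ℝ) : ℂ := ∫ x : ℝ, cE (cI * ((s * x : ℝ) : ℂ)) * (K x : ℂ)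
lemma Khat_sch {K : ℝ → ℝ} (hK : IsKernel K) : ∃ G : 𝓢(ℝ, ℂ), ⇑G = Khat K ∧ Integrable K ∧ Continuous K ∧
    ∀ x, (K x : ℂ) = ((2 * rP : ℝ) : ℂ)⁻¹ * ∫ t : ℝ, cE (-(cI * ((t * x : ℝ) : ℂ))) * Khat K t := by
  obtain ⟨⟨KS, hKS⟩, -, -⟩ := hK
  set KC : 𝓢(ℝ, ℂ) := KS.postcompCLM (𝕜 := ℝ) Complex.ofRealCLM with hKC
  have hc : ∀ x, KC x = (K x : ℂ) := fun x ↦ by rw [hKC, SchwartzMap.postcompCLM_apply, hKS]; rfl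
  have h2 : ((2 * rP)⁻¹ : ℝ) ≠ 0 := by positivity
  set g : ℝ ≃L[ℝ] ℝ := ContinuousLinearEquiv.smulLeft (Units.mk0 _ h2) with hg
  have hga : ∀ s, g s = (2 * rP)⁻¹ * s := fun s ↦ rfl
  have e : ∀ s, (𝓕⁻ KC : 𝓢(ℝ, ℂ)) (g s) = Khat K s := fun s ↦ by
    rw [SchwartzMap.fourierInv_coe, Real.fourierInv_eq', hga]
    unfold Khat
    congr 1; ext v
    rw [hc, smul_eq_mul]; congr 2
    simp only [inner, conj_trivial, RCLike.re_to_real]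
    push_cast
    have : (rP : ℂ) ≠ 0 := by exact_mod_cast Real.pi_ne_zero
    field_simp
    simp
  refine ⟨SchwartzMap.compCLMOfContinuousLinearEquiv ℂ g (𝓕⁻ KC), funext e, by rw [← hKS]; exact KS.integrable, by rw [← hKS]; exact KS.continuous, fun x ↦ ?_⟩
  rw [← hc]
  have h3 : KC = 𝓕 (𝓕⁻ KC) := (FourierTransform.fourier_fourierInv_eq KC).symm
  conv_lhs => rw [h3]
  rw [SchwartzMap.fourier_coe, Real.fourier_eq']
  have h4 := Measure.integral_comp_mul_left (fun v : ℝ ↦ cE (((-2 * rP * (v * x) : ℝ) : ℂ) * cI) • (𝓕⁻ KC : 𝓢(ℝ, ℂ)) v) (2 * rP)⁻¹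
  rw [inv_inv, abs_of_pos pv] at h4
  have h5 : (∫ v : ℝ, cE (((-2 * rP * inner ℝ v x : ℝ) : ℂ) * cI) • (𝓕⁻ KC : 𝓢(ℝ, ℂ)) v) = ∫ v : ℝ, cE (((-2 * rP * (v * x) : ℝ) : ℂ) * cI) • (𝓕⁻ KC : 𝓢(ℝ, ℂ)) v := by
    congr 1; ext v; congr 4; simp [inner, mul_comm]
  rw [h5]
  have h6 : ((2 * rP : ℝ) : ℂ) ≠ 0 := by exact_mod_cast (by positivity : (2 * rP : ℝ) ≠ 0)
  rw [eq_inv_mul_iff_mul_eq₀ h6, ← Complex.real_smul, ← h4]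
  congr 1; ext t
  rw [← hga, e, smul_eq_mul]; congr 2
  rw [hga]; push_cast
  have : (rP : ℂ) ≠ 0 := by exact_mod_cast Real.pi_ne_zero
  field_simp
lemma sch_bd (G : 𝓢(ℝ, ℂ)) (N : ℕ) : ∃ C : ℝ, 0 < C ∧ ∀ s, ‖G s‖ * (1 + s ^ 2) ^ N ≤ C := by
  refine ⟨2 ^ (2 * N) * ((Finset.Iic (2 * N, 0)).sup fun m ↦ SchwartzMap.seminorm ℝ m.1 m.2) G + 1, by positivity, fun s ↦ ?_⟩
  have := SchwartzMap.one_add_le_sup_seminorm_apply (𝕜 := ℝ) (m := (2 * N, 0)) le_rfl le_rfl G s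
  rw [norm_iteratedFDeriv_zero] at this
  have h2 : (1 + s ^ 2) ^ N ≤ (1 + ‖s‖) ^ (2 * N) := by
    rw [pow_mul]; refine pow_le_pow_left₀ pv ?_ N
    rw [Real.norm_eq_abs, ← sq_abs s]; nlinarith [abs_nonneg s]
  calc _ ≤ ‖G s‖ * (1 + ‖s‖) ^ (2 * N) := mNL h2 (nnn _)
    _ ≤ _ := by linarith
lemma Khat_smooth {K : ℝ → ℝ} (hK : IsKernel K) (m : ℕ) : ContDiff ℝ m (Khat K) := by
  obtain ⟨G, hG, -⟩ := Khat_sch hK; rw [← hG]; exact G.smooth m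
lemma Khat_bd {K : ℝ → ℝ} (hK : IsKernel K) (N : ℕ) : ∃ C : ℝ, 0 < C ∧ (∀ s, ‖Khat K s‖ * (1 + s ^ 2) ^ N ≤ C) ∧ ∀ s, |s| * ‖deriv (Khat K) s‖ * (1 + s ^ 2) ^ N ≤ C := by
  obtain ⟨G, hG, -⟩ := Khat_sch hK
  obtain ⟨C1, h1, H1⟩ := sch_bd G N
  obtain ⟨C2, h2, H2⟩ := sch_bd (SchwartzMap.derivCLM ℝ ℂ G) (N + 1)
  rw [← hG]
  refine ⟨max C1 C2, by positivity, fun s ↦ (H1 s).trans (le_max_left _ _), fun s ↦ ?_⟩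
  have := H2 s
  rw [SchwartzMap.derivCLM_apply, pow_succ] at this
  have h3 : |s| ≤ 1 + s ^ 2 := by rw [← sq_abs s]; nlinarith [sq_nonneg (|s| - 1)]
  calc _ = ‖deriv G s‖ * (1 + s ^ 2) ^ N * |s| := by ring
    _ ≤ ‖deriv G s‖ * (1 + s ^ 2) ^ N * (1 + s ^ 2) := by gcongr
    _ = ‖deriv G s‖ * ((1 + s ^ 2) ^ N * (1 + s ^ 2)) := by ring
    _ ≤ _ := this.trans (le_max_right _ _)
lemma Khat_wbd {K : ℝ → ℝ} (hK : IsKernel K) {lam : ℝ} (hl : 0 ≤ lam) : ∃ C : ℝ, 0 < C ∧ ∀ h : ℝ, 0 < h → h ≤ 1 → 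
    (∀ s, ‖Khat K (h * s)‖ * (1 + s ^ 2) ^ (lam / 2) ≤ C * h ^ (-lam) * ((1 + (h * s) ^ 2)⁻¹) ^ 3) ∧
    ∀ s, |s| * ‖deriv (fun s ↦ Khat K (h * s)) s‖ * (1 + s ^ 2) ^ (lam / 2) ≤ C * h ^ (-lam) := by
  obtain ⟨N, hN⟩ := exists_nat_ge (lam / 2)
  obtain ⟨C, hC, H1, H2⟩ := Khat_bd hK (N + 3)
  refine ⟨C, hC, fun h hh hh1 ↦ ?_⟩
  have hw : ∀ s : ℝ, (1 + s ^ 2) ^ (lam / 2) ≤ h ^ (-lam) * (1 + (h * s) ^ 2) ^ N := fun s ↦ by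
    have h1 : 1 + s ^ 2 ≤ h ^ (-2 : ℝ) * (1 + (h * s) ^ 2) := by
      rw [Real.rpow_neg hh.le, ← div_eq_inv_mul, le_div_iff₀ pv, show (2:ℝ) = ((2:ℕ):ℝ) by norm_num, rrc]
      nlinarith
    calc _ ≤ (h ^ (-2 : ℝ) * (1 + (h * s) ^ 2)) ^ (lam / 2) := Real.rpow_le_rpow pv h1 pv
      _ = h ^ (-lam) * (1 + (h * s) ^ 2) ^ (lam / 2) := by
        rw [rmr pv pv, ← rrm hh.le]; congr 2; ring
      _ ≤ _ := by
        refine mNL ?_ pv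
        have h7 : (1 + (h * s) ^ 2) ^ (lam / 2) ≤ (1 + (h * s) ^ 2) ^ (N : ℝ) := Real.rpow_le_rpow_of_exponent_le (by nlinarith [sq_nonneg (h * s)]) hN
        exact h7.trans_eq (rrc _ _)
  constructor
  · intro s
    have hp : 0 < 1 + (h * s) ^ 2 := by positivity
    rw [inv_pow, ← div_eq_mul_inv, le_div_iff₀ pv]
    calc _ ≤ ‖Khat K (h * s)‖ * (h ^ (-lam) * (1 + (h * s) ^ 2) ^ N) * (1 + (h * s) ^ 2) ^ 3 := by gcongr; exact hw s
      _ = h ^ (-lam) * (‖Khat K (h * s)‖ * (1 + (h * s) ^ 2) ^ (N + 3)) := by ring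
      _ ≤ h ^ (-lam) * C := by gcongr; exact H1 _
      _ = _ := by ring
  · intro s
    rw [deriv_comp_mul_left, norm_smul, rno hh.le]
    have h1 : (1:ℝ) ≤ (1 + (h * s) ^ 2) ^ 3 := one_le_pow₀ (by nlinarith [sq_nonneg (h * s)])
    calc _ ≤ |s| * (h * ‖deriv (Khat K) (h * s)‖) * (h ^ (-lam) * (1 + (h * s) ^ 2) ^ N) := by gcongr; exact hw s
      _ ≤ |s| * (h * ‖deriv (Khat K) (h * s)‖) * (h ^ (-lam) * (1 + (h * s) ^ 2) ^ N) * (1 + (h * s) ^ 2) ^ 3 := le_mul_of_one_le_right pv h1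
      _ = h ^ (-lam) * (|h * s| * ‖deriv (Khat K) (h * s)‖ * (1 + (h * s) ^ 2) ^ (N + 3)) := by rw [abs_mul, abs_of_pos hh]; ring
      _ ≤ h ^ (-lam) * C := by gcongr; exact H2 _
      _ = _ := by ring
end c18
section c19
def pj {d : ℕ} (I : Sd d) (y : Fin d → ℝ) (j : I) : ℝ := y ↑j
def dm {ι : Type} [Fintype ι] (g : Fr ι) : Measure Vr ι := volume.withDensity fun x ↦ oR (g x)
lemma pj_meas {d : ℕ} (I : Sd d) : Measurable (pj I) := measurable_pi_lambda _ fun j ↦ measurable_pi_apply _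
lemma pj_glue {d : ℕ} (I : Sd d) (x y) : pj I (glue I x y) = x := by
  ext j; simp [pj, glue]
lemma glue_mp {d : ℕ} (I : Sd d) : MeasurePreserving (fun z : (I → ℝ) × (↥(Iᶜ) → ℝ) ↦ glue I z.1 z.2) (volume.prod volume) volume := by
  have hm : Measurable (fun z : (I → ℝ) × (↥(Iᶜ) → ℝ) ↦ glue I z.1 z.2) := by
    refine measurable_pi_lambda _ fun i ↦ ?_
    unfold glue
    by_cases h : i ∈ I
    · simp only [h, dite_true]; fun_prop
    · simp only [h, dite_false]; fun_prop
  refine ⟨hm, ?_⟩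
  symm
  rw [volume_pi]
  refine Measure.pi_eq fun s hs ↦ ?_
  rw [Measure.map_apply hm (MeasurableSet.univ_pi hs)]
  have : (fun z : (I → ℝ) × (↥(Iᶜ) → ℝ) ↦ glue I z.1 z.2) ⁻¹' (Set.univ.pi s) = (Set.univ.pi fun j : I ↦ s j) ×ˢ (Set.univ.pi fun j : ↥(Iᶜ) ↦ s j) := by
    ext z
    simp only [Set.mem_preimage, Set.mem_pi, Set.mem_univ, true_implies, Set.mem_prod]
    constructor
    · intro h
      refine ⟨fun i ↦ ?_, fun i ↦ ?_⟩
      · have := h i; simpa [glue, i.2] using this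
      · have := h i; simpa [glue, mem_compl.1 i.2] using this
    · rintro ⟨h1, h2⟩ i
      unfold glue
      split_ifs with h
      · exact h1 ⟨i, h⟩
      · exact h2 ⟨i, _⟩
  rw [this, Measure.prod_prod, volume_pi_pi, volume_pi_pi, pcs I (fun i ↦ volume (s i)), pcs Iᶜ (fun i ↦ volume (s i)), prod_mul_prod_compl]
lemma IsDensity.int {ι : Type} [Fintype ι] {g : Fr ι} (hg : IsDensity g) : Integrable g := by
  by_contra h; have := hg.2; rw [integral_undef h] at this; exact zero_ne_one this
lemma IsDensity.prob {ι : Type} [Fintype ι] {g : Fr ι} (hg : IsDensity g) : IPM (dm g) := by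
  refine ⟨?_⟩
  rw [dm, withDensity_apply _ MeasurableSet.univ, Measure.restrict_univ, ← oie hg.int (aoa _ hg.1), hg.2, ofReal_one]
lemma dm_lint {ι : Type} [Fintype ι] {g : Vr ι → ℝ} (hg : IsDensity g) {F : Vr ι → ℝ≥0∞} (hF : Measurable F) : ∫⁻ x, F x ∂(dm g) = ∫⁻ x, ENNReal.ofReal (g x) * F x := by
  rw [dm, lintegral_withDensity_eq_lintegral_mul₀ hg.int.1.aemeasurable.ennreal_ofReal hF.aemeasurable]; rfl
lemma dm_int {ι : Type} [Fintype ι] {g : Fr ι} (hg : IsDensity g) (F : Fc ι) : ∫ x, F x ∂(dm g) = ∫ x, F x * (g x : ℂ) := by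
  rw [dm, integral_withDensity_eq_integral_toReal_smul₀ hg.int.1.aemeasurable.ennreal_ofReal (aoa _ fun _ ↦ ofReal_lt_top)]
  congr 1; ext x; rw [toReal_ofReal (hg.1 x), Complex.real_smul, mul_comm]
lemma dm_marg {d : ℕ} (I : Sd d) {g : Fd d} (hg : IsDensity g) :
    IsDensity (marginal I g) ∧ (dm g).map (pj I) = dm (marginal I g) := by
  have hi : Integrable (fun z : (I → ℝ) × (↥(Iᶜ) → ℝ) ↦ g (glue I z.1 z.2)) (volume.prod volume) := by
    have := (glue_mp I).integrable_comp_of_integrable hg.int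
    exact this
  have hmarg : IsDensity (marginal I g) := by
    refine ⟨fun x ↦ integral_nonneg fun y ↦ hg.1 _, ?_⟩
    have h1 := integral_prod _ hi
    unfold marginal; rw [← h1, ← hg.2]
    have h2 := integral_map (μ := volume.prod volume) (glue_mp I).measurable.aemeasurable (f := g) (by rw [(glue_mp I).map_eq]; exact hg.int.1)
    rw [(glue_mp I).map_eq] at h2; exact h2.symm
  refine ⟨hmarg, Measure.ext_of_lintegral _ fun φ hφ ↦ ?_⟩
  rw [lintegral_map hφ (pj_meas I), dm_lint hg (F := fun x ↦ φ (pj I x)) (hφ.comp (pj_meas I)), dm_lint hmarg hφ]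
  have hgm : AEMeasurable (fun x ↦ oR (g x) * φ (pj I x)) volume := hg.int.1.aemeasurable.ennreal_ofReal.mul (hφ.comp (pj_meas I)).aemeasurable
  have h2 := lintegral_map' (μ := volume.prod volume) (g := fun z : (I → ℝ) × (↥(Iᶜ) → ℝ) ↦ glue I z.1 z.2) (f := fun x ↦ oR (g x) * φ (pj I x)) (by rw [(glue_mp I).map_eq]; exact hgm) (glue_mp I).measurable.aemeasurable
  rw [(glue_mp I).map_eq] at h2
  rw [h2, lintegral_prod _ (by simp only [pj_glue]; exact hi.1.aemeasurable.ennreal_ofReal.mul (hφ.comp measurable_fst).aemeasurable)]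
  refine lintegral_congr_ae ?_
  filter_upwards [hi.prod_right_ae] with x hx
  simp only [pj_glue]
  rw [lintegral_mul_const'' _ hx.1.aemeasurable.ennreal_ofReal, marginal, oie hx (aoa _ fun _ ↦ hg.1 _)]
lemma ft_marg {d : ℕ} (I : Sd d) {g : Fd d} (hg : IsDensity g) (t : I → ℝ) :
    ftI (marginal I g) t = ∫ y, cE (cI * (dotp t (pj I y) : ℝ)) ∂(dm g) := by
  obtain ⟨h1, h2⟩ := dm_marg I hg
  have h3 : Continuous fun x : I → ℝ ↦ cE cD t x := by unfold dotp; fun_prop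
  rw [ftI, ← dm_int h1, ← h2, integral_map (pj_meas I).aemeasurable h3.aestronglyMeasurable]
lemma conv_dm {d : ℕ} {f q : Fd d} (hf : IsDensity f) (hq : IsDensity q) : dm (conv f q) = Measure.conv (dm q) (dm f) := by
  have h0 := conv_withDensity_eq_mlconvolution₀ (μ := (volume : Measure (Fin d → ℝ))) hq.int.1.aemeasurable.ennreal_ofReal hf.int.1.aemeasurable.ennreal_ofReal
  unfold dm
  rw [h0]
  refine withDensity_congr_ae ?_
  have h1 := Integrable.convolution_integrand (ContinuousLinearMap.mul ℝ ℝ) hq.int hf.int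
  filter_upwards [h1.prod_right_ae] with x hx
  rw [lconvolution_def]
  simp only [ContinuousLinearMap.mul_apply'] at hx
  have h2 : conv f q x = ∫ y, q y * f (x - y) := by unfold conv; congr 1; ext y; ring
  rw [h2, oie hx (aoa _ fun y ↦ mul_nonneg (hq.1 _) (hf.1 _))]
  refine lco fun y ↦ ?_
  rw [oRm (hq.1 _), neg_add_eq_sub]
lemma conv_prob {d : ℕ} {f q : Fd d} (hf : IsDensity f) (hq : IsDensity q) : IPM (dm (conv f q)) := by
  have := hf.prob; have := hq.prob
  rw [conv_dm hf hq]; infer_instance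
lemma conv_char {d : ℕ} (I : Sd d) {f q : Fd d} (hf : IsDensity f) (hq : IsDensity q) (t : I → ℝ) :
    ∫ y, cE (cI * (dotp t (pj I y) : ℝ)) ∂(dm (conv f q)) = ftI (marginal I q) t * ftI (marginal I f) t := by
  have := hf.prob; have := hq.prob
  have h3 : Continuous fun x : Fin d → ℝ ↦ cE (cI * (dotp t (pj I x) : ℝ)) := by unfold dotp pj; fun_prop
  rw [conv_dm hf hq, Measure.conv, integral_map fpr h3.aestronglyMeasurable, ft_marg I hf, ft_marg I hq, ← integral_prod_mul]
  congr 1; ext z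
  rw [← Complex.exp_add]; congr 1
  have : dotp t (pj I (z.1 + z.2)) = dotp t (pj I z.1) + dotp t (pj I z.2) := by
    simp [dotp, pj, mul_add, sum_add_distrib]
  rw [this]; push_cast; ring
end c19
section c20
variable {d : ℕ} {I : Sd d} {K : ℝ → ℝ} {q f : Fd d} {h : Fin d → ℝ}
def kp {ι : Type} [Fintype ι] (K : ℝ → ℝ) (h t : ι → ℝ) : ℂ := ∏ j, Khat K (h j * t j)
lemma Kh_prod (I : Sd d) (K : ℝ → ℝ) (h : Fin d → ℝ) (x : I → ℝ) : Kh I K h x = ∏ j : I, ((h j)⁻¹ * K (x j / h j)) := by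
  rw [Kh, pmd, Finset.prod_inv_distrib, pcs I h]
lemma Khat1 (K : ℝ → ℝ) {h : ℝ} (hh : 0 < h) (t : ℝ) : ∫ x : ℝ, cE (cI * ((t * x : ℝ) : ℂ)) * ((h⁻¹ * K (x / h) : ℝ) : ℂ) = Khat K (h * t) := by
  have h4 := Measure.integral_comp_div (fun v : ℝ ↦ cE (cI * ((h * t * v : ℝ) : ℂ)) * (K v : ℂ)) h
  rw [abs_of_pos hh] at h4
  have : ∀ x : ℝ, cE (cI * ((t * x : ℝ) : ℂ)) * ((h⁻¹ * K (x / h) : ℝ) : ℂ) = (h⁻¹ : ℂ) * (cE (cI * ((h * t * (x / h) : ℝ) : ℂ)) * (K (x / h) : ℂ)) := fun x ↦ by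
    rw [show h * t * (x / h) = t * x by field_simp]; push_cast; ring
  simp_rw [this]
  rw [icm, h4, Khat, Complex.real_smul, ← mul_assoc, inv_mul_cancel₀ (by exact_mod_cast hh.ne'), one_mul]
lemma Kh1_inv (hK : IsKernel K) {h : ℝ} (hh : 0 < h) (x : ℝ) : ((2 * rP : ℝ) : ℂ)⁻¹ * ∫ t : ℝ, cE (-(cI * ((t * x : ℝ) : ℂ))) * Khat K (h * t) = ((h⁻¹ * K (x / h) : ℝ) : ℂ) := by
  obtain ⟨-, -, -, -, h1⟩ := Khat_sch hK
  push_cast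
  have h2 := h1 (x / h)
  push_cast at h2
  rw [h2]
  have h4 := Measure.integral_comp_mul_left (fun v : ℝ ↦ cE (-(cI * ((v * (x / h) : ℝ) : ℂ))) * Khat K v) h
  rw [abs_of_pos pv] at h4
  have : ∀ t : ℝ, h * t * (x / h) = t * x := fun t ↦ by field_simp
  simp_rw [this] at h4
  push_cast at h4
  rw [h4, Complex.real_smul]; push_cast; ring
lemma ft_Kh (hh : ∀ j ∈ I, 0 < h j) (t : I → ℝ) : ftI (Kh I K h) t = kp K (pj I h) t := by
  unfold ftI kp
  simp_rw [Kh_prod, exp_dotp, Complex.ofReal_prod, ← pmd]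
  rw [ifp (fun (j : I) (v : ℝ) ↦ cE (cI * ((t j * v : ℝ) : ℂ)) * (((h j)⁻¹ * K (v / h j) : ℝ) : ℂ))]
  exact pco rfl fun j _ ↦ Khat1 K (hh j j.2) (t j)
lemma nexp_dotp {ι : Type} [Fintype ι] (t x : ι → ℝ) : cE (-(cD t x)) =
    ∏ j, cE (-(cI * ((t j * x j : ℝ) : ℂ))) := by
  rw [Complex.exp_neg, exp_dotp, ← Finset.prod_inv_distrib]
  exact pco rfl fun j _ ↦ (Complex.exp_neg _).symm
lemma Kh_LL (hK : IsKernel K) (hh : ∀ j ∈ I, 0 < h j) (x : I → ℝ) : ((Kh I K h x : ℝ) : ℂ) = LL (kp K (pj I h)) x := by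
  unfold LL kp
  simp_rw [nexp_dotp, ← pmd]
  rw [ifp (fun (j : I) (v : ℝ) ↦ cE (-(cI * ((v * x j : ℝ) : ℂ))) * Khat K (pj I h j * v)), Kh_prod, Complex.ofReal_prod, Real.rpow_neg pv, rrc, ← card_univ, Complex.ofReal_inv, Complex.ofReal_pow, ← inv_pow, ← prod_const, ← pmd]
  exact pco rfl fun j _ ↦ (Kh1_inv hK (hh j j.2) (x j)).symm
def Ph (I : Sd d) (K : ℝ → ℝ) (q : Fd d) (h : Fin d → ℝ) (t : I → ℝ) : ℂ :=
  kp K (pj I h) t * (ftI (marginal I q) t)⁻¹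
lemma Lh_LL (hh : ∀ j ∈ I, 0 < h j) : Lh I K q h = LL (Ph I K q h) := by
  ext x; unfold Lh LL Ph; simp_rw [ft_Kh hh, div_eq_mul_inv, Fintype.card_coe]
lemma kp_cont {ι : Type} [Fintype ι] (hK : IsKernel K) (h : ι → ℝ) : Continuous (kp K h) := by
  have := (Khat_smooth hK 0).continuous
  unfold kp; fun_prop
lemma ft_cont {ι : Type} [Fintype ι] {g : Fr ι} (hg : Integrable g) : Continuous (ftI g) := by
  unfold ftI
  refine continuous_of_dominated (bound := fun x ↦ ‖g x‖) (fun t ↦ ?_) (fun t ↦ aoa _ fun x ↦ ?_) hg.norm (aoa _ fun x ↦ ?_)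
  · refine AEStronglyMeasurable.mul (Continuous.aestronglyMeasurable ?_) hg.ofReal.1
    unfold dotp; fun_prop
  · rw [norm_mul, norm_exp_I, one_mul, cnr]
  · unfold dotp; fun_prop
lemma ft_norm {ι : Type} [Fintype ι] {g : Fr ι} (hg : IsDensity g) (t : ι → ℝ) : ‖ftI g t‖ ≤ 1 := by
  refine (norm_integral_le_integral_norm _).trans ?_
  simp_rw [norm_mul, norm_exp_I, one_mul, cnr, Real.norm_eq_abs, abs_of_nonneg (hg.1 _)]
  exact hg.2.le
lemma Kh_int (hK : IsKernel K) (hh : ∀ j ∈ I, 0 < h j) : Integrable (Kh I K h) ∧ ∫⁻ x, ‖Kh I K h x‖ₑ = oR (∫ z, |K z|) ^ I.card := by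
  obtain ⟨-, -, hKi, -⟩ := Khat_sch hK
  have e : Kh I K h = fun x ↦ ∏ j : I, ((h j)⁻¹ * K (x j / h j)) := funext fun x ↦ Kh_prod I K h x
  have h1 : ∀ j : I, Integrable fun v : ℝ ↦ (h j)⁻¹ * K (v / h j) := fun j ↦ (hKi.comp_div (hh j j.2).ne').const_mul _
  have hi : Integrable (Kh I K h) := by
    rw [e]; exact Integrable.fintype_prod (f := fun (j : I) (v : ℝ) ↦ (h j)⁻¹ * K (v / h j)) h1
  refine ⟨hi, ?_⟩
  have h2 : ∫⁻ x, ‖Kh I K h x‖ₑ = oR (∫ x, ‖Kh I K h x‖) := by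
    rw [oie hi.norm (aoa _ fun _ ↦ nnn _)]
    simp_rw [ofReal_norm_eq_enorm]
  rw [h2, e]
  simp_rw [norm_prod]
  rw [ifp (fun (j : I) (v : ℝ) ↦ ‖(h j)⁻¹ * K (v / h j)‖), ← oRp pv]
  congr 1
  rw [← Fintype.card_coe, ← card_univ, ← prod_const]
  refine pco rfl fun j _ ↦ ?_
  have hj := hh j j.2
  simp_rw [norm_mul, norm_inv, Real.norm_eq_abs, abs_of_pos hj]
  rw [icm, Measure.integral_comp_div (fun v ↦ |K v|), abs_of_pos hj, smul_eq_mul, ← mul_assoc, inv_mul_cancel₀ hj.ne', one_mul]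
end c20
section c21
variable {d : ℕ}
lemma lint_pi_fin {n : ℕ} {E : Fin n → Type*} {mE : ∀ i, MeasurableSpace (E i)} {μ : (i : Fin n) → Measure (E i)} [∀ i, SigmaFinite (μ i)]
    (f : (i : Fin n) → E i → Eo) (hf : ∀ i, Measurable (f i)) :
    ∫⁻ x : (i : Fin n) → E i, ∏ i, f i (x i) ∂(Measure.pi μ) = ∏ i, ∫⁻ x, f i x ∂(μ i) := by
  induction n with
  | zero => simp
  | succ n n_ih =>
      calc
        _ = ∫⁻ x : E 0 × ((i : Fin n) → E (Fin.succ i)),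
            f 0 x.1 * ∏ i : Fin n, f (Fin.succ i) (x.2 i)
            ∂((μ 0).prod (Measure.pi (fun i ↦ μ i.succ))) := by
          have hm : Measurable fun x : (i : Fin (n + 1)) → E i ↦ ∏ i, f i (x i) := measurable_prod _ fun i _ ↦ (hf i).comp (measurable_pi_apply i)
          have h := ((measurePreserving_piFinSuccAbove μ 0).symm).lintegral_comp hm
          refine h.symm.trans (lco fun x ↦ ?_)
          rw [Fin.prod_univ_succ]; rfl
        _ = (∫⁻ x, f 0 x ∂μ 0)
            * ∏ i : Fin n, ∫⁻ (x : E (Fin.succ i)), f (Fin.succ i) x ∂(μ i.succ) := by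
          have hm : Measurable fun x : (i : Fin n) → E i.succ ↦ ∏ i, f i.succ (x i) := measurable_prod _ fun i _ ↦ (hf _).comp (measurable_pi_apply i)
          rw [← n_ih _ fun i ↦ hf i.succ, ← lintegral_prod_mul (hf 0).aemeasurable hm.aemeasurable]
        _ = ∏ i, ∫⁻ x, f i x ∂(μ i) := by rw [Fin.prod_univ_succ]
lemma lint_pi {ι : Type*} [Fintype ι] {E : ι → Type*} (f : (i : ι) → E i → Eo)
    {mE : ∀ i, MeasurableSpace (E i)} {μ : (i : ι) → Measure (E i)} [∀ i, SigmaFinite (μ i)] (hf : ∀ i, Measurable (f i)) :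
    ∫⁻ x : (i : ι) → E i, ∏ i, f i (x i) ∂(Measure.pi μ) = ∏ i, ∫⁻ x, f i x ∂(μ i) := by
  let e := (Fintype.equivFin ι).symm
  have hm : Measurable fun x : (i : ι) → E i ↦ ∏ i, f i (x i) := measurable_prod _ fun i _ ↦ (hf i).comp (measurable_pi_apply i)
  rw [← (measurePreserving_piCongrLeft _ e).lintegral_comp hm]
  simp_rw [← e.prod_comp, MeasurableEquiv.coe_piCongrLeft, Equiv.piCongrLeft_apply_apply]
  exact lint_pi_fin (fun i ↦ f (e i)) fun i ↦ hf _
def glueP (P : Part d) (z : (I : P.parts) → ↥I.1 → ℝ) (i : Fin d) : ℝ :=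
  z ⟨P.part i, P.part_mem.2 (mem_univ i)⟩ ⟨i, P.mem_part (mem_univ i)⟩
lemma glueP_meas (P : Part d) : Measurable (glueP P) := by
  unfold glueP; fun_prop
lemma glueP_eq (P : Part d) (z) (I : P.parts) (i : (I : Sd d)) : glueP P z i = z I i := by
  obtain ⟨I, hI⟩ := I; obtain ⟨i, hi⟩ := i
  have : P.part i = I := P.part_eq_of_mem hI hi
  subst this; rfl
lemma pj_glueP (P : Part d) (z) (I : P.parts) : pj (I : Sd d) (glueP P z) = z I := funext fun i ↦ glueP_eq P z I i
lemma glueP_mp (P : Part d) : MeasurePreserving (glueP P) (Measure.pi fun I : P.parts ↦ (volume : Measure (↥I.1 → ℝ))) volume := by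
  refine ⟨glueP_meas P, ?_⟩
  symm
  rw [volume_pi]
  refine Measure.pi_eq fun s hs ↦ ?_
  rw [Measure.map_apply (glueP_meas P) (MeasurableSet.univ_pi hs)]
  have : glueP P ⁻¹' (Set.univ.pi s) = Set.univ.pi fun I : P.parts ↦ Set.univ.pi fun j : (I : Sd d) ↦ s j := by
    ext z
    simp only [Set.mem_preimage, Set.mem_pi, Set.mem_univ, true_implies]
    constructor
    · intro h I j; rw [← glueP_eq P z I j]; exact h _
    · intro h i; exact h ⟨P.part i, P.part_mem.2 (mem_univ i)⟩ ⟨i, P.mem_part (mem_univ i)⟩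
  rw [this, Measure.pi_pi]
  simp_rw [volume_pi_pi]
  have h1 : ∀ I : P.parts, ∏ j : (I : Sd d), volume (s j) = ∏ j ∈ (I : Sd d), volume (s j) := fun I ↦ pcs _ (fun j ↦ volume (s j))
  simp_rw [h1]
  rw [pcs P.parts (fun I ↦ ∏ j ∈ I, volume (s j))]
  have h2 := prod_biUnion (f := fun j ↦ volume (s j)) (s := P.parts) (t := id) P.supIndep.pairwiseDisjoint
  rw [P.biUnion_parts] at h2
  exact h2.symm
lemma pj_qmp (I : Sd d) : Measure.QuasiMeasurePreserving (pj I) volume volume := by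
  refine ⟨pj_meas I, Measure.AbsolutelyContinuous.mk fun s hs h0 ↦ ?_⟩
  rw [Measure.map_apply (pj_meas I) hs, ← (glue_mp I).measure_preimage (pj_meas I hs).nullMeasurableSet]
  have : (fun z : (I → ℝ) × (↥(Iᶜ) → ℝ) ↦ glue I z.1 z.2) ⁻¹' (pj I ⁻¹' s) = s ×ˢ Set.univ := by
    ext z; simp [pj_glue]
  rw [this, Measure.prod_prod, h0, zero_mul]
lemma part_lint (P : Part d) {G : ∀ I : Sd d, (I → ℝ) → Eo} (hG : ∀ I ∈ P.parts, AEMeasurable (G I)) :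
    ∫⁻ x, ∏ I ∈ P.parts, G I (pj I x) = ∏ I ∈ P.parts, ∫⁻ z, G I z := by
  have key : ∀ G' : (∀ I : P.parts, (↥I.1 → ℝ) → Eo), (∀ I, Measurable (G' I)) →
      ∫⁻ x, ∏ I : P.parts, G' I (pj I.1 x) = ∏ I : P.parts, ∫⁻ z, G' I z := by
    intro G' h
    have hm : Measurable fun x : Fin d → ℝ ↦ ∏ I : P.parts, G' I (pj I.1 x) := measurable_prod _ fun I _ ↦ (h I).comp (pj_meas _)
    rw [← (glueP_mp P).lintegral_comp hm]
    simp_rw [pj_glueP]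
    exact lint_pi G' h
  rw [← pcs P.parts (fun I ↦ ∫⁻ z, G I z)]
  have h1 : ∀ I : P.parts, ∫⁻ z, G I z = ∫⁻ z, (hG I I.2).mk (G I) z := fun I ↦ lintegral_congr_ae (hG I I.2).ae_eq_mk
  simp_rw [h1]
  rw [← key _ fun I ↦ (hG I I.2).measurable_mk]
  refine lintegral_congr_ae ?_
  have h2 : ∀ᵐ x, ∀ I : P.parts, G I (pj I.1 x) = (hG I I.2).mk (G I) (pj I.1 x) := by
    rw [ae_all_iff]; intro I
    exact (pj_qmp _).ae (hG I I.2).ae_eq_mk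
  filter_upwards [h2] with x hx
  rw [← pcs P.parts (fun I ↦ G I (pj I x))]
  exact pco rfl fun I _ ↦ hx I
lemma part_int (P : Part d) {G : ∀ I : Sd d, (I → ℝ) → ℂ} (hG : ∀ I ∈ P.parts, ASM (G I)) :
    ∫ x, ∏ I ∈ P.parts, G I (pj I x) = ∏ I ∈ P.parts, ∫ z, G I z := by
  have hm : AEStronglyMeasurable (fun x ↦ ∏ I ∈ P.parts, G I (pj I x)) volume := 
    aestronglyMeasurable_fun_prod _ fun I hI ↦ (hG I hI).comp_quasiMeasurePreserving (pj_qmp I)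
  have h1 := integral_map (μ := (Measure.pi fun I : P.parts ↦ (volume : Measure (↥I.1 → ℝ)))) (glueP_meas P).aemeasurable (f := fun x ↦ ∏ I ∈ P.parts, G I (pj I x)) (by rw [(glueP_mp P).map_eq]; exact hm)
  rw [(glueP_mp P).map_eq] at h1
  rw [h1, ← pcs P.parts (fun I ↦ ∫ z, G I z), ← integral_fintype_prod_eq_prod (fun (I : P.parts) ↦ G I)]
  congr 1; ext z
  rw [← pcs P.parts (fun I ↦ G I (pj I (glueP P z)))]
  simp_rw [pj_glueP]
lemma eLp_prod (P : Part d) {p : Eo} (hp : p ≠ 0) {g : ∀ I : Sd d, (I → ℝ) → ℝ} (hg : ∀ I ∈ P.parts, ASM (g I)) :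
    eLpNorm (fun x ↦ ∏ I ∈ P.parts, g I (pj I x)) p volume ≤ ∏ I ∈ P.parts, eLpNorm (g I) p volume := by
  by_cases ht : p = ⊤
  · subst ht
    simp_rw [eLpNorm_exponent_top]
    refine essSup_le_of_ae_le _ ?_
    have h2 : ∀ᵐ x, ∀ I : Sd d, ‖g I (pj I x)‖ₑ ≤ eLpNormEssSup (g I) volume := by
      rw [ae_all_iff]; intro I
      exact (pj_qmp I).ae (ae_le_eLpNormEssSup (f := g I))
    filter_upwards [h2] with x hx
    rw [← ofReal_norm, norm_prod, ofReal_prod_of_nonneg fun _ _ ↦ nnn _]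
    refine prod_le_prod' fun I _ ↦ ?_
    rw [ofReal_norm]; exact hx I
  · have hr := toReal_pos hp ht
    simp_rw [enl hp ht]
    rw [prod_rpow_of_nonneg pv, ← part_lint P (G := fun I z ↦ ‖g I z‖ₑ ^ p.toReal) fun I hI ↦ (hg I hI).enorm.pow_const _]
    refine le_of_eq ?_
    congr 2; ext x
    rw [prod_rpow_of_nonneg hr.le]; congr 1
    rw [← ofReal_norm, norm_prod, ofReal_prod_of_nonneg fun _ _ ↦ nnn _]
    simp_rw [ofReal_norm]
lemma tele_pt {α : Type*} [DecidableEq α] (s : Finset α) (A b : α → ℂ) :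
    ‖∏ I ∈ s, A I - ∏ I ∈ s, b I‖ ≤ ∑ I ∈ s, ‖A I - b I‖ * ∏ J ∈ s.erase I, (‖A J‖ + ‖b J‖) := by
  induction s using Finset.induction_on with
  | empty => simp
  | insert a s ha ih =>
    rw [prod_insert ha, prod_insert ha, sum_insert ha, erase_insert ha]
    have h1 : A a * ∏ I ∈ s, A I - b a * ∏ I ∈ s, b I = (A a - b a) * ∏ I ∈ s, A I + b a * (∏ I ∈ s, A I - ∏ I ∈ s, b I) := by ring
    rw [h1]
    refine (norm_add_le _ _).trans ?_
    rw [norm_mul, norm_mul, norm_prod]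
    refine add_le_add (mNL (fpl (fun _ _ ↦ nnn _) fun _ _ ↦ by linarith [nnn (b ‹_›)]) (nnn _)) ?_
    refine (mNL ih (nnn _)).trans ?_
    rw [mul_sum]
    refine sum_le_sum fun I hI ↦ ?_
    have hIa : a ≠ I := fun h ↦ ha (h ▸ hI)
    rw [erase_insert_of_ne hIa, prod_insert (by simp [ha])]
    have h2 : 0 ≤ ∏ J ∈ s.erase I, (‖A J‖ + ‖b J‖) := pnn fun _ _ ↦ by positivity
    nlinarith [mul_nonneg (mul_nonneg (nnn (A I - b I)) h2) (nnn (A a))]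
lemma eLp_tele (P : Part d) {p : Eo} (hp : 1 ≤ p) {A b : ∀ I : Sd d, (I → ℝ) → ℂ} (hA : ∀ I ∈ P.parts, ASM (A I)) (hb : ∀ I ∈ P.parts, ASM (b I)) :
    eLpNorm (fun x ↦ ∏ I ∈ P.parts, A I (pj I x) - ∏ I ∈ P.parts, b I (pj I x)) p volume ≤
      ∑ I ∈ P.parts, eLpNorm (A I - b I) p volume * ∏ J ∈ P.parts.erase I, (eLpNorm (A J) p volume + eLpNorm (b J) p volume) := by
  have hp0 : p ≠ 0 := (zero_lt_one.trans_le hp).ne'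
  set g : Sd d → ∀ J : Sd d, (J → ℝ) → ℝ := fun I J z ↦ if J = I then ‖A J z - b J z‖ else ‖A J z‖ + ‖b J z‖ with hg
  have hgm : ∀ I, ∀ J ∈ P.parts, ASM (g I J) := fun I J hJ ↦ by
    by_cases h : J = I
    · simp only [hg, h, if_true]; subst h; exact ((hA _ hJ).sub (hb _ hJ)).norm
    · simp only [hg, h, if_false]; exact (hA _ hJ).norm.add (hb _ hJ).norm
  have h1 : ∀ x, ‖∏ I ∈ P.parts, A I (pj I x) - ∏ I ∈ P.parts, b I (pj I x)‖ ≤ ∑ I ∈ P.parts, ∏ J ∈ P.parts, g I J (pj J x) := fun x ↦ by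
    refine (tele_pt P.parts (fun I ↦ A I (pj I x)) (fun I ↦ b I (pj I x))).trans (sum_le_sum fun I hI ↦ ?_)
    rw [← mul_prod_erase _ _ hI]
    simp only [hg, if_true]
    refine le_of_eq ?_
    congr 1
    exact pco rfl fun J hJ ↦ by rw [if_neg (ne_of_mem_erase hJ)]
  have h2 : eLpNorm (∑ I ∈ P.parts, fun x ↦ ∏ J ∈ P.parts, g I J (pj J x)) p volume ≤ ∑ I ∈ P.parts, eLpNorm (fun x ↦ ∏ J ∈ P.parts, g I J (pj J x)) p volume :=
    eLpNorm_sum_le (fun I _ ↦ aestronglyMeasurable_fun_prod _ fun J hJ ↦ (hgm I J hJ).comp_quasiMeasurePreserving (pj_qmp J)) hp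
  refine ((eLpNorm_mono_real (g := fun x ↦ ∑ I ∈ P.parts, ∏ J ∈ P.parts, g I J (pj J x)) h1).trans_eq ?_).trans (h2.trans (sum_le_sum fun I hI ↦ ?_))
  · congr 1; ext x; simp
  · refine (eLp_prod P hp0 (hgm I)).trans ?_
    rw [← mul_prod_erase _ _ hI]
    refine mul_le_mul' ?_ (prod_le_prod' fun J hJ ↦ ?_)
    · simp only [hg, if_true]; exact (eLpNorm_norm (A I - b I)).le
    · have hJ' := mem_of_mem_erase hJ
      simp only [hg, if_neg (ne_of_mem_erase hJ)]
      refine (eLpNorm_add_le (hA _ hJ').norm (hb _ hJ').norm hp).trans ?_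
      rw [eLpNorm_norm, eLpNorm_norm]
end c21
section c22
variable {d : ℕ} {I : Sd d} {K : ℝ → ℝ} {q f : Fd d} {h : Fin d → ℝ} {p : Eo} {A : ℝ} {lam : Fin d → ℝ}
lemma multiPD_zero {ι : Type} [Fintype ι] [DecidableEq ι] (φ : Fc ι) : multiPD 0 φ = φ := by
  unfold multiPD
  induction (univ (α := ι)).toList with
  | nil => rfl
  | cons a l ih => rw [List.foldr_cons, ih]; rfl
lemma Ng (hI : I.Nonempty) (hN : N1N2 p I q A lam) (t : I → ℝ) :
    ftI (marginal I q) t ≠ 0 ∧ ‖(ftI (marginal I q) t)⁻¹‖ ≤ A * ∏ j : I, (1 + t j ^ 2) ^ (lam j / 2) := by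
  obtain ⟨hA, hl, h2, -, hm, hi⟩ := hN
  by_cases h2' : p = 2
  · have h := (h2 h2').2 t
    have hp : 0 < A⁻¹ * ∏ j : I, (1 + t j ^ 2) ^ (-lam ↑j / 2) := by positivity
    refine ⟨norm_pos_iff.1 (hp.trans_le h), ?_⟩
    rw [norm_inv]
    refine (inv_anti₀ hp h).trans_eq ?_
    rw [mul_inv, inv_inv, ← Finset.prod_inv_distrib]
    congr 1
    refine pco rfl fun j _ ↦ ?_
    rw [neg_div, Real.rpow_neg pv, inv_inv]
  by_cases hT : p = ⊤
  · obtain ⟨h0, -, h1⟩ := hi hT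
    obtain ⟨j, hj⟩ := hI
    exact ⟨h0 t, h1 ⟨j, hj⟩ 0 bN t⟩
  · obtain ⟨h0, -, h1⟩ := hm h2' hT
    refine ⟨h0 t, ?_⟩
    have := h1 0 bS t
    rw [multiPD_zero] at this
    simpa using this
lemma Ph_cont (hK : IsKernel K) (hq : IsDensity q) (h0 : ∀ t, ftI (marginal I q) t ≠ 0) : Continuous (Ph I K q h) :=
  (kp_cont hK _).mul ((ft_cont (dm_marg I hq).1.int).inv₀ h0)
lemma Ph_bd (hK : IsKernel K) (hI : I.Nonempty) (hN : N1N2 p I q A lam) : ∃ G : ℝ, 0 < G ∧ ∀ h : Fin d → ℝ, (∀ j ∈ I, 0 < h j ∧ h j ≤ 1) →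
    ∀ t, ‖Ph I K q h t‖ ≤ (G * ∏ j ∈ I, h j ^ (-lam j)) * Qw (pj I h) t ^ 3 := by
  choose C hC hb using fun j ↦ Khat_wbd hK (hN.2.1 j).le
  refine ⟨A * ∏ j : I, C j, mul_pos hN.1 (fpp fun j _ ↦ hC j), fun h hh t ↦ ?_⟩
  have h1 := (Ng hI hN t).2
  unfold Ph kp Qw
  rw [norm_mul, norm_prod, ← pcs I (fun j ↦ h j ^ (-lam j)), ← prod_pow]
  refine (mNL h1 pv).trans ?_
  have h2 : ∏ j : I, (‖Khat K (h j * t j)‖ * (1 + t j ^ 2) ^ (lam j / 2)) ≤ ∏ j : I, (C j * h j ^ (-lam j) * ((1 + (h j * t j) ^ 2)⁻¹) ^ 3) :=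
    fpl (fun _ _ ↦ by positivity) fun j _ ↦ (hb j (h j) (hh j j.2).1 (hh j j.2).2).1 (t j)
  simp only [pmd] at h2
  have := mNL h2 hN.1.le
  unfold pj
  nlinarith [this]
lemma Ph_Q {G : ℝ} (hh : ∀ j ∈ I, 0 < h j ∧ h j ≤ 1) (hG : 0 ≤ G) {t} (hb : ‖Ph I K q h t‖ ≤ (G * ∏ j ∈ I, h j ^ (-lam j)) * Qw (pj I h) t ^ 3) :
    ‖Ph I K q h t‖ ≤ (G * ∏ j ∈ I, h j ^ (-lam j)) * Qw (pj I h) t := by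
  refine hb.trans (mNL ?_ (mul_nonneg hG (pnn fun j hj ↦ rrn (hh j hj).1.le _)))
  exact (pow_le_of_le_one (Qw_pos _ _).le (Qw_le _ _) bN)
lemma Ph_int (hK : IsKernel K) (hq : IsDensity q) (hI : I.Nonempty) (hN : N1N2 p I q A lam) (hh : ∀ j ∈ I, 0 < h j ∧ h j ≤ 1) : Integrable (Ph I K q h) := by
  obtain ⟨G, hG, hb⟩ := Ph_bd hK hI hN
  exact int_of_Q (h := pj I h) (fun j ↦ (hh j j.2).1) (Ph_cont hK hq fun t ↦ (Ng hI hN t).1).aestronglyMeasurable fun t ↦ Ph_Q hh hG.le (hb h hh t)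
lemma Lh_reg (hK : IsKernel K) (hq : IsDensity q) (hI : I.Nonempty) (hN : N1N2 p I q A lam) (hh : ∀ j ∈ I, 0 < h j ∧ h j ≤ 1) :
    Continuous (Lh I K q h) ∧ ∃ M, ∀ x, ‖Lh I K q h x‖ ≤ M := by
  rw [Lh_LL fun j hj ↦ (hh j hj).1]
  have := Ph_int hK hq hI hN hh
  exact ⟨LL_cont this, _, LL_sup⟩
lemma Dbd_top (hf : IsDensity f) (hq : IsDensity q) (hb : eLpNorm (marginal I q) ⊤ volume < ⊤) {η : I → ℝ} (hη : ∀ j, 0 < η j) (z : I → ℝ) :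
    ∫⁻ ω, ENNReal.ofReal (Bk η (z - pj I ω)) ∂(dm (conv f q)) ≤ ENNReal.ofReal (eLpNorm (marginal I q) ⊤ volume).toReal := by
  have hB : Measurable fun u ↦ oR (Bk η u) := (Bk_cont η).measurable.ennreal_ofReal
  have hm : Measurable fun ω : Fin d → ℝ ↦ oR (Bk η (z - pj I ω)) := hB.comp (measurable_const.sub (pj_meas I))
  have := hf.prob; have := hq.prob
  rw [conv_dm hf hq, Measure.lintegral_conv hm, lls (f := fun x y ↦ oR (Bk η (z - pj I (x + y)))) (hm.comp (measurable_fst.add measurable_snd)).aemeasurable, ofReal_toReal hb.ne]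
  refine (lmo fun y ↦ ?_).trans_eq (by rw [lintegral_const, measure_univ, mul_one])
  have e : ∀ x, pj I (x + y) = pj I x + pj I y := fun x ↦ rfl
  have hB2 : Measurable fun w ↦ oR (Bk η ((z - pj I y) - w)) := hB.comp (measurable_const.sub measurable_id)
  have e2 : ∫⁻ x, oR (Bk η (z - pj I (x + y))) ∂dm q = ∫⁻ w, oR (Bk η ((z - pj I y) - w)) ∂dm (marginal I q) := by
    rw [← (dm_marg I hq).2, lintegral_map hB2 (pj_meas I)]
    refine lco fun x ↦ ?_
    rw [e, sub_sub, add_comm (pj I x)]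
  rw [e2, dm_lint (dm_marg I hq).1 hB2]
  calc _ ≤ ∫⁻ x, eLpNorm (marginal I q) ⊤ volume * oR (Bk η ((z - pj I y) - x)) := by
        refine lintegral_mono_ae ?_
        filter_upwards [ae_le_eLpNormEssSup (f := marginal I q) (μ := volume)] with x hx
        rw [eLpNorm_exponent_top]
        refine mL (le_trans ?_ hx) _
        rw [← ofReal_norm]; exact oRl (Real.le_norm_self _)
    _ = _ := by
        rw [lcm2 _ _ hb.ne, lintegral_sub_left_eq_self (fun x ↦ oR (Bk η x)), Bk_lint hη, mul_one]
lemma exp_le_q (u : ℝ) : rE (-|u|) ≤ 2 * (1 + u ^ 2)⁻¹ := by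
  rw [Real.exp_neg, ← div_eq_mul_inv, inv_eq_one_div, div_le_div_iff₀ (Real.exp_pos _) pv]
  have := Real.quadratic_le_exp_of_nonneg (abs_nonneg u)
  have := abs_nonneg u
  nlinarith [sq_abs u]
lemma Dbd_two (hf : IsDensity f) (hq : IsDensity q) (hi : Integrable (ftI (marginal I q))) {η : I → ℝ} (hη : ∀ j, 0 < η j) (z : I → ℝ) :
    ∫⁻ ω, oR (Bk η (z - pj I ω)) ∂(dm (conv f q)) ≤ oR (∫ t, ‖ftI (marginal I q) t‖) := by
  have := conv_prob hf hq
  have hi' : ∀ j, 0 < (η j)⁻¹ := fun j ↦ inv_pos.2 (hη j)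
  have h1 : ∀ u, Bk η u ≤ (∏ j, (η j)⁻¹) * Qw (fun j ↦ (η j)⁻¹) u := by
    intro u; unfold Bk Qw
    rw [← pmd]
    refine fpl (fun j _ ↦ by have := hη j; positivity) fun j _ ↦ ?_
    have := exp_le_q (u j / η j)
    rw [abs_div, abs_of_pos (hη j)] at this
    have h0 := hη j
    calc _ ≤ (2 * η j)⁻¹ * (2 * (1 + (u j / η j) ^ 2)⁻¹) := by gcongr
      _ = _ := by rw [mul_inv]; field_simp
  set c : ℝ := (2 * rP) ^ (fC I : ℝ) with hc
  have hc0 : 0 < c := by positivity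
  have h2 : ∀ u, ((Qw (fun j ↦ (η j)⁻¹) u : ℝ) : ℂ) = c * LL (fun t ↦ ((Bk (fun j ↦ (η j)⁻¹) t : ℝ) : ℂ)) u := by
    intro u
    rw [← Bk_ft hi' u]; unfold LL
    rw [← mul_assoc, ← Complex.ofReal_mul, hc, Real.rpow_neg pv, mul_inv_cancel₀ hc0.ne', Complex.ofReal_one, one_mul]
    rw [← integral_neg_eq_self]
    congr 1; ext t
    rw [Bk_neg]; congr 2; 
    unfold dotp; simp only [Pi.neg_apply]; push_cast; rw [← mul_neg, ← sum_neg_distrib]; congr 1; refine sum_congr rfl fun _ _ ↦ by ring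
  have h3 : ∀ u, (Qw (fun j ↦ (η j)⁻¹) u) ≤ 1 := Qw_le _
  have hQm : Measurable fun ω ↦ Qw (fun j ↦ (η j)⁻¹) (z - pj I ω) := (Qw_cont _).measurable.comp (measurable_const.sub (pj_meas I))
  have hQi : Integrable (fun ω ↦ Qw (fun j ↦ (η j)⁻¹) (z - pj I ω)) (dm (conv f q)) := 
    Integrable.of_bound hQm.aestronglyMeasurable 1 (aoa _ fun ω ↦ by rw [Real.norm_eq_abs, abs_of_pos (Qw_pos _ _)]; exact h3 _)
  have hP : 0 ≤ ∏ j, (η j)⁻¹ := pnn fun j _ ↦ (hi' j).le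
  calc _ ≤ ∫⁻ ω, oR ((∏ j, (η j)⁻¹) * Qw (fun j ↦ (η j)⁻¹) (z - pj I ω)) ∂(dm (conv f q)) := lmo fun ω ↦ oRl (h1 _)
    _ = oR (∫ ω, (∏ j, (η j)⁻¹) * Qw (fun j ↦ (η j)⁻¹) (z - pj I ω) ∂(dm (conv f q))) := 
      (oie (hQi.const_mul _) (aoa _ fun ω ↦ mul_nonneg hP (Qw_pos _ _).le)).symm
    _ ≤ _ := by
      refine oRl ?_
      rw [icm]
      have h4 : ((∫ ω, Qw (fun j ↦ (η j)⁻¹) (z - pj I ω) ∂(dm (conv f q)) : ℝ) : ℂ) = c * LL (fun t ↦ (ftI (marginal I q) t * ftI (marginal I f) t) * ((Bk (fun j ↦ (η j)⁻¹) t : ℝ) : ℂ)) z := by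
        rw [← integral_complex_ofReal]
        simp_rw [h2]
        rw [icm]
        congr 1
        have := LL_conv (μ := dm (conv f q)) (pj_meas I) (g := fun _ ↦ 1) (ico _) (Φ := fun t ↦ ((Bk (fun j ↦ (η j)⁻¹) t : ℝ) : ℂ)) (Bk_int hi').ofReal z
        simp only [one_mul, mul_one] at this
        rw [this]; simp_rw [conv_char I hf hq]
      have h5 : ∫ ω, Qw (fun j ↦ (η j)⁻¹) (z - pj I ω) ∂(dm (conv f q)) ≤ ∫ t, ‖(ftI (marginal I q) t * ftI (marginal I f) t) * ((Bk (fun j ↦ (η j)⁻¹) t : ℝ) : ℂ)‖ := by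
        refine (Real.le_norm_self _).trans ?_
        rw [← cnr, h4, norm_mul, cnr, rno hc0.le]
        refine (mNL (LL_sup z) hc0.le).trans_eq ?_
        rw [← mul_assoc, hc, Real.rpow_neg pv, mul_inv_cancel₀ hc0.ne', one_mul]
      have h6 : ∀ t, ‖(ftI (marginal I q) t * ftI (marginal I f) t) * ((Bk (fun j ↦ (η j)⁻¹) t : ℝ) : ℂ)‖ ≤ (∏ j, η j) * ‖ftI (marginal I q) t‖ := by
        intro t
        rw [norm_mul, norm_mul, cnr, rno (Bk_nonneg hi' t)]
        have hb : Bk (fun j ↦ (η j)⁻¹) t ≤ ∏ j, η j := (Bk_le hi' t).trans (fpl (fun j _ ↦ by have := hη j; positivity) fun j _ ↦ by 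
          rw [mul_inv, inv_inv]; have := hη j; linarith)
        have hfn := ft_norm (dm_marg I hf).1 t
        have := nnn (ftI (marginal I q) t)
        calc _ ≤ ‖ftI (marginal I q) t‖ * 1 * ∏ j, η j := mul_le_mul (mNL hfn this) hb (Bk_nonneg hi' t) pv
          _ = _ := by ring
      have h7 := integral_mono_of_nonneg (aoa _ fun t ↦ nnn ((ftI (marginal I q) t * ftI (marginal I f) t) * ((Bk (fun j ↦ (η j)⁻¹) t : ℝ) : ℂ))) (hi.norm.const_mul (∏ j, η j)) (aoa _ h6)
      rw [icm] at h7
      calc _ ≤ (∏ j, (η j)⁻¹) * ((∏ j, η j) * ∫ t, ‖ftI (marginal I q) t‖) := mNL (h5.trans h7) hP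
        _ = _ := by rw [← mul_assoc, ← pmd, prod_eq_one (fun j _ ↦ inv_mul_cancel₀ (hη j).ne'), one_mul]
end c22
section c23
variable {d : ℕ} {I J : Sd d} {K : ℝ → ℝ} {q f : Fd d} {h : Fin d → ℝ} {p : Eo} {A : ℝ} {lam : Fin d → ℝ} {n : ℕ}
def wg (lam : Fin d → ℝ) (p : Eo) (n : ℕ) (I : Sd d) (h : Fin d → ℝ) : Prop :=
  (∀ j ∈ I, ∃ k : ℕ, 1 ≤ k ∧ h j = 2 ^ (-(k : ℝ))) ∧
  ((if p = ⊤ then Real.sqrt (rL n) else cpGrid lam p) ≤ (rn n * ∏ j ∈ I, h j) ^ bp p * ∏ j ∈ I, h j ^ lam j)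
lemma wg_pos (hw : wg lam p n I h) : ∀ j ∈ I, 0 < h j ∧ h j ≤ 1 := by
  intro j hj
  obtain ⟨k, -, hk⟩ := hw.1 j hj
  rw [hk]
  exact ⟨by positivity, Real.rpow_le_one_of_one_le_of_nonpos bN bS⟩
lemma bp_pos (hp : 1 < p) : 0 < bp p := by
  unfold bp
  refine lt_min bN ?_
  by_cases hT : p = ⊤
  · subst hT; simp
  have : 1 < p.toReal := by rw [← toReal_one]; exact (toReal_lt_toReal bS hT).2 hp
  rw [sub_pos, div_lt_one bL]; exact this
lemma bp_half (hp : 2 ≤ p) : bp p = 1 / 2 := by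
  unfold bp
  refine min_eq_left ?_
  by_cases hT : p = ⊤
  · subst hT; norm_num
  have : 2 ≤ p.toReal := by rw [← toReal_ofNat]; exact (toReal_le_toReal bS hT).2 hp
  have : 1 / p.toReal ≤ 1 / 2 := one_div_le_one_div_of_le bN this
  linarith
lemma cp_pos (hp : 1 < p) (hT : p ≠ ⊤) (hl : ∀ j, 0 < lam j) : 0 < cpGrid lam p := by
  have : 1 < p.toReal := by rw [← toReal_one]; exact (toReal_lt_toReal bS hT).2 hp
  unfold cpGrid
  refine lt_min one_pos (Real.rpow_pos_of_pos ?_ _)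
  have hm : 0 ≤ lamMax lam := Real.sSup_nonneg (by rintro _ ⟨j, rfl⟩; exact (hl j).le)
  positivity
lemma wg_sub (hl : ∀ j, 0 < lam j) (hp : 1 < p) (hJ : J ⊆ I) (hw : wg lam p n I h) : wg lam p n J h := by
  refine ⟨fun j hj ↦ hw.1 j (hJ hj), hw.2.trans ?_⟩
  have h0 := wg_pos hw
  have hpos : ∀ S ⊆ I, 0 ≤ ∏ j ∈ S, h j := fun S hS ↦ pnn fun j hj ↦ (h0 j (hS hj)).1.le
  have h1 : ∏ j ∈ I, h j ≤ ∏ j ∈ J, h j := by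
    rw [← prod_sdiff hJ]
    exact mul_le_of_le_one_left (hpos _ hJ) (prod_le_one (fun j hj ↦ (h0 j (sdiff_subset hj)).1.le) fun j hj ↦ (h0 j (sdiff_subset hj)).2)
  have h2 : ∏ j ∈ I, h j ^ lam j ≤ ∏ j ∈ J, h j ^ lam j := by
    rw [← prod_sdiff hJ]
    refine mul_le_of_le_one_left (pnn fun j hj ↦ rrn (h0 j (hJ hj)).1.le _) (prod_le_one (fun j hj ↦ rrn (h0 j (sdiff_subset hj)).1.le _) fun j hj ↦ Real.rpow_le_one (h0 j (sdiff_subset hj)).1.le (h0 j (sdiff_subset hj)).2 (hl j).le)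
  have h3 := hpos I subset_rfl
  refine mul_le_mul (Real.rpow_le_rpow pv (mNL h1 pv) (bp_pos hp).le) h2 (pnn fun j hj ↦ rrn (h0 j hj).1.le _) (rrn (mul_nonneg pv (hpos J hJ)) _)
lemma memGrid.wg (hm : memGrid lam p n I h) : wg lam p n I h := ⟨hm.1, hm.2.2⟩
lemma wg_facts (hl : ∀ j, 0 < lam j) (hp : 1 < p) (hw : wg lam p n I h) {c : ℝ} (hc : 0 < c)
    (hcc : c ≤ if p = ⊤ then Real.sqrt (rL n) else cpGrid lam p) : 
    c ^ (bp p)⁻¹ ≤ n * ∏ j ∈ I, h j ∧ (n * ∏ j ∈ I, h j) ^ (-bp p) * ∏ j ∈ I, h j ^ (-lam j) ≤ c⁻¹ := by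
  have h0 := wg_pos hw
  have hT := hcc.trans hw.2
  have hH : 0 ≤ ∏ j ∈ I, h j := pnn fun j hj ↦ (h0 j hj).1.le
  have hb := bp_pos hp
  have h2 : ∏ j ∈ I, h j ^ lam j ≤ 1 := prod_le_one (fun j hj ↦ rrn (h0 j hj).1.le _) fun j hj ↦ Real.rpow_le_one (h0 j hj).1.le (h0 j hj).2 (hl j).le
  have hN : 0 ≤ n * ∏ j ∈ I, h j := by positivity
  constructor
  · have h3 : c ≤ (n * ∏ j ∈ I, h j) ^ bp p := hT.trans (mul_le_of_le_one_right (rrn hN _) h2)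
    calc _ ≤ ((n * ∏ j ∈ I, h j) ^ bp p) ^ (bp p)⁻¹ := Real.rpow_le_rpow hc.le h3 pv
      _ = _ := Real.rpow_rpow_inv hN hb.ne'
  · have := inv_anti₀ hc hT
    rw [mul_inv, ← Finset.prod_inv_distrib, ← Real.rpow_neg hN] at this
    refine le_trans (le_of_eq ?_) this
    congr 1
    exact pco rfl fun j hj ↦ Real.rpow_neg (h0 j hj).1.le _
lemma Gam_le {G : ℝ} (hG : 0 < G) (hl : ∀ j, 0 < lam j) (h0 : ∀ j ∈ I, 0 < h j ∧ h j ≤ 1) :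
    G * ∏ j ∈ I, h j ^ (-lam j) ≤ G * (∏ j : I, pj I h j) ^ (-∑ j ∈ I, lam j) := by
  have e : ∏ j : I, pj I h j = ∏ j ∈ I, h j := pcs I h
  rw [e]
  have hH : 0 < ∏ j ∈ I, h j := fpp fun j hj ↦ (h0 j hj).1
  rw [← sum_neg_distrib, Real.rpow_sum_of_pos hH]
  refine mNL (fpl (fun j hj ↦ rrn (h0 j hj).1.le _) fun j hj ↦ ?_) hG.le
  refine Real.rpow_le_rpow_of_nonpos hH ?_ (by linarith [hl j])
  rw [← mul_prod_erase I h hj]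
  exact mul_le_of_le_one_right (h0 j hj).1.le (prod_le_one (fun i hi ↦ (h0 i (mem_of_mem_erase hi)).1.le) fun i hi ↦ (h0 i (mem_of_mem_erase hi)).2)
lemma U0_eq {G : ℝ} (h0 : ∀ j ∈ I, 0 < h j ∧ h j ≤ 1) (hn : n ≠ 0) :
    U0 (pj I h) n (G * ∏ j ∈ I, h j ^ (-lam j)) = G * ((n * ∏ j ∈ I, h j) ^ (-(1 / 2) : ℝ) * ∏ j ∈ I, h j ^ (-lam j)) ∧
    U0 (pj I h) n (G * ∏ j ∈ I, h j ^ (-lam j)) = G * (rn n ^ (-(1 : ℝ) / 2) * ∏ j ∈ I, h j ^ (-lam j - 1 / 2)) := by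
  have e : ∏ j : I, pj I h j = ∏ j ∈ I, h j := pcs I h
  have hH : 0 < ∏ j ∈ I, h j := fpp fun j hj ↦ (h0 j hj).1
  have hN : (0:ℝ) ≤ n * ∏ j ∈ I, h j := by positivity
  have e1 : U0 (pj I h) n (G * ∏ j ∈ I, h j ^ (-lam j)) = G * ((n * ∏ j ∈ I, h j) ^ (-(1 / 2) : ℝ) * ∏ j ∈ I, h j ^ (-lam j)) := by
    unfold U0; rw [e, Real.sqrt_eq_rpow, Real.rpow_neg hN, div_eq_mul_inv]; ring
  refine ⟨e1, e1.trans ?_⟩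
  rw [rmr pv hH.le, neg_div, mul_assoc, ← Real.finsetProd_rpow _ _ (fun j hj ↦ (h0 j hj).1.le), ← pmd]
  congr 2
  exact pco rfl fun j hj ↦ by rw [← rra (h0 j hj).1]; ring_nf
lemma tsub_pow_anti {a b c : Eo} (hab : a ≤ b) (m : ℕ) : (c - b) ^ m ≤ (c - a) ^ m := ppl (tsub_le_tsub_left hab _) _
def CoreP (I : Sd d) (K : ℝ → ℝ) (q : Fd d) (lam : Fin d → ℝ) (p : Eo) (m : ℕ) (γ C0 C : Eo) : Prop :=
  ∀ n : ℕ, 3 ≤ n → ∀ f : Fd d, IsDensity f → ∀ h, wg lam p n I h →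
    ∫⁻ y, (eLpNorm (xiProc I K f q h y) p volume - min (γ * Up K q lam p n I h) C0) ^ m ∂obsMeasure d n f q ≤
      C * oR (rn n ^ (-rn m / 2)) * oR (∏ j ∈ I, h j)
lemma dens_bd (hp : 2 ≤ p) (hq : IsDensity q) (hN : N1N2 p I q A lam) : ∃ D : ℝ, ∀ f : Fd d, IsDensity f → ∀ {η : I → ℝ} (_ : ∀ j, 0 < η j) (z : I → ℝ),
    ∫⁻ ω, oR (Bk η (z - pj I ω)) ∂(dm (conv f q)) ≤ oR D := by
  rcases hp.eq_or_lt with h2 | h2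
  · exact ⟨_, fun f hf _ hη z ↦ Dbd_two hf hq (hN.2.2.1 h2.symm).1 hη z⟩
  · exact ⟨_, fun f hf _ hη z ↦ Dbd_top hf hq (hN.2.2.2.1 h2) hη z⟩
lemma core_top (hK : IsKernel K) (hq : IsDensity q) (hI : I.Nonempty) (hN : N1N2 ⊤ I q A lam) {m : ℕ} (hm : m ≠ 0) :
    ∃ γ C0 C : Eo, γ ≠ ⊤ ∧ C0 ≠ ⊤ ∧ C ≠ ⊤ ∧ CoreP I K q lam ⊤ m γ C0 C := by
  obtain ⟨D, hD⟩ := dens_bd le_top hq hN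
  obtain ⟨G, hG, hb⟩ := Ph_bd hK hI hN
  obtain ⟨γ, C, hγ, hC, H⟩ := dev_top (ι := I) (le_max_right D 0) hG (sum_nonneg fun j (_ : j ∈ I) ↦ (hN.2.1 j).le) hm
  refine ⟨oR (γ * G), oR (γ * G), oR C, by simp, by simp, by simp, fun n hn f hf h hw ↦ ?_⟩
  have h0 := wg_pos hw
  have hn' : n ≠ 0 := by omega
  have hlog : 0 < rL n := Real.log_pos (by exact_mod_cast (by omega : 1 < n))
  have := conv_prob hf hq
  have hbp := bp_half (p := ⊤) le_top
  obtain ⟨w1, w2⟩ := wg_facts hN.2.1 bS hw (c := Real.sqrt (rL n)) pv bS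
  rw [hbp] at w1 w2
  have e : ∏ j : I, pj I h j = ∏ j ∈ I, h j := pcs I h
  have hk := H (dm (conv f q)) (pj_meas I) (h := pj I h) (fun j ↦ (h0 j j.2).1) (fun j ↦ (h0 j j.2).2) (mul_pos hG (fpp fun j hj ↦ Real.rpow_pos_of_pos (h0 j hj).1 _)) (Gam_le hG hN.2.1 h0)
    (Ph_cont hK hq fun t ↦ (Ng hI hN t).1).aestronglyMeasurable (hb h h0) hn (by rw [e]; refine le_trans (le_of_eq ?_) w1; norm_num [Real.sq_sqrt hlog.le]) 
    (fun z ↦ (hD f hf (fun j ↦ (h0 j j.2).1) z).trans (oRl (le_max_left _ _)))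
  rw [← Lh_LL fun j hj ↦ (h0 j hj).1, e] at hk
  obtain ⟨u1, u2⟩ := U0_eq (G := G) (lam := lam) h0 hn'
  refine le_trans (lmo fun y ↦ tsub_pow_anti (b := min (oR (γ * G) * Up K q lam ⊤ n I h) (oR (γ * G))) ?_ m) (hk.trans_eq ?_)
  · refine le_min ?_ ?_
    · unfold Up; rw [if_pos rfl, ← oRm pv, u2]
      refine oRl (le_of_eq (by ring))
    · rw [u1]
      refine oRl ?_
      have := mNL w2 (Real.sqrt_nonneg (rL n))
      rw [mul_inv_cancel₀ pv] at this
      have := mNL this (mul_pos hγ hG).le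
      linarith
  · rw [oRm pv, oRm pv]
lemma core_ge2 (hp : 2 ≤ p) (hT : p ≠ ⊤) (hK : IsKernel K) (hq : IsDensity q) (hI : I.Nonempty) (hN : N1N2 p I q A lam) {m : ℕ} (hm : m ≠ 0) :
    ∃ γ C0 C : Eo, γ ≠ ⊤ ∧ C0 ≠ ⊤ ∧ C ≠ ⊤ ∧ CoreP I K q lam p m γ C0 C := by
  obtain ⟨D, hD⟩ := dens_bd hp hq hN
  obtain ⟨G, hG, hb⟩ := Ph_bd hK hI hN
  have hp1 : 1 < p := lt_of_lt_of_le bN hp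
  have hr : 2 ≤ p.toReal := by rw [← toReal_ofNat]; exact (toReal_le_toReal bS hT).2 hp
  have hcp := cp_pos hp1 hT hN.2.1
  have hc0 : 0 < (cpGrid lam p) ^ (bp p)⁻¹ := Real.rpow_pos_of_pos hcp _
  obtain ⟨γ, C, hγ, hC, H⟩ := dev_ge2 (ι := I) hr hc0 (le_max_right D _) hG (sum_nonneg fun j (_ : j ∈ I) ↦ (hN.2.1 j).le) hm
  refine ⟨oR (γ * G), oR (γ * G * (cpGrid lam p)⁻¹), oR C, by simp, by simp, by simp, fun n hn f hf h hw ↦ ?_⟩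
  have h0 := wg_pos hw
  have hn' : n ≠ 0 := by omega
  have := conv_prob hf hq
  obtain ⟨w1, w2⟩ := wg_facts hN.2.1 hp1 hw hcp (by simp [hT])
  have e : ∏ j : I, pj I h j = ∏ j ∈ I, h j := pcs I h
  have hk := H (dm (conv f q)) (pj_meas I) (h := pj I h) (fun j ↦ (h0 j j.2).1) (fun j ↦ (h0 j j.2).2) (mul_pos hG (fpp fun j hj ↦ Real.rpow_pos_of_pos (h0 j hj).1 _)) (Gam_le hG hN.2.1 h0)
    (Ph_cont hK hq fun t ↦ (Ng hI hN t).1).aestronglyMeasurable (hb h h0) hn' (by rw [e]; exact w1) 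
    (fun z ↦ (hD f hf (fun j ↦ (h0 j j.2).1) z).trans (oRl (le_max_left _ _)))
  rw [← Lh_LL fun j hj ↦ (h0 j hj).1, e] at hk
  simp_rw [← lpB_eq (p := p.toReal) bL, ofReal_toReal hT] at hk
  obtain ⟨u1, u2⟩ := U0_eq (G := G) (lam := lam) h0 hn'
  rw [bp_half hp] at w2
  refine le_trans (lmo fun y ↦ tsub_pow_anti (b := min (oR (γ * G) * Up K q lam p n I h) (oR (γ * G * (cpGrid lam p)⁻¹))) ?_ m) (hk.trans_eq ?_)
  · refine le_min ?_ ?_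
    · have hU : oR (rn n ^ (-(1 : ℝ) / 2) * ∏ j ∈ I, h j ^ (-lam j - 1 / 2)) ≤ Up K q lam p n I h := by
        unfold Up; rw [if_neg hT]; split_ifs with h2 h3
        · exact le_rfl
        · linarith
        · rw [oRm pv]
          exact mR lsa _
      refine le_trans ?_ (mR hU _)
      rw [← oRm pv, u2]
      refine oRl (le_of_eq (by ring))
    · rw [u1]
      refine oRl ?_
      have := mNL w2 (mul_pos hγ hG).le
      linarith
  · rw [oRm pv, oRm pv]
end c23
section c24
variable {d : ℕ} {I J : Sd d} {K : ℝ → ℝ} {q f : Fd d} {h : Fin d → ℝ} {p : Eo} {A : ℝ} {lam : Fin d → ℝ} {n : ℕ}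
lemma Lh_lt2 (hp : 1 < p) (hp2 : p < 2) (hK : IsKernel K) (hq : IsDensity q) (hI : I.Nonempty) (hN : N1N2 p I q A lam) :
    ∃ E : Eo, E ≠ ⊤ ∧ ∀ h : Fin d → ℝ, (∀ j ∈ I, 0 < h j ∧ h j ≤ 1) →
      eLpNorm (Lh I K q h) p volume ≤ E * oR (∏ j ∈ I, h j ^ (-lam j - (1 - 1 / p.toReal))) := by
  have hT : p ≠ ⊤ := ne_top_of_lt hp2
  have hr1 : 1 < p.toReal := by rw [← toReal_one]; exact (toReal_lt_toReal bS hT).2 hp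
  have hr2 : p.toReal < 2 := by rw [← toReal_ofNat]; exact (toReal_lt_toReal hT bS).2 hp2
  have hA := hN.1
  obtain ⟨n0, n1, n2⟩ := hN.2.2.2.2.1 hp2.ne hT
  choose C hC hb using fun j ↦ Khat_wbd hK (hN.2.1 j).le
  obtain ⟨r, hr⟩ : ∃ r, r = p.toReal := ⟨_, rfl⟩
  rw [← hr] at hr1 hr2 ⊢
  have hr0 : 0 < r := by linarith
  set Z : Eo := ((1 - oR ((2:ℝ) ^ (1 - r)))⁻¹) ^ fC I with hZ
  have hZt : Z ≠ ⊤ := by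
    refine pow_ne_top (inv_ne_top.2 (tsub_pos_of_lt ?_).ne')
    rw [ofReal_lt_one]
    exact Real.rpow_lt_one_of_one_lt_of_neg bN bL
  refine ⟨(oR (A ^ r * ∏ j : I, (2880 * C j ^ r)) * Z) ^ (1 / r), rnt pv (emt bS hZt), fun h hh ↦ ?_⟩
  have key := partD (ι := I) (κ := fun j s ↦ Khat K (h j * s)) (fun j m ↦ (Khat_smooth hK m).comp (contDiff_const.mul contDiff_id)) (h := pj I h) (fun j ↦ (hh j j.2).1)
    (w := fun j s ↦ (1 + s ^ 2) ^ (lam j / 2)) (fun j s ↦ by positivity) (B := fun j ↦ C j * h j ^ (-lam j)) 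
    (fun j s ↦ by
      refine ((hb j (h j) (hh j j.2).1 (hh j j.2).2).1 s).trans ?_
      have := (hh j j.2).1; have := hC j
      refine mNL ?_ pv
      have hx : (1:ℝ) ≤ 1 + (h j * s) ^ 2 := by nlinarith [sq_nonneg (h j * s)]
      show _ ≤ (√(1 + (h j * s) ^ 2))⁻¹
      rw [inv_pow]
      refine inv_anti₀ (Real.sqrt_pos.2 bL) ?_
      refine (Real.sqrt_le_sqrt (le_self_pow₀ hx (by norm_num : 2 ≠ 0))).trans ?_
      rw [Real.sqrt_sq bL]
      exact le_self_pow₀ hx bN)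
    (fun j s ↦ (hb j (h j) (hh j j.2).1 (hh j j.2).2).2 s)
    (ψ := fun t ↦ (ftI (marginal I q) t)⁻¹) (by rw [Fintype.card_coe]; exact n1) hA.le
    (fun S t ↦ by
      have := n2 (fun j ↦ if j ∈ S then 1 else 0) (by rw [sum_ite_mem, univ_inter]; simpa using (card_le_univ S)) t
      rw [norm_mul, norm_prod] at this
      refine le_trans (le_of_eq ?_) this
      congr 1
      refine pco rfl fun j _ ↦ ?_
      split_ifs <;> simp)
    (Ph_int hK hq hI hN hh) hr1 hr2
  have hL : Lh I K q h = LL (fun t : I → ℝ ↦ (∏ j : I, Khat K (h j * t j)) * (ftI (marginal I q) t)⁻¹) := Lh_LL fun j hj ↦ (hh j hj).1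
  rw [enl pv hT, ← hr, hL]
  refine (err key pv).trans_eq ?_
  rw [← hZ]
  have e1 : A ^ r * ∏ j : I, (2880 * (C j * h j ^ (-lam j)) ^ r * pj I h j ^ (1 - r)) = (A ^ r * ∏ j : I, (2880 * C j ^ r)) * (∏ j ∈ I, h j ^ (-lam j - (1 - 1 / r))) ^ r := by
    rw [← pcs I (fun j ↦ h j ^ (-lam j - (1 - 1 / r))), ← Real.finsetProd_rpow _ _ (fun (j : I) _ ↦ rrn (hh j j.2).1.le _), mul_assoc, ← pmd]
    congr 1
    refine pco rfl fun j _ ↦ ?_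
    have h0 := (hh j j.2).1
    rw [rmr (hC j).le (rrn h0.le _), ← rrm h0.le, ← rrm h0.le, mul_assoc, mul_assoc, mul_assoc]
    congr 2
    show _ * (h j) ^ (1 - r) = _
    rw [← rra h0]; congr 1; field_simp; ring
  rw [e1, oRm (mul_nonneg pv (pnn fun j _ ↦ by have := hC j; positivity)), mul_right_comm, mrn _ _ pv]
  congr 1
  have : 0 ≤ ∏ j ∈ I, h j ^ (-lam j - (1 - 1 / r)) := pnn fun j hj ↦ rrn (hh j hj).1.le _
  rw [orn pv pv, ← rrm this, mul_one_div_cancel hr0.ne', Real.rpow_one]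
lemma core_lt2 (hp : 1 < p) (hp2 : p < 2) (hK : IsKernel K) (hq : IsDensity q) (hI : I.Nonempty) (hN : N1N2 p I q A lam) {m : ℕ} (hm : m ≠ 0) :
    ∃ γ C0 C : Eo, γ ≠ ⊤ ∧ C0 ≠ ⊤ ∧ C ≠ ⊤ ∧ CoreP I K q lam p m γ C0 C := by
  obtain ⟨E, hE, hL⟩ := Lh_lt2 hp hp2 hK hq hI hN
  have hT : p ≠ ⊤ := ne_top_of_lt hp2
  have hr1 : 1 < p.toReal := by rw [← toReal_one]; exact (toReal_lt_toReal bS hT).2 hp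
  have hr2 : p.toReal < 2 := by rw [← toReal_ofNat]; exact (toReal_lt_toReal hT bS).2 hp2
  have hcp := cp_pos hp hT hN.2.1
  have hc0 : 0 < (cpGrid lam p) ^ (bp p)⁻¹ := Real.rpow_pos_of_pos hcp _
  have hbp : bp p = 1 - 1 / p.toReal := by
    unfold bp; refine min_eq_right ?_
    have : 1 / 2 ≤ 1 / p.toReal := one_div_le_one_div_of_le bL hr2.le
    linarith
  obtain ⟨C, hC, H⟩ := dev_lt2 (ι := I) hr1 hr2 hm (rn m / 2 + 1)
  obtain ⟨B, hB⟩ : ∃ B, B = E * oR (cpGrid lam p)⁻¹ := ⟨_, rfl⟩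
  have hBt : B ≠ ⊤ := by rw [hB]; exact emt hE bS
  refine ⟨24, 24 * B, C * B ^ m * oR ((cpGrid lam p) ^ (bp p)⁻¹)⁻¹, by simp, emt bS hBt, emt (emt hC (pow_ne_top hBt)) bS, fun n hn f hf h hw ↦ ?_⟩
  have h0 := wg_pos hw
  have hn' : n ≠ 0 := by omega
  have hn0 : (0:ℝ) < n := by positivity
  have := conv_prob hf hq
  obtain ⟨w1, w2⟩ := wg_facts hN.2.1 hp hw hcp (by simp [hT])
  have hU : Up K q lam p n I h = oR (rn n ^ (1 / p.toReal - 1)) * eLpNorm (Lh I K q h) p volume := by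
    unfold Up; rw [if_neg hT, if_neg hp2.ne, if_pos hr2]
  have hH : 0 < ∏ j ∈ I, h j := fpp fun j hj ↦ (h0 j hj).1
  have hUB : Up K q lam p n I h ≤ B := by
    rw [hU, hB]
    refine (mR (hL h h0) _).trans ?_
    rw [mul_left_comm]
    refine mR ?_ _
    rw [← oRm pv]
    refine oRl (le_trans (le_of_eq ?_) w2)
    rw [rmr pv hH.le, mul_assoc, ← Real.finsetProd_rpow _ _ (fun j hj ↦ (h0 j hj).1.le), ← pmd, hbp, neg_sub]
    congr 1
    exact pco rfl fun j hj ↦ by rw [← rra (h0 j hj).1]; ring_nf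
  obtain ⟨hLc, M, hM⟩ := Lh_reg hK hq hI hN h0
  have hk := H (dm (conv f q)) (pj_meas I) hLc.measurable hM (by rw [ofReal_toReal hT]; exact ((hL h h0).trans_lt (mul_lt_top hE.lt_top bS)).ne) hn'
  simp_rw [ofReal_toReal hT, ← hU] at hk
  refine le_trans (lmo fun y ↦ tsub_pow_anti (a := 24 * Up K q lam p n I h) (b := min (24 * Up K q lam p n I h) (24 * B)) ?_ m) (hk.trans ?_)
  · exact le_min le_rfl (mR hUB _)
  · rw [mul_assoc (C * B ^ m * _), mul_assoc (C * B ^ m)]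
    refine mul_le_mul' (mR (ppl hUB _) _) ?_
    rw [← oRm pv, ← oRm pv]
    refine oRl ?_
    rw [neg_add, rra hn0, Real.rpow_neg_one, ← neg_div, mul_left_comm]
    refine mNL ?_ pv
    rw [inv_mul_eq_div, inv_eq_one_div, div_le_div_iff₀ hn0 hc0]
    linarith
lemma core (hp : 1 < p) (hK : IsKernel K) (hq : IsDensity q) (hI : I.Nonempty) (hN : N1N2 p I q A lam) {m : ℕ} (hm : m ≠ 0) :
    ∃ γ C0 C : Eo, γ ≠ ⊤ ∧ C0 ≠ ⊤ ∧ C ≠ ⊤ ∧ CoreP I K q lam p m γ C0 C := by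
  by_cases hT : p = ⊤
  · subst hT; exact core_top hK hq hI hN hm
  rcases lt_or_ge p 2 with h2 | h2
  · exact core_lt2 hp h2 hK hq hI hN hm
  · exact core_ge2 h2 hT hK hq hI hN hm
end c24
section c25
variable {d : ℕ} {I J : Sd d} {K : ℝ → ℝ} {q f : Fd d} {h h' η : Fin d → ℝ} {p : Eo} {A : ℝ} {lam : Fin d → ℝ} {n : ℕ}
lemma young {ι : Type} [Fintype ι] {k : Fr ι} (hk : Continuous k) {v : Fc ι} (hv : ASM v) (hp : 1 ≤ p) :
    eLpNorm (fun x ↦ ∫ u, ((k u : ℝ) : ℂ) * v (x - u)) p volume ≤ (∫⁻ u, ‖k u‖ₑ) * eLpNorm v p volume := by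
  have hpt : ∀ x, ‖∫ u, ((k u : ℝ) : ℂ) * v (x - u)‖ₑ ≤ ∫⁻ u, ‖k u‖ₑ * ‖v (x - u)‖ₑ := fun x ↦ by
    refine (eil _).trans_eq (lco fun u ↦ ?_)
    rw [enorm_mul, ← ofReal_norm ((k u : ℝ) : ℂ), cnr, ofReal_norm]
  have hq : ∀ x : ι → ℝ, Measure.QuasiMeasurePreserving (fun u ↦ x - u) volume volume := fun x ↦ quasiMeasurePreserving_sub_left_of_right_invariant volume x
  by_cases hT : p = ⊤
  · subst hT
    rw [eLpNorm_exponent_top, eLpNorm_exponent_top]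
    refine essSup_le_of_ae_le _ (aoa _ fun x ↦ (hpt x).trans ?_)
    by_cases h0 : ∫⁻ u, ‖k u‖ₑ = 0
    · rw [h0, zero_mul]
      rw [lintegral_eq_zero_iff fpr] at h0
      rw [lintegral_congr_ae (g := fun _ ↦ 0) (by filter_upwards [h0] with u hu; simp only [Pi.zero_apply] at hu; rw [hu, zero_mul]), lintegral_zero]
    rw [← lintegral_mul_const _ fpr]
    refine lintegral_mono_ae ?_
    filter_upwards [(hq x).ae (ae_le_eLpNormEssSup (f := v))] with u hu
    exact mR hu _
  · have hr1 : 1 ≤ p.toReal := by rw [← toReal_one]; exact (toReal_le_toReal bS hT).2 hp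
    have hr0 : 0 < p.toReal := by linarith
    have hp0 : p ≠ 0 := by positivity
    rw [enl hp0 hT, enl hp0 hT]
    have h1 : ∀ x, ‖∫ u, ((k u : ℝ) : ℂ) * v (x - u)‖ₑ ^ p.toReal ≤ (∫⁻ u, ‖k u‖ₑ) ^ (p.toReal - 1) * ∫⁻ w, ‖v w‖ₑ ^ p.toReal * ‖k (x - w)‖ₑ := fun x ↦ by
      refine (err (hpt x) hr0.le).trans ((jensen fpr (hv.comp_quasiMeasurePreserving (hq x)).enorm hr1).trans_eq ?_)
      congr 1
      rw [← lintegral_sub_left_eq_self _ x]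
      refine lco fun w ↦ ?_
      simp only [Function.comp, _root_.sub_sub_cancel]; rw [mul_comm]
    have h2 : ∫⁻ x, ‖∫ u, ((k u : ℝ) : ℂ) * v (x - u)‖ₑ ^ p.toReal ≤ (∫⁻ u, ‖k u‖ₑ) ^ p.toReal * ∫⁻ x, ‖v x‖ₑ ^ p.toReal := by
      by_cases ht : ∫⁻ u, ‖k u‖ₑ = ⊤
      · by_cases hz : ∫⁻ x, ‖v x‖ₑ ^ p.toReal = 0
        · have h3 : ∀ᵐ x, v x = 0 := by
            rw [lintegral_eq_zero_iff' (hv.enorm.pow_const _)] at hz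
            filter_upwards [hz] with x hx
            simpa [hr0, hr0.le] using hx
          have h4 : ∀ x, ∫ u, ((k u : ℝ) : ℂ) * v (x - u) = 0 := fun x ↦ by
            refine integral_eq_zero_of_ae ?_
            filter_upwards [(hq x).ae h3] with u hu
            rw [hu, mul_zero]; rfl
          simp [h4, hr0]
        · rw [ht, top_rpow_of_pos hr0, top_mul hz]; exact le_top
      refine (lmo h1).trans ?_
      rw [lcm2 _ _ (rnt bL ht), conv_lint (hv.enorm.pow_const _) (k := fun u ↦ ‖k u‖ₑ) fpr, ← mul_assoc]
      refine mL (le_of_eq ?_) _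
      nth_rewrite 2 [← ero (∫⁻ u, ‖k u‖ₑ)]
      rw [← rpow_add_of_nonneg _ _ bL bL]; ring_nf
    refine (err h2 pv).trans_eq ?_
    rw [mrn _ _ pv, one_div, rpow_rpow_inv hr0.ne']
lemma diamond_inf (P P' : Part d) : diamond P P' = (P ⊓ P').parts := by
  rw [Finpartition.parts_inf]; unfold diamond
  ext J
  simp only [mem_filter, mem_erase, bot_eq_empty, nonempty_iff_ne_empty, inf_eq_inter]
  exact and_comm
lemma diamond_comm (P P' : Part d) : diamond P P' = diamond P' P := by rw [diamond_inf, diamond_inf, inf_comm]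
lemma diamond_prod (P P' : Part d) {F : Sd d → ℂ} (h0 : F ∅ = 1) :
    ∏ I' ∈ P'.parts, ∏ I ∈ P.parts, F (I ∩ I') = ∏ J ∈ diamond P P', F J := by
  rw [Finset.prod_comm, ← Finset.prod_product' P.parts P'.parts (fun I I' ↦ F (I ∩ I'))]
  unfold diamond
  rw [filter_image, prod_image]
  · symm
    refine prod_filter_of_ne fun z _ hz ↦ ?_
    rw [nonempty_iff_ne_empty]; intro he; rw [he] at hz; exact hz h0
  · rintro ⟨a, b⟩ ha ⟨a', b'⟩ ha' he
    simp only [coe_filter, mem_product, Set.mem_ofPred_eq] at ha ha' he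
    obtain ⟨x, hx⟩ := ha.2
    have hx' := hx; rw [he] at hx'
    rw [mem_inter] at hx hx'
    rw [P.eq_of_mem_parts ha.1.1 ha'.1.1 hx.1 hx'.1, P'.eq_of_mem_parts ha.1.2 ha'.1.2 hx.2 hx'.2]
lemma Kh_cont (hK : IsKernel K) (h : Fin d → ℝ) : Continuous (Kh I K h) := by
  obtain ⟨G, -, -, hc, -⟩ := Khat_sch hK
  unfold Kh; fun_prop
lemma Kh_bd (hK : IsKernel K) (h : Fin d → ℝ) : ∃ M, ∀ x, ‖Kh I K h x‖ ≤ M := by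
  obtain ⟨KS, hKS⟩ := hK.1
  obtain ⟨C, hC⟩ : ∃ C, ∀ x, ‖K x‖ ≤ C := by
    obtain ⟨C, -, hC⟩ := KS.decay 0 0
    refine ⟨C, fun x ↦ ?_⟩
    have := hC x; rw [← hKS]; simpa using this
  refine ⟨‖(∏ j ∈ I, h j)⁻¹‖ * ∏ j : I, C, fun x ↦ ?_⟩
  unfold Kh; rw [norm_mul, norm_prod]
  exact mNL (fpl (fun _ _ ↦ nnn _) fun j _ ↦ hC _) (nnn _)
lemma mean_eq (hK : IsKernel K) (hq : IsDensity q) (hf : IsDensity f) (hI : I.Nonempty) (hN : N1N2 p I q A lam) (hh : ∀ j ∈ I, 0 < h j ∧ h j ≤ 1) (x : I → ℝ) :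
    fHatMean I K f q h x = ∫ y, ((Kh I K h (x - pj I y) : ℝ) : ℂ) ∂(dm f) := by
  have := conv_prob hf hq
  have := hf.prob
  have e1 : fHatMean I K f q h x = ∫ y, Lh I K q h (x - pj I y) ∂(dm (conv f q)) := rfl
  have k1 := LL_conv (μ := dm (conv f q)) (pj_meas I) (g := fun _ ↦ 1) (ico _) (Ph_int hK hq hI hN hh) x
  have hkp : Integrable (kp K (pj I h)) := by
    have := ((Ph_int hK hq hI hN hh).bdd_mul (c := 1) (ft_cont (dm_marg I hq).1.int).aestronglyMeasurable (aoa _ (ft_norm (dm_marg I hq).1)))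
    refine this.congr (aoa _ fun t ↦ ?_)
    have h0 := (Ng hI hN t).1
    simp only [Ph]; field_simp
  have k2 := LL_conv (μ := dm f) (pj_meas I) (g := fun _ ↦ 1) (ico _) hkp x
  simp only [one_mul, mul_one] at k1 k2
  simp_rw [e1, Lh_LL fun j hj ↦ (hh j hj).1, Kh_LL hK fun j hj ↦ (hh j hj).1, k1, k2, conv_char I hf hq, ← ft_marg I hf]
  congr 1; ext t
  have h0 := (Ng hI hN t).1
  unfold Ph; field_simp
lemma mean_conv (hK : IsKernel K) (hq : IsDensity q) (hf : IsDensity f) (hI : I.Nonempty) (hN : N1N2 p I q A lam) (hh : ∀ j ∈ I, 0 < h j ∧ h j ≤ 1) (x : I → ℝ) :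
    fHatMean I K f q h x = ∫ u, ((Kh I K h u : ℝ) : ℂ) * ((marginal I f (x - u) : ℝ) : ℂ) := by
  have hc : Continuous fun w : I → ℝ ↦ ((Kh I K h (x - w) : ℝ) : ℂ) := Complex.continuous_ofReal.comp ((Kh_cont hK h).comp (continuous_const.sub continuous_id))
  rw [mean_eq hK hq hf hI hN hh, ← integral_map (pj_meas I).aemeasurable (f := fun w ↦ ((Kh I K h (x - w) : ℝ) : ℂ)) hc.aestronglyMeasurable, (dm_marg I hf).2, dm_int (dm_marg I hf).1,
    ← integral_sub_left_eq_self (fun u ↦ ((Kh I K h u : ℝ) : ℂ) * ((marginal I f (x - u) : ℝ) : ℂ)) volume x]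
  simp only [_root_.sub_sub_cancel]
def EE (K : ℝ → ℝ) (f : Fd d) (h : Fin d → ℝ) (x : Fin d → ℝ) (J : Sd d) : ℂ := ∫ y, ((∏ j ∈ J, ((h j)⁻¹ * K ((x j - y j) / h j)) : ℝ) : ℂ) ∂(dm f)
lemma EE_mean (hK : IsKernel K) (hq : IsDensity q) (hf : IsDensity f) (hI : I.Nonempty) (hN : N1N2 p I q A lam) (hh : ∀ j ∈ I, 0 < h j ∧ h j ≤ 1) (x : Fin d → ℝ) :
    fHatMean I K f q h (pj I x) = EE K f h x I := by
  rw [mean_eq hK hq hf hI hN hh]; unfold EE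
  congr 1; ext y
  rw [Kh_prod, ← pcs I (fun j ↦ ((h j)⁻¹ * K ((x j - y j) / h j)))]; rfl
lemma EE_prod (hK : IsKernel K) (hf : IsDensity f) (P : Part d) (hP : ∀ x, f x = ∏ I ∈ P.parts, marginal I f (pj I x)) (x : Fin d → ℝ) (I' : Sd d) :
    EE K f h x I' = ∏ I ∈ P.parts, EE K f h x (I ∩ I') := by
  obtain ⟨-, -, -, hc, -⟩ := Khat_sch hK
  set k : Fin d → ℝ → ℝ := fun j s ↦ (h j)⁻¹ * K ((x j - s) / h j) with hk
  have hkc : ∀ j, Continuous (k j) := fun j ↦ by rw [hk]; fun_prop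
  set g : ∀ I : Sd d, (I → ℝ) → ℂ := fun I z ↦ ((∏ j : I, (if (j : Fin d) ∈ I' then k j (z j) else 1) : ℝ) : ℂ) with hg
  have hgc : ∀ I, Continuous (g I) := fun I ↦ by
    rw [hg]; refine Complex.continuous_ofReal.comp (continuous_finsetProd _ fun j _ ↦ ?_)
    split_ifs
    · exact (hkc j).comp (continuous_apply j)
    · exact continuous_const
  have hgpj : ∀ I y, g I (pj I y) = ((∏ j ∈ I ∩ I', k j (y j) : ℝ) : ℂ) := fun I y ↦ by
    rw [hg]; simp only
    congr 1
    have := pcs I (fun j ↦ if j ∈ I' then k j (y j) else 1)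
    refine this.trans ?_
    rw [prod_ite_mem]
  have h1 : ∀ I, EE K f h x (I ∩ I') = ∫ z, g I z * ((marginal I f z : ℝ) : ℂ) := fun I ↦ by
    rw [← dm_int (dm_marg I hf).1, ← (dm_marg I hf).2, integral_map (pj_meas I).aemeasurable (hgc I).aestronglyMeasurable]
    simp_rw [hgpj]; rfl
  simp_rw [h1]
  rw [← part_int P (G := fun I z ↦ g I z * ((marginal I f z : ℝ) : ℂ)) fun I _ ↦ (hgc I).aestronglyMeasurable.mul (Complex.continuous_ofReal.comp_aestronglyMeasurable (dm_marg I hf).1.int.aestronglyMeasurable)]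
  unfold EE
  rw [dm_int hf]
  congr 1; ext y
  have hL : ((∏ j ∈ I', k j (y j) : ℝ) : ℂ) = ∏ I ∈ P.parts, g I (pj I y) := by
    simp_rw [hgpj]
    have h2 := prod_biUnion (f := fun j ↦ if j ∈ I' then k j (y j) else 1) (s := P.parts) (t := id) P.supIndep.pairwiseDisjoint
    rw [P.biUnion_parts, prod_ite_mem, univ_inter] at h2
    simp only [id, prod_ite_mem] at h2
    rw [h2, Complex.ofReal_prod]
  change ((∏ j ∈ I', k j (y j) : ℝ) : ℂ) * ((f y : ℝ) : ℂ) = _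
  rw [hL, hP y, Complex.ofReal_prod, ← pmd]
lemma mean_prod (hK : IsKernel K) (hq : IsDensity q) (hf : IsDensity f) (P P' : Part d) (hP : ∀ x, f x = ∏ I ∈ P.parts, marginal I f (pj I x))
    (hN : ∀ I ∈ diamond P P', N1N2 p I q A lam) (hN' : ∀ I ∈ P'.parts, N1N2 p I q A lam) (hh : ∀ j, 0 < h j ∧ h j ≤ 1) (x : Fin d → ℝ) :
    ∏ I' ∈ P'.parts, fHatMean I' K f q h (pj I' x) = ∏ J ∈ diamond P P', fHatMean J K f q h (pj J x) := by
  have hpr := hf.prob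
  have h1 : ∀ J ∈ diamond P P', fHatMean J K f q h (pj J x) = EE K f h x J := fun J hJ ↦ EE_mean hK hq hf (mem_filter.1 hJ).2 (hN J hJ) (fun j _ ↦ hh j) x
  have h2 : ∀ J ∈ P'.parts, fHatMean J K f q h (pj J x) = EE K f h x J := fun J hJ ↦ EE_mean hK hq hf (P'.nonempty_of_mem_parts hJ) (hN' J hJ) (fun j _ ↦ hh j) x
  rw [pco rfl h1, pco rfl h2, ← diamond_prod P P' (by simp [EE])]
  exact pco rfl fun I' _ ↦ EE_prod hK hf P hP x I'
end c25
section c26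
variable {d : ℕ} {I J : Sd d} {K : ℝ → ℝ} {q f : Fd d} {h h' η : Fin d → ℝ} {p : Eo} {A : ℝ} {lam : Fin d → ℝ} {n : ℕ} {y : Fin n → Fin d → ℝ}
structure Ok (K : ℝ → ℝ) (q : Fd d) (p : Eo) (A : ℝ) (lam : Fin d → ℝ) (I : Sd d) (h : Fin d → ℝ) : Prop where
  kK : IsKernel K
  kq : IsDensity q
  kI : I.Nonempty
  kN : N1N2 p I q A lam
  kh : ∀ j ∈ I, 0 < h j ∧ h j ≤ 1
lemma Ok.pos (o : Ok K q p A lam I h) : ∀ j ∈ I, 0 < h j := fun j hj ↦ (o.kh j hj).1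
lemma Ok.reg (o : Ok K q p A lam I h) : Continuous (Lh I K q h) ∧ ∃ M, ∀ x, ‖Lh I K q h x‖ ≤ M := Lh_reg o.kK o.kq o.kI o.kN o.kh
lemma Ok.cont (o : Ok K q p A lam I h) : Continuous (fHat I K q h y) :=
  continuous_const.mul (continuous_finsetSum _ fun k _ ↦ o.reg.1.comp (f := fun x : I → ℝ ↦ fun j : I ↦ x j - y k j) fpr)
lemma Ok.shift (o : Ok K q p A lam I h) (o' : Ok K q p A lam I η) (x : I → ℝ) : Integrable fun u ↦ ((Kh I K η u : ℝ) : ℂ) * Lh I K q h (x - u) := by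
  obtain ⟨M, hM⟩ := o.reg.2
  exact (Kh_int o.kK o'.pos).1.ofReal.mul_bdd (c := M) (o.reg.1.comp (continuous_const.sub continuous_id)).aestronglyMeasurable (aoa _ fun u ↦ hM _)
lemma Ok.conv_eq (o : Ok K q p A lam I h) (o' : Ok K q p A lam I η) (x : I → ℝ) :
    fHatConv K q I h η y x = (n : ℂ)⁻¹ * ∑ k, LL (fun t ↦ kp K (pj I η) t * (kp K (pj I h) t * (ftI (marginal I q) t)⁻¹)) (x - pj I (y k)) := by
  have e : ∀ u k, (fun j : I ↦ x j - u j - y k j) = x - pj I (y k) - u := fun u k ↦ by ext j; simp [pj]; ring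
  unfold fHatConv fHat
  simp_rw [e, mul_left_comm _ ((n : ℂ)⁻¹), mul_sum]
  rw [integral_finsetSum _ fun k _ ↦ (o.shift o' _).const_mul _]
  refine sum_congr rfl fun k _ ↦ ?_
  rw [icm]
  congr 1
  have := LL_conv (μ := volume) measurable_id (Kh_int (I := I) o.kK o'.pos).1.ofReal (Ph_int o.kK o.kq o.kI o.kN o.kh) (x - pj I (y k))
  simp_rw [Lh_LL o.pos]
  refine this.trans ?_
  congr 1; ext t
  have e2 := ft_Kh (K := K) o'.pos t
  unfold ftI at e2
  simp only [id, Ph]; erw [e2]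
lemma Ok.symm (o : Ok K q p A lam I h) (o' : Ok K q p A lam I η) : fHatConv K q I h η y = fHatConv K q I η h y := by
  ext x; rw [o.conv_eq o', o'.conv_eq o]; simp_rw [mul_left_comm]
lemma Ok.conv_norm (o : Ok K q p A lam I h) (o' : Ok K q p A lam I η) (hp : 1 ≤ p) :
    eLpNorm (fHatConv K q I h η y) p volume ≤ oR (∫ z, |K z|) ^ I.card * eLpNorm (fHat I K q h y) p volume := by
  rw [← (Kh_int o.kK o'.pos).2]
  exact young (Kh_cont o.kK η) o.cont.aestronglyMeasurable hp
lemma marg_aesm (hf : IsDensity f) : ASM (fun x ↦ ((marginal I f x : ℝ) : ℂ)) :=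
  Complex.continuous_ofReal.comp_aestronglyMeasurable (dm_marg I hf).1.int.aestronglyMeasurable
lemma Ok.mean_norm (o : Ok K q p A lam I η) (hf : IsDensity f) (hp : 1 ≤ p) :
    eLpNorm (fHatMean I K f q η) p volume ≤ oR (∫ z, |K z|) ^ I.card * eLpNorm (marginal I f) p volume := by
  rw [← (Kh_int o.kK o.pos).2, funext (mean_conv o.kK o.kq hf o.kI o.kN o.kh)]
  refine (young (Kh_cont o.kK η) (marg_aesm hf) hp).trans_eq ?_
  congr 1
  exact eLpNorm_congr_norm_ae (aoa _ fun x ↦ cnr _)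
lemma Ok.conv_mean (o : Ok K q p A lam I h) (o' : Ok K q p A lam I η) (hf : IsDensity f) (hp : 1 ≤ p) :
    eLpNorm (fHatConv K q I h η y - fHatMean I K f q η) p volume ≤ oR (∫ z, |K z|) ^ I.card * eLpNorm (fun x ↦ fHat I K q h y x - (marginal I f x : ℂ)) p volume := by
  rw [← (Kh_int o.kK o'.pos).2]
  refine Eq.trans_le ?_ (young (Kh_cont o.kK η) (o.cont.aestronglyMeasurable.sub (marg_aesm hf)) hp)
  congr 1; ext x
  rw [Pi.sub_apply, mean_conv o.kK o.kq hf o.kI o.kN o'.kh]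
  have i1 : Integrable fun u ↦ ((Kh I K η u : ℝ) : ℂ) * fHat I K q h y (x - u) := by
    have e : ∀ u, ((Kh I K η u : ℝ) : ℂ) * fHat I K q h y (x - u) = ∑ k, (n : ℂ)⁻¹ * (((Kh I K η u : ℝ) : ℂ) * Lh I K q h (x - pj I (y k) - u)) := fun u ↦ by
      unfold fHat; rw [mul_left_comm, mul_sum, mul_sum]
      refine sum_congr rfl fun k _ ↦ ?_
      congr 3; ext j; simp [pj]; ring
    simp_rw [e]
    exact integrable_finsetSum _ fun k _ ↦ (o.shift o' _).const_mul _
  have i2 : Integrable fun u ↦ ((Kh I K η u : ℝ) : ℂ) * ((marginal I f (x - u) : ℝ) : ℂ) := by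
    obtain ⟨M, hM⟩ := Kh_bd (I := I) o.kK η
    exact ((dm_marg I hf).1.int.comp_sub_left x).ofReal.bdd_mul (c := M) (Complex.continuous_ofReal.comp (Kh_cont o.kK η)).aestronglyMeasurable (aoa _ fun u ↦ (cnr _).trans_le (hM u))
  exact (integral_sub i1 i2).symm.trans (integral_congr_ae (aoa _ fun u ↦ (mul_sub _ _ _).symm))
lemma Ok.mean_meas (o : Ok K q p A lam I h) (hf : IsDensity f) : ASM (fHatMean I K f q h) := by
  have := conv_prob hf o.kq
  exact (Deconv.mean_meas (dm (conv f q)) (pj_meas I) o.reg.1.measurable).aestronglyMeasurable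
lemma h_congr (hh : ∀ j ∈ I, h j = h' j) : Lh I K q h = Lh I K q h' := by
  have : Kh I K h = Kh I K h' := by
    ext x; simp_rw [Kh_prod]; exact pco rfl fun j _ ↦ by rw [hh j j.2]
  unfold Lh; rw [this]
lemma xi_congr (hh : ∀ j ∈ I, h j = h' j) : xiProc I K f q h y = xiProc I K f q h' y := by
  unfold xiProc fHat fHatMean; rw [h_congr hh]
lemma Up_congr (hh : ∀ j ∈ I, h j = h' j) : Up K q lam p n I h = Up K q lam p n I h' := by
  have : ∏ j ∈ I, h j ^ (-lam j - 1 / 2) = ∏ j ∈ I, h' j ^ (-lam j - 1 / 2) := pco rfl fun j hj ↦ by rw [hh j hj]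
  unfold Up; rw [h_congr hh, this]
lemma Ok.xi_meas (o : Ok K q p A lam I h) (hp : 1 < p) (hf : IsDensity f) : Measurable fun y : Fin n → Fin d → ℝ ↦ eLpNorm (xiProc I K f q h y) p volume := by
  have := conv_prob hf o.kq
  have e : ∀ y : Fin n → Fin d → ℝ, xiProc I K f q h y = xiA (dm (conv f q)) (pj I) (Lh I K q h) y := fun y ↦ rfl
  simp_rw [e]
  by_cases hT : p = ⊤
  · subst hT
    have hm := Deconv.xi_meas (dm (conv f q)) (pj_meas I) o.reg.1.measurable n
    refine measurable_of_Iic fun c ↦ ?_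
    have hs : MeasurableSet {z : (Fin n → Fin d → ℝ) × (I → ℝ) | c < ‖xiA (dm (conv f q)) (pj I) (Lh I K q h) z.1 z.2‖ₑ} := measurableSet_lt mco hm.enorm
    have h1 := measurable_measure_prodMk_left (ν := (volume : Measure (I → ℝ))) hs
    have h2 := h1 (measurableSet_singleton 0)
    convert h2 using 1
    ext y
    rw [Set.mem_preimage, Set.mem_Iic, Set.mem_preimage, Set.mem_singleton_iff, eLpNorm_exponent_top, eLpNormEssSup]
    constructor
    · intro hc
      have := _root_.ae_le_essSup (f := fun x ↦ ‖xiA (dm (conv f q)) (pj I) (Lh I K q h) y x‖ₑ) (μ := volume)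
      rw [ae_iff] at this
      refine measure_mono_null (fun x hx ↦ ?_) this
      exact not_le.2 (hc.trans_lt hx)
    · intro hc
      refine essSup_le_of_ae_le _ ?_
      rw [EventuallyLE, ae_iff]
      simp only [not_le]; exact hc
  · have hr : p = oR p.toReal := (ofReal_toReal hT).symm
    have h0 : 0 < p.toReal := toReal_pos pv hT
    rw [hr]; simp_rw [lpB_eq h0]
    exact lpB_meas (dm (conv f q)) (pj_meas I) o.reg.1.measurable
end c26
section c27
variable {d : ℕ} {K : ℝ → ℝ} {q f : Fd d} {p : Eo} {A : ℝ} {lam : Fin d → ℝ} {𝔓 : Set (Part d)}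
def BB (𝔓 : Set (Part d)) (I : Sd d) : Prop := ∃ P ∈ 𝔓, ∃ P' ∈ 𝔓, I ∈ diamond P P'
lemma BB.ne {I : Sd d} (h : BB 𝔓 I) : I.Nonempty := by
  obtain ⟨P, -, P', -, h⟩ := h; exact (mem_filter.1 h).2
open Classical in
lemma theta (hp : 1 < p) (hK : IsKernel K) (hq : IsDensity q) (hN : ∀ I, BB 𝔓 I → N1N2 p I q A lam) {m : ℕ} (hm : m ≠ 0) :
    ∃ γ C0 B : Eo, γ ≠ ⊤ ∧ C0 ≠ ⊤ ∧ B ≠ ⊤ ∧ ∀ n, 3 ≤ n → ∀ f, IsDensity f → ∃ θ : (Fin n → Fin d → ℝ) → Eo, Measurable θ ∧ ∫⁻ y, θ y ^ m ∂obsMeasure d n f q ≤ B ∧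
      ∀ y I, BB 𝔓 I → ∀ h, wg lam p n I h → eLpNorm (xiProc I K f q h y) p volume ≤ min (γ * Up K q lam p n I h) C0 + oR (rn n ^ (-(1 : ℝ) / 2)) * θ y := by
  have hc : ∀ I : Sd d, ∃ γ C0 C : Eo, γ ≠ ⊤ ∧ C0 ≠ ⊤ ∧ C ≠ ⊤ ∧ (BB 𝔓 I → CoreP I K q lam p m γ C0 C) := fun I ↦ by
    by_cases hB : BB 𝔓 I
    · obtain ⟨a, b, c, h1, h2, h3, h4⟩ := core hp hK hq hB.ne (hN I hB) hm
      exact ⟨a, b, c, h1, h2, h3, fun _ ↦ h4⟩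
    · exact ⟨0, 0, 0, by simp, by simp, by simp, fun h ↦ absurd h hB⟩
  choose g c0 c hg hc0 hcc hcore using hc
  refine ⟨∑ I, g I, ∑ I, c0 I, ∑ I, c I * 2 ^ I.card, by simp [hg], by simp [hc0], by simp [mul_eq_top, hcc], fun n hn f hf ↦ ?_⟩
  obtain ⟨γ, hγ⟩ : ∃ γ, γ = ∑ I, g I := ⟨_, rfl⟩
  obtain ⟨C0, hC0⟩ : ∃ C0, C0 = ∑ I, c0 I := ⟨_, rfl⟩
  rw [← hγ, ← hC0]
  have hγI : ∀ I, g I ≤ γ := fun I ↦ hγ ▸ single_le_sum (f := g) (fun _ _ ↦ zero_le) (mem_univ I)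
  have hCI : ∀ I, c0 I ≤ C0 := fun I ↦ hC0 ▸ single_le_sum (f := c0) (fun _ _ ↦ zero_le) (mem_univ I)
  let hk : ∀ I : Sd d, (I → ℕ) → Fin d → ℝ := fun I k j ↦ if hj : j ∈ I then (2 : ℝ) ^ (-(k ⟨j, hj⟩ : ℝ)) else 1
  let Z : ∀ I : Sd d, (I → ℕ) → (Fin n → Fin d → ℝ) → Eo := fun I k y ↦
    if BB 𝔓 I ∧ wg lam p n I (hk I k) then (eLpNorm (xiProc I K f q (hk I k) y) p volume - min (γ * Up K q lam p n I (hk I k)) C0) ^ m else 0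
  have hZm : ∀ I k, Measurable (Z I k) := fun I k ↦ by
    simp only [Z]; split_ifs with h1
    · exact ((Ok.xi_meas (n := n) ⟨hK, hq, h1.1.ne, hN I h1.1, wg_pos h1.2⟩ hp hf).sub_const _).pow_const _
    · exact mco
  let S : (Fin n → Fin d → ℝ) → Eo := fun y ↦ ∑ I, ∑' k, Z I k y
  have hSm : Measurable S := measurable_sum _ fun I _ ↦ Measurable.tsum fun k ↦ hZm I k
  have hn0 : (0 : ℝ) < n := by positivity
  have hm0 : (0 : ℝ) < m := by positivity
  have hnn : oR (rn n ^ (-(1 : ℝ) / 2)) * oR (rn n ^ ((1 : ℝ) / 2)) = 1 := by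
    rw [← oRm pv, ← rra hn0]; norm_num
  have hnm : oR (rn n ^ ((1 : ℝ) / 2)) ^ m * oR (rn n ^ (-rn m / 2)) = 1 := by
    rw [← oRp pv, ← oRm pv, ← rrc, ← rrm hn0.le, ← rra hn0]
    rw [show (1 : ℝ) / 2 * m + -m / 2 = 0 by ring]; simp
  refine ⟨fun y ↦ oR (rn n ^ ((1 : ℝ) / 2)) * S y ^ (1 / (m : ℝ)), (hSm.pow_const _).const_mul _, ?_, ?_⟩
  · have e : ∀ y, (oR (rn n ^ ((1 : ℝ) / 2)) * S y ^ (1 / (m : ℝ))) ^ m = oR (rn n ^ ((1 : ℝ) / 2)) ^ m * S y := fun y ↦ by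
      rw [mul_pow, ← rpow_natCast (S y ^ _), ← erm, one_div_mul_cancel hm0.ne', ero]
    simp_rw [e]
    rw [lcm1 _ hSm, lintegral_finsetSum _ fun I _ ↦ Measurable.tsum fun k ↦ hZm I k, mul_sum]
    refine sum_le_sum fun I _ ↦ ?_
    rw [lintegral_tsum fun k ↦ (hZm I k).aemeasurable]
    have h1 : ∀ k, ∫⁻ y, Z I k y ∂obsMeasure d n f q ≤ c I * oR (rn n ^ (-rn m / 2)) * ∏ j, (2⁻¹ : Eo) ^ (k j) := fun k ↦ by
      simp only [Z]; split_ifs with h1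
      · refine (lmo fun y ↦ tsub_pow_anti (min_le_min (mL (hγI I) _) (hCI I)) m).trans ((hcore I h1.1 n hn f hf _ h1.2).trans_eq ?_)
        congr 1
        rw [ofReal_prod_of_nonneg fun j hj ↦ (wg_pos h1.2 j hj).1.le, ← pcs]
        refine pco rfl fun j _ ↦ ?_
        simp only [hk, j.2, dif_pos]
        rw [Real.rpow_neg bN, rrc, ← inv_pow, oRp bN, ofReal_inv_of_pos bN]; norm_num
      · simp
    refine (mR (ENNReal.tsum_le_tsum h1) _).trans ?_
    rw [ENNReal.tsum_mul_left, mul_comm (c I), mul_assoc, ← mul_assoc, hnm, one_mul]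
    refine mR ((tsum_prod_le fun _ i ↦ (2⁻¹ : Eo) ^ i).trans_eq ?_) _
    rw [tsum_geometric, prod_const, card_univ, Fintype.card_coe, one_sub_inv_two, inv_inv]
  · intro y I hB h hw
    rw [← mul_assoc, hnn, one_mul]
    choose! k hkk using hw.1
    have hcong : ∀ j ∈ I, h j = hk I (fun j ↦ k j) j := fun j hj ↦ by simp only [hk, hj, dif_pos]; exact (hkk j hj).2
    rw [xi_congr hcong, Up_congr hcong]
    have hw' : wg lam p n I (hk I fun j ↦ k j) := by
      unfold wg at hw ⊢
      have e1 := pco (rfl : I = I) hcong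
      have e2 := Finset.prod_congr (rfl : I = I) (g := fun j ↦ hk I (fun j ↦ k j) j ^ lam j) fun j hj ↦ congrArg (· ^ lam j) (hcong j hj)
      exact ⟨fun j hj ↦ by rw [← hcong j hj]; exact hw.1 j hj, hw.2.trans_eq (by rw [← e1, ← e2])⟩
    have h0 := ENNReal.le_tsum (f := fun k ↦ Z I k y) (fun j : I ↦ k j)
    have h1 := h0.trans (single_le_sum (f := fun I ↦ ∑' k, Z I k y) (fun _ _ ↦ zero_le) (mem_univ I))
    simp only [Z, if_pos (And.intro hB hw')] at h1
    rw [add_comm, ← tsub_le_iff_right, one_div, le_rpow_inv_iff hm0, rpow_natCast]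
    exact h1
end c27
section c28
variable {d : ℕ} {K : ℝ → ℝ} {q f : Fd d} {p : Eo} {A : ℝ} {lam : Fin d → ℝ} {𝔓 : Set (Part d)} {n : ℕ} {y : Fin n → Fin d → ℝ} {u v : (Fin d → ℝ) × Part d} {P P' : Part d} {J : Sd d}
structure Cx (K : ℝ → ℝ) (q : Fd d) (p : Eo) (A : ℝ) (lam : Fin d → ℝ) (𝔓 : Set (Part d)) : Prop where
  hp : 1 < p
  hK : IsKernel K
  hq : IsDensity q
  hN : ∀ I, BB 𝔓 I → N1N2 p I q A lam
lemma diag (P : Part d) : P.parts = diamond P P := by rw [diamond_inf, inf_idem]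
lemma Cx.wg (c : Cx K q p A lam 𝔓) (hu : u ∈ HpSet lam p n 𝔓) (hP : P ∈ 𝔓) (hJ : J ∈ diamond u.2 P) : wg lam p n J u.1 := by
  have hl := (c.hN J ⟨_, hu.1, _, hP, hJ⟩).2.1
  unfold diamond at hJ
  rw [mem_filter, mem_image] at hJ
  obtain ⟨⟨z, hz, rfl⟩, -⟩ := hJ
  exact wg_sub hl c.hp inter_subset_left (hu.2 _ (mem_product.1 hz).1).wg
lemma Cx.ok (c : Cx K q p A lam 𝔓) (hu : u ∈ HpSet lam p n 𝔓) (hP : P ∈ 𝔓) (hJ : J ∈ diamond u.2 P) : Ok K q p A lam J u.1 :=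
  ⟨c.hK, c.hq, (mem_filter.1 hJ).2, c.hN J ⟨_, hu.1, _, hP, hJ⟩, wg_pos (c.wg hu hP hJ)⟩
lemma Hp_pos (hu : u ∈ HpSet lam p n 𝔓) (j : Fin d) : 0 < u.1 j ∧ u.1 j ≤ 1 := by
  obtain ⟨I, hI, hj⟩ := u.2.exists_mem (mem_univ j)
  exact wg_pos (hu.2 I hI).wg j hj
def ka (K : ℝ → ℝ) (d : ℕ) : Eo := oR ((∫ z, |K z|) ^ d)
lemma K1 (hK : IsKernel K) : (1 : ℝ) ≤ ∫ z, |K z| := by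
  have := abs_integral_le_integral_abs (f := K) (μ := volume)
  rwa [hK.2.2, abs_one] at this
lemma one_ka (hK : IsKernel K) : 1 ≤ ka K d := by
  rw [ka, one_le_ofReal]; exact one_le_pow₀ (K1 hK)
lemma card_ka (hK : IsKernel K) (J : Sd d) : oR (∫ z, |K z|) ^ J.card ≤ ka K d := by
  rw [ka, ← oRp (by linarith [K1 hK])]
  exact oRl (ppr (K1 hK) ((card_le_univ J).trans_eq (Fintype.card_fin d)))
lemma G_one : 1 ≤ Gbar K q lam p 𝔓 y := le_max_left _ _
lemma G_hat (hu : u ∈ HpSet lam p n 𝔓) (hP : P ∈ 𝔓) (hJ : J ∈ diamond u.2 P) : ka K d * eLpNorm (fHat J K q u.1 y) p volume ≤ Gbar K q lam p 𝔓 y := by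
  refine (mR ?_ _).trans (le_max_right _ _)
  exact le_iSup₂_of_le u hu (le_iSup₂_of_le P hP (le_iSup₂_of_le J hJ le_rfl))
lemma G_hat1 (hK : IsKernel K) (hu : u ∈ HpSet lam p n 𝔓) (hP : P ∈ 𝔓) (hJ : J ∈ diamond u.2 P) : eLpNorm (fHat J K q u.1 y) p volume ≤ Gbar K q lam p 𝔓 y :=
  (le_mul_of_one_le_left' (one_ka hK)).trans (G_hat hu hP hJ)
lemma F_marg (hJ : BB 𝔓 J) : eLpNorm (marginal J f) p volume ≤ fpE p 𝔓 f := by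
  obtain ⟨P, hP, P', hP', hJ⟩ := hJ
  refine le_trans ?_ (le_max_right _ _)
  exact le_iSup₂_of_le P hP (le_iSup₂_of_le P' hP' (le_iSup₂_of_le (f := fun I _ ↦ eLpNorm (marginal I f) p volume) J hJ le_rfl))
def rr (K : ℝ → ℝ) (q f : Fd d) (p : Eo) (𝔓 : Set (Part d)) (y : Fin n → Fin d → ℝ) (u : (Fin d → ℝ) × Part d) : Eo :=
  ⨆ P' ∈ 𝔓, ⨆ I ∈ diamond u.2 P', eLpNorm (fun xI ↦ fHat I K q u.1 y xI - (marginal I f xI : ℂ)) p volume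
lemma le_rr (hP : P ∈ 𝔓) (hJ : J ∈ diamond u.2 P) : eLpNorm (fun xI ↦ fHat J K q u.1 y xI - (marginal J f xI : ℂ)) p volume ≤ rr K q f p 𝔓 y u :=
  le_iSup₂_of_le P hP (le_iSup₂_of_le J hJ le_rfl)
lemma prod_aesm (P : Part d) {B : ∀ I : Sd d, (I → ℝ) → ℂ} (hB : ∀ I ∈ P.parts, ASM (B I)) : ASM fun x ↦ ∏ I ∈ P.parts, B I (pj I x) :=
  aestronglyMeasurable_fun_prod _ fun I hI ↦ (hB I hI).comp_quasiMeasurePreserving (pj_qmp I)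
lemma tele_bd (P : Part d) (hp : 1 ≤ p) {B b : ∀ I : Sd d, (I → ℝ) → ℂ} (hB : ∀ I ∈ P.parts, ASM (B I)) (hb : ∀ I ∈ P.parts, ASM (b I))
    {e W : Eo} {D : ℕ} (he : ∀ I ∈ P.parts, eLpNorm (B I - b I) p volume ≤ e) (hW : ∀ I ∈ P.parts, eLpNorm (B I) p volume + eLpNorm (b I) p volume ≤ W) (h1 : 1 ≤ W) (hD : P.parts.card ≤ D) :
    eLpNorm (fun x ↦ ∏ I ∈ P.parts, B I (pj I x) - ∏ I ∈ P.parts, b I (pj I x)) p volume ≤ D * (e * W ^ (D - 1)) := by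
  refine (eLp_tele P hp hB hb).trans ((sum_le_card_nsmul _ _ (e * W ^ (D - 1)) fun I hI ↦ mul_le_mul' (he I hI) ?_).trans ?_)
  · refine (prod_le_pow_card _ _ W fun J hJ ↦ hW J (mem_of_mem_erase hJ)).trans (ppr h1 ?_)
    rw [card_erase_of_mem hI]; omega
  · rw [nsmul_eq_mul]; exact mL (by exact_mod_cast hD) _
lemma card_le_d (P : Part d) : P.parts.card ≤ d := P.card_parts_le_card.trans_eq bS
lemma card_le_D (hP : P ∈ 𝔓) : P.parts.card ≤ Dd 𝔓 := le_csSup ⟨d, by rintro _ ⟨P, -, rfl⟩; exact card_le_d P⟩ ⟨P, hP, rfl⟩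
lemma Cx.symm (c : Cx K q p A lam 𝔓) (hu : u ∈ HpSet lam p n 𝔓) (hv : v ∈ HpSet lam p n 𝔓) : fHatProdAux K q u v y = fHatProdAux K q v u y := by
  ext x; unfold fHatProdAux; rw [diamond_comm v.2]
  exact pco rfl fun J hJ ↦ by rw [(c.ok hu hv.1 hJ).symm (c.ok hv hu.1 (diamond_comm u.2 v.2 ▸ hJ))]
def Ep (K : ℝ → ℝ) (f q : Fd d) (h : Fin d → ℝ) (P : Part d) (x : Fin d → ℝ) : ℂ := ∏ I ∈ P.parts, fHatMean I K f q h (pj I x)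
lemma Cx.mean_le (c : Cx K q p A lam 𝔓) (hf : IsDensity f) (hu : u ∈ HpSet lam p n 𝔓) (hP : P ∈ 𝔓) (hJ : J ∈ diamond u.2 P) :
    eLpNorm (fHatMean J K f q u.1) p volume ≤ ka K d * fpE p 𝔓 f :=
  ((c.ok hu hP hJ).mean_norm hf c.hp.le).trans (mul_le_mul' (card_ka c.hK J) (F_marg ⟨_, hu.1, _, hP, hJ⟩))
lemma Cx.T1 (c : Cx K q p A lam 𝔓) (hf : IsDensity f) (hu : u ∈ HpSet lam p n 𝔓) (hv : v ∈ HpSet lam p n 𝔓) :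
    ASM (fHatProdAux K q u v y) ∧ ASM (Ep K f q v.1 (u.2 ⊓ v.2)) ∧ 
    eLpNorm (fHatProdAux K q u v y - Ep K f q v.1 (u.2 ⊓ v.2)) p volume ≤ d * (ka K d * rr K q f p 𝔓 y u * (Gbar K q lam p 𝔓 y + ka K d * fpE p 𝔓 f) ^ (d - 1)) := by
  have e := diamond_inf u.2 v.2
  have o : ∀ J ∈ (u.2 ⊓ v.2).parts, Ok K q p A lam J u.1 ∧ Ok K q p A lam J v.1 := fun J hJ ↦ ⟨c.ok hu hv.1 (e ▸ hJ), c.ok hv hu.1 (diamond_comm u.2 v.2 ▸ e ▸ hJ)⟩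
  have a1 : ∀ J ∈ (u.2 ⊓ v.2).parts, ASM (fHatConv K q J u.1 v.1 y) := fun J hJ ↦ by
    obtain ⟨o1, o2⟩ := o J hJ
    have : fHatConv K q J u.1 v.1 y = fun x ↦ (n : ℂ)⁻¹ * ∑ k, LL (fun t ↦ kp K (pj J v.1) t * (kp K (pj J u.1) t * (ftI (marginal J q) t)⁻¹)) (x - pj J (y k)) := funext (o1.conv_eq o2)
    have hi := (Ph_int o1.kK o1.kq o1.kI o1.kN o1.kh)
    have hM : ∃ M, ∀ t, ‖kp K (pj J v.1) t‖ ≤ M := by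
      refine ⟨∫ x, ‖((Kh J K v.1 x : ℝ) : ℂ)‖, fun t ↦ ?_⟩
      rw [← ft_Kh o2.pos]
      refine (norm_integral_le_integral_norm _).trans_eq (integral_congr_ae (aoa _ fun x ↦ ?_))
      simp [Complex.norm_exp]
    obtain ⟨M, hM⟩ := hM
    have hc := LL_cont (hi.bdd_mul (c := M) (kp_cont o1.kK (pj J v.1)).aestronglyMeasurable (aoa _ hM))
    rw [this]
    exact (continuous_const.mul (continuous_finsetSum _ fun k _ ↦ hc.comp (continuous_id.sub continuous_const))).aestronglyMeasurable
  have a2 : ∀ J ∈ (u.2 ⊓ v.2).parts, ASM (fHatMean J K f q v.1) := fun J hJ ↦ (o J hJ).2.mean_meas hf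
  have ex : fHatProdAux K q u v y = fun x ↦ ∏ J ∈ (u.2 ⊓ v.2).parts, fHatConv K q J u.1 v.1 y (pj J x) := by
    ext x; unfold fHatProdAux; rw [e]; rfl
  refine ⟨ex ▸ prod_aesm _ a1, prod_aesm _ a2, ?_⟩
  rw [ex]
  refine tele_bd (u.2 ⊓ v.2) c.hp.le a1 a2 (fun J hJ ↦ ?_) (fun J hJ ↦ ?_) (G_one.trans lsa) (card_le_d _)
  · exact ((o J hJ).1.conv_mean (o J hJ).2 hf c.hp.le).trans (mul_le_mul' (card_ka c.hK J) (le_rr hv.1 (e ▸ hJ)))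
  · refine add_le_add (((o J hJ).1.conv_norm (o J hJ).2 c.hp.le).trans ((mL (card_ka c.hK J) _).trans (G_hat hu hv.1 (e ▸ hJ)))) (c.mean_le hf hv hu.1 (diamond_comm u.2 v.2 ▸ e ▸ hJ))
end c28
section c29
variable {d : ℕ} {K : ℝ → ℝ} {q f : Fd d} {p : Eo} {A : ℝ} {lam : Fin d → ℝ} {𝔓 : Set (Part d)} {n : ℕ} {y : Fin n → Fin d → ℝ} {u v : (Fin d → ℝ) × Part d} {P P' : Part d} {J : Sd d} {γ C0 ζ : Eo}
lemma pow1 (z : Eo) (N : ℕ) : (1 + z) ^ N ≤ 1 + N * z * (1 + z) ^ N := by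
  induction N with
  | zero => simp
  | succ N ih =>
    have h1 : 1 ≤ (1 + z) ^ (N + 1) := one_le_pow₀ lsa
    calc (1 + z) ^ (N + 1) = (1 + z) ^ N * (1 + z) := pow_succ _ _
      _ ≤ (1 + N * z * (1 + z) ^ N) * (1 + z) := mL ih _
      _ = 1 + z * 1 + N * z * (1 + z) ^ (N + 1) := by ring
      _ ≤ 1 + z * (1 + z) ^ (N + 1) + N * z * (1 + z) ^ (N + 1) := aL (aR (mR h1 _) _) _
      _ = _ := by push_cast; ring
def Xi (K : ℝ → ℝ) (q f : Fd d) (lam : Fin d → ℝ) (p : Eo) (𝔓 : Set (Part d)) (γ C0 ζ : Eo) (y : Fin n → Fin d → ℝ) : Prop :=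
  ∀ I, BB 𝔓 I → ∀ h, wg lam p n I h → eLpNorm (xiProc I K f q h y) p volume ≤ min (γ * Up K q lam p n I h) C0 + ζ
def Rem (𝔓 : Set (Part d)) (C0 G ζ : Eo) : Eo := Dd 𝔓 * ((G * (2 + C0)) ^ (Dd 𝔓 - 1) * ((C0 * (Dd 𝔓 - 1 : ℕ) + 1) * (ζ * (1 + ζ) ^ (Dd 𝔓 - 1))))
lemma fHat_le (hX : Xi K q f lam p 𝔓 γ C0 ζ y) (c : Cx K q p A lam 𝔓) (hf : IsDensity f) (hv : v ∈ HpSet lam p n 𝔓) (hP : P ∈ 𝔓) (hJ : J ∈ diamond v.2 P) :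
    eLpNorm (fHatMean J K f q v.1) p volume ≤ eLpNorm (fHat J K q v.1 y) p volume + (C0 + ζ) ∧ eLpNorm (fHat J K q v.1 y) p volume ≤ ka K d * fpE p 𝔓 f + (C0 + ζ) := by
  have o := c.ok hv hP hJ
  have h1 := (hX J ⟨_, hv.1, _, hP, hJ⟩ _ (c.wg hv hP hJ)).trans (aL (min_le_right _ _) ζ)
  have hx : ASM (xiProc J K f q v.1 y) := o.cont.aestronglyMeasurable.sub (o.mean_meas hf)
  constructor
  · have := eLpNorm_sub_le (μ := volume) o.cont.aestronglyMeasurable hx c.hp.le (f := fHat J K q v.1 y)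
    rw [show fHat J K q v.1 y - xiProc J K f q v.1 y = fHatMean J K f q v.1 by ext x; simp [xiProc]] at this
    exact this.trans (aR h1 _)
  · have := eLpNorm_add_le (μ := volume) (o.mean_meas hf) hx c.hp.le
    rw [show fHatMean J K f q v.1 + xiProc J K f q v.1 y = fHat J K q v.1 y by ext x; simp [xiProc]] at this
    exact this.trans (add_le_add (c.mean_le hf hv hP hJ) h1)
lemma Cx.T2 (c : Cx K q p A lam 𝔓) (hf : IsDensity f) (hX : Xi K q f lam p 𝔓 γ C0 ζ y) (hv : v ∈ HpSet lam p n 𝔓) :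
    ASM (fHatProd K q v y) ∧ eLpNorm (Ep K f q v.1 v.2 - fHatProd K q v y) p volume ≤ 
      LamThr K q lam p 𝔓 ((γ + 1) * (2 + C0) ^ (Dd 𝔓)) y * UpPart K q lam p n v + Rem 𝔓 C0 (Gbar K q lam p 𝔓 y) ζ := by
  have dg : ∀ J ∈ v.2.parts, J ∈ diamond v.2 v.2 := fun J hJ ↦ diag v.2 ▸ hJ
  have o : ∀ J ∈ v.2.parts, Ok K q p A lam J v.1 := fun J hJ ↦ c.ok hv hv.1 (dg J hJ)
  have a1 : ∀ J ∈ v.2.parts, ASM (fHatMean J K f q v.1) := fun J hJ ↦ (o J hJ).mean_meas hf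
  have a2 : ∀ J ∈ v.2.parts, ASM (fHat J K q v.1 y) := fun J hJ ↦ (o J hJ).cont.aestronglyMeasurable
  refine ⟨prod_aesm _ a2, ?_⟩
  obtain ⟨G, hG⟩ : ∃ G, G = Gbar K q lam p 𝔓 y := ⟨_, rfl⟩
  obtain ⟨U, hU⟩ : ∃ U, U = UpPart K q lam p n v := ⟨_, rfl⟩
  have hG1 : 1 ≤ G := hG ▸ G_one
  have k := tele_bd v.2 c.hp.le a1 a2 (e := min (γ * U) C0 + ζ) (W := G * (2 + C0) * (1 + ζ)) (fun J hJ ↦ ?_) (fun J hJ ↦ ?_) ?_ (card_le_D hv.1)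
  · refine k.trans ?_
    unfold LamThr Rem
    rw [← hG, ← hU]
    obtain ⟨D, hD⟩ : ∃ D, D = Dd 𝔓 := ⟨_, rfl⟩
    rw [← hD]
    obtain ⟨N, hN⟩ : ∃ N, N = D - 1 := ⟨_, rfl⟩
    rw [← hN]
    have h1 : (min (γ * U) C0 + ζ) * (1 + ζ) ^ N ≤ γ * U + (C0 * N + 1) * (ζ * (1 + ζ) ^ N) := by
      rw [add_mul]
      calc _ ≤ min (γ * U) C0 * (1 + N * ζ * (1 + ζ) ^ N) + ζ * (1 + ζ) ^ N := aL (mR (pow1 ζ N) _) _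
        _ = min (γ * U) C0 + min (γ * U) C0 * (N * ζ * (1 + ζ) ^ N) + ζ * (1 + ζ) ^ N := by ring
        _ ≤ γ * U + C0 * (N * ζ * (1 + ζ) ^ N) + ζ * (1 + ζ) ^ N := aL (add_le_add (min_le_left _ _) (mL (min_le_right _ _) _)) _
        _ = _ := by ring
    have h2 : G ^ N ≤ G ^ (D * (D - 1)) := pow_le_pow_right₀ hG1 (by rw [← hN]; rcases D with _ | D; · simp [hN]
                                                                     · exact Nat.le_mul_of_pos_left _ bO)
    have h3 : (2 + C0) ^ N ≤ (2 + C0) ^ D := pow_le_pow_right₀ (le_trans bN (le_self_add (a := (2 : ℝ≥0∞)) (b := C0))) bO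
    calc (D : Eo) * ((min (γ * U) C0 + ζ) * (G * (2 + C0) * (1 + ζ)) ^ N) = D * ((G * (2 + C0)) ^ N * ((min (γ * U) C0 + ζ) * (1 + ζ) ^ N)) := by rw [mul_pow _ (1 + ζ)]; ring
      _ ≤ D * ((G * (2 + C0)) ^ N * (γ * U + (C0 * N + 1) * (ζ * (1 + ζ) ^ N))) := mR (mR h1 _) _
      _ = D * (γ * (2 + C0) ^ N) * G ^ N * U + D * ((G * (2 + C0)) ^ N * ((C0 * N + 1) * (ζ * (1 + ζ) ^ N))) := by rw [mul_pow]; ring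
      _ ≤ D * ((γ + 1) * (2 + C0) ^ D) * G ^ (D * (D - 1)) * U + D * ((G * (2 + C0)) ^ N * ((C0 * N + 1) * (ζ * (1 + ζ) ^ N))) := aL (mL (mul_le_mul' (mR (mul_le_mul' (lsa : γ ≤ γ + 1) h3) _) h2) _) _
      _ = _ := by rw [hN]
  · have h1 := hX J ⟨_, hv.1, _, hv.1, dg J hJ⟩ _ (c.wg hv hv.1 (dg J hJ))
    rw [← neg_sub, eLpNorm_neg]
    refine h1.trans (aL (min_le_min_right _ (mR ?_ _)) _)
    rw [hU]; exact le_iSup₂_of_le (f := fun I _ ↦ Up K q lam p n I v.1) J hJ le_rfl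
  · have h1 := G_hat1 (q := q) (y := y) c.hK hv hv.1 (dg J hJ)
    rw [← hG] at h1
    calc _ ≤ (G + (C0 + ζ)) + G := add_le_add ((fHat_le hX c hf hv hv.1 (dg J hJ)).1.trans (aL h1 _)) h1
      _ ≤ (G + (G * C0 + G * ζ)) + G + G * ζ * (1 + C0) := (aL (aR (add_le_add (le_mul_of_one_le_left' hG1) (le_mul_of_one_le_left' hG1)) _) _).trans lsa
      _ = _ := by ring
  · exact one_le_mul (one_le_mul hG1 (le_trans bN (le_self_add (a := (2 : ℝ≥0∞)) (b := C0)))) le_self_add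
lemma Cx.delta (c : Cx K q p A lam 𝔓) (hf : IsDensity f) (hX : Xi K q f lam p 𝔓 γ C0 ζ y) (hu : u ∈ HpSet lam p n 𝔓) (hs : u.2 ∈ structSet 𝔓 f) :
    DeltaT K q lam p 𝔓 ((γ + 1) * (2 + C0) ^ (Dd 𝔓)) y u ≤ d * (ka K d * rr K q f p 𝔓 y u * (Gbar K q lam p 𝔓 y + ka K d * fpE p 𝔓 f) ^ (d - 1)) + Rem 𝔓 C0 (Gbar K q lam p 𝔓 y) ζ := by
  refine iSup₂_le fun v hv ↦ tsub_le_iff_right.2 ?_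
  obtain ⟨a1, a2, t1⟩ := c.T1 (y := y) hf hu hv
  obtain ⟨a3, t2⟩ := c.T2 hf hX hv
  have e : Ep K f q v.1 (u.2 ⊓ v.2) = Ep K f q v.1 v.2 := by
    ext x; unfold Ep
    rw [← diamond_inf]
    exact (mean_prod c.hK c.hq hf u.2 v.2 hs.2 (fun I hI ↦ c.hN I ⟨_, hu.1, _, hv.1, hI⟩) (fun I hI ↦ c.hN I ⟨_, hv.1, _, hv.1, diag v.2 ▸ hI⟩) (Hp_pos hv) x).symm
  rw [e] at a2 t1
  have k := eLpNorm_add_le (a1.sub a2) (a2.sub a3) c.hp.le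
  rw [sub_add_sub_cancel] at k
  refine k.trans ((add_le_add t1 t2).trans_eq ?_)
  ring
lemma Cx.loss (c : Cx K q p A lam 𝔓) (hf : IsDensity f) (hX : Xi K q f lam p 𝔓 γ C0 ζ y) (hu : u ∈ HpSet lam p n 𝔓) (hs : u.2 ∈ structSet 𝔓 f) {γp : Eo} (hγ : γp = (γ + 1) * (2 + C0) ^ (Dd 𝔓))
    {s : (Fin d → ℝ) × Part d} (h1 : s ∈ HpSet lam p n 𝔓) (h2 : crit K q lam p 𝔓 γp y s = ⨅ v ∈ HpSet lam p n 𝔓, crit K q lam p 𝔓 γp y v) :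
    eLpNorm (fun x ↦ fHatProd K q s y x - (f x : ℂ)) p volume ≤ 3 * (d * (ka K d * rr K q f p 𝔓 y u * (Gbar K q lam p 𝔓 y + ka K d * fpE p 𝔓 f) ^ (d - 1))) +
      2 * (Rem 𝔓 C0 (Gbar K q lam p 𝔓 y) ζ + LamThr K q lam p 𝔓 γp y * UpPart K q lam p n u) := by
  obtain ⟨a1, -⟩ := c.T1 (y := y) hf hu h1
  obtain ⟨a2, -⟩ := c.T2 hf hX hu
  obtain ⟨a3, -⟩ := c.T2 hf hX h1
  have e := c.symm (y := y) hu h1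
  have hD := c.delta hf hX hu hs
  rw [← hγ] at hD
  have dg : ∀ J ∈ u.2.parts, J ∈ diamond u.2 u.2 := fun J hJ ↦ diag u.2 ▸ hJ
  have hfm : ASM fun x ↦ ((f x : ℝ) : ℂ) := Complex.continuous_ofReal.comp_aestronglyMeasurable hf.int.aestronglyMeasurable
  have t3 : eLpNorm (fHatProd K q u y - fun x ↦ ((f x : ℝ) : ℂ)) p volume ≤ d * (rr K q f p 𝔓 y u * (Gbar K q lam p 𝔓 y + ka K d * fpE p 𝔓 f) ^ (d - 1)) := by
    have ef : (fun x ↦ ((f x : ℝ) : ℂ)) = fun x ↦ ∏ I ∈ u.2.parts, ((marginal I f (pj I x) : ℝ) : ℂ) := by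
      ext x; rw [hs.2 x, Complex.ofReal_prod]; rfl
    rw [ef]
    refine tele_bd u.2 c.hp.le (B := fun I ↦ fHat I K q u.1 y) (b := fun I z ↦ ((marginal I f z : ℝ) : ℂ)) (fun I hI ↦ (c.ok hu hu.1 (dg I hI)).cont.aestronglyMeasurable) (fun I hI ↦ marg_aesm hf)
      (fun I hI ↦ le_rr hu.1 (dg I hI)) (fun I hI ↦ add_le_add (G_hat1 c.hK hu hu.1 (dg I hI)) ?_) (G_one.trans lsa) (card_le_d _)
    rw [eLpNorm_congr_norm_ae (g := marginal I f) (aoa _ fun x ↦ cnr _)]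
    exact (F_marg ⟨_, hu.1, _, hu.1, dg I hI⟩).trans (le_mul_of_one_le_left' (one_ka c.hK))
  have t1 : eLpNorm (fHatProd K q s y - fHatProdAux K q u s y) p volume ≤ DeltaT K q lam p 𝔓 γp y u + LamThr K q lam p 𝔓 γp y * UpPart K q lam p n s := by
    rw [← neg_sub, eLpNorm_neg]
    exact le_tsub_add.trans (aL (le_iSup₂_of_le (f := fun v _ ↦ eLpNorm (fun x ↦ fHatProdAux K q u v y x - fHatProd K q v y x) p volume - LamThr K q lam p 𝔓 γp y * UpPart K q lam p n v) s h1 le_rfl) _)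
  have t2 : eLpNorm (fHatProdAux K q u s y - fHatProd K q u y) p volume ≤ DeltaT K q lam p 𝔓 γp y s + LamThr K q lam p 𝔓 γp y * UpPart K q lam p n u := by
    rw [e]
    exact le_tsub_add.trans (aL (le_iSup₂_of_le (f := fun v _ ↦ eLpNorm (fun x ↦ fHatProdAux K q s v y x - fHatProd K q v y x) p volume - LamThr K q lam p 𝔓 γp y * UpPart K q lam p n v) u hu le_rfl) _)
  have hcr : crit K q lam p 𝔓 γp y s ≤ crit K q lam p 𝔓 γp y u := h2.trans_le (iInf₂_le u hu)
  have k1 := eLpNorm_add_le (a3.sub a1) (a1.sub a2) c.hp.le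
  have k2 := eLpNorm_add_le (a3.sub a2) (a2.sub hfm) c.hp.le
  rw [sub_add_sub_cancel] at k1 k2
  refine k2.trans ((add_le_add (k1.trans (add_le_add t1 t2)) t3).trans ?_)
  obtain ⟨r, hr⟩ : ∃ r, r = rr K q f p 𝔓 y u := ⟨_, rfl⟩
  obtain ⟨W, hW⟩ : ∃ W, W = (Gbar K q lam p 𝔓 y + ka K d * fpE p 𝔓 f) ^ (d - 1) := ⟨_, rfl⟩
  rw [← hr, ← hW] at hD ⊢
  unfold crit at hcr
  have k3 : d * (r * W) ≤ d * (ka K d * r * W) := mR (mL (le_mul_of_one_le_left' (one_ka c.hK)) _) _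
  calc _ = (DeltaT K q lam p 𝔓 γp y s + LamThr K q lam p 𝔓 γp y * UpPart K q lam p n s) + (DeltaT K q lam p 𝔓 γp y u + LamThr K q lam p 𝔓 γp y * UpPart K q lam p n u) + d * (r * W) := by ring
    _ ≤ (DeltaT K q lam p 𝔓 γp y u + LamThr K q lam p 𝔓 γp y * UpPart K q lam p n u) + (DeltaT K q lam p 𝔓 γp y u + LamThr K q lam p 𝔓 γp y * UpPart K q lam p n u) + d * (ka K d * r * W) := add_le_add (aL hcr _) k3
    _ ≤ ((d * (ka K d * r * W) + Rem 𝔓 C0 (Gbar K q lam p 𝔓 y) ζ) + LamThr K q lam p 𝔓 γp y * UpPart K q lam p n u) + ((d * (ka K d * r * W) + Rem 𝔓 C0 (Gbar K q lam p 𝔓 y) ζ) + LamThr K q lam p 𝔓 γp y * UpPart K q lam p n u) + d * (ka K d * r * W) :=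
      aL (add_le_add (aL hD _) (aL hD _)) _
    _ = _ := by ring
end c29
section c30
variable {d : ℕ} {K : ℝ → ℝ} {q f : Fd d} {p : Eo} {A : ℝ} {lam : Fin d → ℝ} {𝔓 : Set (Part d)} {n : ℕ} {y : Fin n → Fin d → ℝ} {u v : (Fin d → ℝ) × Part d} {γ C0 ζ : Eo}
lemma fin_bd {r G a b κ C θ ν U D g E H : Eo} {e N M : ℕ} (hζ : ζ = ν * θ) (hν : ν ≤ 1) (hG : G ≤ a * (1 + ζ)) (hE : E ≤ a * (1 + ζ)) (hr : r ≤ b * (1 + ζ)) :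
    3 * (H * (κ * r * E ^ e)) + 2 * (D * ((G * C) ^ N * ((C0 * N + 1) * (ζ * (1 + ζ) ^ N))) + D * g * G ^ M * U) ≤
     3 * H * κ * a ^ e * r + (2 * D * a ^ M * (g * U) + (3 * H * κ * a ^ e * b * e + 2 * D * (a * C) ^ N * (C0 * N + 1)) * ν) * (1 + θ) ^ (e + 2 + 2 * N + 1 + M) := by
  have hz : ζ ≤ ν * (1 + θ) := hζ ▸ mR le_add_self _
  have hT : 1 + ζ ≤ 1 + θ := aR (hζ ▸ mul_le_of_le_one_left' hν) _
  obtain ⟨T, hTe⟩ : ∃ T, T = 1 + θ := ⟨_, rfl⟩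
  have h1 : 1 ≤ T := hTe ▸ lsa
  rw [← hTe] at hz hT ⊢
  have p0 : ∀ {i j : ℕ}, i ≤ j → T ^ i ≤ T ^ j := fun h ↦ ppr h1 h
  have t1 : r * (1 + ζ) ^ e ≤ r + b * e * ν * T ^ (e + 2 + 2 * N + 1 + M) := by
    calc r * (1 + ζ) ^ e ≤ r * (1 + e * ζ * (1 + ζ) ^ e) := mR (pow1 _ _) _
      _ = r + r * (e * ζ * (1 + ζ) ^ e) := by ring
      _ ≤ r + (b * T) * (e * (ν * T) * T ^ e) := aR (mul_le_mul' (hr.trans (mR hT _)) (mul_le_mul' (mR hz _) (ppl hT _))) _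
      _ = r + b * e * ν * T ^ (e + 2) := by ring
      _ ≤ _ := aR (mR (p0 bO) _) _
  have t2 : G ^ N * (ζ * (1 + ζ) ^ N) ≤ a ^ N * (ν * T ^ (e + 2 + 2 * N + 1 + M)) := by
    calc _ ≤ (a * T) ^ N * (ν * T * T ^ N) := mul_le_mul' (ppl (hG.trans (mR hT _)) _) (mul_le_mul' hz (ppl hT _))
      _ = a ^ N * (ν * T ^ (2 * N + 1)) := by rw [mul_pow]; ring
      _ ≤ _ := mR (mR (p0 bO) _) _
  have t3 : G ^ M ≤ a ^ M * T ^ (e + 2 + 2 * N + 1 + M) :=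
    (ppl (hG.trans (mR hT _)) _).trans ((mul_pow _ _ _).trans_le (mR (p0 bO) _))
  obtain ⟨S, hS⟩ : ∃ S, S = T ^ (e + 2 + 2 * N + 1 + M) := ⟨_, rfl⟩
  rw [← hS] at t1 t2 t3 ⊢
  calc _ ≤ 3 * (H * (κ * r * (a * (1 + ζ)) ^ e)) + 2 * (D * ((G * C) ^ N * ((C0 * N + 1) * (ζ * (1 + ζ) ^ N))) + D * g * G ^ M * U) :=
        aL (mR (mR (mR (ppl hE _) _) _) _) _
    _ = 3 * H * κ * a ^ e * (r * (1 + ζ) ^ e) + (2 * D * C ^ N * (C0 * N + 1) * (G ^ N * (ζ * (1 + ζ) ^ N)) + 2 * D * g * U * G ^ M) := by rw [mul_pow, mul_pow]; ring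
    _ ≤ 3 * H * κ * a ^ e * (r + b * e * ν * S) + (2 * D * C ^ N * (C0 * N + 1) * (a ^ N * (ν * S)) + 2 * D * g * U * (a ^ M * S)) :=
        add_le_add (mR t1 _) (add_le_add (mR t2 _) (mR t3 _))
    _ = _ := by rw [mul_pow]; ring
lemma risk_bd {Ω : Type*} [MeasurableSpace Ω] {μ : Measure Ω} [IPM μ] {l r θ : Ω → Eo} (hθ : Measurable θ) {ρ : ℝ} (hρ : 1 ≤ ρ) {L m : ℕ} (hm : L * ρ ≤ m) {B c1 W : Eo} (hB : ∫⁻ y, θ y ^ m ∂μ ≤ B)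
    (hc : c1 ≠ ⊤) (h : ∀ y, l y ≤ c1 * r y + W * (1 + θ y) ^ L) :
    (∫⁻ y, l y ^ ρ ∂μ) ^ (1 / ρ) ≤ 2 * (c1 * (∫⁻ y, r y ^ ρ ∂μ) ^ (1 / ρ) + W * (2 ^ m * (1 + B))) := by
  have h0 : 0 ≤ ρ := by linarith
  have hi : 0 ≤ 1 / ρ := by positivity
  have hi1 : 1 / ρ ≤ 1 := by rw [div_le_one bL]; exact hρ
  have hinv : ρ * (1 / ρ) = 1 := by field_simp
  have b1 : ∫⁻ y, (1 + θ y) ^ m ∂μ ≤ 2 ^ m * (1 + B) := by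
    calc _ ≤ ∫⁻ y, 2 ^ m * (1 + θ y ^ m) ∂μ := lmo fun y ↦ by
          rcases le_total (θ y) 1 with h | h
          · calc (1 + θ y) ^ m ≤ (1 + 1) ^ m := ppl (aR h _) _
              _ ≤ _ := by rw [one_add_one_eq_two]; exact le_mul_of_one_le_right' lsa
          · calc (1 + θ y) ^ m ≤ (θ y + θ y) ^ m := ppl (aL h _) _
              _ = 2 ^ m * θ y ^ m := by rw [← two_mul, mul_pow]
              _ ≤ _ := mR le_add_self _
      _ = 2 ^ m * (1 + ∫⁻ y, θ y ^ m ∂μ) := by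
          rw [lcm1 _ fpr, lal fpr]; simp
      _ ≤ _ := mR (aR hB _) _
  have b2 : ∀ y, l y ^ ρ ≤ 2 ^ ρ * (c1 ^ ρ * r y ^ ρ + W ^ ρ * (1 + θ y) ^ m) := fun y ↦ by
    have e1 : (1 : Eo) ≤ 1 + θ y := lsa
    calc l y ^ ρ ≤ (c1 * r y + W * (1 + θ y) ^ L) ^ ρ := err (h y) h0
      _ ≤ 2 ^ (ρ - 1) * ((c1 * r y) ^ ρ + (W * (1 + θ y) ^ L) ^ ρ) := rpow_add_le_mul_rpow_add_rpow _ _ hρ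
      _ ≤ _ := by
        rw [mrn _ _ h0, mrn _ _ h0, ← rpow_natCast_mul]
        refine mul_le_mul' (rpow_le_rpow_of_exponent_le bN bL) (aR (mR ?_ _) _)
        rw [← rpow_natCast]
        exact rpow_le_rpow_of_exponent_le e1 hm
  have b3 : ∫⁻ y, l y ^ ρ ∂μ ≤ 2 ^ ρ * (c1 ^ ρ * ∫⁻ y, r y ^ ρ ∂μ + W ^ ρ * (2 ^ m * (1 + B))) := by
    refine (lmo b2).trans ?_
    rw [lcm2 _ _ (rnt h0 bN), lintegral_add_right _ fpr, lcm2 _ _ (rnt h0 hc), lcm1 _ fpr]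
    exact mR (aR (mR b1 _) _) _
  refine (err b3 hi).trans ?_
  have q1 : ∀ x : Eo, (x ^ ρ) ^ (1 / ρ) = x := fun x ↦ by rw [← erm, hinv, ero]
  rw [mrn _ _ hi, q1]
  refine mR ((rpow_add_le_add_rpow _ _ hi hi1).trans ?_) _
  rw [mrn _ _ hi, q1, mrn _ _ hi, q1]
  refine aR (mR ?_ _) _
  calc _ ≤ (2 ^ m * (1 + B)) ^ (1 : ℝ) := rpow_le_rpow_of_exponent_le (one_le_mul (one_le_pow₀ bN) lsa) hi1
    _ = _ := ero _
lemma Cx.Gr (c : Cx K q p A lam 𝔓) (hf : IsDensity f) (hX : Xi K q f lam p 𝔓 γ C0 ζ y) (hu : u ∈ HpSet lam p n 𝔓) :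
    Gbar K q lam p 𝔓 y + ka K d * fpE p 𝔓 f ≤ (ka K d * (ka K d * fpE p 𝔓 f + C0) + ka K d * fpE p 𝔓 f) * (1 + ζ) ∧ rr K q f p 𝔓 y u ≤ (C0 + ka K d * fpE p 𝔓 f + fpE p 𝔓 f) * (1 + ζ) := by
  have hκ := one_ka (d := d) c.hK
  have hF : 1 ≤ fpE p 𝔓 f := le_max_left _ _
  have l := fun v hv P hP J hJ ↦ (fHat_le (v := v) (P := P) (J := J) hX c hf hv hP hJ).2
  obtain ⟨F, hFe⟩ : ∃ F, F = fpE p 𝔓 f := ⟨_, rfl⟩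
  rw [← hFe] at hF l ⊢
  have hM : ∀ v ∈ HpSet lam p n 𝔓, ∀ P ∈ 𝔓, ∀ J ∈ diamond v.2 P, eLpNorm (fHat J K q v.1 y) p volume ≤ (ka K d * F + C0) * (1 + ζ) := fun v hv P hP J hJ ↦ by
    calc _ ≤ ka K d * F + (C0 + 1 * ζ) := by rw [one_mul]; exact l v hv P hP J hJ
      _ ≤ ka K d * F + (C0 + ka K d * F * ζ) + C0 * ζ := le_add_right (aR (aR (mL (one_le_mul hκ hF) _) _) _)
      _ = _ := by ring
  constructor
  · rw [add_mul]
    refine add_le_add (max_le ?_ ?_) (le_mul_of_one_le_right' lsa)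
    · exact one_le_mul (one_le_mul hκ ((one_le_mul hκ hF).trans lsa)) lsa
    · rw [mul_assoc]
      exact mR (iSup₂_le fun v hv ↦ iSup₂_le fun P hP ↦ iSup₂_le fun J hJ ↦ hM v hv P hP J hJ) _
  · refine iSup₂_le fun P hP ↦ iSup₂_le fun J hJ ↦ ?_
    have k := eLpNorm_sub_le (c.ok hu hP hJ).cont.aestronglyMeasurable (marg_aesm hf) c.hp.le (f := fHat J K q u.1 y) (g := fun z ↦ ((marginal J f z : ℝ) : ℂ)) (μ := volume)
    rw [eLpNorm_congr_norm_ae (f := fun z ↦ ((marginal J f z : ℝ) : ℂ)) (g := marginal J f) (aoa _ fun x ↦ cnr _)] at k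
    refine k.trans ((add_le_add (hM u hu P hP J hJ) (F_marg ⟨_, hu.1, _, hP, hJ⟩)).trans ?_)
    rw [← hFe, add_mul _ F, add_comm C0]
    exact aR (le_mul_of_one_le_right' lsa) _
end c30
section c31
def ca (κ C0 F : Eo) : Eo := κ * (κ * F + C0) + κ * F
lemma ca_mono {κ C0 F F' : Eo} (h : F ≤ F') : ca κ C0 F ≤ ca κ C0 F' := by unfold ca; gcongr
lemma ca_top {κ C0 F : Eo} (h1 : κ ≠ ⊤) (h2 : C0 ≠ ⊤) (h : F ≠ ⊤) : ca κ C0 F ≠ ⊤ := by unfold ca; finiteness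
def k1 (H κ C0 F : Eo) (e : ℕ) : Eo := 3 * H * κ * ca κ C0 F ^ e
def k2 (D κ C0 F : Eo) (M : ℕ) : Eo := 2 * D * ca κ C0 F ^ M
def k3 (H D κ C0 F : Eo) (e N : ℕ) : Eo := k1 H κ C0 F e * (C0 + κ * F + F) * e + 2 * D * (ca κ C0 F * (2 + C0)) ^ N * (C0 * N + 1)
def KK1 (H D κ C0 B F : Eo) (e M : ℕ) : Eo := 2 * (k1 H κ C0 F e + k2 D κ C0 F M * B) + 1
def KK2 (H D κ C0 B F : Eo) (e N : ℕ) : Eo := 2 * (k3 H D κ C0 F e N * B)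
lemma KK1_mono {H D κ C0 B F F' : Eo} {e M : ℕ} (h : F ≤ F') : KK1 H D κ C0 B F e M ≤ KK1 H D κ C0 B F' e M := by
  have := ca_mono (κ := κ) (C0 := C0) h
  unfold KK1 k1 k2; gcongr
lemma KK2_mono {H D κ C0 B F F' : Eo} {e M : ℕ} (h : F ≤ F') : KK2 H D κ C0 B F e M ≤ KK2 H D κ C0 B F' e M := by
  have := ca_mono (κ := κ) (C0 := C0) h
  unfold KK2 k3 k1; gcongr
end c31
/-- **Theorem 3** (oracle inequality): for `p ∈ (1,∞]`, under Assumptions (N1)-(N2),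
there are a constant `γ_p ∈ (0,∞)` for the selection rule and constants
`C_{p,1}(𝐟_p)`, `C_{p,2}(𝐟_p)` (functions of `𝐟_p`, bounded on any bounded interval of
`ℝ_+`) such that, for every `n ≥ 3` and every `f ∈ 𝔽_p[𝔓]`, any estimator `f̃ = f̃_{(h̃,P̃)}`
obeying the selection rule satisfies
`R_p[f̃,f] ≤ C_{p,1}(𝐟_p)·inf_{(h,P)∈H_p[𝔓], P∈𝔓(f)} {R_p[(h,P),f] + γ_p U_p(h,P)}
  + C_{p,2}(𝐟_p) n^{-1/2}`. -/
theorem statement6 (d : ℕ) (hd : 0 < d)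
    (K : ℝ → ℝ) (hK : IsKernel K) (q : (Fin d → ℝ) → ℝ) (hq : IsDensity q)
    (A : ℝ) (lam : Fin d → ℝ) (𝔓 : Set (Part d)) (p : ℝ≥0∞) (hp : 1 < p)
    (hN : ∀ P ∈ 𝔓, ∀ P' ∈ 𝔓, ∀ I ∈ diamond P P', N1N2 p I q A lam) :
    ∃ γp : ℝ≥0∞, 0 < γp ∧ γp ≠ ⊤ ∧
    ∃ C1 C2 : ℝ → ℝ≥0∞,
      (∀ M : ℝ, ∃ c : ℝ≥0∞, c ≠ ⊤ ∧ ∀ x ∈ Set.Icc (0 : ℝ) M, C1 x ≤ c ∧ C2 x ≤ c) ∧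
      ∀ n : ℕ, 3 ≤ n → ∀ f : (Fin d → ℝ) → ℝ, IsDensity f → fpE p 𝔓 f ≠ ⊤ →
        ∀ sel : (Fin n → Fin d → ℝ) → (Fin d → ℝ) × Part d,
          IsSelection K q lam p 𝔓 γp sel →
          riskSel K q p sel f ≤
            C1 ((fpE p 𝔓 f).toReal) *
              (⨅ hP ∈ {hP ∈ HpSet lam p n 𝔓 | hP.2 ∈ structSet 𝔓 f},
                (riskOracle K q p 𝔓 n hP f + γp * UpPart K q lam p n hP)) +
            C2 ((fpE p 𝔓 f).toReal) * ENNReal.ofReal ((n : ℝ) ^ (-(1 : ℝ) / 2)) := by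
  have c : Cx K q p A lam 𝔓 := ⟨hp, hK, hq, fun I ⟨P, hP, P', hP', hI⟩ => hN P hP P' hP' I hI⟩
  obtain ⟨ρ, hρ⟩ : ∃ ρ : ℝ, ρ = if p = ⊤ then 1 else p.toReal := ⟨_, rfl⟩
  have hρ1 : 1 ≤ ρ := by
    rw [hρ]; split_ifs with h
    · exact le_rfl
    · exact (ENNReal.toReal_mono h hp.le).trans_eq' (by simp)
  obtain ⟨D, hD⟩ : ∃ D, D = Dd 𝔓 := ⟨_, rfl⟩
  obtain ⟨L, hL⟩ : ∃ L, L = (d - 1) + 2 + 2 * (D - 1) + 1 + D * (D - 1) := ⟨_, rfl⟩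
  obtain ⟨m, hm⟩ : ∃ m, m = ⌈(L : ℝ) * ρ⌉₊ + 1 := ⟨_, rfl⟩
  have hm' : (L : ℝ) * ρ ≤ m := by rw [hm]; push_cast; linarith [Nat.le_ceil ((L : ℝ) * ρ)]
  obtain ⟨γ, C0, B, h1, h2, h3, H⟩ := theta hp hK hq c.hN (m := m) (by omega)
  obtain ⟨γp, hγ⟩ : ∃ γp, γp = (γ + 1) * (2 + C0) ^ (Dd 𝔓) := ⟨_, rfl⟩
  obtain ⟨κ, hκ⟩ : ∃ κ, κ = ka K d := ⟨_, rfl⟩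
  obtain ⟨B', hB'⟩ : ∃ B', B' = 2 ^ m * (1 + B) := ⟨_, rfl⟩
  have hBt : B' ≠ ⊤ := by rw [hB']; finiteness
  have hκt : κ ≠ ⊤ := by rw [hκ]; exact ENNReal.ofReal_ne_top
  have k1t : ∀ F : ℝ≥0∞, F ≠ ⊤ → k1 d κ C0 F (d - 1) ≠ ⊤ := fun F hF => by
    have := ca_top hκt h2 hF; unfold k1; finiteness
  have K1t : ∀ F : ℝ≥0∞, F ≠ ⊤ → KK1 d D κ C0 B' F (d - 1) (D * (D - 1)) ≠ ⊤ := fun F hF => by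
    have := ca_top hκt h2 hF; have := k1t F hF; unfold KK1 k2; finiteness
  have K2t : ∀ F : ℝ≥0∞, F ≠ ⊤ → KK2 d D κ C0 B' F (d - 1) (D - 1) ≠ ⊤ := fun F hF => by
    have := ca_top hκt h2 hF; have := k1t F hF; unfold KK2 k3; finiteness
  refine ⟨γp, ?_, ?_, fun x => KK1 d D κ C0 B' (ENNReal.ofReal x) (d - 1) (D * (D - 1)), fun x => KK2 d D κ C0 B' (ENNReal.ofReal x) (d - 1) (D - 1), ?_, ?_⟩
  · rw [hγ]; exact pos_iff_ne_zero.2 (mul_ne_zero (by simp) (pow_ne_zero _ (by simp)))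
  · rw [hγ]; finiteness
  · intro M
    refine ⟨_, ENNReal.add_ne_top.2 ⟨K1t _ (ENNReal.ofReal_ne_top (r := M)), K2t _ (ENNReal.ofReal_ne_top (r := M))⟩, fun x hx => ?_⟩
    have hx := ENNReal.ofReal_le_ofReal hx.2
    exact ⟨le_add_right (KK1_mono hx), le_add_left (KK2_mono hx)⟩
  intro n hn f hf hfp sel hsel
  simp only [ENNReal.ofReal_toReal hfp]
  obtain ⟨θ, hθ, hθB, hx⟩ := H n hn f hf
  obtain ⟨ν, hν⟩ : ∃ ν, ν = ENNReal.ofReal ((n : ℝ) ^ (-(1 : ℝ) / 2)) := ⟨_, rfl⟩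
  rw [← hν] at hx ⊢
  have hν1 : ν ≤ 1 := by
    rw [hν, ENNReal.ofReal_le_one]
    exact Real.rpow_le_one_of_one_le_of_nonpos (by exact_mod_cast (by omega : 1 ≤ n)) (by norm_num)
  have : IsProbabilityMeasure (obsMeasure d n f q) := by
    have := conv_prob hf hq
    exact inferInstanceAs (IsProbabilityMeasure (Measure.pi fun _ : Fin n => dm (conv f q)))
  have eS : riskSel K q p sel f = (∫⁻ y, eLpNorm (fun x => fHatProd K q (sel y) y x - (f x : ℂ)) p volume ^ ρ ∂obsMeasure d n f q) ^ (1 / ρ) := by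
    rw [hρ]; unfold riskSel; split_ifs with h
    · simp [h]
    · rfl
  have eO : ∀ u, riskOracle K q p 𝔓 n u f = (∫⁻ y, rr K q f p 𝔓 y u ^ ρ ∂obsMeasure d n f q) ^ (1 / ρ) := fun u => by
    rw [hρ]; unfold riskOracle rr; split_ifs with h
    · simp [h]
    · rfl
  obtain ⟨F, hF⟩ : ∃ F, F = fpE p 𝔓 f := ⟨_, rfl⟩
  rw [← hF] at hfp ⊢
  obtain ⟨C1, hC1⟩ : ∃ C1, C1 = KK1 d D κ C0 B' F (d - 1) (D * (D - 1)) := ⟨_, rfl⟩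
  rw [← hC1]
  have c10 : C1 ≠ 0 := by rw [hC1]; unfold KK1; simp
  have c1t : C1 ≠ ⊤ := hC1 ▸ K1t F hfp
  rw [← tsub_le_iff_right, ← ENNReal.div_le_iff' c10 c1t]
  refine le_iInf₂ fun u hu => ?_
  rw [ENNReal.div_le_iff' c10 c1t, tsub_le_iff_right, eO, eS]
  refine (risk_bd hθ hρ1 hm' hθB (k1t F hfp) (W := k2 D κ C0 F (D * (D - 1)) * (γp * UpPart K q lam p n u) + k3 d D κ C0 F (d - 1) (D - 1) * ν) (r := fun y => rr K q f p 𝔓 y u) fun y => ?_).trans ?_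
  · have hX : Xi K q f lam p 𝔓 γ C0 (ν * θ y) y := hx y
    obtain ⟨g1, g2⟩ := c.Gr hf hX hu.1
    refine (c.loss hf hX hu.1 hu.2 hγ (hsel y).1 (hsel y).2).trans ?_
    unfold Rem LamThr
    rw [← hF, ← hκ] at g1 g2 ⊢
    rw [← hD, hL]
    exact fin_bd rfl hν1 (le_self_add.trans g1) g1 g2
  · rw [← hB', hC1]
    obtain ⟨R, hR⟩ : ∃ R, R = (∫⁻ y, rr K q f p 𝔓 y u ^ ρ ∂obsMeasure d n f q) ^ (1 / ρ) := ⟨_, rfl⟩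
    rw [← hR]
    unfold KK1 KK2
    obtain ⟨a, ha⟩ : ∃ a, a = k1 d κ C0 F (d - 1) := ⟨_, rfl⟩
    obtain ⟨b, hb⟩ : ∃ b, b = k2 D κ C0 F (D * (D - 1)) := ⟨_, rfl⟩
    obtain ⟨e, he⟩ : ∃ e, e = k3 d D κ C0 F (d - 1) (D - 1) := ⟨_, rfl⟩
    rw [← ha, ← hb, ← he]
    calc _ ≤ 2 * (a * R + (b * (γp * UpPart K q lam p n u) + e * ν) * B') + (2 * (a * (γp * UpPart K q lam p n u)) + 2 * (b * B' * R) + (R + γp * UpPart K q lam p n u)) := le_self_add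
      _ = _ := by ring

end Deconv
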